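/- Let d ∈ ℕ, let ν₁,…,ν_d ∈ ℕ, let ω^{(i)} ∈ ℝ^{ν_i} be non-resonant for each i = 1,…,d, let b_i = ν_i − 1 and b = b₁ + … + b_d. Let 2 < p < ∞ and s > s* := b(1/2 − 1/p) + max(d/2 − (d+2)/p, 0). Then there exists a constant K > 0 (depending on d, the ω^{(i)}, p, s) such that for every finitely supported a : ℤ^{ν₁}×…×ℤ^{ν_d} → ℂ one has limsup_{L→∞} (1/(2L)^d) ∫_0^1 ∫_{[−L,L]^d} | ∑_{n} a_n e^{i(⟨n⟩_ω · x − t |⟨n⟩_ω|²)} |^p dx dt ≤ K^p · ( ∑_{n} (1+|n|)^{2s} |a_n|^2 )^{p/2}, where for n = (n₁,…,n_d) one sets ⟨n⟩_ω = (n₁·ω^{(1)}, …, n_d·ω^{(d)}) ∈ ℝ^d. (Fixed-time L^p Strichartz estimates in higher dimensions from ℓ²-decoupling, Theorem 3.3.) -/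

import Mathlib

open MeasureTheory Filter

/-- The `i`-th component `⟨n_i⟩_{ω^{(i)}} = n_i · ω^{(i)}` of the frequency vector of a
multi-index `n ∈ ℤ^{ν₁} × … × ℤ^{ν_d}`. -/
noncomputable def freqVec {d : ℕ} {ν : Fin d → ℕ} (ω : ∀ i, Fin (ν i) → ℝ)
    (n : ∀ i, Fin (ν i) → ℤ) (i : Fin d) : ℝ :=
  ∑ j, (n i j : ℝ) * ω i j

/-- The height `|n|` (Euclidean norm of the full integer vector) of a multi-index. -/
noncomputable def heightVec {d : ℕ} {ν : Fin d → ℕ} (n : ∀ i, Fin (ν i) → ℤ) : ℝ :=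
  Real.sqrt (∑ i, ∑ j, ((n i j : ℝ)) ^ 2)

open MeasureTheory Filter
open scoped ENNReal NNReal
namespace Strz

/-- Minkowski for finite sums. -/
theorem mink {α ι : Type*} [MeasurableSpace α] (μ : Measure α) (S : Finset ι)
    (G : ι → α → ℝ≥0∞) (hG : ∀ c ∈ S, Measurable (G c)) (r : ℝ) (hr : 1 ≤ r) :
    (∫⁻ z, (∑ c ∈ S, G c z) ^ r ∂μ) ^ (1 / r) ≤ ∑ c ∈ S, (∫⁻ z, (G c z) ^ r ∂μ) ^ (1 / r) := by
  classical
  induction S using Finset.induction_on with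
  | empty =>
    simp only [Finset.sum_empty]
    rw [ENNReal.zero_rpow_of_pos (by linarith), lintegral_zero, ENNReal.zero_rpow_of_pos (by positivity)]
  | insert a S ha ih =>
    simp only [Finset.sum_insert ha]
    have h1 : Measurable (G a) := hG a (by simp)
    have h2 : Measurable (fun z => ∑ c ∈ S, G c z) :=
      Finset.measurable_fun_sum _ (fun c hc => hG c (by simp [hc]))
    refine (ENNReal.lintegral_Lp_add_le h1.aemeasurable h2.aemeasurable hr).trans ?_
    gcongr
    exact ih (fun c hc => hG c (by simp [hc]))

theorem mink_pow {α ι : Type*} [MeasurableSpace α] (μ : Measure α) (S : Finset ι)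
    (F : ι → α → ℝ≥0∞) (hF : ∀ c ∈ S, Measurable (F c)) (p : ℝ) (hp : 2 ≤ p) :
    ∫⁻ z, (∑ c ∈ S, F c z ^ (2 / p)) ^ (p / 2) ∂μ ≤
      (∑ c ∈ S, (∫⁻ z, F c z ∂μ) ^ (2 / p)) ^ (p / 2) := by
  have h := mink μ S (fun c z => F c z ^ (2 / p)) (fun c hc => (hF c hc).pow_const _) (p / 2)
    (by linarith)
  have e : ∀ c z, (F c z ^ (2 / p)) ^ (p / 2) = F c z := by
    intro c z
    rw [← ENNReal.rpow_mul, div_mul_div_cancel₀ (by positivity)]; simp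
  simp only [e] at h
  have h2 := ENNReal.rpow_le_rpow h (z := p / 2) (by positivity)
  rw [← ENNReal.rpow_mul, one_div, inv_mul_cancel₀ (by positivity), ENNReal.rpow_one] at h2
  convert h2 using 3
  · simp

/-- Jensen (Hölder) for a measure of finite mass. -/
theorem jensen {α : Type*} [MeasurableSpace α] (μ : Measure α) (F : α → ℝ≥0∞)
    (hF : Measurable F) (q : ℝ) (hq : 1 ≤ q) :
    (∫⁻ z, F z ∂μ) ^ q ≤ μ Set.univ ^ (q - 1) * ∫⁻ z, F z ^ q ∂μ := by
  have h := ENNReal.lintegral_mul_norm_pow_le (μ := μ) (f := fun z => F z ^ q) (g := fun _ => 1)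
    (hF.pow_const _).aemeasurable aemeasurable_const (p := 1 / q) (q := 1 - 1 / q) (by positivity)
    (by rw [sub_nonneg, div_le_one (by positivity)]; exact hq) (by ring)
  have e : ∀ z, (F z ^ q) ^ (1 / q) * (1 : ℝ≥0∞) ^ (1 - 1 / q) = F z := by
    intro z; rw [← ENNReal.rpow_mul, mul_one_div_cancel (by positivity)]; simp
  simp only [e] at h
  have h2 := ENNReal.rpow_le_rpow h (z := q) (by positivity)
  rw [ENNReal.mul_rpow_of_nonneg _ _ (by positivity), ← ENNReal.rpow_mul, ← ENNReal.rpow_mul,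
    one_div_mul_cancel (by positivity), ENNReal.rpow_one, lintegral_one] at h2
  rw [mul_comm]
  convert h2 using 3
  rw [sub_mul, one_mul, one_div_mul_cancel (by positivity)]

/-- interpolation between `L²` and `L^p` at the intermediate exponent. -/
theorem interp {α : Type*} [MeasurableSpace α] (μ : Measure α) (f : α → ℝ≥0∞)
    (hf : Measurable f) (p : ℝ) (hp : 2 ≤ p) :
    (∫⁻ z, f z ^ (4 * p / (p + 2)) ∂μ) ^ (2 / (4 * p / (p + 2))) ≤
      (∫⁻ z, f z ^ (2 : ℝ) ∂μ) ^ (1 / 2 : ℝ) * (∫⁻ z, f z ^ p ∂μ) ^ (1 / p) := by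
  have hp0 : 0 < p := by linarith
  have h := ENNReal.lintegral_mul_norm_pow_le (μ := μ) (f := fun z => f z ^ (2 : ℝ))
    (g := fun z => f z ^ p)
    (hf.pow_const _).aemeasurable (hf.pow_const _).aemeasurable (p := p / (p + 2))
    (q := 2 / (p + 2)) (by positivity) (by positivity) (by field_simp)
  have e : ∀ z, (f z ^ (2 : ℝ)) ^ (p / (p + 2)) * (f z ^ p) ^ (2 / (p + 2)) =
      f z ^ (4 * p / (p + 2)) := by
    intro z
    rw [← ENNReal.rpow_mul, ← ENNReal.rpow_mul, ← ENNReal.rpow_add_of_nonneg _ _ (by positivity) (by positivity)]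
    congr 1; field_simp; ring
  simp only [e] at h
  have h2 := ENNReal.rpow_le_rpow h (z := 2 / (4 * p / (p + 2))) (by positivity)
  rw [ENNReal.mul_rpow_of_nonneg _ _ (by positivity), ← ENNReal.rpow_mul, ← ENNReal.rpow_mul] at h2
  convert h2 using 3
  · field_simp; norm_num
  · field_simp; norm_num

end Strz

open MeasureTheory Filter
open scoped ENNReal NNReal
namespace Strz

theorem lint_pi_succ {m : ℕ} (μ : Measure ℝ) [IsProbabilityMeasure μ]
    (F : (Fin (m + 1) → ℝ) → ℝ≥0∞) (hF : Measurable F) :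
    ∫⁻ y, F y ∂(Measure.pi fun _ => μ) =
      ∫⁻ y', ∫⁻ s, F (Fin.cons s y') ∂μ ∂(Measure.pi fun _ : Fin m => μ) := by
  have h := measurePreserving_piFinSuccAbove (fun _ : Fin (m + 1) => μ) 0
  have h2 := (h.symm).lintegral_comp (f := F) hF
  rw [← h2, lintegral_prod_symm _ (by fun_prop)]
  simp [MeasurableEquiv.piFinSuccAbove_symm_apply, Fin.insertNthEquiv]

theorem meas_cons {m : ℕ} : Measurable (fun q : ℝ × (Fin m → ℝ) => (Fin.cons q.1 q.2 : Fin (m+1) → ℝ)) := by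
  refine measurable_pi_lambda _ (fun i => ?_)
  refine Fin.cases ?_ (fun j => ?_) i
  · simpa using measurable_fst
  · simp only [Fin.cons_succ]; fun_prop

theorem cons_update {m : ℕ} (s t : ℝ) (y : Fin m → ℝ) (j : Fin m) :
    Function.update (Fin.cons s y : Fin (m+1) → ℝ) j.succ t = Fin.cons s (Function.update y j t) := by
  rw [Fin.cons_update]

theorem loomis_whitney (m : ℕ) : ∀ (μ : Measure ℝ) [IsProbabilityMeasure μ] (θ : ℝ), 0 ≤ θ →
    m * θ ≤ 1 → ∀ (g : Fin (m + 1) → (Fin (m + 1) → ℝ) → ℝ≥0∞), (∀ i, Measurable (g i)) →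
    (∀ i y s, g i (Function.update y i s) = g i y) →
    ∫⁻ y, ∏ i, g i y ^ θ ∂(Measure.pi fun _ => μ) ≤
      ∏ i, (∫⁻ y, g i y ∂(Measure.pi fun _ => μ)) ^ θ := by
  induction m with
  | zero =>
    intro μ _ θ h0 h1 g hg hi
    have hc : ∀ y, g 0 y = g 0 0 := by
      intro y
      rw [← hi 0 0 (y 0)]; congr 1; ext i; fin_cases i; simp
    simp only [Nat.reduceAdd, Finset.univ_unique, Fin.default_eq_zero, Fin.isValue,
      Finset.prod_singleton, hc]
    simp
  | succ m ih =>
    intro μ _ θ h0 h1 g hg hi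
    push_cast at h1
    -- g 0 as function of the tail
    let g0 : (Fin (m+1) → ℝ) → ℝ≥0∞ := fun y' => g 0 (Fin.cons 0 y')
    let G : Fin (m+1) → (Fin (m+1) → ℝ) → ℝ≥0∞ := fun j y' => ∫⁻ s, g j.succ (Fin.cons s y') ∂μ
    have hg0 : ∀ s y', g 0 (Fin.cons s y') = g0 y' := by
      intro s y'
      simp only [g0]; rw [← hi 0 (Fin.cons 0 y') s]; simp
    have mg0 : Measurable g0 := (hg 0).comp (meas_cons.comp (by fun_prop : Measurable fun y' => ((0:ℝ), y')))
    have mG2 : ∀ j, Measurable (fun q : ℝ × (Fin (m+1) → ℝ) => g j (Fin.cons q.1 q.2)) :=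
      fun j => (hg j).comp meas_cons
    have mG : ∀ j, Measurable (G j) := fun j => (mG2 j.succ).lintegral_prod_left'
    have hGi : ∀ j y s, G j (Function.update y j s) = G j y := by
      intro j y s
      simp only [G]; congr 1; ext t
      rw [← cons_update, hi]
    have i0 : ∫⁻ y, g 0 y ∂(Measure.pi fun _ => μ) = ∫⁻ y', g0 y' ∂(Measure.pi fun _ => μ) := by
      rw [lint_pi_succ μ _ (hg 0)]; simp [hg0]
    have ij : ∀ j : Fin (m+1), ∫⁻ y, g j.succ y ∂(Measure.pi fun _ => μ) =
        ∫⁻ y', G j y' ∂(Measure.pi fun _ => μ) := by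
      intro j; rw [lint_pi_succ μ _ (hg _)]
    rw [lint_pi_succ μ _ (Finset.measurable_fun_prod _ fun i _ => (hg i).pow_const _)]
    rw [Fin.prod_univ_succ, i0]
    simp only [ij]
    have step : ∀ y', ∫⁻ s, ∏ i, g i (Fin.cons s y') ^ θ ∂μ ≤ g0 y' ^ θ * ∏ j, G j y' ^ θ := by
      intro y'
      have e1 : ∀ s, ∏ i, g i (Fin.cons s y') ^ θ =
          g0 y' ^ θ * ∏ j : Fin (m+1), g j.succ (Fin.cons s y') ^ θ := by
        intro s; rw [Fin.prod_univ_succ, hg0]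
      simp only [e1]
      have mm : ∀ j : Fin (m+1), Measurable (fun s => g j.succ (Fin.cons s y')) := fun j =>
        (mG2 j.succ).comp (by fun_prop : Measurable fun s => (s, y'))
      rw [lintegral_const_mul _ (Finset.measurable_fun_prod _ fun i _ => (mm i).pow_const _)]
      gcongr
      have := ENNReal.lintegral_mul_prod_norm_pow_le (μ := μ) (Finset.univ : Finset (Fin (m+1)))
        (g := fun _ => 1) (f := fun j s => g j.succ (Fin.cons s y')) aemeasurable_const
        (fun j _ => (mm j).aemeasurable) (1 - (m+1) * θ) (p := fun _ => θ)
        (by simp) (by linarith) (fun _ _ => h0)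
      simpa using this
    refine (lintegral_mono step).trans ?_
    by_cases hθ : θ = 1
    · subst hθ
      have hm : m = 0 := by
        have : (m : ℝ) ≤ 0 := by linarith
        exact Nat.le_zero.1 (by exact_mod_cast this)
      subst hm
      have hc : ∀ y, G 0 y = G 0 0 := by
        intro y
        rw [← hGi 0 0 (y 0)]; congr 1; ext i; fin_cases i; simp
      have e0 : ∀ F : Fin (0+1) → ℝ≥0∞, ∏ j, F j = F 0 := by intro F; simp
      simp only [ENNReal.rpow_one, e0, hc]
      rw [lintegral_mul_const _ mg0]; simp
    · have hθ1 : θ < 1 := by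
        refine lt_of_le_of_ne ?_ hθ
        have : 0 ≤ (m:ℝ) * θ := by positivity
        linarith
      have h1θ : 0 < 1 - θ := by linarith
      have hol := ENNReal.lintegral_mul_norm_pow_le (μ := Measure.pi fun _ : Fin (m+1) => μ) (f := g0)
        (g := fun y' => ∏ j, G j y' ^ (θ / (1 - θ))) mg0.aemeasurable
        (Finset.measurable_fun_prod _ fun i _ => (mG i).pow_const _).aemeasurable
        h0 h1θ.le (by ring)
      have e : ∀ y', (∏ j, G j y' ^ (θ / (1 - θ))) ^ (1 - θ) = ∏ j, G j y' ^ θ := by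
        intro y'
        rw [← ENNReal.prod_rpow_of_nonneg h1θ.le]
        refine Finset.prod_congr rfl fun j _ => ?_
        rw [← ENNReal.rpow_mul, div_mul_cancel₀ _ h1θ.ne']
      simp only [e] at hol
      refine hol.trans ?_
      gcongr
      have := ih μ (θ / (1 - θ)) (by positivity) (by
        rw [← mul_div_assoc, div_le_one h1θ]; linarith) G mG hGi
      have h2 := ENNReal.rpow_le_rpow this h1θ.le
      refine h2.trans (le_of_eq ?_)
      rw [← ENNReal.prod_rpow_of_nonneg h1θ.le]
      refine Finset.prod_congr rfl fun j _ => ?_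
      rw [← ENNReal.rpow_mul, div_mul_cancel₀ _ h1θ.ne']

/-- packing bound -/
theorem packing {E : Type*} [NormedAddCommGroup E] [NormedSpace ℝ E] [FiniteDimensional ℝ E]
    (s : Finset E) (x : E) (r R : ℝ) (hr : 0 < r) (hR : 0 ≤ R) (hs : ∀ c ∈ s, ‖c - x‖ ≤ R)
    (h : ∀ c ∈ s, ∀ d ∈ s, c ≠ d → r ≤ ‖c - d‖) :
    (s.card : ℝ) ≤ (1 + 2 * R / r) ^ Module.finrank ℝ E := by
  borelize E
  let μ : Measure E := Measure.addHaar
  have ρpos : 0 < R + r / 2 := by positivity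
  have I0 : 0 < r / 2 := by positivity
  set A := ⋃ c ∈ s, Metric.ball (c : E) (r / 2) with hA
  have D : Set.Pairwise (s : Set E) (Function.onFun Disjoint fun c => Metric.ball (c : E) (r / 2)) := by
    rintro c hc d hd hcd
    apply Metric.ball_disjoint_ball
    rw [dist_eq_norm]
    have := h c hc d hd hcd
    linarith
  have A_subset : A ⊆ Metric.ball x (R + r / 2) := by
    refine Set.iUnion₂_subset fun y hy => ?_
    apply Metric.ball_subset_ball'
    rw [dist_eq_norm]
    have := hs y hy
    linarith
  have I : (s.card : ℝ≥0∞) * ENNReal.ofReal ((r / 2) ^ Module.finrank ℝ E) * μ (Metric.ball 0 1) ≤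
      ENNReal.ofReal ((R + r / 2) ^ Module.finrank ℝ E) * μ (Metric.ball 0 1) :=
    calc
      _ = μ A := by
        rw [hA, measure_biUnion_finset D fun c _ => measurableSet_ball]
        simp only [μ.addHaar_ball_of_pos _ I0]
        simp only [Finset.sum_const, nsmul_eq_mul, mul_assoc]
      _ ≤ μ (Metric.ball x (R + r / 2)) := measure_mono A_subset
      _ = _ := by
        simp only [μ.addHaar_ball_of_pos _ ρpos]
  have J := (ENNReal.mul_le_mul_iff_left (Metric.measure_ball_pos μ _ zero_lt_one).ne' measure_ball_lt_top.ne).1 I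
  have K := ENNReal.toReal_le_of_le_ofReal (pow_nonneg ρpos.le _) J
  rw [ENNReal.toReal_mul, ENNReal.toReal_natCast, ENNReal.toReal_ofReal (by positivity)] at K
  have : (1 + 2 * R / r) = (R + r / 2) / (r / 2) := by field_simp; ring
  rw [this, div_pow, le_div_iff₀ (by positivity)]
  exact K

end Strz

open MeasureTheory Filter
open scoped ENNReal NNReal ComplexConjugate
set_option linter.unusedSectionVars false
set_option linter.unusedSimpArgs false
set_option linter.unusedVariables false
namespace Strz

section spec
variable {V : Type} [NormedAddCommGroup V] [InnerProductSpace ℝ V] [FiniteDimensional ℝ V]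
  [MeasurableSpace V] [BorelSpace V]
variable {V' : Type} [NormedAddCommGroup V'] [InnerProductSpace ℝ V'] [FiniteDimensional ℝ V']
  [MeasurableSpace V'] [BorelSpace V']

/-- the phase -/
noncomputable def ph (ζ z : V × ℝ) : ℝ := inner ℝ ζ.1 z.1 - ζ.2 * z.2

/-- the character -/
noncomputable def ec (ζ z : V × ℝ) : ℂ := Complex.exp (Complex.I * (ph ζ z : ℂ))

theorem ph_add_right (ζ z w : V × ℝ) : ph ζ (z + w) = ph ζ z + ph ζ w := by
  simp only [ph, Prod.fst_add, Prod.snd_add, inner_add_right]; ring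
theorem ph_add_left (ζ z w : V × ℝ) : ph (ζ + z) w = ph ζ w + ph z w := by
  simp only [ph, Prod.fst_add, Prod.snd_add, inner_add_left]; ring
theorem ph_neg_left (ζ z : V × ℝ) : ph (-ζ) z = - ph ζ z := by
  simp only [ph, Prod.fst_neg, Prod.snd_neg, inner_neg_left]; ring
theorem ph_neg_right (ζ z : V × ℝ) : ph ζ (-z) = - ph ζ z := by
  simp only [ph, Prod.fst_neg, Prod.snd_neg, inner_neg_right]; ring
theorem ec_add_right (ζ z w : V × ℝ) : ec ζ (z + w) = ec ζ z * ec ζ w := by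
  simp only [ec, ph_add_right, ← Complex.exp_add]; push_cast; ring_nf
theorem ec_add_left (ζ z w : V × ℝ) : ec (ζ + z) w = ec ζ w * ec z w := by
  simp only [ec, ph_add_left, ← Complex.exp_add]; push_cast; ring_nf
theorem norm_ec (ζ z : V × ℝ) : ‖ec ζ z‖ = 1 := by
  simp only [ec]; rw [mul_comm]; exact Complex.norm_exp_ofReal_mul_I _
theorem conj_ec (ζ z : V × ℝ) : conj (ec ζ z) = ec (-ζ) z := by
  simp only [ec, ← Complex.exp_conj, ph_neg_left]; simp

theorem continuous_ec : Continuous (fun q : (V × ℝ) × (V × ℝ) => ec q.1 q.2) := by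
  unfold ec ph; fun_prop

@[fun_prop]
theorem meas_ec {Y : Type*} [MeasurableSpace Y] {a b : Y → V × ℝ} (ha : Measurable a)
    (hb : Measurable b) : Measurable (fun y => ec (a y) (b y)) :=
  (continuous_ec (V := V)).measurable.comp (ha.prodMk hb)

/-- `f` has Fourier representation supported in `Ω`. -/
def Spec (Ω : Set (V × ℝ)) (f : V × ℝ → ℂ) : Prop :=
  ∃ (Y : Type) (_ : MeasurableSpace Y) (μ : Measure Y) (_ : SFinite μ) (κ : Y → V × ℝ) (h : Y → ℂ),
    Measurable κ ∧ Measurable h ∧ Integrable h μ ∧ (∀ y, h y ≠ 0 → κ y ∈ Ω) ∧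
      ∀ z, f z = ∫ y, ec (κ y) z * h y ∂μ

theorem Spec.mono {Ω Ω' : Set (V × ℝ)} {f : V × ℝ → ℂ} (hf : Spec Ω f) (h : Ω ⊆ Ω') :
    Spec Ω' f := by
  obtain ⟨Y, _, μ, _, κ, h', a, b, c, d, e⟩ := hf
  exact ⟨Y, _, μ, ‹_›, κ, h', a, b, c, fun y hy => h (d y hy), e⟩

theorem Spec.continuous {Ω : Set (V × ℝ)} {f : V × ℝ → ℂ} (hf : Spec Ω f) : Continuous f := by
  obtain ⟨Y, _, μ, _, κ, h', a, b, c, d, e⟩ := hf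
  rw [show f = _ from funext e]
  refine continuous_of_dominated (bound := fun y => ‖h' y‖) ?_ ?_ c.norm ?_
  · intro z; exact ((meas_ec a measurable_const).mul b).aestronglyMeasurable
  · intro z; refine Filter.Eventually.of_forall fun y => ?_
    rw [norm_mul, norm_ec, one_mul]
  · refine Filter.Eventually.of_forall fun y => ?_
    exact ((continuous_ec (V := V)).comp (by fun_prop : Continuous fun z => (κ y, z))).mul continuous_const

theorem Spec.measurable {Ω : Set (V × ℝ)} {f : V × ℝ → ℂ} (hf : Spec Ω f) : Measurable f :=
  hf.continuous.measurable

theorem Spec.bdd {Ω : Set (V × ℝ)} {f : V × ℝ → ℂ} (hf : Spec Ω f) :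
    ∃ C : ℝ, 0 ≤ C ∧ ∀ z, ‖f z‖ ≤ C := by
  obtain ⟨Y, _, μ, _, κ, h', a, b, c, d, e⟩ := hf
  refine ⟨∫ y, ‖h' y‖ ∂μ, by positivity, fun z => ?_⟩
  rw [e]
  refine (norm_integral_le_integral_norm _).trans (le_of_eq ?_)
  simp [norm_ec]

theorem Spec.zero (Ω : Set (V × ℝ)) : Spec Ω (fun _ => 0) :=
  ⟨Unit, inferInstance, 0, inferInstance, fun _ => 0, fun _ => 0, measurable_const,
    measurable_const, by simp, by simp, by simp⟩

theorem Spec.add {Ω : Set (V × ℝ)} {f g : V × ℝ → ℂ} (hf : Spec Ω f) (hg : Spec Ω g) :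
    Spec Ω (fun z => f z + g z) := by
  obtain ⟨Y, _, μ, _, κ, h, a, b, c, d, e⟩ := hf
  obtain ⟨Y', _, μ', _, κ', h', a', b', c', d', e'⟩ := hg
  have hi : MeasurableEmbedding (Sum.inl : Y → Y ⊕ Y') := ⟨Sum.inl_injective, measurable_inl, fun s hs => hs.inl_image⟩
  have hi' : MeasurableEmbedding (Sum.inr : Y' → Y ⊕ Y') := ⟨Sum.inr_injective, measurable_inr, fun s hs => hs.inr_image⟩
  have mk : Measurable (Sum.elim κ κ') := a.sumElim a'
  have mh : Measurable (Sum.elim h h') := b.sumElim b'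
  have I1 : ∀ G : Y ⊕ Y' → ℂ, Integrable (G ∘ Sum.inl) μ → Integrable G (μ.map Sum.inl) :=
    fun G hG => (hi.integrable_map_iff).2 hG
  have I2 : ∀ G : Y ⊕ Y' → ℂ, Integrable (G ∘ Sum.inr) μ' → Integrable G (μ'.map Sum.inr) :=
    fun G hG => (hi'.integrable_map_iff).2 hG
  refine ⟨Y ⊕ Y', inferInstance, μ.map Sum.inl + μ'.map Sum.inr, inferInstance, Sum.elim κ κ',
    Sum.elim h h', mk, mh, ?_, ?_, ?_⟩
  · exact (I1 _ (by simpa using c)).add_measure (I2 _ (by simpa using c'))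
  · rintro (y | y) hy
    · exact d y hy
    · exact d' y hy
  · intro z
    have J : Integrable (fun y => ec (κ y) z * h y) μ := by
      refine c.bdd_mul (c := 1) (meas_ec a measurable_const).aestronglyMeasurable ?_
      exact Filter.Eventually.of_forall fun y => (norm_ec _ _).le
    have J' : Integrable (fun y => ec (κ' y) z * h' y) μ' := by
      refine c'.bdd_mul (c := 1) (meas_ec a' measurable_const).aestronglyMeasurable ?_
      exact Filter.Eventually.of_forall fun y => (norm_ec _ _).le
    dsimp only
    rw [integral_add_measure (I1 (fun q => ec (Sum.elim κ κ' q) z * Sum.elim h h' q) J) (I2 _ J'), hi.integral_map, hi'.integral_map, e, e']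
    simp only [Sum.elim_inl, Sum.elim_inr]

theorem Spec.sum {ι : Type*} {Ω : Set (V × ℝ)} (S : Finset ι) {f : ι → V × ℝ → ℂ}
    (hf : ∀ c ∈ S, Spec Ω (f c)) : Spec Ω (fun z => ∑ c ∈ S, f c z) := by
  classical
  induction S using Finset.induction_on with
  | empty => simpa using Spec.zero Ω
  | insert a S ha ih =>
    simp only [Finset.sum_insert ha]
    exact (hf a (by simp)).add (ih fun c hc => hf c (by simp [hc]))

theorem Spec.mul {Ω Ω' Ω'' : Set (V × ℝ)} {f g : V × ℝ → ℂ} (hf : Spec Ω f) (hg : Spec Ω' g)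
    (hΩ : ∀ ζ ∈ Ω, ∀ ζ' ∈ Ω', ζ + ζ' ∈ Ω'') : Spec Ω'' (fun z => f z * g z) := by
  obtain ⟨Y, _, μ, _, κ, h, a, b, c, d, e⟩ := hf
  obtain ⟨Y', _, μ', _, κ', h', a', b', c', d', e'⟩ := hg
  refine ⟨Y × Y', inferInstance, μ.prod μ', inferInstance, fun q => κ q.1 + κ' q.2,
    fun q => h q.1 * h' q.2, by fun_prop, by fun_prop, c.mul_prod c', ?_, ?_⟩
  · intro q hq
    exact hΩ _ (d _ (left_ne_zero_of_mul hq)) _ (d' _ (right_ne_zero_of_mul hq))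
  · intro z
    dsimp only
    rw [e, e', ← integral_prod_mul]
    congr 1; ext q
    simp only [ec_add_left]; ring

theorem Spec.conj {Ω Ω' : Set (V × ℝ)} {f : V × ℝ → ℂ} (hf : Spec Ω f)
    (hΩ : ∀ ζ ∈ Ω, -ζ ∈ Ω') : Spec Ω' (fun z => conj (f z)) := by
  obtain ⟨Y, _, μ, _, κ, h, a, b, c, d, e⟩ := hf
  refine ⟨Y, inferInstance, μ, inferInstance, fun y => - κ y, fun y => starRingEnd ℂ (h y),
    by fun_prop, (Complex.continuous_conj.measurable).comp b, ?_, ?_, ?_⟩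
  · exact (integrable_norm_iff ((Complex.continuous_conj.measurable).comp b).aestronglyMeasurable).1
      (by simpa using c.norm)
  · intro y hy; exact hΩ _ (d y (by simpa using hy))
  · intro z
    dsimp only
    rw [e, ← integral_conj]
    simp [conj_ec]

theorem Spec.comp {Ω : Set (V × ℝ)} {Ω' : Set (V' × ℝ)} {f : V × ℝ → ℂ} (hf : Spec Ω f)
    (B : V' × ℝ → V × ℝ) (m : V × ℝ → V' × ℝ) (c : V × ℝ → ℝ) (hm : Measurable m)
    (hc : Measurable c) (hB : ∀ ζ z, ph ζ (B z) = ph (m ζ) z + c ζ)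
    (hΩ : ∀ ζ ∈ Ω, m ζ ∈ Ω') : Spec Ω' (fun z => f (B z)) := by
  obtain ⟨Y, _, μ, _, κ, h, a, b, i, d, e⟩ := hf
  have mE : Measurable (fun y => Complex.exp (Complex.I * (c (κ y) : ℂ))) := by fun_prop
  refine ⟨Y, inferInstance, μ, inferInstance, fun y => m (κ y),
    fun y => Complex.exp (Complex.I * (c (κ y) : ℂ)) * h y, by fun_prop, by fun_prop, ?_, ?_, ?_⟩
  · refine i.bdd_mul (c := 1) mE.aestronglyMeasurable ?_
    refine Filter.Eventually.of_forall fun y => ?_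
    rw [mul_comm]; exact (Complex.norm_exp_ofReal_mul_I _).le
  · intro y hy; exact hΩ _ (d y (right_ne_zero_of_mul hy))
  · intro z
    dsimp only
    rw [e]; congr 1; ext y
    rw [← mul_assoc]; congr 1
    simp only [ec, hB, ← Complex.exp_add]; push_cast; ring_nf

theorem Spec.translate {Ω : Set (V × ℝ)} {f : V × ℝ → ℂ} (hf : Spec Ω f) (z0 : V × ℝ) :
    Spec Ω (fun z => f (z + z0)) :=
  hf.comp (fun z => z + z0) id (fun ζ => ph ζ z0) measurable_id
    (by unfold ph; fun_prop) (fun ζ z => by simp [ph_add_right]) (fun ζ h => h)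

theorem Spec.atom {Ω : Set (V × ℝ)} (ζ : V × ℝ) (h : ζ ∈ Ω) (a : ℂ) : Spec Ω (fun z => a * ec ζ z) :=
  ⟨Unit, inferInstance, Measure.dirac (), inferInstance, fun _ => ζ, fun _ => a, measurable_const,
    measurable_const, by simp, fun _ _ => h, fun z => by simp [mul_comm]⟩

/-- reproducing formula -/
theorem Spec.repro {Ω : Set (V × ℝ)} {f : V × ℝ → ℂ} (hf : Spec Ω f) {P : Type*} [MeasurableSpace P]
    (π : Measure P) [SFinite π] (m : P → ℂ) (w : P → V × ℝ) (hm : Integrable m π)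
    (hw : Measurable w) (a : ℂ) (ha : ∀ ζ ∈ Ω, ∫ p, m p * ec ζ (-(w p)) ∂π = a) (z : V × ℝ) :
    ∫ p, m p * f (z - w p) ∂π = a * f z := by
  obtain ⟨Y, _, μ, _, κ, h, mκ, b, i, d, e⟩ := hf
  simp only [e, ← integral_const_mul]
  have key : Integrable (Function.uncurry fun p y => m p * (ec (κ y) (z - w p) * h y)) (π.prod μ) := by
    have := (hm.mul_prod i).bdd_mul (c := 1) (f := fun q : P × Y => ec (κ q.2) (z - w q.1))
      (by fun_prop : Measurable fun q : P × Y => ec (κ q.2) (z - w q.1)).aestronglyMeasurable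
      (Filter.Eventually.of_forall fun y => (norm_ec _ _).le)
    refine this.congr (Filter.Eventually.of_forall fun q => ?_)
    simp only [Function.uncurry]; ring
  rw [integral_integral_swap key]
  congr 1; ext y
  by_cases hy : h y = 0
  · simp [hy]
  · rw [← ha (κ y) (d y hy), ← integral_mul_const]
    congr 1; ext p
    rw [sub_eq_add_neg, ec_add_right]; ring

end spec
end Strz

open MeasureTheory Filter
open scoped ENNReal NNReal ComplexConjugate FourierTransform
set_option linter.unusedSectionVars false
set_option linter.unusedSimpArgs false
set_option linter.unusedVariables false
namespace Strz

section sch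
variable {E : Type} [NormedAddCommGroup E] [InnerProductSpace ℝ E] [FiniteDimensional ℝ E]
  [MeasurableSpace E] [BorelSpace E]

/-- unnormalised inverse Fourier transform -/
noncomputable def ift (χ : E → ℂ) (x : E) : ℂ :=
  ∫ η, Complex.exp (Complex.I * (inner ℝ η x : ℝ)) * χ η

theorem ift_core (χ : E → ℂ) (h1 : HasCompactSupport χ) (h2 : ContDiff ℝ (⊤ : ℕ∞) χ) :
    Continuous (ift χ) ∧ (∀ k : ℕ, ∃ C : ℝ, 0 ≤ C ∧ ∀ x, ‖ift χ x‖ ≤ C * ((1 + ‖x‖) ^ k)⁻¹) ∧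
    ∀ ξ, ∫ x, ift χ x * Complex.exp (-(Complex.I * (inner ℝ ξ x : ℝ))) =
      ((2 * Real.pi) ^ Module.finrank ℝ E : ℝ) * χ ξ := by
  let f : SchwartzMap E ℂ := h1.toSchwartzMap h2
  have hf : ∀ x, f x = χ x := fun x => rfl
  let g : SchwartzMap E ℂ := 𝓕⁻ f
  have hg : ∀ x, ift χ x = g ((2 * Real.pi)⁻¹ • x) := by
    intro x
    simp only [g, SchwartzMap.fourierInv_coe, Real.fourierInv_eq', ift]
    congr 1; ext η
    rw [hf, smul_eq_mul, inner_smul_right]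
    congr 2
    push_cast
    have : (Real.pi : ℂ) ≠ 0 := by exact_mod_cast Real.pi_ne_zero
    field_simp
  have hpi := Real.pi_pos
  refine ⟨?_, ?_, ?_⟩
  · rw [show ift χ = _ from funext hg]; exact g.continuous.comp (by fun_prop)
  · intro k
    obtain ⟨C, hC0, hC⟩ : ∃ C : ℝ, 0 ≤ C ∧ ∀ x, (1 + ‖x‖) ^ k * ‖g x‖ ≤ C := by
      have := SchwartzMap.one_add_le_sup_seminorm_apply (𝕜 := ℝ) (m := (k, 0)) (k := k) (n := 0) le_rfl le_rfl g
      refine ⟨2 ^ k * ((Finset.Iic (k, 0)).sup fun m => SchwartzMap.seminorm ℝ m.1 m.2) g, by positivity, fun x => ?_⟩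
      simpa using this x
    refine ⟨C * (2 * Real.pi) ^ k, by positivity, fun x => ?_⟩
    rw [hg]
    have h := hC ((2 * Real.pi)⁻¹ • x)
    have h3 : (1 + ‖x‖) ≤ (2 * Real.pi) * (1 + ‖(2 * Real.pi)⁻¹ • x‖) := by
      rw [norm_smul, Real.norm_of_nonneg (by positivity), mul_add, ← mul_assoc, mul_inv_cancel₀ (by positivity)]
      have := Real.pi_gt_three
      linarith
    rw [← div_eq_mul_inv, le_div_iff₀ (by positivity)]
    calc _ ≤ ‖g ((2 * Real.pi)⁻¹ • x)‖ * ((2 * Real.pi) * (1 + ‖(2 * Real.pi)⁻¹ • x‖)) ^ k := by gcongr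
      _ = ((1 + ‖(2 * Real.pi)⁻¹ • x‖) ^ k * ‖g ((2 * Real.pi)⁻¹ • x)‖) * (2 * Real.pi) ^ k := by
        rw [mul_pow]; ring
      _ ≤ _ := by gcongr
  · intro ξ
    have e1 : χ ξ = (𝓕 g) ξ := by
      rw [← hf]; simp only [g]; rw [FourierTransform.fourier_fourierInv_eq]
    rw [e1, SchwartzMap.fourier_coe, Real.fourier_eq']
    have e2 : ∀ x, ift χ x * Complex.exp (-(Complex.I * (inner ℝ ξ x : ℝ))) =
      (fun y => Complex.exp (((-2 * Real.pi * inner ℝ y ξ : ℝ) : ℂ) * Complex.I) • g y) ((2 * Real.pi)⁻¹ • x) := by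
      intro x
      simp only [hg, smul_eq_mul]
      rw [mul_comm]; congr 2
      rw [inner_smul_left, real_inner_comm]
      push_cast
      have : (Real.pi : ℂ) ≠ 0 := by exact_mod_cast Real.pi_ne_zero
      simp
      field_simp
    rw [integral_congr_ae (Eventually.of_forall e2)]
    rw [Measure.integral_comp_inv_smul volume (fun y => Complex.exp (((-2 * Real.pi * inner ℝ y ξ : ℝ) : ℂ) * Complex.I) • g y) (2 * Real.pi), abs_of_pos (by positivity)]
    simp

theorem exists_bump (r R : ℝ) (hr : 0 < r) (hR : r < R) : ∃ χ : E → ℝ, HasCompactSupport χ ∧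
    ContDiff ℝ (⊤ : ℕ∞) χ ∧ (∀ x, 0 ≤ χ x) ∧ (∀ x, ‖x‖ ≤ r → χ x = 1) ∧ (∀ x, R ≤ ‖x‖ → χ x = 0) := by
  let b : ContDiffBump (0 : E) := ⟨r, R, hr, hR⟩
  refine ⟨b, b.hasCompactSupport, b.contDiff, fun x => b.nonneg, fun x hx => ?_, fun x hx => ?_⟩
  · exact b.one_of_mem_closedBall (by simpa using hx)
  · exact b.zero_of_le_dist (by simpa using hx)

theorem sch_Phi (R : ℝ) (hR : 0 < R) : ∃ Φ : E → ℂ, Continuous Φ ∧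
    (∀ k : ℕ, ∃ C : ℝ, 0 ≤ C ∧ ∀ x, ‖Φ x‖ ≤ C * ((1 + ‖x‖) ^ k)⁻¹) ∧
    ∀ ξ, ‖ξ‖ ≤ R → ∫ x, Φ x * Complex.exp (-(Complex.I * (inner ℝ ξ x : ℝ))) = 1 := by
  obtain ⟨χ, a, b, c, d, e⟩ := exists_bump (E := E) R (R + 1) hR (by linarith)
  have a' : HasCompactSupport (fun x => (χ x : ℂ)) := a.comp_left (g := fun x : ℝ => (x : ℂ)) (by simp)
  have b' : ContDiff ℝ (⊤ : ℕ∞) (fun x => (χ x : ℂ)) := Complex.ofRealCLM.contDiff.comp b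
  obtain ⟨i, j, k⟩ := ift_core _ a' b'
  have hpi := Real.pi_pos
  set M : ℝ := (2 * Real.pi) ^ Module.finrank ℝ E with hM
  have hM0 : 0 < M := by positivity
  refine ⟨fun x => (M : ℂ)⁻¹ * ift (fun x => (χ x : ℂ)) x, by fun_prop, fun n => ?_, fun ξ hξ => ?_⟩
  · obtain ⟨C, hC0, hC⟩ := j n
    refine ⟨M⁻¹ * C, by positivity, fun x => ?_⟩
    rw [norm_mul, mul_assoc]
    simp only [norm_inv, Complex.norm_real, Real.norm_of_nonneg hM0.le]
    gcongr; exact hC x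
  · simp_rw [mul_assoc]
    rw [integral_const_mul, k, d ξ hξ]
    have : (M : ℂ) ≠ 0 := by exact_mod_cast hM0.ne'
    simp [this]

theorem decay_integrable {f : E → ℂ} (hf : Measurable f)
    (h : ∀ k : ℕ, ∃ C : ℝ, 0 ≤ C ∧ ∀ x, ‖f x‖ ≤ C * ((1 + ‖x‖) ^ k)⁻¹) : Integrable f := by
  obtain ⟨C, h0, hC⟩ := h (Module.finrank ℝ E + 1)
  have h2 : Integrable (fun x : E => (1 + ‖x‖) ^ (-((Module.finrank ℝ E + 1 : ℕ) : ℝ))) :=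
    integrable_one_add_norm (by push_cast; linarith)
  refine (h2.const_mul C).mono' hf.aestronglyMeasurable (Eventually.of_forall fun x => ?_)
  rw [Real.rpow_neg (by positivity), Real.rpow_natCast]
  exact hC x

theorem sch_psi : ∃ χ ψ : E → ℂ, Measurable χ ∧ Integrable χ ∧ (∀ η, χ η ≠ 0 → ‖η‖ ≤ 1) ∧
    Continuous ψ ∧ (∀ x, ψ x = ift χ x) ∧
    (∀ k : ℕ, ∃ C : ℝ, 0 ≤ C ∧ ∀ x, ‖ψ x‖ ≤ C * ((1 + ‖x‖) ^ k)⁻¹) ∧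
    (∃ c : ℝ, 0 < c ∧ ∀ x, ‖x‖ ≤ 1 → c ≤ ‖ψ x‖) ∧
    (∀ ξ, 2 ≤ ‖ξ‖ → ∫ x, ψ x * conj (ψ x) * Complex.exp (-(Complex.I * (inner ℝ ξ x : ℝ))) = 0) := by
  obtain ⟨χ, a, b, c, d, e⟩ := exists_bump (E := E) (1/2) 1 (by norm_num) (by norm_num)
  have a' : HasCompactSupport (fun x => (χ x : ℂ)) := a.comp_left (g := fun x : ℝ => (x : ℂ)) (by simp)
  have b' : ContDiff ℝ (⊤ : ℕ∞) (fun x => (χ x : ℂ)) := Complex.ofRealCLM.contDiff.comp b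
  obtain ⟨i, j, k⟩ := ift_core _ a' b'
  have mχ : Measurable (fun x => (χ x : ℂ)) := b'.continuous.measurable
  have iχ : Integrable (fun x => (χ x : ℂ)) := b'.continuous.integrable_of_hasCompactSupport a'
  have iχr : Integrable χ := b.continuous.integrable_of_hasCompactSupport a
  have sχ : ∀ η, (χ η : ℂ) ≠ 0 → ‖η‖ ≤ 1 := by
    intro η hη; by_contra hh; exact hη (by rw [e η (by linarith)]; simp)
  have ipos : 0 < ∫ x, χ x := by
    rw [integral_pos_iff_support_of_nonneg c iχr]
    refine lt_of_lt_of_le (Metric.measure_ball_pos volume (0:E) (r := 1/2) (by norm_num)) (measure_mono ?_)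
    intro x hx
    rw [Function.mem_support, d x (by simpa using (Metric.mem_ball.1 hx).le)]; norm_num
  have c1 : 0 < Real.cos 1 := Real.cos_one_pos
  refine ⟨_, ift (fun x => (χ x : ℂ)), mχ, iχ, sχ, i, fun x => rfl, j, ⟨Real.cos 1 * ∫ x, χ x, by positivity, ?_⟩, ?_⟩
  · intro x hx
    refine le_trans ?_ (Complex.re_le_norm _)
    have ii : Integrable (fun η => Complex.exp (Complex.I * (inner ℝ η x : ℝ)) * (χ η : ℂ)) := by
      refine iχ.bdd_mul (c := 1) (by fun_prop) (Eventually.of_forall fun y => ?_)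
      rw [mul_comm]; exact (Complex.norm_exp_ofReal_mul_I _).le
    have : (ift (fun x => (χ x : ℂ)) x).re = ∫ η, Real.cos (inner ℝ η x) * χ η := by
      unfold ift
      have := integral_re ii
      simp only [RCLike.re_to_complex] at this
      rw [← this]
      congr 1; ext η
      rw [Complex.re_mul_ofReal, mul_comm Complex.I, Complex.exp_ofReal_mul_I_re]
    rw [this, ← integral_const_mul]
    refine integral_mono (iχr.const_mul _) ?_ ?_
    · refine iχr.bdd_mul (c := 1) (by fun_prop) (Eventually.of_forall fun y => Real.abs_cos_le_one _)
    · intro η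
      dsimp only
      by_cases h : ‖η‖ ≤ 1
      · have h3 : |inner ℝ η x| ≤ 1 := by
          refine (abs_real_inner_le_norm η x).trans ?_
          calc _ ≤ (1:ℝ) * 1 := by gcongr
            _ = 1 := by norm_num
        refine mul_le_mul_of_nonneg_right ?_ (c η)
        rw [← Real.cos_abs (inner ℝ η x)]
        exact Real.cos_le_cos_of_nonneg_of_le_pi (abs_nonneg _) (by linarith [Real.pi_gt_three]) h3
      · rw [e η (by linarith)]; simp
  · intro ξ hξ
    have hdec := decay_integrable i.measurable j
    have hs : Spec (V := E) {ζ | ‖ζ.1‖ ≤ 1} (fun z => conj (ift (fun x => (χ x : ℂ)) (-z.1))) := by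
      refine ⟨E, inferInstance, volume, inferInstance, fun η => (η, 0), fun η => χ η, by fun_prop, mχ, iχ,
        fun η hη => sχ η hη, fun z => ?_⟩
      dsimp only
      unfold ift
      rw [← integral_conj]
      congr 1; ext η
      simp [ec, ph, ← Complex.exp_conj]
    have := hs.repro (P := E) volume (fun p => ift (fun x => (χ x : ℂ)) p * Complex.exp (-(Complex.I * (inner ℝ ξ p : ℝ))))
      (fun p => (p, 0)) ?_ (by fun_prop) 0 ?_ 0
    · simp only [zero_mul, Prod.fst_sub, Prod.fst_zero, zero_sub, neg_neg, Prod.fst_neg] at this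
      rw [← this]; congr 1; ext p; ring
    · refine (hdec.bdd_mul (c := 1) (f := fun p => Complex.exp (-(Complex.I * (inner ℝ ξ p : ℝ)))) (by fun_prop)
        (Eventually.of_forall fun y => ?_)).congr (Eventually.of_forall fun p => by ring)
      rw [Complex.norm_exp]; simp
    · intro ζ hζ
      have h4 := k (ξ + ζ.1)
      rw [e (ξ + ζ.1)] at h4
      · simp only [Complex.ofReal_zero, mul_zero] at h4
        rw [← h4]; congr 1; ext p
        rw [mul_assoc]; congr 1
        simp only [ec, ph, ← Complex.exp_add, inner_add_left]
        congr 1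
        simp; ring
      · have h5 : ‖ξ‖ - ‖ζ.1‖ ≤ ‖ξ + ζ.1‖ := by
          have := norm_sub_norm_le ξ (-ζ.1); simpa using this
        have : ‖ζ.1‖ ≤ 1 := hζ
        linarith

end sch
end Strz

open MeasureTheory Filter
open scoped ENNReal NNReal ComplexConjugate FourierTransform
set_option linter.unusedSectionVars false
set_option linter.unusedSimpArgs false
set_option linter.unusedVariables false
namespace Strz

section ker
variable {E : Type*} [NormedAddCommGroup E] [NormedSpace ℝ E] [FiniteDimensional ℝ E]
  [MeasureSpace E] [BorelSpace E] [(volume : Measure E).IsAddHaarMeasure]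

variable (E) in
/-- decay exponent -/
noncomputable def dm : ℕ := Module.finrank ℝ E + 1

noncomputable def ukr (ρ : ℝ) (z : E) : ℝ := ρ / (ρ + ‖z‖) ^ (dm E)
noncomputable def uk (ρ : ℝ) (z : E) : ℝ≥0∞ := ENNReal.ofReal (ukr ρ z)

noncomputable def U (ρ : ℝ) : Measure E := volume.withDensity (uk ρ)

/-- convolution with a measure -/
noncomputable def cv (ν : Measure E) (F : E → ℝ≥0∞) (z : E) : ℝ≥0∞ := ∫⁻ w, F (z - w) ∂ν

noncomputable def av (ρ : ℝ) (F : E → ℝ≥0∞) : E → ℝ≥0∞ := cv (U ρ) F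

@[fun_prop]
theorem uk_meas (ρ : ℝ) : Measurable (uk ρ : E → ℝ≥0∞) := by unfold uk ukr; fun_prop

instance (ρ : ℝ) : SFinite (U ρ : Measure E) := by unfold U; infer_instance

theorem cv_meas (ν : Measure E) [SFinite ν] {F : E → ℝ≥0∞} (hF : Measurable F) : Measurable (cv ν F) := by
  unfold cv
  exact Measurable.lintegral_prod_right' (f := fun q : E × E => F (q.1 - q.2)) (by fun_prop)

theorem av_meas (ρ : ℝ) {F : E → ℝ≥0∞} (hF : Measurable F) : Measurable (av ρ F) := cv_meas _ hF

theorem cv_mono (ν : Measure E) {F G : E → ℝ≥0∞} (h : ∀ z, F z ≤ G z) (z : E) : cv ν F z ≤ cv ν G z :=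
  lintegral_mono fun _ => h _

theorem av_mono (ρ : ℝ) {F G : E → ℝ≥0∞} (h : ∀ z, F z ≤ G z) (z : E) : av ρ F z ≤ av ρ G z :=
  cv_mono _ h z

theorem cv_const_mul (ν : Measure E) {F : E → ℝ≥0∞} (hF : Measurable F) (C : ℝ≥0∞) (z : E) :
    cv ν (fun z => C * F z) z = C * cv ν F z := by
  unfold cv; rw [lintegral_const_mul _ (by fun_prop)]

theorem av_const_mul (ρ : ℝ) {F : E → ℝ≥0∞} (hF : Measurable F) (C : ℝ≥0∞) (z : E) :
    av ρ (fun z => C * F z) z = C * av ρ F z := cv_const_mul _ hF C z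

theorem cv_sum {ι : Type*} (ν : Measure E) (S : Finset ι) {F : ι → E → ℝ≥0∞}
    (hF : ∀ c ∈ S, Measurable (F c)) (z : E) :
    cv ν (fun z => ∑ c ∈ S, F c z) z = ∑ c ∈ S, cv ν (F c) z := by
  unfold cv; rw [lintegral_finsetSum' S fun c hc => ?_]
  exact ((hF c hc).comp (by fun_prop : Measurable fun w => z - w)).aemeasurable

theorem cv_comm (ν ν' : Measure E) [SFinite ν] [SFinite ν'] {F : E → ℝ≥0∞} (hF : Measurable F) (z : E) :
    cv ν (cv ν' F) z = cv ν' (cv ν F) z := by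
  unfold cv
  rw [lintegral_lintegral_swap (by fun_prop)]
  simp only [sub_right_comm]

theorem av_eq (ρ : ℝ) {F : E → ℝ≥0∞} (hF : Measurable F) (z : E) :
    av ρ F z = ∫⁻ w, uk ρ w * F (z - w) := by
  unfold av cv U
  rw [lintegral_withDensity_eq_lintegral_mul _ (uk_meas ρ) (by fun_prop)]; rfl

theorem av_eq' (ρ : ℝ) {F : E → ℝ≥0∞} (hF : Measurable F) (z : E) :
    av ρ F z = ∫⁻ w, uk ρ (z - w) * F w := by
  rw [av_eq ρ hF, ← lintegral_sub_left_eq_self _ z]; simp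

theorem ukr_nonneg {ρ : ℝ} (h : 0 < ρ) (z : E) : 0 ≤ ukr ρ z := by unfold ukr; positivity

theorem uk_shift {ρ : ℝ} (h : 0 < ρ) (z w : E) :
    uk ρ (z - w) ≤ ENNReal.ofReal ((1 + ‖w‖ / ρ) ^ dm E) * uk ρ z := by
  unfold uk
  rw [← ENNReal.ofReal_mul (by positivity)]
  refine ENNReal.ofReal_le_ofReal ?_
  unfold ukr
  rw [div_le_iff₀ (by positivity)]
  have h1 : ρ + ‖z‖ ≤ (1 + ‖w‖ / ρ) * (ρ + ‖z - w‖) := by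
    have h2 : ‖z‖ ≤ ‖z - w‖ + ‖w‖ := by simpa using norm_add_le (z - w) w
    have h3 : (1 + ‖w‖ / ρ) * (ρ + ‖z - w‖) = ρ + ‖z - w‖ + ‖w‖ + ‖w‖ / ρ * ‖z - w‖ := by field_simp; ring
    have h4 : 0 ≤ ‖w‖ / ρ * ‖z - w‖ := by positivity
    linarith
  calc ρ = ρ / (ρ + ‖z‖) ^ dm E * (ρ + ‖z‖) ^ dm E := by field_simp
    _ ≤ ρ / (ρ + ‖z‖) ^ dm E * ((1 + ‖w‖ / ρ) * (ρ + ‖z - w‖)) ^ dm E := by gcongr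
    _ = _ := by rw [mul_pow]; ring

theorem av_shift {ρ : ℝ} (h : 0 < ρ) {F : E → ℝ≥0∞} (hF : Measurable F) (z w : E) :
    av ρ F (z - w) ≤ ENNReal.ofReal ((1 + ‖w‖ / ρ) ^ dm E) * av ρ F z := by
  rw [av_eq' _ hF, av_eq' _ hF, ← lintegral_const_mul _ (by fun_prop)]
  refine lintegral_mono fun x => ?_
  rw [← mul_assoc, sub_right_comm]
  gcongr
  exact uk_shift h _ _

theorem av_shift' {ρ : ℝ} (h : 0 < ρ) {F : E → ℝ≥0∞} (hF : Measurable F) (z w : E) :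
    av ρ F (z + w) ≤ ENNReal.ofReal ((1 + ‖w‖ / ρ) ^ dm E) * av ρ F z := by
  simpa using av_shift h hF z (-w)

theorem av_cv {ρ : ℝ} (h : 0 < ρ) {F : E → ℝ≥0∞} (hF : Measurable F) (ν : Measure E) [SFinite ν] (z : E) :
    av ρ (cv ν F) z ≤ (∫⁻ w, ENNReal.ofReal ((1 + ‖w‖ / ρ) ^ dm E) ∂ν) * av ρ F z := by
  unfold av
  rw [cv_comm _ _ hF, ← lintegral_mul_const _ (by fun_prop)]
  exact lintegral_mono fun w => av_shift h hF z w

theorem lint_smul (F : E → ℝ≥0∞) {r : ℝ} (hr : r ≠ 0) :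
    ∫⁻ x, F (r • x) = ENNReal.ofReal (|(r ^ Module.finrank ℝ E)⁻¹|) * ∫⁻ x, F x := by
  have h := Measure.map_addHaar_smul (volume : Measure E) hr
  have e := lintegral_map_equiv F (Homeomorph.smul (Units.mk0 r hr) : E ≃ₜ E).toMeasurableEquiv (μ := volume)
  have : (⇑(Homeomorph.smul (Units.mk0 r hr) : E ≃ₜ E).toMeasurableEquiv) = fun x : E => r • x := rfl
  rw [this] at e
  rw [← e]
  have h' : Measure.map (fun x : E => r • x) volume = ENNReal.ofReal (|(r ^ Module.finrank ℝ E)⁻¹|) • volume := h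
  rw [h', lintegral_smul_measure, smul_eq_mul]

variable (E) in
noncomputable def mass : ℝ≥0∞ := ∫⁻ x : E, uk 1 x

theorem mass_lt : mass E < ⊤ := by
  have := finite_integral_one_add_norm (μ := (volume : Measure E)) (r := dm E) (by unfold dm; push_cast; linarith)
  convert this using 3 with x
  unfold mass uk ukr
  congr 1; ext x
  rw [Real.rpow_neg (by positivity), Real.rpow_natCast]; simp

theorem lint_uk {ρ : ℝ} (h : 0 < ρ) : ∫⁻ x : E, uk ρ x = mass E := by
  have h1 : ∀ x : E, uk ρ x = (fun y => ENNReal.ofReal ((ρ ^ Module.finrank ℝ E)⁻¹) * uk 1 y) (ρ⁻¹ • x) := by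
    intro x
    simp only [uk]
    rw [← ENNReal.ofReal_mul (by positivity)]
    congr 1
    simp only [ukr, norm_smul, norm_inv, Real.norm_of_nonneg h.le, dm]
    have : 1 + ρ⁻¹ * ‖x‖ = (ρ + ‖x‖) / ρ := by field_simp
    rw [this, div_pow, pow_succ]; field_simp; ring
  rw [lintegral_congr h1, lint_smul (fun y : E => ENNReal.ofReal ((ρ ^ Module.finrank ℝ E)⁻¹) * uk 1 y) (r := ρ⁻¹) (by positivity), lintegral_const_mul _ (by fun_prop), ← mul_assoc,
    ← ENNReal.ofReal_mul (by positivity), abs_of_pos (by positivity), inv_pow, inv_inv, mul_inv_cancel₀ (by positivity)]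
  simp [mass]

theorem U_univ {ρ : ℝ} (h : 0 < ρ) : (U ρ : Measure E) Set.univ = mass E := by
  unfold U; rw [withDensity_apply _ MeasurableSet.univ, Measure.restrict_univ, lint_uk h]

theorem lint_cv (ν : Measure E) [SFinite ν] {F : E → ℝ≥0∞} (hF : Measurable F) :
    ∫⁻ z, cv ν F z = ν Set.univ * ∫⁻ z, F z := by
  unfold cv
  rw [lintegral_lintegral_swap (by fun_prop)]
  simp only [lintegral_sub_right_eq_self]
  simp [mul_comm]

theorem lint_av {ρ : ℝ} (h : 0 < ρ) {F : E → ℝ≥0∞} (hF : Measurable F) :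
    ∫⁻ z, av ρ F z = mass E * ∫⁻ z, F z := by
  unfold av; rw [lint_cv _ hF, U_univ h]

theorem av_jensen {ρ : ℝ} (h : 0 < ρ) {F : E → ℝ≥0∞} (hF : Measurable F) (q : ℝ) (hq : 1 ≤ q) (z : E) :
    av ρ F z ^ q ≤ mass E ^ (q - 1) * av ρ (fun z => F z ^ q) z := by
  have := jensen (U ρ : Measure E) (fun w => F (z - w)) (by fun_prop) q hq
  rwa [U_univ h] at this

theorem ukr_scale {r ρ : ℝ} (hr : 0 < r) (h : r ≤ ρ) (z : E) :
    ukr r z ≤ (ρ / r) ^ (dm E) * ukr ρ z := by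
  have hρ : 0 < ρ := by linarith
  unfold ukr
  have h1 : ρ + ‖z‖ ≤ (ρ / r) * (r + ‖z‖) := by
    have : 1 ≤ ρ / r := by rw [le_div_iff₀ hr]; linarith
    rw [mul_add, div_mul_cancel₀ _ hr.ne']
    have := mul_le_mul_of_nonneg_right this (norm_nonneg z)
    linarith
  rw [← mul_div_assoc, div_le_div_iff₀ (by positivity) (by positivity)]
  calc r * (ρ + ‖z‖) ^ dm E ≤ ρ * ((ρ / r) * (r + ‖z‖)) ^ dm E := by gcongr
    _ = _ := by rw [mul_pow]; ring

theorem av_scale {r ρ : ℝ} (hr : 0 < r) (h : r ≤ ρ) {F : E → ℝ≥0∞} (hF : Measurable F) (z : E) :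
    av r F z ≤ ENNReal.ofReal ((ρ / r) ^ (dm E)) * av ρ F z := by
  have hρ : 0 < ρ := by linarith
  rw [av_eq _ hF, av_eq _ hF, ← lintegral_const_mul _ (by fun_prop)]
  refine lintegral_mono fun x => ?_
  rw [← mul_assoc]
  gcongr
  unfold uk
  rw [← ENNReal.ofReal_mul (by positivity)]
  exact ENNReal.ofReal_le_ofReal (ukr_scale hr h x)

/-- scales comparable from above: shrinking the scale -/
theorem ukr_scale' {r ρ : ℝ} (hr : 0 < r) (h : r ≤ ρ) (z : E) :
    ukr ρ z ≤ (ρ / r) * ukr r z := by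
  have hρ : 0 < ρ := by linarith
  unfold ukr
  have : ρ / r * (r / (r + ‖z‖) ^ dm E) = ρ / (r + ‖z‖) ^ dm E := by field_simp
  rw [this]
  gcongr

theorem av_scale' {r ρ : ℝ} (hr : 0 < r) (h : r ≤ ρ) {F : E → ℝ≥0∞} (hF : Measurable F) (z : E) :
    av ρ F z ≤ ENNReal.ofReal (ρ / r) * av r F z := by
  have hρ : 0 < ρ := by linarith
  rw [av_eq _ hF, av_eq _ hF, ← lintegral_const_mul _ (by fun_prop)]
  refine lintegral_mono fun x => ?_
  rw [← mul_assoc]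
  gcongr
  unfold uk
  rw [← ENNReal.ofReal_mul (by positivity)]
  exact ENNReal.ofReal_le_ofReal (ukr_scale' hr h x)

theorem ukr_conv {r ρ : ℝ} (hr : 0 < r) (h : r ≤ ρ) (v w : E) :
    ukr r w * ukr ρ (v - w) ≤ 4 ^ (dm E) * ukr ρ v * (ukr r w + ukr ρ (v - w)) := by
  have hρ : 0 < ρ := by linarith
  have n1 := ukr_nonneg hr w
  have n2 := ukr_nonneg hρ (v - w)
  have n3 := ukr_nonneg hρ v
  have tri : ‖v‖ ≤ ‖v - w‖ + ‖w‖ := by simpa using norm_add_le (v - w) w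
  have key : ukr ρ (v - w) ≤ 4 ^ dm E * ukr ρ v ∨ ukr r w ≤ 4 ^ dm E * ukr ρ v := by
    by_cases h1 : ρ + ‖v‖ ≤ 4 * (ρ + ‖v - w‖)
    · left
      unfold ukr
      rw [← mul_div_assoc, div_le_div_iff₀ (by positivity) (by positivity)]
      calc ρ * (ρ + ‖v‖) ^ dm E ≤ ρ * (4 * (ρ + ‖v - w‖)) ^ dm E := by gcongr
        _ = _ := by rw [mul_pow]; ring
    · right
      have h2 : ρ + ‖v‖ ≤ 4 * (r + ‖w‖) := by
        push Not at h1
        linarith [norm_nonneg v]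
      unfold ukr
      rw [← mul_div_assoc, div_le_div_iff₀ (by positivity) (by positivity)]
      calc r * (ρ + ‖v‖) ^ dm E ≤ ρ * (4 * (r + ‖w‖)) ^ dm E := by gcongr
        _ = _ := by rw [mul_pow]; ring
  have h4 : 0 ≤ (4:ℝ) ^ dm E * ukr ρ v := by positivity
  rcases key with k | k
  · calc _ ≤ ukr r w * (4 ^ dm E * ukr ρ v) := by gcongr
      _ ≤ _ := by nlinarith
  · calc _ ≤ (4 ^ dm E * ukr ρ v) * ukr ρ (v - w) := by gcongr
      _ ≤ _ := by nlinarith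

theorem av_av {r ρ : ℝ} (hr : 0 < r) (h : r ≤ ρ) {F : E → ℝ≥0∞} (hF : Measurable F) (z : E) :
    av ρ (av r F) z ≤ (4 ^ (dm E) * 2 * mass E) * av ρ F z := by
  have hρ : 0 < ρ := by linarith
  have m1 := av_meas r hF
  rw [av_eq' _ m1]
  have e1 : ∀ w, uk ρ (z - w) * av r F w = ∫⁻ x, uk ρ (z - w) * (uk r (w - x) * F x) := by
    intro w
    rw [av_eq' _ hF, lintegral_const_mul _ (by fun_prop)]
  rw [lintegral_congr e1, lintegral_lintegral_swap (by fun_prop), av_eq' _ hF,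
    ← lintegral_const_mul _ (by fun_prop)]
  refine lintegral_mono fun x => ?_
  have e2 : ∀ w, uk ρ (z - w) * (uk r (w - x) * F x) = (uk r (w - x) * uk ρ ((z - x) - (w - x))) * F x := by
    intro w; rw [sub_sub_sub_cancel_right]; ring
  simp only [e2]
  rw [lintegral_mul_const _ (by fun_prop), ← mul_assoc]
  gcongr
  rw [lintegral_sub_right_eq_self (fun w => uk r w * uk ρ (z - x - w)) x]
  calc _ ≤ ∫⁻ w, (4 ^ dm E * uk ρ (z - x)) * (uk r w + uk ρ (z - x - w)) := by
        refine lintegral_mono fun w => ?_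
        have n1 := ukr_nonneg hr w
        have n2 := ukr_nonneg hρ (z - x - w)
        have n3 := ukr_nonneg hρ (z - x)
        unfold uk
        rw [← ENNReal.ofReal_mul n1, ← ENNReal.ofReal_add n1 n2]
        have : (4 : ℝ≥0∞) ^ dm E = ENNReal.ofReal (4 ^ dm E) := by
          rw [ENNReal.ofReal_pow (by norm_num)]; norm_num
        rw [this, ← ENNReal.ofReal_mul (by positivity), ← ENNReal.ofReal_mul (by positivity)]
        exact ENNReal.ofReal_le_ofReal (ukr_conv hr h _ _)
    _ = (4 ^ dm E * uk ρ (z - x)) * (mass E + mass E) := by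
        rw [lintegral_const_mul _ (by fun_prop), lintegral_add_left (by fun_prop),
          lintegral_sub_left_eq_self (fun w => uk ρ w) (z - x), lint_uk hr, lint_uk hρ]
    _ = _ := by ring

end ker
end Strz

open MeasureTheory Filter
open scoped ENNReal NNReal ComplexConjugate FourierTransform
set_option linter.unusedSectionVars false
set_option linter.unusedSimpArgs false
set_option linter.unusedVariables false
namespace Strz

section loc
variable {V : Type} [NormedAddCommGroup V] [InnerProductSpace ℝ V] [FiniteDimensional ℝ V]
  [MeasurableSpace V] [BorelSpace V]

instance instHaarProd : (volume : Measure (V × ℝ)).IsAddHaarMeasure :=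
  inferInstanceAs ((volume : Measure V).prod (volume : Measure ℝ)).IsAddHaarMeasure

theorem av_dil {E : Type*} [NormedAddCommGroup E] [NormedSpace ℝ E] [FiniteDimensional ℝ E]
    [MeasureSpace E] [BorelSpace E] [(volume : Measure E).IsAddHaarMeasure]
    {ρ : ℝ} (h : 0 < ρ) {F : E → ℝ≥0∞} (hF : Measurable F) (z : E) :
    av ρ F z = ∫⁻ w, uk 1 w * F (z - ρ • w) := by
  rw [av_eq _ hF]
  have h1 : ∀ x : E, uk ρ x * F (z - x) =
      (fun y => ENNReal.ofReal ((ρ ^ Module.finrank ℝ E)⁻¹) * (uk 1 y * F (z - ρ • y))) (ρ⁻¹ • x) := by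
    intro x
    have hu : uk ρ x = ENNReal.ofReal ((ρ ^ Module.finrank ℝ E)⁻¹) * uk 1 (ρ⁻¹ • x) := by
      simp only [uk]
      rw [← ENNReal.ofReal_mul (by positivity)]
      congr 1
      simp only [ukr, norm_smul, norm_inv, Real.norm_of_nonneg h.le, dm]
      have : 1 + ρ⁻¹ * ‖x‖ = (ρ + ‖x‖) / ρ := by field_simp
      rw [this, div_pow, pow_succ]; field_simp; ring
    simp only [hu, smul_inv_smul₀ h.ne', mul_assoc]
  rw [lintegral_congr h1, lint_smul (fun y : E => ENNReal.ofReal ((ρ ^ Module.finrank ℝ E)⁻¹) * (uk 1 y * F (z - ρ • y))) (r := ρ⁻¹) (by positivity), lintegral_const_mul _ (by fun_prop), ← mul_assoc,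
    ← ENNReal.ofReal_mul (by positivity), abs_of_pos (by positivity), inv_pow, inv_inv, mul_inv_cancel₀ (by positivity)]
  simp

/-- polynomial decay kernel -/
noncomputable def pk (E : Type*) [NormedAddCommGroup E] (N : ℕ) (x : E) : ℝ≥0∞ :=
  ENNReal.ofReal (((1 + ‖x‖) ^ N)⁻¹)

@[fun_prop]
theorem pk_meas {E : Type*} [NormedAddCommGroup E] [MeasurableSpace E] [BorelSpace E] (N : ℕ) : Measurable (pk E N) := by
  unfold pk; fun_prop

theorem pk_lint {E : Type*} [NormedAddCommGroup E] [NormedSpace ℝ E] [FiniteDimensional ℝ E]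
    [MeasureSpace E] [BorelSpace E] [(volume : Measure E).IsAddHaarMeasure] (N : ℕ)
    (hN : Module.finrank ℝ E < N) : ∫⁻ x, pk E N x < ⊤ := by
  have := finite_integral_one_add_norm (μ := (volume : Measure E)) (r := N) (by exact_mod_cast hN)
  convert this using 3 with x
  rw [Real.rpow_neg (by positivity), Real.rpow_natCast, pk]

variable (V) in
noncomputable def dN : ℕ := 2 * dm (V × ℝ)

/-- tube map -/
noncomputable def tmap (a : V) (σ lam : ℝ) (p : V × ℝ) : V × ℝ := (σ⁻¹ • p.1 + (lam⁻¹ * p.2) • a, lam⁻¹ * p.2)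

theorem tmap_meas (a : V) (σ lam : ℝ) : Measurable (tmap a σ lam) := by
  unfold tmap; fun_prop

noncomputable def tw (p : V × ℝ) : ℝ≥0∞ := pk V (dN V) p.1 * pk ℝ (dN V) p.2

@[fun_prop]
theorem tw_meas : Measurable (tw : V × ℝ → ℝ≥0∞) := by unfold tw; fun_prop

noncomputable def TU (a : V) (σ lam : ℝ) : Measure (V × ℝ) :=
  (volume.withDensity tw).map (tmap a σ lam)

instance (a : V) (σ lam : ℝ) : SFinite (TU a σ lam) := by unfold TU; infer_instance

theorem lint_TU (a : V) (σ lam : ℝ) {G : V × ℝ → ℝ≥0∞} (hG : Measurable G) :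
    ∫⁻ w, G w ∂(TU a σ lam) = ∫⁻ p, tw p * G (tmap a σ lam p) := by
  unfold TU
  rw [lintegral_map hG (tmap_meas _ _ _), lintegral_withDensity_eq_lintegral_mul _ tw_meas (show Measurable fun p => G (tmap a σ lam p) from hG.comp (tmap_meas _ _ _))]
  rfl

theorem finrank_prod : Module.finrank ℝ (V × ℝ) = Module.finrank ℝ V + 1 := by simp

variable (V) in
noncomputable def tmass : ℝ≥0∞ := (∫⁻ x : V, pk V (dm (V × ℝ)) x) * ∫⁻ x : ℝ, pk ℝ (dm (V × ℝ)) x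

theorem tmass_lt : tmass V < ⊤ := by
  unfold tmass
  refine ENNReal.mul_lt_top (pk_lint _ ?_) (pk_lint _ ?_)
  · unfold dm; simp
  · unfold dm; simp

theorem TU_moment (a : V) {σ lam ρ : ℝ} (hσ : 0 < σ) (hl : 0 < lam) (h1 : 1 / σ ≤ ρ) (h2 : 1 / lam ≤ ρ) :
    ∫⁻ w, ENNReal.ofReal ((1 + ‖w‖ / ρ) ^ dm (V × ℝ)) ∂(TU a σ lam) ≤
      ENNReal.ofReal ((1 + ‖a‖) ^ dm (V × ℝ)) * tmass V := by
  have hρ : 0 < ρ := lt_of_lt_of_le (by positivity) h1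
  rw [lint_TU _ _ _ (by fun_prop)]
  unfold tmass
  rw [← lintegral_prod_mul (by fun_prop) (by fun_prop), ← lintegral_const_mul _ (by fun_prop)]
  refine lintegral_mono fun p => ?_
  dsimp only
  unfold tw pk
  rw [← ENNReal.ofReal_mul (by positivity), ← ENNReal.ofReal_mul (by positivity),
    ← ENNReal.ofReal_mul (by positivity), ← ENNReal.ofReal_mul (by positivity)]
  refine ENNReal.ofReal_le_ofReal ?_
  set k := dm (V × ℝ) with hk
  have hN : dN V = k + k := by unfold dN; omega
  rw [hN, pow_add, pow_add]
  have key : 1 + ‖tmap a σ lam p‖ / ρ ≤ (1 + ‖a‖) * ((1 + ‖p.1‖) * (1 + ‖p.2‖)) := by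
    have e1 : σ⁻¹ / ρ ≤ 1 := by rw [div_le_one hρ]; simpa using h1
    have e2 : lam⁻¹ / ρ ≤ 1 := by rw [div_le_one hρ]; simpa using h2
    have b1 : ‖σ⁻¹ • p.1 + (lam⁻¹ * p.2) • a‖ ≤ σ⁻¹ * ‖p.1‖ + lam⁻¹ * ‖p.2‖ * ‖a‖ := by
      refine (norm_add_le _ _).trans ?_
      rw [norm_smul, norm_smul, norm_mul, Real.norm_of_nonneg (by positivity : 0 ≤ σ⁻¹),
        Real.norm_of_nonneg (by positivity : 0 ≤ lam⁻¹)]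
    have b2 : ‖lam⁻¹ * p.2‖ = lam⁻¹ * ‖p.2‖ := by
      rw [norm_mul, Real.norm_of_nonneg (by positivity : 0 ≤ lam⁻¹)]
    have b3 : ‖tmap a σ lam p‖ ≤ σ⁻¹ * ‖p.1‖ + lam⁻¹ * ‖p.2‖ * (1 + ‖a‖) := by
      unfold tmap
      rw [Prod.norm_def]
      refine max_le (b1.trans ?_) (b2.le.trans ?_)
      · have : 0 ≤ lam⁻¹ * ‖p.2‖ := by positivity
        nlinarith
      · have : 0 ≤ lam⁻¹ * ‖p.2‖ * ‖a‖ := by positivity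
        have : 0 ≤ σ⁻¹ * ‖p.1‖ := by positivity
        nlinarith
    have b4 : ‖tmap a σ lam p‖ / ρ ≤ ‖p.1‖ + ‖p.2‖ * (1 + ‖a‖) := by
      calc _ ≤ (σ⁻¹ * ‖p.1‖ + lam⁻¹ * ‖p.2‖ * (1 + ‖a‖)) / ρ := by gcongr
        _ = (σ⁻¹ / ρ) * ‖p.1‖ + (lam⁻¹ / ρ) * (‖p.2‖ * (1 + ‖a‖)) := by ring
        _ ≤ 1 * ‖p.1‖ + 1 * (‖p.2‖ * (1 + ‖a‖)) := by gcongr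
        _ = _ := by ring
    have c1 := norm_nonneg p.1
    have c2 := norm_nonneg p.2
    have c3 := norm_nonneg a
    have c4 := mul_nonneg c1 c2
    have c5 := mul_nonneg c3 c1
    have c6 := mul_nonneg c3 c4
    nlinarith
  calc _ ≤ ((1 + ‖p.1‖) ^ k * (1 + ‖p.1‖) ^ k)⁻¹ * ((1 + ‖p.2‖) ^ k * (1 + ‖p.2‖) ^ k)⁻¹ *
        ((1 + ‖a‖) * ((1 + ‖p.1‖) * (1 + ‖p.2‖))) ^ k := by gcongr
    _ = _ := by
      rw [mul_pow, mul_pow]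
      have : 0 < 1 + ‖p.1‖ := by positivity
      have : 0 < 1 + ‖p.2‖ := by positivity
      field_simp

theorem TU_univ_le (a : V) (σ lam : ℝ) : (TU a σ lam) Set.univ ≤ tmass V := by
  have := lint_TU a σ lam (G := fun _ => 1) measurable_const
  rw [lintegral_one] at this
  rw [this]; unfold tmass
  rw [← lintegral_prod_mul (by fun_prop) (by fun_prop)]
  refine lintegral_mono fun p => ?_
  simp only [mul_one]
  unfold tw pk
  gcongr ENNReal.ofReal ?_ * ENNReal.ofReal ?_
  · gcongr
    · simp
    · unfold dN; omega
  · gcongr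
    · simp
    · unfold dN; omega

/-- the set of frequencies for local constancy -/
def LC (A : ℝ) (a c : V) (c2 σ lam : ℝ) : Set (V × ℝ) :=
  {ζ | ‖ζ.1 - c‖ ≤ A * σ ∧ |ζ.2 - inner ℝ ζ.1 a - c2| ≤ A * lam}

variable (V) in
theorem loc_const1 (A : ℝ) (hA : 0 < A) : ∃ C : ℝ≥0∞, C ≠ ⊤ ∧
    ∀ (a c : V) (c2 σ lam : ℝ) (f : V × ℝ → ℂ), 0 < σ → 0 < lam → Spec (LC A a c c2 σ lam) f →
    ∀ z, ‖f z‖ₑ ≤ C * cv (TU a σ lam) (fun z => ‖f z‖ₑ) z := by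
  obtain ⟨Φ1, c1, d1, i1⟩ := sch_Phi (E := V) A hA
  obtain ⟨Φ2, c2, d2, i2⟩ := sch_Phi (E := ℝ) A hA
  obtain ⟨C1, hC1, e1⟩ := d1 (dN V)
  obtain ⟨C2, hC2, e2⟩ := d2 (dN V)
  refine ⟨ENNReal.ofReal (C1 * C2), ENNReal.ofReal_ne_top, ?_⟩
  intro a c c2' σ lam f hσ hl hf z
  let m : V × ℝ → ℂ := fun p => ec (σ⁻¹ • c, lam⁻¹ * c2') p * (Φ1 p.1 * Φ2 p.2)
  have im0 : Integrable (fun p : V × ℝ => Φ1 p.1 * Φ2 p.2) :=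
    (decay_integrable c1.measurable d1).mul_prod (decay_integrable c2.measurable d2)
  have im : Integrable m := by
    refine im0.bdd_mul (c := 1) (by fun_prop : Measurable fun p => ec (σ⁻¹ • c, lam⁻¹ * c2') p).aestronglyMeasurable ?_
    exact Filter.Eventually.of_forall fun y => (norm_ec _ _).le
  have rep := hf.repro (P := V × ℝ) volume m (tmap a σ lam) im (tmap_meas _ _ _) 1 ?_ z
  · rw [one_mul] at rep
    rw [← rep]
    refine (enorm_integral_le_lintegral_enorm _).trans ?_
    have hm : Measurable f := hf.measurable
    unfold cv
    rw [lint_TU _ _ _ (by fun_prop), ← lintegral_const_mul _ (by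
      have := tmap_meas a σ lam; fun_prop)]
    refine lintegral_mono fun p => ?_
    rw [enorm_mul, ← mul_assoc]
    gcongr
    simp only [m, enorm_mul]
    rw [← ofReal_norm, ← ofReal_norm, ← ofReal_norm, norm_ec]
    unfold tw pk
    rw [ENNReal.ofReal_mul hC1]
    calc _ = ENNReal.ofReal ‖Φ1 p.1‖ * ENNReal.ofReal ‖Φ2 p.2‖ := by simp
      _ ≤ ENNReal.ofReal (C1 * ((1 + ‖p.1‖) ^ dN V)⁻¹) * ENNReal.ofReal (C2 * ((1 + ‖p.2‖) ^ dN V)⁻¹) := by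
        gcongr
        · exact e1 _
        · exact e2 _
      _ = _ := by rw [ENNReal.ofReal_mul hC1, ENNReal.ofReal_mul hC2]; ring
  · intro ζ hζ
    have h1 := i1 (σ⁻¹ • (ζ.1 - c)) (by
      rw [norm_smul, Real.norm_of_nonneg (by positivity), inv_mul_le_iff₀ hσ, mul_comm]; exact hζ.1)
    have h2 := i2 (- (lam⁻¹ * (ζ.2 - inner ℝ ζ.1 a - c2'))) (by
      rw [norm_neg, norm_mul, Real.norm_of_nonneg (by positivity), inv_mul_le_iff₀ hl, mul_comm]; exact hζ.2)
    have h3 := integral_prod_mul (μ := (volume : Measure V)) (ν := (volume : Measure ℝ))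
      (fun x => Φ1 x * Complex.exp (-(Complex.I * (inner ℝ (σ⁻¹ • (ζ.1 - c)) x : ℝ))))
      (fun x => Φ2 x * Complex.exp (-(Complex.I * (inner ℝ (- (lam⁻¹ * (ζ.2 - inner ℝ ζ.1 a - c2'))) x : ℝ))))
    rw [h1, h2, one_mul] at h3
    rw [← h3]
    refine integral_congr_ae (Eventually.of_forall fun p => ?_)
    have e : ec (σ⁻¹ • c, lam⁻¹ * c2') p * ec ζ (-(tmap a σ lam p)) =
        Complex.exp (-(Complex.I * (inner ℝ (σ⁻¹ • (ζ.1 - c)) p.1 : ℝ))) *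
        Complex.exp (-(Complex.I * (inner ℝ (- (lam⁻¹ * (ζ.2 - inner ℝ ζ.1 a - c2'))) p.2 : ℝ))) := by
      unfold ec
      rw [← Complex.exp_add, ← Complex.exp_add]
      congr 1
      rw [← mul_add, ← neg_add, ← mul_add, ← mul_neg]
      congr 1
      norm_cast
      simp only [ph, tmap, Prod.fst_neg, Prod.snd_neg, inner_neg_right, inner_smul_left, inner_smul_right,
        inner_add_right, inner_sub_left, inner_neg_left]
      simp
      ring
    simp only [m]
    calc _ = (ec (σ⁻¹ • c, lam⁻¹ * c2') p * ec ζ (-(tmap a σ lam p))) * (Φ1 p.1 * Φ2 p.2) := by ring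
      _ = _ := by rw [e]; ring

variable (V) in
theorem loc_const (A : ℝ) (hA : 0 < A) (q : ℝ) (hq : 1 ≤ q) : ∃ C : ℝ≥0∞, C ≠ ⊤ ∧
    ∀ (a c : V) (c2 σ lam : ℝ) (f : V × ℝ → ℂ), 0 < σ → 0 < lam → Spec (LC A a c c2 σ lam) f →
    ∀ z, ‖f z‖ₑ ^ q ≤ C * cv (TU a σ lam) (fun z => ‖f z‖ₑ ^ q) z := by
  obtain ⟨C, hC, h⟩ := loc_const1 V A hA
  refine ⟨C ^ q * tmass V ^ (q - 1), ENNReal.mul_ne_top (by simp [hC, show 0 ≤ q by linarith]) (by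
    exact ENNReal.rpow_ne_top_of_nonneg (by linarith) tmass_lt.ne), ?_⟩
  intro a c c2 σ lam f hσ hl hf z
  have hm : Measurable f := hf.measurable
  have h1 := ENNReal.rpow_le_rpow (h a c c2 σ lam f hσ hl hf z) (show 0 ≤ q by linarith)
  rw [ENNReal.mul_rpow_of_nonneg _ _ (by linarith)] at h1
  refine h1.trans ?_
  rw [mul_assoc]
  gcongr
  refine (jensen (TU a σ lam) (fun w => ‖f (z - w)‖ₑ) (by fun_prop) q hq).trans ?_
  unfold cv
  gcongr
  exact TU_univ_le _ _ _

theorem cv_TU_zero {σ : ℝ} (hσ : 0 < σ) {F : V × ℝ → ℝ≥0∞} (hF : Measurable F) (z : V × ℝ) :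
    cv (TU 0 σ σ) F z ≤ av (1 / σ) F z := by
  unfold cv
  rw [lint_TU _ _ _ (by fun_prop), av_dil (by positivity) hF]
  refine lintegral_mono fun p => ?_
  dsimp only
  have e : tmap 0 σ σ p = (1 / σ) • p := by
    ext <;> simp [tmap]
  rw [e]
  gcongr
  unfold tw pk uk ukr
  rw [← ENNReal.ofReal_mul (by positivity)]
  refine ENNReal.ofReal_le_ofReal ?_
  rw [one_div, ← mul_inv]
  gcongr
  rw [← mul_pow]
  have c1 := norm_nonneg p.1
  have c2 := norm_nonneg p.2
  have k1 : 1 + ‖p‖ ≤ (1 + ‖p.1‖) * (1 + ‖p.2‖) := by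
    rw [Prod.norm_def]
    rcases max_cases ‖p.1‖ ‖p.2‖ with ⟨h, _⟩ | ⟨h, _⟩ <;> rw [h] <;> nlinarith
  calc (1 + ‖p‖) ^ dm (V × ℝ) ≤ ((1 + ‖p.1‖) * (1 + ‖p.2‖)) ^ dm (V × ℝ) := by gcongr
    _ ≤ _ := by
      refine pow_le_pow_right₀ (by nlinarith) ?_
      unfold dN; omega

/-- isotropic local constancy -/
theorem loc_iso (A : ℝ) (hA : 0 < A) (q : ℝ) (hq : 1 ≤ q) : ∃ C : ℝ≥0∞, C ≠ ⊤ ∧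
    ∀ (c : V) (c2 σ : ℝ) (f : V × ℝ → ℂ), 0 < σ →
    Spec {ζ | ‖ζ.1 - c‖ ≤ A * σ ∧ |ζ.2 - c2| ≤ A * σ} f →
    ∀ z, ‖f z‖ₑ ^ q ≤ C * av (1 / σ) (fun z => ‖f z‖ₑ ^ q) z := by
  obtain ⟨C, hC, h⟩ := loc_const V A hA q hq
  refine ⟨C, hC, fun c c2 σ f hσ hf z => ?_⟩
  have hm : Measurable f := hf.measurable
  refine (h 0 c c2 σ σ f hσ hσ (hf.mono ?_) z).trans ?_
  · intro ζ hζ; simpa [LC] using hζ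
  · gcongr
    exact cv_TU_zero hσ (by fun_prop) z

end loc
end Strz

open MeasureTheory Filter
open scoped ENNReal NNReal ComplexConjugate FourierTransform
set_option linter.unusedSectionVars false
set_option linter.unusedSimpArgs false
set_option linter.unusedVariables false
namespace Strz

section orth
variable {V : Type} [NormedAddCommGroup V] [InnerProductSpace ℝ V] [FiniteDimensional ℝ V]
  [MeasurableSpace V] [BorelSpace V]

theorem orth_sum (A : ℝ) (hA : 0 < A) (ψ : V → ℂ) (cψ : Continuous ψ)
    (dψ : ∀ k : ℕ, ∃ C : ℝ, 0 ≤ C ∧ ∀ x, ‖ψ x‖ ≤ C * ((1 + ‖x‖) ^ k)⁻¹)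
    (oψ : ∀ ξ : V, 2 ≤ ‖ξ‖ → ∫ x, ψ x * conj (ψ x) * Complex.exp (-(Complex.I * (inner ℝ ξ x : ℝ))) = 0)
    (σ : ℝ) (hσ : 0 < σ) (S : Finset V) (g : V → V × ℝ → ℂ)
    (sep : ∀ c ∈ S, ∀ c' ∈ S, c ≠ c' → σ ≤ ‖c - c'‖)
    (hg : ∀ c ∈ S, Spec {ζ | ‖ζ.1 - c‖ ≤ A * σ} (g c)) (z : V × ℝ) :
    ∫⁻ x, ‖ψ x‖ₑ ^ 2 * ‖∑ c ∈ S, g c (z - (σ⁻¹ • x, 0))‖ₑ ^ 2 ≤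
      ENNReal.ofReal (2 * (1 + 2 * ((2 * A + 2))) ^ Module.finrank ℝ V) *
        ∑ c ∈ S, ∫⁻ x, ‖ψ x‖ₑ ^ 2 * ‖g c (z - (σ⁻¹ • x, 0))‖ₑ ^ 2 := by
  classical
  set w : V → V × ℝ := fun x => (σ⁻¹ • x, 0) with hw
  have mw : Measurable w := by simp only [hw]; fun_prop
  have gm : ∀ c ∈ S, Measurable (g c) := fun c hc => (hg c hc).measurable
  have iψ : Integrable (fun x => ψ x * conj (ψ x)) := by
    obtain ⟨C, h0, hC⟩ := dψ 0
    refine (decay_integrable cψ.measurable dψ).mul_bdd (c := C) ?_ ?_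
    · exact (Complex.continuous_conj.measurable.comp cψ.measurable).aestronglyMeasurable
    · exact Eventually.of_forall fun x => by simpa using hC x
  have ib : ∀ c ∈ S, ∀ c' ∈ S, Integrable fun x =>
      ψ x * conj (ψ x) * (g c (z - w x) * conj (g c' (z - w x))) := by
    intro c hc c' hc'
    obtain ⟨B, -, hB⟩ := (hg c hc).bdd
    obtain ⟨B', -, hB'⟩ := (hg c' hc').bdd
    have m1 := gm c hc
    have m2 := gm c' hc'
    refine iψ.mul_bdd (c := B * B') ?_ ?_
    · refine Measurable.aestronglyMeasurable ?_
      exact (m1.comp (by fun_prop)).mul (Complex.continuous_conj.measurable.comp (m2.comp (by fun_prop)))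
    · refine Eventually.of_forall fun x => ?_
      rw [norm_mul, RCLike.norm_conj]
      exact mul_le_mul (hB _) (hB' _) (norm_nonneg _) ((norm_nonneg _).trans (hB z))
  -- the total as a complex integral
  have e1 : ∫⁻ x, ‖ψ x‖ₑ ^ 2 * ‖∑ c ∈ S, g c (z - w x)‖ₑ ^ 2 =
      ‖∑ c ∈ S, ∑ c' ∈ S, ∫ x, ψ x * conj (ψ x) * (g c (z - w x) * conj (g c' (z - w x)))‖ₑ := by
    have : ∑ c ∈ S, ∑ c' ∈ S, ∫ x, ψ x * conj (ψ x) * (g c (z - w x) * conj (g c' (z - w x))) =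
        ∫ x, (((‖ψ x‖ ^ 2 * ‖∑ c ∈ S, g c (z - w x)‖ ^ 2 : ℝ)) : ℂ) := by
      rw [Finset.sum_congr rfl fun c hc => (integral_finsetSum S fun c' hc' => ib c hc c' hc').symm,
        ← integral_finsetSum S fun c hc => integrable_finsetSum S fun c' hc' => ib c hc c' hc']
      congr 1; ext x
      push_cast
      rw [← Complex.mul_conj', ← Complex.mul_conj', map_sum, Finset.sum_mul_sum, Finset.mul_sum]
      simp only [Finset.mul_sum]
    rw [this, integral_complex_ofReal, ← ofReal_norm, Complex.norm_real, Real.norm_of_nonneg (integral_nonneg fun x => by positivity),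
      ofReal_integral_eq_lintegral_ofReal]
    · refine lintegral_congr fun x => ?_
      rw [ENNReal.ofReal_mul (by positivity), ENNReal.ofReal_pow (by positivity), ENNReal.ofReal_pow (by positivity), ofReal_norm, ofReal_norm]
    · have h2 : Integrable fun x => ∑ c ∈ S, ∑ c' ∈ S, ψ x * conj (ψ x) * (g c (z - w x) * conj (g c' (z - w x))) :=
        integrable_finsetSum S fun c hc => integrable_finsetSum S fun c' hc' => ib c hc c' hc'
      refine h2.norm.congr (Eventually.of_forall fun x => ?_)
      dsimp only
      have : ∑ c ∈ S, ∑ c' ∈ S, ψ x * conj (ψ x) * (g c (z - w x) * conj (g c' (z - w x))) =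
        (((‖ψ x‖ ^ 2 * ‖∑ c ∈ S, g c (z - w x)‖ ^ 2 : ℝ)) : ℂ) := by
        push_cast
        rw [← Complex.mul_conj', ← Complex.mul_conj', map_sum, Finset.sum_mul_sum, Finset.mul_sum]
        simp only [Finset.mul_sum]
      rw [this, Complex.norm_real, Real.norm_of_nonneg (by positivity)]
    · exact Eventually.of_forall fun x => by positivity
  rw [e1]
  set J : V → ℝ≥0∞ := fun c => ∫⁻ x, ‖ψ x‖ₑ ^ 2 * ‖g c (z - w x)‖ₑ ^ 2 with hJ
  have far : ∀ c ∈ S, ∀ c' ∈ S, (2 * A + 2) * σ < ‖c - c'‖ →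
      ∫ x, ψ x * conj (ψ x) * (g c (z - w x) * conj (g c' (z - w x))) = 0 := by
    intro c hc c' hc' hcc
    have s1 := (hg c hc).mul (Ω'' := {ζ | ‖ζ.1 - (c - c')‖ ≤ 2 * A * σ}) ((hg c' hc').conj (Ω' := {ζ | ‖ζ.1 + c'‖ ≤ A * σ}) (by
      intro ζ hζ
      simp only [Set.mem_ofPred_eq, Prod.fst_neg] at hζ ⊢
      rwa [← norm_neg, neg_add, neg_neg, ← sub_eq_add_neg])) (by
      intro ζ hζ ζ' hζ'
      simp only [Set.mem_ofPred_eq, Prod.fst_add] at hζ hζ' ⊢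
      calc ‖ζ.1 + ζ'.1 - (c - c')‖ = ‖(ζ.1 - c) + (ζ'.1 + c')‖ := by congr 1; abel
        _ ≤ _ := norm_add_le _ _
        _ ≤ A * σ + A * σ := add_le_add hζ hζ'
        _ = _ := by ring)
    have := s1.repro volume (fun x => ψ x * conj (ψ x)) w iψ mw 0 (by
      intro ζ hζ
      have hζ' : ‖ζ.1 - (c - c')‖ ≤ 2 * A * σ := hζ
      have h3 : 2 ≤ ‖σ⁻¹ • ζ.1‖ := by
        rw [norm_smul, norm_inv, Real.norm_of_nonneg hσ.le, le_inv_mul_iff₀ hσ]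
        have := norm_sub_norm_le (c - c') ζ.1
        rw [norm_sub_rev (c - c') ζ.1] at this
        nlinarith
      rw [← oψ _ h3]
      congr 1; ext x
      congr 1
      simp [ec, ph, hw, inner_smul_left, inner_smul_right]) z
    simpa using this
  have near : ∀ c ∈ S, ∀ c' ∈ S, 
      ‖∫ x, ψ x * conj (ψ x) * (g c (z - w x) * conj (g c' (z - w x)))‖ₑ ≤ J c + J c' := by
    intro c hc c' hc'
    have m1 := gm c hc
    have m2 := gm c' hc'
    refine (enorm_integral_le_lintegral_enorm _).trans ?_
    have mψ := cψ.measurable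
    rw [hJ]; dsimp only
    rw [← lintegral_add_left (by fun_prop)]
    refine lintegral_mono fun x => ?_
    dsimp only
    have hc : ∀ u : ℂ, ‖conj u‖ₑ = ‖u‖ₑ := fun u => by rw [← ofReal_norm, RCLike.norm_conj, ofReal_norm]
    rw [enorm_mul, enorm_mul, enorm_mul, hc, hc, ← mul_add, ← pow_two]
    gcongr
    generalize ‖g c (z - w x)‖ₑ = u
    generalize ‖g c' (z - w x)‖ₑ = v
    rcases le_total u v with h | h
    · calc u * v ≤ v * v := by gcongr
        _ ≤ _ := by rw [← pow_two]; exact le_add_self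
    · calc u * v ≤ u * u := by gcongr
        _ ≤ _ := by rw [← pow_two]; exact le_self_add
  set M : ℝ := (1 + 2 * (2 * A + 2)) ^ Module.finrank ℝ V with hM
  have cnt : ∀ c ∈ S, (((S.filter fun c' => ‖c' - c‖ ≤ (2 * A + 2) * σ).card : ℕ) : ℝ≥0∞) ≤ ENNReal.ofReal M := by
    intro c hc
    have := packing (S.filter fun c' => ‖c' - c‖ ≤ (2 * A + 2) * σ) c σ ((2 * A + 2) * σ) hσ (by positivity)
      (fun c' hc' => (Finset.mem_filter.1 hc').2) (fun a ha b hb => sep a (Finset.mem_filter.1 ha).1 b (Finset.mem_filter.1 hb).1)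
    rw [← ENNReal.ofReal_natCast]
    refine ENNReal.ofReal_le_ofReal (this.trans (le_of_eq ?_))
    rw [hM]; congr 1; field_simp
  calc _ ≤ ∑ c ∈ S, ∑ c' ∈ S, ‖∫ x, ψ x * conj (ψ x) * (g c (z - w x) * conj (g c' (z - w x)))‖ₑ := by
        refine (enorm_sum_le _ _).trans ?_
        exact Finset.sum_le_sum fun c hc => enorm_sum_le _ _
    _ ≤ ∑ c ∈ S, ∑ c' ∈ S, if ‖c' - c‖ ≤ (2 * A + 2) * σ then (J c + J c') else 0 := by
        refine Finset.sum_le_sum fun c hc => Finset.sum_le_sum fun c' hc' => ?_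
        split_ifs with h
        · exact near c hc c' hc'
        · rw [far c hc c' hc' (by rw [norm_sub_rev]; exact not_le.1 h)]; simp
    _ = 2 * ∑ c ∈ S, ∑ c' ∈ S, if ‖c' - c‖ ≤ (2 * A + 2) * σ then J c else 0 := by
        have : ∀ c c', (if ‖c' - c‖ ≤ (2 * A + 2) * σ then (J c + J c') else 0) =
          (if ‖c' - c‖ ≤ (2 * A + 2) * σ then J c else 0) + (if ‖c - c'‖ ≤ (2 * A + 2) * σ then J c' else 0) := by
          intro c c'
          rw [norm_sub_rev c c']
          split_ifs <;> simp
        simp only [this, Finset.sum_add_distrib]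
        rw [Finset.sum_comm (f := fun c c' => if ‖c - c'‖ ≤ (2 * A + 2) * σ then J c' else 0), ← two_mul]
    _ ≤ 2 * ∑ c ∈ S, ENNReal.ofReal M * J c := by
        gcongr with c hc
        rw [← Finset.sum_filter, Finset.sum_const, nsmul_eq_mul]
        gcongr
        exact cnt c hc
    _ = _ := by
        rw [← Finset.mul_sum, ← mul_assoc]
        congr 1
        rw [ENNReal.ofReal_mul (by norm_num)]; simp

variable (V) in
theorem OL (A : ℝ) (hA : 0 < A) : ∃ C : ℝ≥0∞, C ≠ ⊤ ∧ ∀ (σ : ℝ) (S : Finset V) (g : V → V × ℝ → ℂ), 0 < σ →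
    (∀ c ∈ S, ∀ c' ∈ S, c ≠ c' → σ ≤ ‖c - c'‖) →
    (∀ c ∈ S, Spec {ζ | ‖ζ.1 - c‖ ≤ A * σ} (g c)) → ∀ z,
    av (1 / σ) (fun z => ‖∑ c ∈ S, g c z‖ₑ ^ (2 : ℝ)) z ≤
      C * ∑ c ∈ S, av (1 / σ) (fun z => ‖g c z‖ₑ ^ (2 : ℝ)) z := by
  obtain ⟨χ, ψ, -, -, -, cψ, -, dψ, ⟨c0, hc0, lψ⟩, oψ⟩ := sch_psi (E := V)
  have mψ := cψ.measurable
  set k := dm (V × ℝ) with hk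
  -- lower bound constant
  set b : ℝ≥0∞ := ∫⁻ x : V, ‖ψ x‖ₑ ^ 2 * (ENNReal.ofReal ((1 + ‖x‖) ^ k))⁻¹ with hb
  set M : ℝ≥0∞ := ∫⁻ x : V, ‖ψ x‖ₑ ^ 2 * ENNReal.ofReal ((1 + ‖x‖) ^ k) with hM
  have hMtop : M < ⊤ := by
    obtain ⟨C, hC, h⟩ := dψ (2 * k)
    calc M ≤ ∫⁻ x : V, ENNReal.ofReal (C ^ 2) * pk V k x := by
          refine lintegral_mono fun x => ?_
          dsimp only
          rw [← ofReal_norm, ← ENNReal.ofReal_pow (by positivity), ← ENNReal.ofReal_mul (by positivity), pk,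
            ← ENNReal.ofReal_mul (by positivity)]
          refine ENNReal.ofReal_le_ofReal ?_
          calc ‖ψ x‖ ^ 2 * (1 + ‖x‖) ^ k ≤ (C * ((1 + ‖x‖) ^ (2 * k))⁻¹) ^ 2 * (1 + ‖x‖) ^ k := by gcongr; exact h x
            _ = C ^ 2 * (((1 + ‖x‖) ^ (2 * k))⁻¹ * (((1 + ‖x‖) ^ (2 * k))⁻¹ * (1 + ‖x‖) ^ k)) := by ring
            _ ≤ C ^ 2 * (((1 + ‖x‖) ^ (2 * k))⁻¹ * (1 + ‖x‖) ^ k) := by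
              gcongr
              refine mul_le_of_le_one_left (by positivity) ?_
              exact inv_le_one_of_one_le₀ (one_le_pow₀ (by simp))
            _ = _ := by rw [two_mul, pow_add]; field_simp
      _ < ⊤ := by
        rw [lintegral_const_mul _ (by fun_prop)]
        refine ENNReal.mul_lt_top ENNReal.ofReal_lt_top (pk_lint _ ?_)
        rw [hk]; unfold dm; simp
  have hb0 : b ≠ 0 := by
    have : ENNReal.ofReal (c0 ^ 2 / 2 ^ k) * volume (Metric.closedBall (0 : V) 1) ≤ b := by
      rw [← setLIntegral_const]
      refine (setLIntegral_mono' Metric.isClosed_closedBall.measurableSet ?_).trans (setLIntegral_le_lintegral _ _)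
      intro x hx
      have hx' : ‖x‖ ≤ 1 := by simpa using hx
      rw [← ofReal_norm, ← ENNReal.ofReal_pow (by positivity), ← ENNReal.ofReal_inv_of_pos (by positivity), ← ENNReal.ofReal_mul (by positivity)]
      refine ENNReal.ofReal_le_ofReal ?_
      rw [div_eq_mul_inv]
      have := lψ x hx'
      gcongr
      linarith
    refine (lt_of_lt_of_le ?_ this).ne'
    refine ENNReal.mul_pos (by simp; positivity) ?_
    exact (Metric.measure_closedBall_pos _ _ (by norm_num)).ne'
  have hbtop : b ≠ ⊤ := by
    refine (lt_of_le_of_lt (lintegral_mono fun x => ?_) hMtop).ne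
    gcongr
    refine le_trans (b := 1) ?_ ?_
    · rw [ENNReal.inv_le_one, ← ENNReal.ofReal_one]
      exact ENNReal.ofReal_le_ofReal (one_le_pow₀ (by simp))
    · rw [← ENNReal.ofReal_one]
      exact ENNReal.ofReal_le_ofReal (one_le_pow₀ (by simp))
  set N : ℝ≥0∞ := ENNReal.ofReal (2 * (1 + 2 * ((2 * A + 2))) ^ Module.finrank ℝ V) with hN
  refine ⟨b⁻¹ * (N * M), ENNReal.mul_ne_top (by simp [hb0]) (ENNReal.mul_ne_top ENNReal.ofReal_ne_top hMtop.ne), ?_⟩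
  intro σ S g hσ sep hg z
  have gm : ∀ c ∈ S, Measurable (g c) := fun c hc => (hg c hc).measurable
  set F : V × ℝ → ℝ≥0∞ := fun z => ‖∑ c ∈ S, g c z‖ₑ ^ (2 : ℝ) with hF
  have mF : Measurable F := by
    refine Measurable.pow_const (Measurable.enorm ?_) _
    exact Finset.measurable_sum S gm
  let w : V → V × ℝ := fun x => (σ⁻¹ • x, 0)
  have mw : Measurable w := by fun_prop
  let ν : Measure (V × ℝ) := (volume.withDensity fun x : V => ‖ψ x‖ₑ ^ 2).map w
  have lν : ∀ G : V × ℝ → ℝ≥0∞, Measurable G → ∫⁻ u, G u ∂ν = ∫⁻ x, ‖ψ x‖ₑ ^ 2 * G (w x) := by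
    intro G hG
    rw [lintegral_map hG mw, lintegral_withDensity_eq_lintegral_mul _ (by fun_prop) (show Measurable fun x => G (w x) from hG.comp mw)]
    rfl
  have nw : ∀ x, ‖w x‖ / (1 / σ) = ‖x‖ := by
    intro x
    simp only [w, Prod.norm_def, norm_zero, norm_smul, norm_inv, Real.norm_of_nonneg hσ.le]
    rw [max_eq_left (by positivity)]; field_simp
  have s1 : b * av (1 / σ) F z ≤ cv ν (av (1 / σ) F) z := by
    have mA := av_meas (1 / σ) mF
    unfold cv
    rw [lν _ (by fun_prop), hb, ← lintegral_mul_const _ (by fun_prop)]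
    refine lintegral_mono fun x => ?_
    dsimp only
    rw [mul_assoc]
    gcongr
    rw [mul_comm, ← div_eq_mul_inv]
    refine ENNReal.div_le_of_le_mul' ?_
    have := av_shift' (by positivity : 0 < 1 / σ) mF (z - w x) (w x)
    rwa [sub_add_cancel, nw] at this
  have s2 : cv ν (av (1 / σ) F) z = av (1 / σ) (cv ν F) z := cv_comm _ _ mF z
  have s3 : ∀ z, cv ν F z ≤ N * cv ν (fun z => ∑ c ∈ S, ‖g c z‖ₑ ^ (2 : ℝ)) z := by
    intro z
    rw [cv_sum _ _ (fun c hc => (gm c hc).enorm.pow_const _)]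
    have := orth_sum A hA ψ cψ dψ oψ σ hσ S g sep hg z
    unfold cv
    rw [lν _ (by fun_prop)]
    simp only [hF, ENNReal.rpow_two]
    refine this.trans (le_of_eq ?_)
    rw [hN]; congr 1
    refine Finset.sum_congr rfl fun c hc => ?_
    have := gm c hc
    rw [lν _ (by fun_prop)]
  have mG : Measurable fun z => ∑ c ∈ S, ‖g c z‖ₑ ^ (2 : ℝ) :=
    Finset.measurable_sum S fun c hc => (gm c hc).enorm.pow_const _
  have s4 : av (1 / σ) (cv ν F) z ≤ N * (M * av (1 / σ) (fun z => ∑ c ∈ S, ‖g c z‖ₑ ^ (2 : ℝ)) z) := by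
    refine (av_mono _ s3 z).trans ?_
    rw [av_const_mul _ (cv_meas _ mG)]
    gcongr
    refine (av_cv (by positivity) mG ν z).trans ?_
    gcongr
    rw [lν _ (by fun_prop), hM]
    simp only [nw]
    exact le_rfl
  have e : ∑ c ∈ S, av (1 / σ) (fun z => ‖g c z‖ₑ ^ (2 : ℝ)) z = av (1 / σ) (fun z => ∑ c ∈ S, ‖g c z‖ₑ ^ (2 : ℝ)) z :=
    (cv_sum _ _ (fun c hc => (gm c hc).enorm.pow_const _) z).symm
  rw [e]
  calc av (1 / σ) F z = b⁻¹ * (b * av (1 / σ) F z) := by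
        rw [← mul_assoc, ENNReal.inv_mul_cancel hb0 hbtop, one_mul]
    _ ≤ b⁻¹ * (N * (M * av (1 / σ) (fun z => ∑ c ∈ S, ‖g c z‖ₑ ^ (2 : ℝ)) z)) := by
        exact mul_le_mul_right (s1.trans (s2.le.trans s4)) _
    _ = _ := by ring

end orth
end Strz

open MeasureTheory Filter
open scoped ENNReal NNReal ComplexConjugate FourierTransform
set_option linter.unusedSectionVars false
set_option linter.unusedSimpArgs false
set_option linter.unusedVariables false
namespace Strz

section infl
variable {V : Type} [NormedAddCommGroup V] [InnerProductSpace ℝ V] [FiniteDimensional ℝ V]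
  [MeasurableSpace V] [BorelSpace V]

def Box (A σ : ℝ) (c : V) : Set (V × ℝ) :=
  {ζ | ‖ζ.1 - c‖ ≤ A * σ ∧ |ζ.2 - ‖ζ.1‖ ^ 2| ≤ A * σ ^ 2}

noncomputable def vv (c : V) : V × ℝ := ((2 : ℝ) • c, 1)

noncomputable def TT {m : ℕ} (c : Fin (m + 1) → V) (y : Fin (m + 1) → ℝ) : V × ℝ := ∑ i, y i • vv (c i)

theorem TT_meas {m : ℕ} (c : Fin (m + 1) → V) : Measurable (TT c) := by
  unfold TT; fun_prop

theorem TT_update {m : ℕ} (c : Fin (m + 1) → V) (y : Fin (m + 1) → ℝ) (i : Fin (m + 1)) :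
    TT c y = TT c (Function.update y i 0) + y i • vv (c i) := by
  classical
  unfold TT
  rw [← Finset.add_sum_erase _ _ (Finset.mem_univ i), ← Finset.add_sum_erase (a := i) (f := fun j => Function.update y i 0 j • vv (c j)) _ (Finset.mem_univ i)]
  rw [Function.update_self, zero_smul, zero_add, add_comm]
  congr 1
  refine Finset.sum_congr rfl fun j hj => ?_
  rw [Function.update_of_ne (Finset.ne_of_mem_erase hj)]

theorem norm_vv (c : V) (h : ‖c‖ ≤ 1) : ‖vv c‖ ≤ 2 := by
  unfold vv
  rw [Prod.norm_def]
  refine max_le ?_ (by norm_num)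
  rw [norm_smul]; norm_num; linarith

theorem norm_TT {m : ℕ} (c : Fin (m + 1) → V) (h : ∀ i, ‖c i‖ ≤ 1) (y : Fin (m + 1) → ℝ) (hy : ∀ i, |y i| ≤ 1) :
    ‖TT c y‖ ≤ 2 * (m + 1) := by
  unfold TT
  refine (norm_sum_le _ _).trans ?_
  calc _ ≤ ∑ i : Fin (m + 1), (2 : ℝ) := by
        refine Finset.sum_le_sum fun i _ => ?_
        rw [norm_smul]
        calc _ ≤ 1 * (2 : ℝ) := mul_le_mul (hy i) (norm_vv _ (h i)) (norm_nonneg _) (by norm_num)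
          _ = 2 := by ring
    _ = _ := by simp; ring

theorem tube_shift (τ c : V) {σ ρ r K D : ℝ} (hσ : 0 < σ) (hr : 0 < r) (hρ : 0 < ρ) (hK : 0 < K) (hD : 0 ≤ D)
    (h : ‖τ - c‖ * K ≤ D) (hρr : ρ ≤ K * r) {F : V × ℝ → ℝ≥0∞} (hF : Measurable F) (s : ℝ) (hs : |s| ≤ ρ) (z : V × ℝ) :
    cv (TU ((2 : ℝ) • τ) σ ρ⁻¹) (av r F) (z + s • vv c) ≤
      ENNReal.ofReal ((1 + 2 * D) ^ dm (V × ℝ) * 2 ^ dN V) * cv (TU ((2 : ℝ) • τ) σ ρ⁻¹) (av r F) z := by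
  have mA := av_meas r hF
  have mt := tmap_meas ((2 : ℝ) • τ) σ ρ⁻¹
  unfold cv
  rw [lint_TU _ _ _ (by fun_prop), lint_TU _ _ _ (by fun_prop), ← lintegral_const_mul _ (by fun_prop),
    ← lintegral_add_right_eq_self _ ((0, s / ρ) : V × ℝ)]
  refine lintegral_mono fun p => ?_
  dsimp only
  have e1 : z + s • vv c - tmap ((2 : ℝ) • τ) σ ρ⁻¹ (p + (0, s / ρ)) =
      (z - tmap ((2 : ℝ) • τ) σ ρ⁻¹ p) + ((2 * s) • (c - τ), 0) := by
    have : ρ * (p.2 + s / ρ) = ρ * p.2 + s := by field_simp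
    ext
    · simp only [vv, tmap, inv_inv, Prod.fst_add, Prod.fst_sub, Prod.smul_fst, Prod.snd_add, this, add_zero]
      module
    · simp only [vv, tmap, inv_inv, Prod.snd_add, Prod.snd_sub, Prod.smul_snd, this]
      simp
  rw [e1]
  have e2 := av_shift' hr hF (z - tmap ((2 : ℝ) • τ) σ ρ⁻¹ p) ((2 * s) • (c - τ), 0)
  have e3 : ‖(((2 * s) • (c - τ), 0) : V × ℝ)‖ / r ≤ 2 * D := by
    rw [Prod.norm_def]
    simp only [norm_zero]
    rw [max_eq_left (norm_nonneg _), norm_smul, div_le_iff₀ hr, norm_mul, Real.norm_eq_abs, Real.norm_eq_abs,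
      norm_sub_rev c τ, abs_of_pos (by norm_num : (0:ℝ) < 2)]
    have := norm_nonneg (τ - c)
    calc 2 * |s| * ‖τ - c‖ ≤ 2 * (K * r) * ‖τ - c‖ := by gcongr; linarith
      _ = 2 * (‖τ - c‖ * K) * r := by ring
      _ ≤ 2 * D * r := by gcongr
  have e4 : tw (p + (0, s / ρ)) ≤ ENNReal.ofReal (2 ^ dN V) * tw p := by
    unfold tw pk
    simp only [Prod.fst_add, Prod.snd_add, add_zero]
    rw [mul_left_comm]
    gcongr
    rw [← ENNReal.ofReal_mul (by positivity)]
    refine ENNReal.ofReal_le_ofReal ?_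
    rw [← div_eq_mul_inv, inv_eq_one_div, div_le_div_iff₀ (by positivity) (by positivity), one_mul, ← mul_pow]
    gcongr
    have h1 : |s / ρ| ≤ 1 := by rw [abs_div, abs_of_pos hρ, div_le_one hρ]; exact hs
    have h2 := norm_sub_le (p.2 + s / ρ) (s / ρ)
    rw [add_sub_cancel_right, Real.norm_eq_abs (s / ρ)] at h2
    have h3 := norm_nonneg (p.2 + s / ρ)
    linarith
  calc _ ≤ (ENNReal.ofReal (2 ^ dN V) * tw p) * (ENNReal.ofReal ((1 + 2 * D) ^ dm (V × ℝ)) * av r F (z - tmap ((2 : ℝ) • τ) σ ρ⁻¹ p)) := by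
        gcongr
        refine e2.trans ?_
        gcongr
    _ = _ := by rw [ENNReal.ofReal_mul (by positivity)]; ring

/-- averaging over a transversal parallelepiped -/
theorem avg_par {m : ℕ} (Λ : ℝ≥0∞) (c : Fin (m + 1) → V) (hc : ∀ i, ‖c i‖ ≤ 1)
    (hT : Measure.map (TT c) volume ≤ Λ • (volume : Measure (V × ℝ))) {ρ : ℝ} (hρ : 0 < ρ)
    {G : V × ℝ → ℝ≥0∞} (hG : Measurable G) (z : V × ℝ) :
    ∫⁻ y, G (z + ρ • TT c y) ∂(Measure.pi fun _ : Fin (m + 1) => (volume : Measure ℝ).restrict (Set.Icc 0 1)) ≤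
      ENNReal.ofReal ((1 + 2 * (m + 1)) ^ dm (V × ℝ)) * Λ * av ρ G z := by
  rw [← Measure.restrict_pi_pi]
  have mT := TT_meas c
  calc _ ≤ ∫⁻ y in Set.univ.pi fun _ : Fin (m + 1) => Set.Icc (0 : ℝ) 1,
        ENNReal.ofReal ((1 + 2 * (m + 1)) ^ dm (V × ℝ)) * (uk 1 (-(TT c y)) * G (z + ρ • TT c y)) ∂(Measure.pi fun _ => volume) := by
        refine setLIntegral_mono' (MeasurableSet.univ_pi fun _ => measurableSet_Icc) fun y hy => ?_
        rw [← mul_assoc]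
        refine le_mul_of_one_le_left (by positivity) ?_
        unfold uk ukr
        rw [← ENNReal.ofReal_mul (by positivity), ← ENNReal.ofReal_one]
        refine ENNReal.ofReal_le_ofReal ?_
        rw [norm_neg, mul_one_div, one_le_div (by positivity)]
        gcongr
        refine norm_TT c hc y fun i => ?_
        have := hy i (Set.mem_univ i)
        rw [abs_of_nonneg this.1]; exact this.2
    _ ≤ ∫⁻ y, ENNReal.ofReal ((1 + 2 * (m + 1)) ^ dm (V × ℝ)) * (uk 1 (-(TT c y)) * G (z + ρ • TT c y)) ∂(Measure.pi fun _ => volume) :=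
        setLIntegral_le_lintegral _ _
    _ = ENNReal.ofReal ((1 + 2 * (m + 1)) ^ dm (V × ℝ)) * ∫⁻ w, (uk 1 (-w) * G (z + ρ • w)) ∂(Measure.map (TT c) volume) := by
        rw [lintegral_const_mul _ (by fun_prop), lintegral_map (by fun_prop) mT]; rfl
    _ ≤ ENNReal.ofReal ((1 + 2 * (m + 1)) ^ dm (V × ℝ)) * (Λ * ∫⁻ w, (uk 1 (-w) * G (z + ρ • w))) := by
        gcongr
        rw [← smul_eq_mul, ← lintegral_smul_measure]
        exact lintegral_mono' hT le_rfl
    _ = _ := by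
        rw [av_dil hρ hG, mul_assoc, ← lintegral_neg_eq_self]
        simp [sub_eq_add_neg]

variable (V) in
/-- one ball inflation step -/
theorem ball_step (m : ℕ) (A : ℝ) (hA : 0 < A) (D : ℝ) (hD : 0 ≤ D) (q θ : ℝ) (hq : 2 ≤ q) (hθ : 0 ≤ θ) (hmθ : m * θ ≤ 1)
    (Λ : ℝ≥0∞) (hΛ : Λ ≠ ⊤) : ∃ C : ℝ≥0∞, C ≠ ⊤ ∧
    ∀ (K σ r ρ : ℝ) (c : Fin (m + 1) → V) (S : Fin (m + 1) → Finset V) (f : Fin (m + 1) → V → V × ℝ → ℂ),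
      0 < K → 0 < σ → 1 / σ ≤ r → r ≤ ρ → ρ ≤ K * r → ρ ≤ 1 / σ ^ 2 → (∀ i, ‖c i‖ ≤ 1) →
      Measure.map (TT c) volume ≤ Λ • (volume : Measure (V × ℝ)) →
      (∀ i, ∀ τ ∈ S i, ‖τ‖ ≤ 1 ∧ ‖τ - c i‖ * K ≤ D ∧ Spec (Box A σ τ) (f i τ)) →
      ∫⁻ z, ∏ i, (∑ τ ∈ S i, (av r (fun z => ‖f i τ z‖ₑ ^ q) z) ^ (2 / q)) ^ (θ * (q / 2)) ≤
      C * ∫⁻ z, ∏ i, (∑ τ ∈ S i, (av ρ (fun z => ‖f i τ z‖ₑ ^ q) z) ^ (2 / q)) ^ (θ * (q / 2)) := by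
  obtain ⟨C1, hC1, h1⟩ := loc_const V (A + A ^ 2) (by positivity) q (by linarith)
  set C2 : ℝ≥0∞ := ENNReal.ofReal ((1 + 2 * D) ^ dm (V × ℝ) * 2 ^ dN V) with hC2
  set C3 : ℝ≥0∞ := ENNReal.ofReal ((1 + 2 * (m + 1)) ^ dm (V × ℝ)) * Λ with hC3
  set C4 : ℝ≥0∞ := ENNReal.ofReal (3 ^ dm (V × ℝ)) * tmass V with hC4
  set C5 : ℝ≥0∞ := 4 ^ dm (V × ℝ) * 2 * mass (V × ℝ) with hC5
  have hC3' : C3 ≠ ⊤ := ENNReal.mul_ne_top ENNReal.ofReal_ne_top hΛ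
  have hC4' : C4 ≠ ⊤ := ENNReal.mul_ne_top ENNReal.ofReal_ne_top tmass_lt.ne
  have hC5' : C5 ≠ ⊤ := ENNReal.mul_ne_top (ENNReal.mul_ne_top (by simp) (by simp)) (mass_lt (E := V × ℝ)).ne
  set C6 : ℝ≥0∞ := (C1 * C2) * (C2 * (C3 * (C4 * C5))) with hC6
  have hC6' : C6 ≠ ⊤ := by
    have : C2 ≠ ⊤ := ENNReal.ofReal_ne_top
    finiteness
  refine ⟨∏ _i : Fin (m + 1), C6 ^ θ, ENNReal.prod_ne_top fun i _ => ENNReal.rpow_ne_top_of_nonneg hθ hC6', ?_⟩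
  intro K σ r ρ c S f hK hσ hσr hrρ hρK hρσ hc hT hS
  have hr : 0 < r := lt_of_lt_of_le (by positivity) hσr
  have hρ : 0 < ρ := by linarith
  have q0 : 0 < q := by linarith
  let F : Fin (m + 1) → V → V × ℝ → ℝ≥0∞ := fun i τ z => ‖f i τ z‖ₑ ^ q
  have mF : ∀ i, ∀ τ ∈ S i, Measurable (F i τ) := fun i τ hτ => ((hS i τ hτ).2.2.measurable.enorm).pow_const _
  let H : Fin (m + 1) → V → V × ℝ → ℝ≥0∞ := fun i τ => cv (TU ((2 : ℝ) • τ) σ ρ⁻¹) (av r (F i τ))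
  have mH : ∀ i, ∀ τ ∈ S i, Measurable (H i τ) := fun i τ hτ => cv_meas _ (av_meas _ (mF i τ hτ))
  have hH : ∀ i, ∀ τ ∈ S i, ∀ z, av r (F i τ) z ≤ C1 * H i τ z := by
    intro i τ hτ z
    have h2 : ∀ z, F i τ z ≤ C1 * cv (TU ((2 : ℝ) • τ) σ ρ⁻¹) (F i τ) z := by
      refine h1 ((2 : ℝ) • τ) τ (-‖τ‖ ^ 2) σ ρ⁻¹ (f i τ) hσ (by positivity) ((hS i τ hτ).2.2.mono ?_)
      rintro ζ ⟨hζ1, hζ2⟩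
      refine ⟨?_, ?_⟩
      · refine hζ1.trans ?_
        gcongr; nlinarith
      · have e : ζ.2 - inner ℝ ζ.1 ((2 : ℝ) • τ) - -‖τ‖ ^ 2 = (ζ.2 - ‖ζ.1‖ ^ 2) + ‖ζ.1 - τ‖ ^ 2 := by
          rw [norm_sub_sq_real, inner_smul_right]; ring
        rw [e]
        have e2 : ‖ζ.1 - τ‖ ^ 2 ≤ (A * σ) ^ 2 := by gcongr
        have e3 : σ ^ 2 ≤ ρ⁻¹ := by
          rw [le_inv_comm₀ (by positivity) hρ]; simpa using hρσ
        calc |(ζ.2 - ‖ζ.1‖ ^ 2) + ‖ζ.1 - τ‖ ^ 2| ≤ |ζ.2 - ‖ζ.1‖ ^ 2| + |‖ζ.1 - τ‖ ^ 2| := abs_add_le _ _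
          _ ≤ A * σ ^ 2 + (A * σ) ^ 2 := by rw [abs_of_nonneg (by positivity : 0 ≤ ‖ζ.1 - τ‖ ^ 2)]; gcongr
          _ = (A + A ^ 2) * σ ^ 2 := by ring
          _ ≤ _ := by gcongr
    refine (av_mono _ h2 z).trans ?_
    rw [av_const_mul _ (cv_meas _ (mF i τ hτ))]
    gcongr
    exact (cv_comm _ _ (mF i τ hτ) z).le
  have hsh : ∀ i, ∀ τ ∈ S i, ∀ z s, |s| ≤ ρ → H i τ (z + s • vv (c i)) ≤ C2 * H i τ z := by
    intro i τ hτ z s hs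
    exact tube_shift τ (c i) hσ hr hρ hK hD (hS i τ hτ).2.1 hρK (mF i τ hτ) s hs z
  have havg : ∀ i, ∀ τ ∈ S i, ∀ z, av ρ (H i τ) z ≤ (C4 * C5) * av ρ (F i τ) z := by
    intro i τ hτ z
    refine (av_cv hρ (av_meas _ (mF i τ hτ)) _ z).trans ?_
    rw [mul_assoc]
    gcongr
    · refine (TU_moment _ hσ (by positivity) (hσr.trans hrρ) (by simp)).trans ?_
      rw [hC4]
      gcongr
      have := (hS i τ hτ).1
      rw [norm_smul]; norm_num; linarith
    · exact av_av hr hrρ (mF i τ hτ) z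
  let μ : Measure ℝ := (volume : Measure ℝ).restrict (Set.Icc 0 1)
  haveI : IsProbabilityMeasure μ := ⟨by simp [μ]⟩
  let P : Measure (Fin (m + 1) → ℝ) := Measure.pi fun _ => μ
  have aeP : ∀ᵐ y ∂P, ∀ i, 0 ≤ y i ∧ y i ≤ 1 := by
    simp only [P, μ]
    rw [← Measure.restrict_pi_pi, ae_restrict_iff' (MeasurableSet.univ_pi fun _ => measurableSet_Icc)]
    exact Eventually.of_forall fun y hy i => hy i (Set.mem_univ i)
  let Φ : Fin (m + 1) → V × ℝ → ℝ≥0∞ := fun i z => (∑ τ ∈ S i, (av r (F i τ) z) ^ (2 / q)) ^ (θ * (q / 2))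
  have mΦ : ∀ i, Measurable (Φ i) := fun i =>
    (Finset.measurable_sum _ fun τ hτ => (av_meas r (mF i τ hτ)).pow_const _).pow_const _
  have mT := TT_meas c
  have pull : ∀ (a : ℝ≥0∞) (T : Finset V) (x : V → ℝ≥0∞), (∑ τ ∈ T, (a * x τ) ^ (2 / q)) ^ (q / 2) =
      a * (∑ τ ∈ T, (x τ) ^ (2 / q)) ^ (q / 2) := by
    intro a T x
    simp only [ENNReal.mul_rpow_of_nonneg _ _ (show 0 ≤ 2 / q by positivity)]
    rw [← Finset.mul_sum, ENNReal.mul_rpow_of_nonneg _ _ (by positivity), ← ENNReal.rpow_mul]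
    congr 1
    rw [div_mul_div_cancel₀ (by positivity)]; simp
  have key : ∀ z, ∫⁻ y, ∏ i, Φ i (z + ρ • TT c y) ∂P ≤
      (∏ _i : Fin (m + 1), C6 ^ θ) * ∏ i, (∑ τ ∈ S i, (av ρ (F i τ) z) ^ (2 / q)) ^ (θ * (q / 2)) := by
    intro z
    let g : Fin (m + 1) → (Fin (m + 1) → ℝ) → ℝ≥0∞ := fun i y =>
      (C1 * C2) * (∑ τ ∈ S i, (H i τ (z + ρ • TT c (Function.update y i 0))) ^ (2 / q)) ^ (q / 2)
    have mg : ∀ i, Measurable (g i) := by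
      intro i
      refine Measurable.const_mul (Measurable.pow_const (Finset.measurable_sum _ fun τ hτ => ?_) _) _
      refine ((mH i τ hτ).comp ?_).pow_const _
      have : Measurable fun y : Fin (m + 1) → ℝ => Function.update y i 0 := by fun_prop
      fun_prop
    have b1 : ∀ᵐ y ∂P, ∏ i, Φ i (z + ρ • TT c y) ≤ ∏ i, g i y ^ θ := by
      filter_upwards [aeP] with y hy
      refine Finset.prod_le_prod' fun i _ => ?_
      simp only [Φ, g]
      rw [mul_comm θ, ENNReal.rpow_mul]
      refine ENNReal.rpow_le_rpow ?_ hθ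
      rw [← pull]
      refine ENNReal.rpow_le_rpow (Finset.sum_le_sum fun τ hτ => ENNReal.rpow_le_rpow ?_ (by positivity)) (by positivity)
      refine (hH i τ hτ _).trans ?_
      rw [mul_assoc]
      gcongr
      rw [TT_update c y i, smul_add, ← add_assoc, smul_smul]
      refine hsh i τ hτ _ _ ?_
      rw [abs_mul, abs_of_pos hρ, abs_of_nonneg (hy i).1]
      nlinarith [(hy i).2]
    have b2 := loomis_whitney m μ θ hθ hmθ g mg (by
      intro i y s; simp only [g, Function.update_idem])
    have b3 : ∀ i, ∫⁻ y, g i y ∂P ≤ C6 * (∑ τ ∈ S i, (av ρ (F i τ) z) ^ (2 / q)) ^ (q / 2) := by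
      intro i
      have m3 : ∀ τ ∈ S i, Measurable fun y => H i τ (z + ρ • TT c y) := fun τ hτ => (mH i τ hτ).comp (by fun_prop)
      calc ∫⁻ y, g i y ∂P ≤ ∫⁻ y, (C1 * C2) * (C2 * (∑ τ ∈ S i, (H i τ (z + ρ • TT c y)) ^ (2 / q)) ^ (q / 2)) ∂P := by
            refine lintegral_mono_ae ?_
            filter_upwards [aeP] with y hy
            simp only [g]
            refine mul_le_mul_right ?_ _
            rw [← pull]
            refine ENNReal.rpow_le_rpow (Finset.sum_le_sum fun τ hτ => ENNReal.rpow_le_rpow ?_ (by positivity)) (by positivity)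
            have : z + ρ • TT c (Function.update y i 0) = (z + ρ • TT c y) + (-(ρ * y i)) • vv (c i) := by
              rw [TT_update c y i, smul_add, ← add_assoc, smul_smul, neg_smul]; abel
            rw [this]
            refine hsh i τ hτ _ _ ?_
            rw [abs_neg, abs_mul, abs_of_pos hρ, abs_of_nonneg (hy i).1]
            nlinarith [(hy i).2]
        _ = (C1 * C2) * (C2 * ∫⁻ y, (∑ τ ∈ S i, (H i τ (z + ρ • TT c y)) ^ (2 / q)) ^ (q / 2) ∂P) := by
            have : Measurable fun y => (∑ τ ∈ S i, (H i τ (z + ρ • TT c y)) ^ (2 / q)) ^ (q / 2) :=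
              (Finset.measurable_sum _ fun τ hτ => (m3 τ hτ).pow_const _).pow_const _
            rw [lintegral_const_mul _ (by fun_prop), lintegral_const_mul _ this]
        _ ≤ (C1 * C2) * (C2 * (∑ τ ∈ S i, (∫⁻ y, H i τ (z + ρ • TT c y) ∂P) ^ (2 / q)) ^ (q / 2)) := by
            gcongr
            exact mink_pow P (S i) _ m3 q hq
        _ ≤ (C1 * C2) * (C2 * (∑ τ ∈ S i, ((C3 * (C4 * C5)) * av ρ (F i τ) z) ^ (2 / q)) ^ (q / 2)) := by
            gcongr with τ hτ
            refine (avg_par Λ c hc hT hρ (mH i τ hτ) z).trans ?_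
            rw [mul_assoc C3]
            gcongr
            exact havg i τ hτ z
        _ = _ := by rw [pull, hC6]; ring
    calc _ ≤ ∫⁻ y, ∏ i, g i y ^ θ ∂P := lintegral_mono_ae b1
      _ ≤ ∏ i, (∫⁻ y, g i y ∂P) ^ θ := b2
      _ ≤ ∏ i, (C6 ^ θ * (∑ τ ∈ S i, (av ρ (F i τ) z) ^ (2 / q)) ^ (θ * (q / 2))) := by
          refine Finset.prod_le_prod' fun i _ => ?_
          refine (ENNReal.rpow_le_rpow (b3 i) hθ).trans (le_of_eq ?_)
          rw [ENNReal.mul_rpow_of_nonneg _ _ hθ, mul_comm θ, ENNReal.rpow_mul]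
      _ = _ := Finset.prod_mul_distrib
  have mprod : Measurable fun z => ∏ i, Φ i z := Finset.measurable_prod _ fun i _ => mΦ i
  calc ∫⁻ z, ∏ i, Φ i z = ∫⁻ y, (∫⁻ z, ∏ i, Φ i (z + ρ • TT c y)) ∂P := by
        have : ∀ y, ∫⁻ z, ∏ i, Φ i (z + ρ • TT c y) = ∫⁻ z, ∏ i, Φ i z := by
          intro y
          exact lintegral_add_right_eq_self (fun z => ∏ i, Φ i z) _
        simp only [this]
        simp [P]
    _ = ∫⁻ z, (∫⁻ y, ∏ i, Φ i (z + ρ • TT c y) ∂P) := by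
        rw [lintegral_lintegral_swap]
        refine Measurable.aemeasurable ?_
        exact mprod.comp (by fun_prop : Measurable fun q : (Fin (m + 1) → ℝ) × (V × ℝ) => q.2 + ρ • TT c q.1)
    _ ≤ ∫⁻ z, (∏ _i : Fin (m + 1), C6 ^ θ) * ∏ i, (∑ τ ∈ S i, (av ρ (F i τ) z) ^ (2 / q)) ^ (θ * (q / 2)) :=
        lintegral_mono key
    _ = _ := by
        rw [lintegral_const_mul]
        refine Finset.measurable_prod _ fun i _ => ?_
        exact (Finset.measurable_sum _ fun τ hτ => (av_meas ρ (mF i τ hτ)).pow_const _).pow_const _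

end infl
end Strz

open MeasureTheory Filter
open scoped ENNReal NNReal ComplexConjugate FourierTransform
set_option linter.unusedSectionVars false
set_option linter.unusedSimpArgs false
set_option linter.unusedVariables false
namespace Strz

section fam
variable {V : Type} [NormedAddCommGroup V] [InnerProductSpace ℝ V] [FiniteDimensional ℝ V]
  [MeasurableSpace V] [BorelSpace V]

structure IsFam (A σ : ℝ) (S : Finset V) (f : V → V × ℝ → ℂ) : Prop where
  ball : ∀ c ∈ S, ‖c‖ ≤ 1
  sep : ∀ c ∈ S, ∀ c' ∈ S, c ≠ c' → σ ≤ ‖c - c'‖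
  spec : ∀ c ∈ S, Spec (Box A σ c) (f c)

theorem IsFam.sub {A σ : ℝ} {S T : Finset V} {f : V → V × ℝ → ℂ} (h : IsFam A σ S f) (hT : T ⊆ S) : IsFam A σ T f :=
  ⟨fun c hc => h.ball c (hT hc), fun c hc c' hc' => h.sep c (hT hc) c' (hT hc'), fun c hc => h.spec c (hT hc)⟩

noncomputable def nrm (p : ℝ) (f : V × ℝ → ℂ) : ℝ≥0∞ := ∫⁻ z, ‖f z‖ₑ ^ p

noncomputable def NN (p : ℝ) (S : Finset V) (f : V → V × ℝ → ℂ) : ℝ≥0∞ :=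
  (∑ c ∈ S, (nrm p (f c)) ^ (2 / p)) ^ (p / 2)

variable (V) in
def DecB (p A δ : ℝ) (B : ℝ≥0∞) : Prop := ∀ (S : Finset V) (f : V → V × ℝ → ℂ), IsFam A δ S f →
  nrm p (fun z => ∑ c ∈ S, f c z) ≤ B * NN p S f

theorem DecB.mono {p A δ : ℝ} {B B' : ℝ≥0∞} (h : DecB V p A δ B) (hB : B ≤ B') : DecB V p A δ B' :=
  fun S f hf => (h S f hf).trans (by gcongr)

theorem NN_mono {p : ℝ} (hp : 2 ≤ p) {S T : Finset V} (h : S ⊆ T) (f : V → V × ℝ → ℂ) : NN p S f ≤ NN p T f := by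
  unfold NN
  exact ENNReal.rpow_le_rpow (Finset.sum_le_sum_of_subset h) (by linarith)

theorem esq_sum_le {ι : Type*} (S : Finset ι) (f : ι → ℂ) :
    ‖∑ c ∈ S, f c‖ₑ ^ (2 : ℝ) ≤ S.card * ∑ c ∈ S, ‖f c‖ₑ ^ (2 : ℝ) := by
  have h : ‖∑ c ∈ S, f c‖ ^ 2 ≤ S.card * ∑ c ∈ S, ‖f c‖ ^ 2 :=
    (pow_le_pow_left₀ (norm_nonneg _) (norm_sum_le _ _) 2).trans (sq_sum_le_card_mul_sum_sq)
  have e : ∀ x : ℂ, ‖x‖ₑ ^ (2 : ℝ) = ENNReal.ofReal (‖x‖ ^ 2) := by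
    intro x
    rw [ENNReal.ofReal_pow (norm_nonneg _), ofReal_norm]; norm_cast
  simp only [e]
  rw [← ENNReal.ofReal_sum_of_nonneg (fun i _ => by positivity), ← ENNReal.ofReal_natCast, ← ENNReal.ofReal_mul (by positivity)]
  exact ENNReal.ofReal_le_ofReal h

theorem nrm_sum_sq {ι : Type*} {p : ℝ} (hp : 2 ≤ p) (S : Finset ι) (f : ι → V × ℝ → ℂ) (hf : ∀ c ∈ S, Measurable (f c)) :
    ∫⁻ z, (∑ c ∈ S, ‖f c z‖ₑ ^ (2 : ℝ)) ^ (p / 2) ≤ (∑ c ∈ S, (nrm p (f c)) ^ (2 / p)) ^ (p / 2) := by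
  have h := mink_pow volume S (fun c z => ‖f c z‖ₑ ^ p) (fun c hc => by have := hf c hc; fun_prop) p hp
  have e : ∀ x : ℝ≥0∞, (x ^ p) ^ (2 / p) = x ^ (2 : ℝ) := by
    intro x; rw [← ENNReal.rpow_mul]; congr 1; field_simp
  simp only [e] at h
  exact h

/-- finite sums -/
theorem nrm_sum_card {ι : Type*} {p : ℝ} (hp : 2 ≤ p) (S : Finset ι) (f : ι → V × ℝ → ℂ) (hf : ∀ c ∈ S, Measurable (f c)) :
    nrm p (fun z => ∑ c ∈ S, f c z) ≤ (S.card : ℝ≥0∞) ^ (p / 2) * (∑ c ∈ S, (nrm p (f c)) ^ (2 / p)) ^ (p / 2) := by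
  refine le_trans ?_ (mul_le_mul_right (nrm_sum_sq hp S f hf) _)
  rw [← lintegral_const_mul' _ _ (ENNReal.rpow_ne_top_of_nonneg (by linarith) (by simp))]
  refine lintegral_mono fun z => ?_
  dsimp only
  rw [← ENNReal.mul_rpow_of_nonneg _ _ (by linarith)]
  have e : ‖∑ c ∈ S, f c z‖ₑ ^ p = (‖∑ c ∈ S, f c z‖ₑ ^ (2 : ℝ)) ^ (p / 2) := by
    rw [← ENNReal.rpow_mul]; congr 1; ring
  rw [e]
  exact ENNReal.rpow_le_rpow (esq_sum_le _ _) (by linarith)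

/-- the trivial bound -/
theorem triv_dec {p A δ : ℝ} (hp : 2 ≤ p) (hδ : 0 < δ) (hδ1 : δ ≤ 1) :
    DecB V p A δ (ENNReal.ofReal (3 ^ (Module.finrank ℝ V * (p / 2))) *
      ENNReal.ofReal (δ ^ (-(Module.finrank ℝ V * (p / 2))))) := by
  intro S f hf
  refine (nrm_sum_card hp S f fun c hc => (hf.spec c hc).measurable).trans ?_
  unfold NN
  gcongr
  have h1 := packing S 0 δ 1 hδ (by norm_num) (fun c hc => by simpa using hf.ball c hc) hf.sep
  rw [← ENNReal.ofReal_natCast, ENNReal.ofReal_rpow_of_nonneg (by positivity) (by linarith), ← ENNReal.ofReal_mul (by positivity)]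
  refine ENNReal.ofReal_le_ofReal ?_
  calc (S.card : ℝ) ^ (p / 2) ≤ ((3 / δ) ^ Module.finrank ℝ V) ^ (p / 2) := by
        refine Real.rpow_le_rpow (by positivity) (h1.trans ?_) (by linarith)
        gcongr
        rw [mul_one, ← sub_nonneg]
        have : 3 / δ - (1 + 2 / δ) = 1 / δ - 1 := by ring
        rw [this, sub_nonneg, le_div_iff₀ hδ]; linarith
    _ = _ := by
        rw [← Real.rpow_natCast, ← Real.rpow_mul (by positivity), Real.div_rpow (by norm_num) hδ.le, Real.rpow_neg hδ.le]
        rfl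

/-- rounding -/
theorem rounding (S : Finset V) {σ : ℝ} (hσ : 0 < σ) : ∃ r : V → V, (∀ c ∈ S, r c ∈ S ∧ ‖c - r c‖ ≤ σ) ∧
    ∀ c ∈ S, ∀ c' ∈ S, r c ≠ r c' → σ ≤ ‖r c - r c'‖ := by
  classical
  induction S using Finset.induction_on with
  | empty => exact ⟨id, by simp, by simp⟩
  | insert a S ha ih =>
    obtain ⟨r, h1, h2⟩ := ih
    by_cases h : ∃ c ∈ S, ‖a - r c‖ ≤ σ
    · obtain ⟨c, hc, hca⟩ := h
      refine ⟨Function.update r a (r c), ?_, ?_⟩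
      · intro x hx
        rcases Finset.mem_insert.1 hx with rfl | hx2
        · rw [Function.update_self]; exact ⟨Finset.mem_insert_of_mem (h1 c hc).1, hca⟩
        · rw [Function.update_of_ne (by rintro rfl; exact ha hx2)]
          exact ⟨Finset.mem_insert_of_mem (h1 x hx2).1, (h1 x hx2).2⟩
      · have : ∀ x ∈ insert a S, ∃ y ∈ S, Function.update r a (r c) x = r y := by
          intro x hx
          rcases Finset.mem_insert.1 hx with rfl | hx2
          · exact ⟨c, hc, by rw [Function.update_self]⟩
          · exact ⟨x, hx2, by rw [Function.update_of_ne (by rintro rfl; exact ha hx2)]⟩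
        intro x hx y hy
        obtain ⟨x', hx', e1⟩ := this x hx
        obtain ⟨y', hy', e2⟩ := this y hy
        rw [e1, e2]; exact h2 x' hx' y' hy'
    · push Not at h
      refine ⟨Function.update r a a, ?_, ?_⟩
      · intro x hx
        rcases Finset.mem_insert.1 hx with rfl | hx2
        · rw [Function.update_self]; exact ⟨Finset.mem_insert_self _ _, by simpa using hσ.le⟩
        · rw [Function.update_of_ne (by rintro rfl; exact ha hx2)]
          exact ⟨Finset.mem_insert_of_mem (h1 x hx2).1, (h1 x hx2).2⟩
      · intro x hx y hy hxy
        rcases Finset.mem_insert.1 hx with rfl | hx2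
        · rcases Finset.mem_insert.1 hy with rfl | hy2
          · exact absurd rfl hxy
          · have : y ≠ x := by rintro rfl; exact ha hy2
            rw [Function.update_self, Function.update_of_ne this]
            exact (h y hy2).le
        · have e : x ≠ a := by rintro rfl; exact ha hx2
          rcases Finset.mem_insert.1 hy with rfl | hy2
          · rw [Function.update_self, Function.update_of_ne e, norm_sub_rev]
            exact (h x hx2).le
          · have e' : y ≠ a := by rintro rfl; exact ha hy2
            rw [Function.update_of_ne e, Function.update_of_ne e'] at hxy ⊢
            exact h2 x hx2 y hy2 hxy

open Classical in
/-- coarse pieces -/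
noncomputable def crs (S : Finset V) (r : V → V) (f : V → V × ℝ → ℂ) (τ : V) : V × ℝ → ℂ :=
  fun z => ∑ c ∈ S with r c = τ, f c z

open Classical in
theorem crs_sum (S : Finset V) (r : V → V) (f : V → V × ℝ → ℂ) (z : V × ℝ) :
    ∑ τ ∈ S.image r, crs S r f τ z = ∑ c ∈ S, f c z := by
  unfold crs
  exact Finset.sum_fiberwise_of_maps_to (fun c hc => Finset.mem_image_of_mem r hc) _

theorem box_sub {A σ δ : ℝ} (hA : 2 ≤ A) (hδ : 0 < δ) (h : 2 * δ ≤ σ) {c τ : V} (hc : ‖c - τ‖ ≤ σ) : Box A δ c ⊆ Box A σ τ := by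
  rintro ζ ⟨h1, h2⟩
  refine ⟨?_, h2.trans ?_⟩
  · calc ‖ζ.1 - τ‖ = ‖(ζ.1 - c) + (c - τ)‖ := by abel_nf
      _ ≤ ‖ζ.1 - c‖ + ‖c - τ‖ := norm_add_le _ _
      _ ≤ A * δ + σ := add_le_add h1 hc
      _ ≤ _ := by nlinarith
  · gcongr; linarith

open Classical in
theorem IsFam.coarse {A σ δ : ℝ} {S : Finset V} {f : V → V × ℝ → ℂ} (hf : IsFam A δ S f) (hA : 2 ≤ A) (hδ : 0 < δ)
    (h : 2 * δ ≤ σ) {r : V → V} (hr : ∀ c ∈ S, r c ∈ S ∧ ‖c - r c‖ ≤ σ)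
    (hr2 : ∀ c ∈ S, ∀ c' ∈ S, r c ≠ r c' → σ ≤ ‖r c - r c'‖) : IsFam A σ (S.image r) (crs S r f) := by
  refine ⟨?_, ?_, ?_⟩
  · intro τ hτ
    obtain ⟨c, hc, rfl⟩ := Finset.mem_image.1 hτ
    exact hf.ball _ (hr c hc).1
  · intro τ hτ τ' hτ' hne
    obtain ⟨c, hc, rfl⟩ := Finset.mem_image.1 hτ
    obtain ⟨c', hc', rfl⟩ := Finset.mem_image.1 hτ'
    exact hr2 c hc c' hc' hne
  · intro τ hτ
    refine Spec.sum _ fun c hc => ?_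
    obtain ⟨hc2, rfl⟩ := Finset.mem_filter.1 hc
    exact (hf.spec c hc2).mono (box_sub hA hδ h (hr c hc2).2)

/-- linear change of variables -/
theorem lint_lin {W W' : Type*} [NormedAddCommGroup W] [NormedSpace ℝ W] [FiniteDimensional ℝ W] [MeasurableSpace W] [BorelSpace W]
    [NormedAddCommGroup W'] [NormedSpace ℝ W'] [FiniteDimensional ℝ W'] [MeasurableSpace W'] [BorelSpace W']
    (μ : Measure W) (μ' : Measure W') [μ.IsAddHaarMeasure] [μ'.IsAddHaarMeasure] (L : W ≃ₗ[ℝ] W') :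
    ∃ κ : ℝ≥0∞, κ ≠ 0 ∧ κ ≠ ⊤ ∧ ∀ F : W' → ℝ≥0∞, Measurable F → ∫⁻ z, F (L z) ∂μ = κ * ∫⁻ z, F z ∂μ' := by
  have mL : Measurable L := L.toContinuousLinearEquiv.continuous.measurable
  have h : (μ.map L).IsAddHaarMeasure := L.toContinuousLinearEquiv.isAddHaarMeasure_map μ
  refine ⟨Measure.addHaarScalarFactor (μ.map L) μ', ?_, by simp, ?_⟩
  · have := Measure.addHaarScalarFactor_pos_of_isAddHaarMeasure (μ.map L) μ'
    simpa using this.ne'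
  · intro F hF
    rw [← lintegral_map hF mL]
    conv_lhs => rw [Measure.isAddLeftInvariant_eq_smul (μ.map L) μ']
    simp only [lintegral_smul_measure]
    rfl

/-- parabolic rescaling -/
theorem rescale {p A δ lam : ℝ} {B : ℝ≥0∞} (hp : 2 ≤ p) (hl : 0 < lam) (hD : DecB V p A (δ / lam) B) (c0 : V)
    (S : Finset V) (f : V → V × ℝ → ℂ) (hf : IsFam A δ S f) (hS : ∀ c ∈ S, ‖c - c0‖ ≤ lam) :
    nrm p (fun z => ∑ c ∈ S, f c z) ≤ B * NN p S f := by
  classical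
  let L : (V × ℝ) ≃ₗ[ℝ] (V × ℝ) :=
    { toFun := fun z => (lam⁻¹ • z.1 + (2 * (lam⁻¹) ^ 2 * z.2) • c0, (lam⁻¹) ^ 2 * z.2)
      invFun := fun z => (lam • z.1 - (lam * 2 * z.2) • c0, lam ^ 2 * z.2)
      map_add' := by
        intro x y
        ext
        · simp only [Prod.fst_add, Prod.snd_add]; module
        · simp only [Prod.snd_add]; ring
      map_smul' := by
        intro a x
        ext
        · simp only [Prod.smul_fst, Prod.smul_snd, RingHom.id_apply, smul_eq_mul]; module
        · simp only [Prod.smul_snd, RingHom.id_apply, smul_eq_mul]; ring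
      left_inv := by
        intro x
        ext
        · dsimp only
          rw [smul_add, smul_smul, smul_smul, mul_inv_cancel₀ hl.ne', one_smul]
          have : lam * (2 * lam⁻¹ ^ 2 * x.2) = lam * 2 * (lam⁻¹ ^ 2 * x.2) := by ring
          rw [this, add_sub_cancel_right]
        · dsimp only; field_simp
      right_inv := by
        intro x
        ext
        · dsimp only
          rw [smul_sub, smul_smul, smul_smul, inv_mul_cancel₀ hl.ne', one_smul]
          have : lam⁻¹ * (lam * 2 * x.2) = 2 * lam⁻¹ ^ 2 * (lam ^ 2 * x.2) := by field_simp
          rw [this, sub_add_cancel]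
        · dsimp only; field_simp }
  have hL : ∀ z, L z = (lam⁻¹ • z.1 + (2 * (lam⁻¹) ^ 2 * z.2) • c0, (lam⁻¹) ^ 2 * z.2) := fun z => rfl
  obtain ⟨κ, hκ0, hκ, hIntg⟩ := lint_lin (volume : Measure (V × ℝ)) (volume : Measure (V × ℝ)) L
  let η : V × ℝ := (lam⁻¹ • c0, -((lam⁻¹) ^ 2 * ‖c0‖ ^ 2))
  let e : V → V := fun c => lam⁻¹ • (c - c0)
  let g : V → V × ℝ → ℂ := fun c' z => (1 * ec (-η) z) * f (c0 + lam • c') (L z)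
  have he : ∀ c, c0 + lam • e c = c := by
    intro c; simp only [e]; rw [smul_smul, mul_inv_cancel₀ hl.ne', one_smul, add_sub_cancel]
  have einj : Function.Injective e := by
    intro a b hab; rw [← he a, ← he b, hab]
  have hfam : IsFam A (δ / lam) (S.image e) g := by
    refine ⟨?_, ?_, ?_⟩
    · intro c' hc'
      obtain ⟨c, hc, rfl⟩ := Finset.mem_image.1 hc'
      simp only [e]
      rw [norm_smul, norm_inv, Real.norm_eq_abs, abs_of_pos hl, inv_mul_le_iff₀ hl, mul_one]
      exact hS c hc
    · intro c' hc' d' hd' hne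
      obtain ⟨c, hc, rfl⟩ := Finset.mem_image.1 hc'
      obtain ⟨d, hd, rfl⟩ := Finset.mem_image.1 hd'
      have : e c - e d = lam⁻¹ • (c - d) := by simp only [e]; module
      rw [this, norm_smul, norm_inv, Real.norm_eq_abs, abs_of_pos hl, div_eq_inv_mul]
      gcongr
      exact hf.sep c hc d hd (by rintro rfl; exact hne rfl)
    · intro c' hc'
      obtain ⟨c, hc, rfl⟩ := Finset.mem_image.1 hc'
      simp only [g, he]
      have s1 : Spec {-η} (fun z : V × ℝ => 1 * ec (-η) z) := Spec.atom (-η) (Set.mem_singleton _) 1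
      have s2 := (hf.spec c hc).comp (Ω' := {ζ | ζ + -η ∈ Box A (δ / lam) (e c)}) L
        (fun ζ => (lam⁻¹ • ζ.1, (lam⁻¹) ^ 2 * (ζ.2 - 2 * inner ℝ ζ.1 c0))) (fun _ => 0) (by fun_prop) (by fun_prop)
        (by
          intro ζ z
          rw [hL]
          simp only [ph, inner_add_right, inner_smul_right, inner_smul_left]
          simp
          ring)
        (by
          rintro ζ ⟨h1, h2⟩
          have e1 : (lam⁻¹ • ζ.1, lam⁻¹ ^ 2 * (ζ.2 - 2 * inner ℝ ζ.1 c0)) + -η =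
            (lam⁻¹ • (ζ.1 - c0), lam⁻¹ ^ 2 * (ζ.2 - 2 * inner ℝ ζ.1 c0 + ‖c0‖ ^ 2)) := by
            ext
            · simp only [η, Prod.fst_add, Prod.fst_neg]; module
            · simp only [η, Prod.snd_add, Prod.snd_neg]; ring
          show _ ∈ Box _ _ _
          rw [e1]
          refine ⟨?_, ?_⟩
          · dsimp only [e]
            rw [← smul_sub, sub_sub_sub_cancel_right, norm_smul, norm_inv, Real.norm_eq_abs, abs_of_pos hl,
              mul_div_assoc', inv_mul_eq_div]
            gcongr
          · dsimp only
            rw [norm_smul, norm_inv, Real.norm_eq_abs, abs_of_pos hl, mul_pow, ← mul_sub, norm_sub_sq_real, abs_mul,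
              abs_of_pos (by positivity : 0 < lam⁻¹ ^ 2)]
            have : ζ.2 - 2 * inner ℝ ζ.1 c0 + ‖c0‖ ^ 2 - (‖ζ.1‖ ^ 2 - 2 * inner ℝ ζ.1 c0 + ‖c0‖ ^ 2) = ζ.2 - ‖ζ.1‖ ^ 2 := by ring
            rw [this, div_pow, mul_div_assoc', inv_pow, inv_mul_eq_div]
            gcongr)
      refine s1.mul s2 ?_
      rintro ζ rfl ζ' h'
      rw [add_comm]; exact h'
  have key := hD _ g hfam
  have n1 : ∀ c', (∀ z, ‖g c' z‖ₑ = ‖f (c0 + lam • c') (L z)‖ₑ) := by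
    intro c' z
    simp only [g, one_mul]
    rw [enorm_mul, ← ofReal_norm (ec (-η) z), norm_ec]; simp
  have n2 : nrm p (fun z => ∑ c ∈ S.image e, g c z) = κ * nrm p (fun z => ∑ c ∈ S, f c z) := by
    unfold nrm
    rw [← hIntg _ (by
      have : Measurable fun z => ∑ c ∈ S, f c z := Finset.measurable_sum _ fun c hc => (hf.spec c hc).measurable
      fun_prop)]
    refine lintegral_congr fun z => ?_
    dsimp only
    rw [Finset.sum_image (fun a _ b _ h => einj h)]
    simp only [g, he, one_mul]
    rw [← Finset.mul_sum, enorm_mul, ← ofReal_norm (ec (-η) z), norm_ec]; simp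
  have n3 : ∀ c ∈ S, nrm p (g (e c)) = κ * nrm p (f c) := by
    intro c hc
    unfold nrm
    rw [← hIntg _ (by have := (hf.spec c hc).measurable; fun_prop)]
    refine lintegral_congr fun z => ?_
    rw [n1, he]
  have n4 : NN p (S.image e) g = κ * NN p S f := by
    unfold NN
    rw [Finset.sum_image (fun a _ b _ h => einj h), Finset.sum_congr rfl fun c hc => by rw [n3 c hc, ENNReal.mul_rpow_of_nonneg _ _ (by positivity)],
      ← Finset.mul_sum, ENNReal.mul_rpow_of_nonneg _ _ (by linarith), ← ENNReal.rpow_mul]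
    have : 2 / p * (p / 2) = 1 := by field_simp
    rw [this, ENNReal.rpow_one]
  rw [n2, n4, mul_left_comm] at key
  exact (ENNReal.mul_le_mul_iff_right hκ0 hκ).1 key

end fam
end Strz

open MeasureTheory Filter
open scoped ENNReal NNReal ComplexConjugate FourierTransform
set_option linter.unusedSectionVars false
set_option linter.unusedSimpArgs false
set_option linter.unusedVariables false
namespace Strz

theorem holder_prod {α : Type*} [MeasurableSpace α] (μ : Measure α) (m : ℕ) (h : Fin (m + 1) → α → ℝ≥0∞)
    (hh : ∀ i, Measurable (h i)) :
    ∫⁻ z, ∏ i, h i z ^ (1 / ((m : ℝ) + 1)) ∂μ ≤ ∏ i, (∫⁻ z, h i z ∂μ) ^ (1 / ((m : ℝ) + 1)) := by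
  have := ENNReal.lintegral_prod_norm_pow_le (μ := μ) (Finset.univ : Finset (Fin (m + 1))) (f := h)
    (p := fun _ => 1 / ((m : ℝ) + 1)) (fun i _ => (hh i).aemeasurable) (by simp; field_simp) (fun i _ => by positivity)
  exact this

theorem cs_lint {α : Type*} [MeasurableSpace α] (μ : Measure α) (F G : α → ℝ≥0∞) (hF : Measurable F) (hG : Measurable G) :
    ∫⁻ z, F z ^ (1 / 2 : ℝ) * G z ^ (1 / 2 : ℝ) ∂μ ≤ (∫⁻ z, F z ∂μ) ^ (1 / 2 : ℝ) * (∫⁻ z, G z ∂μ) ^ (1 / 2 : ℝ) :=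
  ENNReal.lintegral_mul_norm_pow_le hF.aemeasurable hG.aemeasurable (by norm_num) (by norm_num) (by norm_num)

theorem cs_sum {ι : Type*} (S : Finset ι) (F G : ι → ℝ≥0∞) :
    ∑ c ∈ S, F c ^ (1 / 2 : ℝ) * G c ^ (1 / 2 : ℝ) ≤ (∑ c ∈ S, F c) ^ (1 / 2 : ℝ) * (∑ c ∈ S, G c) ^ (1 / 2 : ℝ) := by
  have h := ENNReal.inner_le_Lp_mul_Lq S (fun c => F c ^ (1 / 2 : ℝ)) (fun c => G c ^ (1 / 2 : ℝ)) (p := 2) (q := 2)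
    (by rw [Real.holderConjugate_iff]; norm_num)
  have e : ∀ x : ℝ≥0∞, (x ^ (1 / 2 : ℝ)) ^ (2 : ℝ) = x := by
    intro x; rw [← ENNReal.rpow_mul]; norm_num
  simp only [e] at h
  exact h

section mul
variable {V : Type} [NormedAddCommGroup V] [InnerProductSpace ℝ V] [FiniteDimensional ℝ V]
  [MeasurableSpace V] [BorelSpace V]

structure Trans (m : ℕ) (K : ℝ) (Λ : ℝ≥0∞) (c : Fin (m + 1) → V) (S : Fin (m + 1) → Finset V) : Prop where
  ball : ∀ i, ‖c i‖ ≤ 1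
  map : Measure.map (TT c) volume ≤ Λ • (volume : Measure (V × ℝ))
  near : ∀ i, ∀ τ ∈ S i, ‖τ - c i‖ * K ≤ 2

noncomputable def QQ (q s : ℝ) {m : ℕ} (ρ : ℝ) (S : Fin (m + 1) → Finset V) (f : Fin (m + 1) → V → V × ℝ → ℂ) : ℝ≥0∞ :=
  ∫⁻ z, ∏ i, (∑ τ ∈ S i, (av ρ (fun z => ‖f i τ z‖ₑ ^ q) z) ^ (2 / q)) ^ s

noncomputable def XX (s : ℝ) {m : ℕ} (ρ : ℝ) (S : Fin (m + 1) → Finset V) (f : Fin (m + 1) → V → V × ℝ → ℂ) : ℝ≥0∞ :=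
  ∫⁻ z, ∏ i, (∑ τ ∈ S i, av ρ (fun z => ‖f i τ z‖ₑ ^ (2 : ℝ)) z) ^ s

variable (V) in
theorem infl (m : ℕ) (A : ℝ) (hA : 0 < A) (q θ : ℝ) (hq : 2 ≤ q) (hθ : 0 ≤ θ) (hmθ : m * θ ≤ 1)
    (Λ : ℝ≥0∞) (hΛ : Λ ≠ ⊤) (ε : ℝ) (hε : 0 < ε) : ∃ K0 : ℝ, 1 ≤ K0 ∧ ∀ K, K0 ≤ K → ∃ C : ℝ≥0∞, C ≠ ⊤ ∧
    ∀ (σ : ℝ) (c : Fin (m + 1) → V) (S : Fin (m + 1) → Finset V) (f : Fin (m + 1) → V → V × ℝ → ℂ),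
      0 < σ → σ ≤ 1 → Trans m K Λ c S → (∀ i, IsFam A σ (S i) (f i)) →
      QQ q (θ * (q / 2)) (1 / σ) S f ≤ C * ENNReal.ofReal (σ ^ (-ε)) * QQ q (θ * (q / 2)) (1 / σ ^ 2) S f := by
  obtain ⟨C0, hC0, h0⟩ := ball_step V m A hA 2 (by norm_num) q θ hq hθ hmθ Λ hΛ
  set C := max C0 1 with hC
  have hC' : C ≠ ⊤ := by simp [hC, hC0]
  set x := C.toReal with hx
  have hx1 : 1 ≤ x := by
    rw [hx, ← ENNReal.toReal_one]; exact ENNReal.toReal_mono hC' (le_max_right _ _)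
  have hCx : C = ENNReal.ofReal x := (ENNReal.ofReal_toReal hC').symm
  refine ⟨max 2 (x ^ (1 / ε)), le_trans (by norm_num) (le_max_left _ _), fun K hK => ⟨C, hC', ?_⟩⟩
  intro σ c S f hσ hσ1 hT hf
  have hK2 : 2 ≤ K := (le_max_left _ _).trans hK
  have hK0 : 0 < K := by linarith
  have hxK : x ≤ K ^ ε := by
    calc x = (x ^ (1 / ε)) ^ ε := by rw [← Real.rpow_mul (by linarith)]; field_simp; simp
      _ ≤ K ^ ε := Real.rpow_le_rpow (by positivity) ((le_max_right _ _).trans hK) hε.le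
  have it : ∀ k : ℕ, ∀ r ρ : ℝ, 1 / σ ≤ r → r ≤ ρ → ρ ≤ K ^ k * r → ρ ≤ 1 / σ ^ 2 →
      QQ q (θ * (q / 2)) r S f ≤ C ^ k * QQ q (θ * (q / 2)) ρ S f := by
    intro k
    induction k with
    | zero =>
      intro r ρ h1 h2 h3 h4
      have : ρ = r := le_antisymm (by simpa using h3) h2
      rw [this]; simp
    | succ k ih =>
      intro r ρ h1 h2 h3 h4
      have hr : 0 < r := lt_of_lt_of_le (by positivity) h1
      set r' := min ρ (K * r) with hr'
      have g1 : r ≤ r' := le_min h2 (by nlinarith)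
      have g2 : r' ≤ K * r := min_le_right _ _
      have g3 : r' ≤ ρ := min_le_left _ _
      have g4 : ρ ≤ K ^ k * r' := by
        rw [hr', mul_min_of_nonneg _ _ (by positivity)]
        refine le_min ?_ ?_
        · exact le_mul_of_one_le_left (by linarith) (one_le_pow₀ (by linarith))
        · rw [pow_succ] at h3; linarith
      calc _ ≤ C0 * QQ q (θ * (q / 2)) r' S f := h0 K σ r r' c S f hK0 hσ h1 g1 g2 (g3.trans h4) hT.ball hT.map
            (fun i τ hτ => ⟨(hf i).ball τ hτ, hT.near i τ hτ, (hf i).spec τ hτ⟩)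
        _ ≤ C * (C ^ k * QQ q (θ * (q / 2)) ρ S f) :=
            mul_le_mul' (le_max_left _ _) (ih r' ρ (h1.trans g1) g3 g4 h4)
        _ = _ := by ring
  set k := ⌈Real.log (1 / σ) / Real.log K⌉₊ with hk
  have hlK : 0 < Real.log K := Real.log_pos (by linarith)
  have hls : 0 ≤ Real.log (1 / σ) := Real.log_nonneg (by rw [le_div_iff₀ hσ]; linarith)
  have k1 : 1 / σ ≤ K ^ k := by
    rw [← Real.log_le_log_iff (by positivity) (by positivity), Real.log_pow]
    have := Nat.le_ceil (Real.log (1 / σ) / Real.log K)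
    rwa [div_le_iff₀ hlK] at this
  have k2 : (k : ℝ) ≤ Real.log (1 / σ) / Real.log K + 1 := (Nat.ceil_lt_add_one (by positivity)).le
  have main := it k (1 / σ) (1 / σ ^ 2) le_rfl
    (one_div_le_one_div_of_le (by positivity) (by nlinarith))
    (by
      calc 1 / σ ^ 2 = 1 / σ * (1 / σ) := by field_simp
        _ ≤ _ := by gcongr) le_rfl
  refine main.trans ?_
  gcongr
  rw [hCx, ← ENNReal.ofReal_pow (by linarith), ← ENNReal.ofReal_mul (by linarith)]
  refine ENNReal.ofReal_le_ofReal ?_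
  calc x ^ k = x ^ (k : ℝ) := (Real.rpow_natCast _ _).symm
    _ ≤ x ^ (Real.log (1 / σ) / Real.log K + 1) := Real.rpow_le_rpow_of_exponent_le hx1 k2
    _ = x * x ^ (Real.log (1 / σ) / Real.log K) := by rw [Real.rpow_add (by linarith), Real.rpow_one, mul_comm]
    _ ≤ x * (K ^ ε) ^ (Real.log (1 / σ) / Real.log K) := by gcongr
    _ = x * σ ^ (-ε) := by
        congr 1
        rw [← Real.rpow_mul hK0.le, Real.rpow_def_of_pos hK0, Real.rpow_def_of_pos hσ]
        congr 1
        rw [one_div, Real.log_inv]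
        field_simp

end mul
end Strz

open MeasureTheory Filter
open scoped ENNReal NNReal ComplexConjugate FourierTransform
set_option linter.unusedSectionVars false
set_option linter.unusedSimpArgs false
set_option linter.unusedVariables false
namespace Strz

theorem prod_mono_const {α : Type*} [MeasurableSpace α] (μ : Measure α) (m : ℕ) (a b : Fin (m + 1) → α → ℝ≥0∞) (C : ℝ≥0∞)
    (hC : C ≠ ⊤) (s : ℝ) (hs : 0 ≤ s) (h : ∀ i z, a i z ≤ C * b i z) :
    ∫⁻ z, ∏ i, a i z ^ s ∂μ ≤ (C ^ s) ^ (m + 1) * ∫⁻ z, ∏ i, b i z ^ s ∂μ := by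
  rw [← lintegral_const_mul' _ _ (ENNReal.pow_ne_top (ENNReal.rpow_ne_top_of_nonneg hs hC))]
  refine lintegral_mono fun z => ?_
  calc ∏ i, a i z ^ s ≤ ∏ i, (C ^ s * b i z ^ s) := by
        refine Finset.prod_le_prod' fun i _ => ?_
        rw [← ENNReal.mul_rpow_of_nonneg _ _ hs]
        exact ENNReal.rpow_le_rpow (h i z) hs
    _ = _ := by rw [Finset.prod_mul_distrib]; simp

section mul
variable {V : Type} [NormedAddCommGroup V] [InnerProductSpace ℝ V] [FiniteDimensional ℝ V]
  [MeasurableSpace V] [BorelSpace V]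

theorem av_two_le {ρ q : ℝ} (hρ : 0 < ρ) (hq : 2 ≤ q) {f : V × ℝ → ℂ} (hf : Measurable f) (z : V × ℝ) :
    av ρ (fun z => ‖f z‖ₑ ^ (2 : ℝ)) z ≤ (mass (V × ℝ) ^ (q / 2 - 1)) ^ (2 / q) * (av ρ (fun z => ‖f z‖ₑ ^ q) z) ^ (2 / q) := by
  have h := av_jensen hρ (F := fun z => ‖f z‖ₑ ^ (2 : ℝ)) (by fun_prop) (q / 2) (by linarith) z
  have e : ∀ x : ℝ≥0∞, (x ^ (2 : ℝ)) ^ (q / 2) = x ^ q := by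
    intro x; rw [← ENNReal.rpow_mul]; congr 1; ring
  simp only [e] at h
  have h2 := ENNReal.rpow_le_rpow h (by positivity : 0 ≤ 2 / q)
  rw [ENNReal.mul_rpow_of_nonneg _ _ (by positivity), ← ENNReal.rpow_mul (av ρ (fun z => ‖f z‖ₑ ^ (2 : ℝ)) z)] at h2
  have : q / 2 * (2 / q) = 1 := by field_simp
  rwa [this, ENNReal.rpow_one] at h2

theorem mass_pow_ne {s t : ℝ} (hs : 0 ≤ s) (ht : 0 ≤ t) : (mass (V × ℝ) ^ s) ^ t ≠ ⊤ :=
  ENNReal.rpow_ne_top_of_nonneg ht (ENNReal.rpow_ne_top_of_nonneg hs mass_lt.ne)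

variable (V) in
theorem XX_le_QQ (m : ℕ) (s q : ℝ) (hs : 0 ≤ s) (hq : 2 ≤ q) : ∃ C : ℝ≥0∞, C ≠ ⊤ ∧
    ∀ (ρ : ℝ) (S : Fin (m + 1) → Finset V) (f : Fin (m + 1) → V → V × ℝ → ℂ), 0 < ρ →
    (∀ i, ∀ τ ∈ S i, Measurable (f i τ)) → XX s ρ S f ≤ C * QQ q s ρ S f := by
  have hC := mass_pow_ne (V := V) (by linarith : 0 ≤ q / 2 - 1) (by positivity : 0 ≤ 2 / q)
  refine ⟨(((mass (V × ℝ) ^ (q / 2 - 1)) ^ (2 / q)) ^ s) ^ (m + 1), ENNReal.pow_ne_top (ENNReal.rpow_ne_top_of_nonneg hs hC), ?_⟩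
  intro ρ S f hρ hf
  refine prod_mono_const _ m _ _ _ hC s hs fun i z => ?_
  rw [Finset.mul_sum]
  exact Finset.sum_le_sum fun τ hτ => av_two_le hρ hq (hf i τ hτ) z

theorem QQ_le_NN (m : ℕ) (p : ℝ) (hp : 2 ≤ p) (ρ : ℝ) (hρ : 0 < ρ) (S : Fin (m + 1) → Finset V) (f : Fin (m + 1) → V → V × ℝ → ℂ)
    (hf : ∀ i, ∀ τ ∈ S i, Measurable (f i τ)) :
    QQ p (p / (2 * ((m : ℝ) + 1))) ρ S f ≤ mass (V × ℝ) * ∏ i, NN p (S i) (f i) ^ (1 / ((m : ℝ) + 1)) := by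
  unfold QQ
  have e : p / (2 * ((m : ℝ) + 1)) = p / 2 * (1 / ((m : ℝ) + 1)) := by field_simp
  simp only [e, ENNReal.rpow_mul]
  have mA : ∀ i, ∀ τ ∈ S i, Measurable (av ρ (fun z => ‖f i τ z‖ₑ ^ p)) := by
    intro i τ hτ
    have := hf i τ hτ
    exact av_meas ρ (by fun_prop)
  refine (holder_prod _ m _ ?_).trans ?_
  · intro i
    exact (Finset.measurable_sum _ fun τ hτ => (mA i τ hτ).pow_const _).pow_const _
  calc _ ≤ ∏ i, (mass (V × ℝ) * NN p (S i) (f i)) ^ (1 / ((m : ℝ) + 1)) := by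
        refine Finset.prod_le_prod' fun i _ => ENNReal.rpow_le_rpow ?_ (by positivity)
        refine (mink_pow volume (S i) _ (mA i) p hp).trans (le_of_eq ?_)
        unfold NN nrm
        have : ∀ τ ∈ S i, (∫⁻ z, av ρ (fun z => ‖f i τ z‖ₑ ^ p) z) ^ (2 / p) =
            mass (V × ℝ) ^ (2 / p) * (∫⁻ z, ‖f i τ z‖ₑ ^ p) ^ (2 / p) := by
          intro τ hτ
          have := hf i τ hτ
          rw [lint_av hρ (by fun_prop), ENNReal.mul_rpow_of_nonneg _ _ (by positivity)]
        rw [Finset.sum_congr rfl this, ← Finset.mul_sum, ENNReal.mul_rpow_of_nonneg _ _ (by positivity), ← ENNReal.rpow_mul]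
        have : 2 / p * (p / 2) = 1 := by field_simp
        rw [this, ENNReal.rpow_one]
    _ = _ := by
        simp only [ENNReal.mul_rpow_of_nonneg _ _ (by positivity : 0 ≤ 1 / ((m : ℝ) + 1))]
        rw [Finset.prod_mul_distrib]
        congr 1
        simp only [Finset.prod_const, Finset.card_univ, Fintype.card_fin]
        rw [← ENNReal.rpow_natCast, ← ENNReal.rpow_mul]
        have : 1 / ((m : ℝ) + 1) * ((m + 1 : ℕ) : ℝ) = 1 := by push_cast; field_simp
        rw [this, ENNReal.rpow_one]

theorem QQ_interp (m : ℕ) (p s : ℝ) (hp : 2 ≤ p) (hs : 0 ≤ s) (ρ : ℝ) (hρ : 0 < ρ) (S : Fin (m + 1) → Finset V) (f : Fin (m + 1) → V → V × ℝ → ℂ)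
    (hf : ∀ i, ∀ τ ∈ S i, Measurable (f i τ)) :
    QQ (4 * p / (p + 2)) s ρ S f ≤ XX s ρ S f ^ (1 / 2 : ℝ) * QQ p s ρ S f ^ (1 / 2 : ℝ) := by
  have mA : ∀ (q : ℝ) i, ∀ τ ∈ S i, Measurable (av ρ (fun z => ‖f i τ z‖ₑ ^ q)) := by
    intro q i τ hτ
    have := hf i τ hτ
    exact av_meas ρ (by fun_prop)
  unfold XX QQ
  refine le_trans ?_ (cs_lint _ _ _ ?_ ?_)
  · refine lintegral_mono fun z => ?_
    dsimp only
    rw [← ENNReal.prod_rpow_of_nonneg (by norm_num), ← ENNReal.prod_rpow_of_nonneg (by norm_num), ← Finset.prod_mul_distrib]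
    refine Finset.prod_le_prod' fun i _ => ?_
    rw [← ENNReal.rpow_mul, ← ENNReal.rpow_mul, mul_comm s, ENNReal.rpow_mul, ENNReal.rpow_mul, ← ENNReal.mul_rpow_of_nonneg _ _ hs]
    refine ENNReal.rpow_le_rpow ?_ hs
    refine le_trans (Finset.sum_le_sum fun τ hτ => ?_) (cs_sum _ _ _)
    have := hf i τ hτ
    have h := interp (U ρ) (fun w => ‖f i τ (z - w)‖ₑ) (by fun_prop) p hp
    refine h.trans (le_of_eq ?_)
    rw [← ENNReal.rpow_mul]
    have : 2 / p * (1 / 2) = 1 / p := by field_simp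
    rw [this]
    rfl
  · exact Finset.measurable_prod _ fun i _ => (Finset.measurable_sum _ fun τ hτ => mA _ i τ hτ).pow_const _
  · exact Finset.measurable_prod _ fun i _ => (Finset.measurable_sum _ fun τ hτ => (mA _ i τ hτ).pow_const _).pow_const _

open Classical in
variable (V) in
theorem XX_coarse (m : ℕ) (A s : ℝ) (hA : 0 < A) (hs : 0 ≤ s) : ∃ C : ℝ≥0∞, C ≠ ⊤ ∧
    ∀ (σ : ℝ) (S : Fin (m + 1) → Finset V) (g : Fin (m + 1) → V → V × ℝ → ℂ) (r : Fin (m + 1) → V → V), 0 < σ →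
    (∀ i, IsFam A σ (S i) (g i)) →
    XX s (1 / σ) (fun i => (S i).image (r i)) (fun i => crs (S i) (r i) (g i)) ≤ C * XX s (1 / σ) S g := by
  obtain ⟨C, hC, h⟩ := OL V A hA
  refine ⟨(C ^ s) ^ (m + 1), ENNReal.pow_ne_top (ENNReal.rpow_ne_top_of_nonneg hs hC), ?_⟩
  intro σ S g r hσ hf
  refine prod_mono_const _ m _ _ _ hC s hs fun i z => ?_
  rw [← Finset.sum_fiberwise_of_maps_to (fun c hc => Finset.mem_image_of_mem (r i) hc) (fun c => av (1 / σ) (fun z => ‖g i c z‖ₑ ^ (2 : ℝ)) z),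
    Finset.mul_sum]
  refine Finset.sum_le_sum fun τ hτ => ?_
  have hsub := (hf i).sub (T := (S i).filter fun c => r i c = τ) (Finset.filter_subset _ _)
  exact h σ _ (g i) hσ hsub.sep (fun c hc => (hsub.spec c hc).mono fun ζ hζ => hζ.1) z

open Classical in
variable (V) in
theorem one_step (m : ℕ) (p A : ℝ) (hp : 2 ≤ p) (hmp : (m : ℝ) * p ≤ 2 * (m + 2)) (hA : 2 ≤ A) (Λ : ℝ≥0∞) (hΛ : Λ ≠ ⊤)
    (ε : ℝ) (hε : 0 < ε) : ∃ K0 : ℝ, 1 ≤ K0 ∧ ∀ K, K0 ≤ K → ∃ C : ℝ≥0∞, C ≠ ⊤ ∧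
    ∀ (σ : ℝ) (c : Fin (m + 1) → V) (S : Fin (m + 1) → Finset V) (g : Fin (m + 1) → V → V × ℝ → ℂ) (r : Fin (m + 1) → V → V),
      0 < σ → σ ≤ 1 / 2 → Trans m K Λ c S → (∀ i, IsFam A (σ ^ 2) (S i) (g i)) →
      (∀ i, ∀ c ∈ S i, r i c ∈ S i ∧ ‖c - r i c‖ ≤ σ) → (∀ i, ∀ c ∈ S i, ∀ c' ∈ S i, r i c ≠ r i c' → σ ≤ ‖r i c - r i c'‖) →
      XX (p / (2 * ((m : ℝ) + 1))) (1 / σ) (fun i => (S i).image (r i)) (fun i => crs (S i) (r i) (g i)) ≤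
        C * ENNReal.ofReal (σ ^ (-ε)) * XX (p / (2 * ((m : ℝ) + 1))) (1 / σ ^ 2) S g ^ (1 / 2 : ℝ) *
          (∏ i, NN p ((S i).image (r i)) (crs (S i) (r i) (g i)) ^ (1 / ((m : ℝ) + 1))) ^ (1 / 2 : ℝ) := by
  set q := 4 * p / (p + 2) with hq
  set s := p / (2 * ((m : ℝ) + 1)) with hs
  have hs0 : 0 ≤ s := by positivity
  have hq2 : 2 ≤ q := by rw [hq, le_div_iff₀ (by linarith)]; linarith
  set θ := (p + 2) / (4 * ((m : ℝ) + 1)) with hθ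
  have hθq : θ * (q / 2) = s := by rw [hθ, hq, hs]; field_simp
  have hmθ : m * θ ≤ 1 := by rw [hθ, mul_div_assoc', div_le_one (by positivity)]; nlinarith
  obtain ⟨K0, hK0, hI⟩ := infl V m A (by linarith) q θ hq2 (by positivity) hmθ Λ hΛ ε hε
  rw [hθq] at hI
  obtain ⟨C1, hC1, h1⟩ := XX_le_QQ V m s q hs0 hq2
  obtain ⟨C3, hC3, h3⟩ := XX_coarse V m A s (by linarith) hs0
  refine ⟨K0, hK0, fun K hK => ?_⟩
  obtain ⟨C2, hC2, h2⟩ := hI K hK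
  refine ⟨C1 * C2 * C3 ^ (1 / 2 : ℝ) * mass (V × ℝ) ^ (1 / 2 : ℝ), ?_, ?_⟩
  · have := (mass_lt (E := V × ℝ)).ne
    finiteness
  intro σ c S g r hσ hσ2 hT hg hr hr2
  have hF : ∀ i, IsFam A σ ((S i).image (r i)) (crs (S i) (r i) (g i)) := fun i =>
    (hg i).coarse hA (by positivity) (by nlinarith) (hr i) (hr2 i)
  have hmF : ∀ i, ∀ τ ∈ (S i).image (r i), Measurable (crs (S i) (r i) (g i) τ) := fun i τ hτ => ((hF i).spec τ hτ).measurable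
  have hT' : Trans m K Λ c (fun i => (S i).image (r i)) := ⟨hT.ball, hT.map, fun i τ hτ => by
    obtain ⟨c', hc', rfl⟩ := Finset.mem_image.1 hτ
    exact hT.near i _ (hr i c' hc').1⟩
  have a1 := h1 (1 / σ) (fun i => (S i).image (r i)) (fun i => crs (S i) (r i) (g i)) (by positivity) hmF
  have a2 := h2 σ c (fun i => (S i).image (r i)) (fun i => crs (S i) (r i) (g i)) hσ (by linarith) hT' hF
  have a3 := QQ_interp m p s hp hs0 (1 / σ ^ 2) (by positivity) (fun i => (S i).image (r i)) (fun i => crs (S i) (r i) (g i)) hmF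
  have a4 := QQ_le_NN m p hp (1 / σ ^ 2) (by positivity) (fun i => (S i).image (r i)) (fun i => crs (S i) (r i) (g i)) hmF
  have a5 := h3 (σ ^ 2) S g r (by positivity) hg
  rw [← hq] at a3
  rw [← hs] at a4
  calc _ ≤ C1 * (C2 * ENNReal.ofReal (σ ^ (-ε)) * ((C3 * XX s (1 / σ ^ 2) S g) ^ (1 / 2 : ℝ) *
        (mass (V × ℝ) * ∏ i, NN p ((S i).image (r i)) (crs (S i) (r i) (g i)) ^ (1 / ((m : ℝ) + 1))) ^ (1 / 2 : ℝ))) := by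
        refine a1.trans (mul_le_mul_right (a2.trans (mul_le_mul_right (a3.trans ?_) _)) _)
        exact mul_le_mul' (ENNReal.rpow_le_rpow a5 (by norm_num)) (ENNReal.rpow_le_rpow a4 (by norm_num))
    _ = _ := by
        rw [ENNReal.mul_rpow_of_nonneg _ _ (by norm_num), ENNReal.mul_rpow_of_nonneg _ _ (by norm_num)]
        ring

end mul
end Strz

open MeasureTheory Filter
open scoped ENNReal NNReal ComplexConjugate FourierTransform
set_option linter.unusedSectionVars false
set_option linter.unusedSimpArgs false
set_option linter.unusedVariables false
namespace Strz

section mul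
variable {V : Type} [NormedAddCommGroup V] [InnerProductSpace ℝ V] [FiniteDimensional ℝ V]
  [MeasurableSpace V] [BorelSpace V]

variable (V) in
def EE (p A η : ℝ) : Prop := ∃ C : ℝ≥0∞, C ≠ ⊤ ∧ ∀ δ : ℝ, 0 < δ → δ ≤ 1 → DecB V p A δ (C * ENNReal.ofReal (δ ^ (-η)))

open Classical in
theorem NN_coarse {p A δ σ : ℝ} {B : ℝ≥0∞} (hp : 2 ≤ p) (hσ : 0 < σ) (hB : DecB V p A (δ / (2 * σ)) B) {S : Finset V}
    {f : V → V × ℝ → ℂ} (hf : IsFam A δ S f) {π : V → V} (hπ : ∀ c ∈ S, ‖c - π c‖ ≤ 2 * σ) :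
    NN p (S.image π) (crs S π f) ≤ B * NN p S f := by
  have h : ∀ τ ∈ S.image π, (nrm p (crs S π f τ)) ^ (2 / p) ≤
      B ^ (2 / p) * ∑ c ∈ S with π c = τ, nrm p (f c) ^ (2 / p) := by
    intro τ hτ
    have := rescale hp (by positivity : 0 < 2 * σ) hB τ _ f (hf.sub (T := S.filter fun c => π c = τ) (Finset.filter_subset _ _))
      (by
        intro c hc
        obtain ⟨h1, rfl⟩ := Finset.mem_filter.1 hc
        exact hπ c h1)
    have h2 := ENNReal.rpow_le_rpow this (by positivity : 0 ≤ 2 / p)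
    rw [ENNReal.mul_rpow_of_nonneg _ _ (by positivity)] at h2
    refine h2.trans (le_of_eq ?_)
    unfold NN
    rw [← ENNReal.rpow_mul]
    have : p / 2 * (2 / p) = 1 := by field_simp
    rw [this, ENNReal.rpow_one]
  unfold NN
  calc _ ≤ (∑ τ ∈ S.image π, B ^ (2 / p) * ∑ c ∈ S with π c = τ, nrm p (f c) ^ (2 / p)) ^ (p / 2) :=
        ENNReal.rpow_le_rpow (Finset.sum_le_sum h) (by positivity)
    _ = _ := by
        rw [← Finset.mul_sum, Finset.sum_fiberwise_of_maps_to (fun c hc => Finset.mem_image_of_mem π hc),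
          ENNReal.mul_rpow_of_nonneg _ _ (by positivity), ← ENNReal.rpow_mul]
        have : 2 / p * (p / 2) = 1 := by field_simp
        rw [this, ENNReal.rpow_one]

open Classical in
theorem crs_comp (S : Finset V) (π r : V → V) (f : V → V × ℝ → ℂ) :
    crs (S.image π) r (crs S π f) = crs S (r ∘ π) f := by
  funext τ z
  unfold crs
  rw [← Finset.sum_fiberwise_of_maps_to (s := S.filter fun c => (r ∘ π) c = τ) (t := (S.image π).filter fun c => r c = τ) (g := π)]
  · refine Finset.sum_congr rfl fun c' hc' => ?_
    obtain ⟨_, h2⟩ := Finset.mem_filter.1 hc'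
    refine Finset.sum_congr ?_ fun _ _ => rfl
    ext c
    simp only [Finset.mem_filter, Function.comp]
    constructor
    · rintro ⟨a, rfl⟩; exact ⟨⟨a, h2⟩, rfl⟩
    · rintro ⟨⟨a, _⟩, b⟩; exact ⟨a, b⟩
  · intro c hc
    obtain ⟨h1, h2⟩ := Finset.mem_filter.1 hc
    exact Finset.mem_filter.2 ⟨Finset.mem_image_of_mem _ h1, h2⟩

open Classical in
theorem crs_id (S : Finset V) (f : V → V × ℝ → ℂ) {c : V} (hc : c ∈ S) : crs S id f c = f c := by
  funext z
  unfold crs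
  simp [Finset.sum_filter, hc]

noncomputable def sg (δ : ℝ) (i : ℕ) : ℝ := δ ^ ((1 / 2 : ℝ) ^ i)
noncomputable def bb (η ε : ℝ) (i : ℕ) : ℝ := η * (1 - (1 + i / 2) * (1 / 2) ^ i) + ε * i * (1 / 2) ^ i

theorem sg_sq {δ : ℝ} (h : 0 < δ) (i : ℕ) : sg δ (i + 1) ^ 2 = sg δ i := by
  unfold sg
  rw [← Real.rpow_natCast, ← Real.rpow_mul h.le]
  congr 1
  rw [pow_succ]; push_cast; ring

theorem sg_pos {δ : ℝ} (h : 0 < δ) (i : ℕ) : 0 < sg δ i := by unfold sg; positivity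

theorem sg_le {δ : ℝ} (h : 0 < δ) (h1 : δ ≤ 1) (i : ℕ) : δ ≤ sg δ i := by
  unfold sg
  conv_lhs => rw [← Real.rpow_one δ]
  exact Real.rpow_le_rpow_of_exponent_ge h h1 (pow_le_one₀ (by norm_num) (by norm_num))

open Classical in
variable (V) in
/-- one level of the iteration -/
def Lev (m : ℕ) (p A K : ℝ) (Λ : ℝ≥0∞) (b : ℝ) (i : ℕ) : Prop := ∃ C : ℝ≥0∞, C ≠ ⊤ ∧
  ∀ (δ : ℝ) (c : Fin (m + 1) → V) (S : Fin (m + 1) → Finset V) (f : Fin (m + 1) → V → V × ℝ → ℂ), 0 < δ → δ ≤ 1 →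
    sg δ i ≤ 1 / 2 → Trans m K Λ c S → (∀ j, IsFam A δ (S j) (f j)) →
    ∃ π : Fin (m + 1) → V → V, (∀ j, ∀ c ∈ S j, π j c ∈ S j ∧ ‖c - π j c‖ ≤ 2 * sg δ i) ∧
      (∀ j, IsFam A (sg δ i) ((S j).image (π j)) (crs (S j) (π j) (f j))) ∧
      XX (p / (2 * ((m : ℝ) + 1))) (1 / sg δ i) (fun j => (S j).image (π j)) (fun j => crs (S j) (π j) (f j)) ≤
        C * ENNReal.ofReal (δ ^ (-b)) * ∏ j, NN p (S j) (f j) ^ (1 / ((m : ℝ) + 1))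

variable (V) in
theorem lev_zero (m : ℕ) (p A K : ℝ) (Λ : ℝ≥0∞) (η ε : ℝ) (hp : 2 ≤ p) : Lev V m p A K Λ (bb η ε 0) 0 := by
  classical
  obtain ⟨C1, hC1, h1⟩ := XX_le_QQ V m (p / (2 * ((m : ℝ) + 1))) p (by positivity) hp
  have := (mass_lt (E := V × ℝ)).ne
  refine ⟨C1 * mass (V × ℝ), by finiteness, ?_⟩
  intro δ c S f hδ hδ1 hs hT hf
  have e0 : sg δ 0 = δ := by simp [sg]
  have hm : ∀ i, ∀ τ ∈ S i, Measurable (f i τ) := fun i τ hτ => ((hf i).spec τ hτ).measurable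
  refine ⟨fun _ => id, ?_, ?_, ?_⟩
  · intro j c hc
    refine ⟨hc, ?_⟩
    rw [e0]; simp [hδ.le]
  · intro j
    rw [e0, Finset.image_id]
    exact ⟨(hf j).ball, (hf j).sep, fun c hc => by rw [crs_id _ _ hc]; exact (hf j).spec c hc⟩
  · have eb : bb η ε 0 = 0 := by simp [bb]
    rw [e0, eb]
    have : XX (p / (2 * ((m : ℝ) + 1))) (1 / δ) (fun j => (S j).image id) (fun j => crs (S j) id (f j)) =
        XX (p / (2 * ((m : ℝ) + 1))) (1 / δ) S f := by
      unfold XX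
      refine lintegral_congr fun z => Finset.prod_congr rfl fun i _ => ?_
      congr 1
      dsimp only
      rw [Finset.image_id]
      exact Finset.sum_congr rfl fun τ hτ => by rw [crs_id _ _ hτ]
    rw [this]
    refine (h1 (1 / δ) S f (by positivity) hm).trans ?_
    have h2 := QQ_le_NN m p hp (1 / δ) (by positivity) S f hm
    simp only [neg_zero, Real.rpow_zero, ENNReal.ofReal_one, mul_one]
    rw [mul_assoc]
    exact mul_le_mul_right h2 _

theorem prod_rpow_pull {m : ℕ} (B : ℝ≥0∞) (N : Fin (m + 1) → ℝ≥0∞) :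
    ∏ i, (B * N i) ^ (1 / ((m : ℝ) + 1)) = B * ∏ i, N i ^ (1 / ((m : ℝ) + 1)) := by
  simp only [ENNReal.mul_rpow_of_nonneg _ _ (by positivity : 0 ≤ 1 / ((m : ℝ) + 1))]
  rw [Finset.prod_mul_distrib]
  congr 1
  simp only [Finset.prod_const, Finset.card_univ, Fintype.card_fin]
  rw [← ENNReal.rpow_natCast, ← ENNReal.rpow_mul]
  have : 1 / ((m : ℝ) + 1) * ((m + 1 : ℕ) : ℝ) = 1 := by push_cast; field_simp
  rw [this, ENNReal.rpow_one]

variable (V) in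
theorem lev_all (m : ℕ) (p A : ℝ) (hp : 2 ≤ p) (hmp : (m : ℝ) * p ≤ 2 * (m + 2)) (hA : 2 ≤ A) (Λ : ℝ≥0∞) (hΛ : Λ ≠ ⊤)
    (η ε : ℝ) (hη : 0 ≤ η) (hε : 0 < ε) (hE : EE V p A η) : ∃ K0 : ℝ, 1 ≤ K0 ∧ ∀ K, K0 ≤ K → ∀ i, Lev V m p A K Λ (bb η ε i) i := by
  classical
  obtain ⟨K0, hK0, hO⟩ := one_step V m p A hp hmp hA Λ hΛ ε hε
  obtain ⟨CE, hCE, hE⟩ := hE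
  refine ⟨K0, hK0, fun K hK i => ?_⟩
  obtain ⟨C1, hC1, h1⟩ := hO K hK
  induction i with
  | zero => exact lev_zero V m p A K Λ η ε hp
  | succ i ih =>
    obtain ⟨C2, hC2, h2⟩ := ih
    refine ⟨C1 * C2 ^ (1 / 2 : ℝ) * (CE * ENNReal.ofReal (2 ^ η)) ^ (1 / 2 : ℝ), by finiteness, ?_⟩
    intro δ c S f hδ hδ1 hs hT hf
    set σ := sg δ (i + 1) with hσ
    have hσ0 : 0 < σ := sg_pos hδ _
    have hσ2 : sg δ i = σ ^ 2 := (sg_sq hδ i).symm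
    obtain ⟨π, p1, p2, p3⟩ := h2 δ c S f hδ hδ1 (by rw [hσ2]; nlinarith) hT hf
    rw [hσ2] at p1 p2 p3
    have hr := fun j => rounding ((S j).image (π j)) hσ0
    choose r r1 r2 using hr
    have q1 : ∀ j, ∀ c ∈ S j, (r j ∘ π j) c ∈ S j ∧ ‖c - (r j ∘ π j) c‖ ≤ 2 * σ := by
      intro j c hc
      have a := r1 j _ (Finset.mem_image_of_mem (π j) hc)
      obtain ⟨c2, hc2, e2⟩ := Finset.mem_image.1 a.1
      refine ⟨?_, ?_⟩
      · simp only [Function.comp]; rw [← e2]; exact (p1 j c2 hc2).1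
      · calc ‖c - (r j ∘ π j) c‖ = ‖(c - π j c) + (π j c - r j (π j c))‖ := by simp
          _ ≤ 2 * σ ^ 2 + σ := (norm_add_le _ _).trans (add_le_add (p1 j c hc).2 a.2)
          _ ≤ _ := by nlinarith
    have q2 : ∀ j, IsFam A σ (((S j).image (π j)).image (r j)) (crs ((S j).image (π j)) (r j) (crs (S j) (π j) (f j))) := fun j =>
      (p2 j).coarse hA (by positivity) (by nlinarith) (r1 j) (r2 j)
    have hT' : Trans m K Λ c (fun j => (S j).image (π j)) := ⟨hT.ball, hT.map, fun j τ hτ => by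
      obtain ⟨c', hc', rfl⟩ := Finset.mem_image.1 hτ
      exact hT.near j _ (p1 j c' hc').1⟩
    have main := h1 σ c (fun j => (S j).image (π j)) (fun j => crs (S j) (π j) (f j)) r hσ0 hs hT' p2 r1 r2
    simp only [crs_comp, Finset.image_image] at main q2
    refine ⟨fun j => r j ∘ π j, q1, q2, main.trans ?_⟩
    have hδσ : δ / (2 * σ) ≤ 1 := by
      rw [div_le_one (by positivity)]; linarith [sg_le hδ hδ1 (i + 1)]
    have y1 : ∏ j, NN p ((S j).image (r j ∘ π j)) (crs (S j) (r j ∘ π j) (f j)) ^ (1 / ((m : ℝ) + 1)) ≤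
        (CE * ENNReal.ofReal ((δ / (2 * σ)) ^ (-η))) * ∏ j, NN p (S j) (f j) ^ (1 / ((m : ℝ) + 1)) := by
      rw [← prod_rpow_pull]
      refine Finset.prod_le_prod' fun j _ => ENNReal.rpow_le_rpow ?_ (by positivity)
      exact NN_coarse hp hσ0 (hE _ (by positivity) hδσ) (hf j) (fun c hc => (q1 j c hc).2)
    set P := ∏ j, NN p (S j) (f j) ^ (1 / ((m : ℝ) + 1)) with hP
    have hh : (0 : ℝ) ≤ 1 / 2 := by norm_num
    calc _ ≤ C1 * ENNReal.ofReal (σ ^ (-ε)) * (C2 * ENNReal.ofReal (δ ^ (-bb η ε i)) * P) ^ (1 / 2 : ℝ) *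
          ((CE * ENNReal.ofReal ((δ / (2 * σ)) ^ (-η))) * P) ^ (1 / 2 : ℝ) :=
          mul_le_mul' (mul_le_mul_right (ENNReal.rpow_le_rpow p3 hh) _) (ENNReal.rpow_le_rpow y1 hh)
      _ = C1 * C2 ^ (1 / 2 : ℝ) * CE ^ (1 / 2 : ℝ) * (ENNReal.ofReal (σ ^ (-ε)) * ENNReal.ofReal (δ ^ (-bb η ε i)) ^ (1 / 2 : ℝ) *
          ENNReal.ofReal ((δ / (2 * σ)) ^ (-η)) ^ (1 / 2 : ℝ)) * (P ^ (1 / 2 : ℝ) * P ^ (1 / 2 : ℝ)) := by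
          simp only [ENNReal.mul_rpow_of_nonneg _ _ hh]; ring
      _ = C1 * C2 ^ (1 / 2 : ℝ) * CE ^ (1 / 2 : ℝ) * (ENNReal.ofReal (2 ^ η) ^ (1 / 2 : ℝ) * ENNReal.ofReal (δ ^ (-bb η ε (i + 1)))) * P := by
          congr 1
          · congr 1
            rw [ENNReal.ofReal_rpow_of_nonneg (by positivity) hh, ENNReal.ofReal_rpow_of_nonneg (by positivity) hh,
              ENNReal.ofReal_rpow_of_nonneg (by positivity) hh, ← ENNReal.ofReal_mul (by positivity), ← ENNReal.ofReal_mul (by positivity),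
              ← ENNReal.ofReal_mul (by positivity)]
            congr 1
            have e1 : (δ / (2 * σ)) ^ (-η) = 2 ^ η * (δ ^ (-η) * σ ^ η) := by
              rw [Real.div_rpow hδ.le (by positivity), Real.mul_rpow (by norm_num) hσ0.le, Real.rpow_neg (by norm_num : (0:ℝ) ≤ 2), Real.rpow_neg hσ0.le]
              field_simp
            rw [e1, Real.mul_rpow (by positivity) (by positivity), mul_left_comm]
            congr 1
            rw [hσ]; unfold sg
            rw [← Real.rpow_mul hδ.le, ← Real.rpow_mul hδ.le, ← Real.rpow_mul hδ.le, ← Real.rpow_add hδ, ← Real.rpow_add hδ, ← Real.rpow_mul hδ.le, ← Real.rpow_add hδ]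
            congr 1
            unfold bb
            rw [pow_succ]; push_cast; ring
          · rw [← ENNReal.rpow_add_of_nonneg _ _ hh hh]; norm_num
      _ = _ := by rw [ENNReal.mul_rpow_of_nonneg _ _ hh]; ring

end mul
end Strz

open MeasureTheory Filter
open scoped ENNReal NNReal ComplexConjugate FourierTransform
set_option linter.unusedSectionVars false
set_option linter.unusedSimpArgs false
set_option linter.unusedVariables false
namespace Strz

section mul
variable {V : Type} [NormedAddCommGroup V] [InnerProductSpace ℝ V] [FiniteDimensional ℝ V]
  [MeasurableSpace V] [BorelSpace V]

variable (V) in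
theorem muldec (m : ℕ) (p A : ℝ) (hp : 2 ≤ p) (hmp : (m : ℝ) * p ≤ 2 * (m + 2)) (hA : 2 ≤ A) (Λ : ℝ≥0∞) (hΛ : Λ ≠ ⊤)
    (η : ℝ) (hη : 0 < η) (hE : EE V p A η) (M : ℕ) (hM : dm (V × ℝ) * (p / 2) ≤ η * M / 4) :
    ∃ K0 : ℝ, 1 ≤ K0 ∧ ∀ K, K0 ≤ K → ∃ C : ℝ≥0∞, C ≠ ⊤ ∧
      ∀ (δ : ℝ) (c : Fin (m + 1) → V) (S : Fin (m + 1) → Finset V) (f : Fin (m + 1) → V → V × ℝ → ℂ), 0 < δ → δ ≤ 1 →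
        Trans m K Λ c S → (∀ j, IsFam A δ (S j) (f j)) →
        ∫⁻ z, ∏ j, (av K (fun z => ‖∑ c ∈ S j, f j c z‖ₑ ^ (2 : ℝ)) z) ^ (p / (2 * ((m : ℝ) + 1))) ≤
          C * ENNReal.ofReal (δ ^ (-(η * (1 - (1 / 2) ^ M)))) * ∏ j, NN p (S j) (f j) ^ (1 / ((m : ℝ) + 1)) := by
  classical
  obtain ⟨K0, hK0, hL⟩ := lev_all V m p A hp hmp hA Λ hΛ η (η / 4) hη.le (by positivity) hE
  obtain ⟨CE, hCE, hE⟩ := hE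
  obtain ⟨CO, hCO, hO⟩ := OL (V := V) A (by linarith)
  refine ⟨K0, hK0, fun K hK => ?_⟩
  obtain ⟨CL, hCL, hL⟩ := hL K hK M
  have hK1 : 1 ≤ K := hK0.trans hK
  have hmass := (mass_lt (E := V × ℝ)).ne
  set s := p / (2 * ((m : ℝ) + 1)) with hs
  have hs0 : 0 ≤ s := by positivity
  set θ : ℝ := min (1 / 2) (1 / K) with hθ
  have hθ0 : 0 < θ := by positivity
  set CA : ℝ≥0∞ := CO ^ (p / 2) * CL with hCA
  set CB : ℝ≥0∞ := mass (V × ℝ) ^ (p / 2 - 1) * mass (V × ℝ) * CE * ENNReal.ofReal (θ ^ (-η)) with hCB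
  have hCAt : CA ≠ ⊤ := ENNReal.mul_ne_top (ENNReal.rpow_ne_top_of_nonneg (by positivity) hCO) hCL
  have hCBt : CB ≠ ⊤ := by
    have : mass (V × ℝ) ^ (p / 2 - 1) ≠ ⊤ := ENNReal.rpow_ne_top_of_nonneg (by linarith) hmass
    rw [hCB]; finiteness
  refine ⟨CA + CB, by finiteness, ?_⟩
  intro δ c S f hδ hδ1 hT hf
  set P := ∏ j, NN p (S j) (f j) ^ (1 / ((m : ℝ) + 1)) with hP
  have hm : ∀ j, Measurable fun z => ∑ c ∈ S j, f j c z := fun j =>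
    Finset.measurable_sum _ fun c hc => ((hf j).spec c hc).measurable
  set σ := sg δ M with hσ
  have hσ0 : 0 < σ := sg_pos hδ _
  by_cases hcase : σ ≤ θ
  · have h12 : σ ≤ 1 / 2 := hcase.trans (min_le_left _ _)
    have h1K : σ ≤ 1 / K := hcase.trans (min_le_right _ _)
    have hKσ : K ≤ 1 / σ := by
      rw [le_div_iff₀ hσ0]; rw [le_div_iff₀ (by linarith)] at h1K; linarith
    obtain ⟨π, p1, p2, p3⟩ := hL δ c S f hδ hδ1 h12 hT hf
    set D := ENNReal.ofReal ((1 / σ / K) ^ dm (V × ℝ)) * CO with hD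
    have hDt : D ≠ ⊤ := by finiteness
    have h1 := prod_mono_const (volume : Measure (V × ℝ)) m (fun j z => av K (fun z => ‖∑ c ∈ S j, f j c z‖ₑ ^ (2 : ℝ)) z)
      (fun j z => ∑ τ ∈ (S j).image (π j), av (1 / σ) (fun z => ‖crs (S j) (π j) (f j) τ z‖ₑ ^ (2 : ℝ)) z) D hDt s hs0 (by
        intro j z
        have := hm j
        refine (av_scale (by linarith) hKσ (by fun_prop) z).trans ?_
        rw [hD, mul_assoc]
        refine mul_le_mul_right ?_ _
        have h := hO σ _ (crs (S j) (π j) (f j)) hσ0 (p2 j).sep (fun c hc => ((p2 j).spec c hc).mono fun ζ h => h.1) z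
        simp only [crs_sum] at h
        exact h)
    refine h1.trans ?_
    refine (mul_le_mul_right p3 _).trans ?_
    have e : (D ^ s) ^ (m + 1) ≤ CO ^ (p / 2) * ENNReal.ofReal (δ ^ (-(dm (V × ℝ) * (p / 2) * (1 / 2) ^ M))) := by
      rw [← ENNReal.rpow_natCast, ← ENNReal.rpow_mul]
      have : s * ((m + 1 : ℕ) : ℝ) = p / 2 := by rw [hs]; push_cast; field_simp
      rw [this, hD, ENNReal.mul_rpow_of_nonneg _ _ (by positivity), mul_comm]
      refine mul_le_mul_right ?_ _
      rw [ENNReal.ofReal_rpow_of_nonneg (by positivity) (by positivity)]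
      refine ENNReal.ofReal_le_ofReal ?_
      have h2 : 1 / σ / K ≤ 1 / σ := div_le_self (by positivity) hK1
      calc ((1 / σ / K) ^ dm (V × ℝ)) ^ (p / 2) ≤ ((1 / σ) ^ dm (V × ℝ)) ^ (p / 2) := by gcongr
        _ = _ := by
          rw [← Real.rpow_natCast, ← Real.rpow_mul (by positivity), one_div, ← Real.rpow_neg_one, ← Real.rpow_mul hσ0.le, hσ]
          unfold sg
          rw [← Real.rpow_mul hδ.le]
          congr 1; ring
    refine (mul_le_mul' e le_rfl).trans ?_
    have e2 : δ ^ (-(dm (V × ℝ) * (p / 2) * (1 / 2) ^ M)) * δ ^ (-bb η (η / 4) M) ≤ δ ^ (-(η * (1 - (1 / 2) ^ M))) := by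
      rw [← Real.rpow_add hδ]
      refine Real.rpow_le_rpow_of_exponent_ge hδ hδ1 ?_
      unfold bb
      have : (0 : ℝ) < (1 / 2) ^ M := by positivity
      nlinarith [mul_le_mul_of_nonneg_right hM this.le]
    calc _ = CO ^ (p / 2) * CL * (ENNReal.ofReal (δ ^ (-(dm (V × ℝ) * (p / 2) * (1 / 2) ^ M))) * ENNReal.ofReal (δ ^ (-bb η (η / 4) M))) * P := by ring
      _ ≤ CA * ENNReal.ofReal (δ ^ (-(η * (1 - (1 / 2) ^ M)))) * P := by
        rw [← ENNReal.ofReal_mul (by positivity)]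
        gcongr
      _ ≤ _ := by gcongr; exact le_self_add
  · push Not at hcase
    have h1 : ∀ j, ∫⁻ z, (av K (fun z => ‖∑ c ∈ S j, f j c z‖ₑ ^ (2 : ℝ)) z) ^ (p / 2) ≤
        CB * ENNReal.ofReal (δ ^ (-(η * (1 - (1 / 2) ^ M)))) * NN p (S j) (f j) := by
      intro j
      have := hm j
      have ej : ∀ x : ℝ≥0∞, (x ^ (2 : ℝ)) ^ (p / 2) = x ^ p := by
        intro x; rw [← ENNReal.rpow_mul]; congr 1; ring
      calc _ ≤ ∫⁻ z, mass (V × ℝ) ^ (p / 2 - 1) * av K (fun z => ‖∑ c ∈ S j, f j c z‖ₑ ^ p) z := by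
            refine lintegral_mono fun z => ?_
            have := av_jensen (by linarith : 0 < K) (F := fun z => ‖∑ c ∈ S j, f j c z‖ₑ ^ (2 : ℝ)) (by fun_prop) (p / 2) (by linarith) z
            simp only [ej] at this
            exact this
        _ = mass (V × ℝ) ^ (p / 2 - 1) * (mass (V × ℝ) * nrm p (fun z => ∑ c ∈ S j, f j c z)) := by
            rw [lintegral_const_mul _ (av_meas _ (by fun_prop)), lint_av (by linarith) (by fun_prop)]
            rfl
        _ ≤ mass (V × ℝ) ^ (p / 2 - 1) * (mass (V × ℝ) * (CE * ENNReal.ofReal (δ ^ (-η)) * NN p (S j) (f j))) := by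
            refine mul_le_mul_right (mul_le_mul_right (hE δ hδ hδ1 _ _ (hf j)) _) _
        _ ≤ mass (V × ℝ) ^ (p / 2 - 1) * (mass (V × ℝ) * (CE * (ENNReal.ofReal (θ ^ (-η)) * ENNReal.ofReal (δ ^ (-(η * (1 - (1 / 2) ^ M))))) * NN p (S j) (f j))) := by
            refine mul_le_mul_right (mul_le_mul_right (mul_le_mul' (mul_le_mul_right ?_ _) le_rfl) _) _
            rw [← ENNReal.ofReal_mul (by positivity)]
            refine ENNReal.ofReal_le_ofReal ?_
            have e3 : δ ^ (-η) = σ ^ (-η) * δ ^ (-(η * (1 - (1 / 2) ^ M))) := by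
              rw [hσ]; unfold sg
              rw [← Real.rpow_mul hδ.le, ← Real.rpow_add hδ]; congr 1; ring
            rw [e3]
            refine mul_le_mul_of_nonneg_right ?_ (by positivity)
            exact Real.rpow_le_rpow_of_nonpos hθ0 hcase.le (by linarith)
        _ = _ := by rw [hCB]; ring
    have e4 : ∀ x : ℝ≥0∞, x ^ s = (x ^ (p / 2)) ^ (1 / ((m : ℝ) + 1)) := by
      intro x; rw [← ENNReal.rpow_mul, hs]; congr 1; field_simp
    simp only [e4]
    refine (holder_prod _ m _ fun j => ?_).trans ?_
    · have := hm j
      have := av_meas K (F := fun z => ‖∑ c ∈ S j, f j c z‖ₑ ^ (2 : ℝ)) (by fun_prop)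
      fun_prop
    · refine (Finset.prod_le_prod' fun j _ => ENNReal.rpow_le_rpow (h1 j) (by positivity)).trans ?_
      rw [prod_rpow_pull]
      gcongr
      exact le_add_self

end mul
end Strz

open MeasureTheory Filter
open scoped ENNReal NNReal ComplexConjugate FourierTransform
set_option linter.unusedSectionVars false
set_option linter.unusedSimpArgs false
set_option linter.unusedVariables false
namespace Strz

section cyl
variable {V : Type} [NormedAddCommGroup V] [InnerProductSpace ℝ V] [FiniteDimensional ℝ V]
  [MeasurableSpace V] [BorelSpace V]
variable {V' : Type} [NormedAddCommGroup V'] [InnerProductSpace ℝ V'] [FiniteDimensional ℝ V']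
  [MeasurableSpace V'] [BorelSpace V']

/-- orthogonal splitting data -/
structure Split (ι : V' →ₗ[ℝ] V) (P : V →ₗ[ℝ] V') (e : V) : Prop where
  unit : ‖e‖ = 1
  adj : ∀ ξ x, inner ℝ ξ (ι x) = inner ℝ (P ξ) x
  dec : ∀ ξ, ι (P ξ) + (inner ℝ e ξ : ℝ) • e = ξ
  ort : ∀ x, inner ℝ e (ι x) = 0
  inv : ∀ x, P (ι x) = x
  ker : P e = 0

theorem Split.norm_sq {ι : V' →ₗ[ℝ] V} {P : V →ₗ[ℝ] V'} {e : V} (h : Split ι P e) (ξ : V) :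
    ‖ξ‖ ^ 2 = ‖P ξ‖ ^ 2 + (inner ℝ e ξ) ^ 2 := by
  have h1 : inner ℝ ξ ξ = inner ℝ ξ (ι (P ξ) + (inner ℝ e ξ : ℝ) • e) := by rw [h.dec]
  rw [real_inner_self_eq_norm_sq, inner_add_right, h.adj, real_inner_self_eq_norm_sq, inner_smul_right, real_inner_comm e ξ] at h1
  rw [h1]; ring

theorem Split.norm_le {ι : V' →ₗ[ℝ] V} {P : V →ₗ[ℝ] V'} {e : V} (h : Split ι P e) (ξ : V) : ‖P ξ‖ ≤ ‖ξ‖ := by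
  refine abs_le_of_sq_le_sq' ?_ (norm_nonneg _) |>.2
  rw [h.norm_sq]; nlinarith [sq_nonneg (inner ℝ e ξ : ℝ)]

theorem Split.inner_le {ι : V' →ₗ[ℝ] V} {P : V →ₗ[ℝ] V'} {e : V} (h : Split ι P e) (ξ : V) : |inner ℝ e ξ| ≤ ‖ξ‖ := by
  have := abs_real_inner_le_norm e ξ
  rwa [h.unit, one_mul] at this

noncomputable def Split.L {ι : V' →ₗ[ℝ] V} {P : V →ₗ[ℝ] V'} {e : V} (h : Split ι P e) (a : ℝ) : (ℝ × (V' × ℝ)) ≃ₗ[ℝ] (V × ℝ) where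
  toFun := fun z => (ι z.2.1 + (z.1 + 2 * a * z.2.2) • e, z.2.2)
  invFun := fun z => (inner ℝ e z.1 - 2 * a * z.2, (P z.1, z.2))
  map_add' := by
    intro x y
    ext
    · simp only [Prod.fst_add, Prod.snd_add, map_add]; module
    · simp only [Prod.snd_add]
  map_smul' := by
    intro c x
    ext
    · simp only [Prod.smul_fst, Prod.smul_snd, RingHom.id_apply, smul_eq_mul, map_smul]; module
    · simp only [Prod.smul_snd, RingHom.id_apply, smul_eq_mul]
  left_inv := by
    intro x
    have e1 : inner ℝ e e = (1 : ℝ) := by rw [real_inner_self_eq_norm_sq, h.unit]; norm_num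
    ext
    · dsimp only
      rw [inner_add_right, h.ort, inner_smul_right, e1]; ring
    · dsimp only
      rw [map_add, map_smul, h.inv, h.ker, smul_zero, add_zero]
    · rfl
  right_inv := by
    intro x
    ext
    · dsimp only
      rw [sub_add_cancel, h.dec]
    · rfl

theorem cyl_class {p A σ a : ℝ} {B : ℝ≥0∞} (hp : 2 ≤ p) (hA : 0 ≤ A) (hσ : 0 < σ)
    {ι : V' →ₗ[ℝ] V} {P : V →ₗ[ℝ] V'} {e : V} (h : Split ι P e)
    (hD : DecB V' p (4 * (A + (A + 2) ^ 2)) (σ / 2) B) (S : Finset V) (f : V → V × ℝ → ℂ) (hf : IsFam A σ S f)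
    (ha : ∀ c ∈ S, |inner ℝ e c - a| ≤ 2 * σ) (hs : ∀ c ∈ S, ∀ c' ∈ S, c ≠ c' → σ / 2 ≤ ‖P c - P c'‖) :
    nrm p (fun z => ∑ c ∈ S, f c z) ≤ B * NN p S f := by
  classical
  set L := h.L a with hLdef
  have hL : ∀ z, L z = (ι z.2.1 + (z.1 + 2 * a * z.2.2) • e, z.2.2) := fun z => rfl
  have mL : Measurable L := L.toContinuousLinearEquiv.continuous.measurable
  obtain ⟨κ, hκ0, hκ, hIntg⟩ := lint_lin ((volume : Measure ℝ).prod (volume : Measure (V' × ℝ))) (volume : Measure (V × ℝ)) L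
  have inj : Set.InjOn P S := by
    intro c hc c' hc' he
    by_contra hne
    have := hs c hc c' hc' hne
    rw [he, sub_self, norm_zero] at this
    linarith
  let Q : V' → V := Function.invFunOn P S
  have hQ : ∀ c ∈ S, Q (P c) = c := fun c hc => inj.leftInvOn_invFunOn hc
  let η : V' × ℝ := (0, a ^ 2)
  let g : ℝ → V' → V' × ℝ → ℂ := fun w c' z => (1 * ec η z) * f (Q c') (L (w, z))
  have hfam : ∀ w, IsFam (4 * (A + (A + 2) ^ 2)) (σ / 2) (S.image P) (g w) := by
    intro w
    refine ⟨?_, ?_, ?_⟩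
    · intro c' hc'
      obtain ⟨c, hc, rfl⟩ := Finset.mem_image.1 hc'
      exact (h.norm_le c).trans (hf.ball c hc)
    · intro c' hc' d' hd' hne
      obtain ⟨c, hc, rfl⟩ := Finset.mem_image.1 hc'
      obtain ⟨d, hd, rfl⟩ := Finset.mem_image.1 hd'
      exact hs c hc d hd (by rintro rfl; exact hne rfl)
    · intro c' hc'
      obtain ⟨c, hc, rfl⟩ := Finset.mem_image.1 hc'
      simp only [g, hQ c hc]
      have s1 : Spec {η} (fun z : V' × ℝ => 1 * ec η z) := Spec.atom η (Set.mem_singleton _) 1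
      have mP : Measurable P := P.toContinuousLinearMap.continuous.measurable
      have s2 := (hf.spec c hc).comp (Ω' := {ζ | ζ + η ∈ Box (4 * (A + (A + 2) ^ 2)) (σ / 2) (P c)}) (fun z => L (w, z))
        (fun ζ => (P ζ.1, ζ.2 - 2 * a * inner ℝ e ζ.1)) (fun ζ => w * inner ℝ e ζ.1) (by fun_prop) (by fun_prop)
        (by
          intro ζ z
          rw [hL]
          simp only [ph, inner_add_right, inner_smul_right, h.adj, real_inner_comm e ζ.1]
          ring)
        (by
          rintro ζ ⟨h1, h2⟩
          refine ⟨?_, ?_⟩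
          · simp only [η, Prod.fst_add, add_zero]
            rw [← map_sub]
            refine (h.norm_le _).trans (h1.trans ?_)
            nlinarith [sq_nonneg (A + 2)]
          · simp only [η, Prod.fst_add, add_zero, Prod.snd_add]
            have e1 := h.norm_sq ζ.1
            have e2 : ζ.2 - 2 * a * inner ℝ e ζ.1 + a ^ 2 - ‖P ζ.1‖ ^ 2 = (ζ.2 - ‖ζ.1‖ ^ 2) + (inner ℝ e ζ.1 - a) ^ 2 := by
              rw [e1]; ring
            rw [e2]
            have e3 : |inner ℝ e ζ.1 - a| ≤ (A + 2) * σ := by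
              calc |inner ℝ e ζ.1 - a| = |inner ℝ e (ζ.1 - c) + (inner ℝ e c - a)| := by rw [inner_sub_right]; ring_nf
                _ ≤ A * σ + 2 * σ := (abs_add_le _ _).trans (add_le_add ((h.inner_le _).trans h1) (ha c hc))
                _ = _ := by ring
            have e4 : (inner ℝ e ζ.1 - a) ^ 2 ≤ ((A + 2) * σ) ^ 2 := by
              rw [← sq_abs]; gcongr
            calc |ζ.2 - ‖ζ.1‖ ^ 2 + (inner ℝ e ζ.1 - a) ^ 2| ≤ A * σ ^ 2 + ((A + 2) * σ) ^ 2 := by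
                  refine (abs_add_le _ _).trans (add_le_add h2 ?_)
                  rwa [abs_of_nonneg (sq_nonneg _)]
              _ = _ := by ring)
      refine s1.mul s2 ?_
      rintro ζ rfl ζ' h'
      rw [add_comm _ ζ']; exact h'
  have mf : ∀ c ∈ S, Measurable (f c) := fun c hc => (hf.spec c hc).measurable
  have msum : Measurable fun z => ∑ c ∈ S, f c z := Finset.measurable_sum _ mf
  have n1 : ∀ w c', (∀ z, ‖g w c' z‖ₑ = ‖f (Q c') (L (w, z))‖ₑ) := by
    intro w c' z
    simp only [g, one_mul]
    rw [enorm_mul, ← ofReal_norm (ec η z), norm_ec]; simp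
  have key : ∀ w, nrm p (fun z => ∑ c ∈ S, f c (L (w, z))) ≤ B * (∑ c ∈ S, (nrm p (fun z => f c (L (w, z)))) ^ (2 / p)) ^ (p / 2) := by
    intro w
    have := hD _ (g w) (hfam w)
    have e1 : nrm p (fun z => ∑ c ∈ S.image P, g w c z) = nrm p (fun z => ∑ c ∈ S, f c (L (w, z))) := by
      unfold nrm
      refine lintegral_congr fun z => ?_
      dsimp only
      rw [Finset.sum_image inj]
      simp only [g, one_mul]
      rw [← Finset.mul_sum, enorm_mul, ← ofReal_norm (ec η z), norm_ec, Finset.sum_congr rfl fun c hc => by rw [hQ c hc]]; simp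
    have e2 : NN p (S.image P) (g w) = (∑ c ∈ S, (nrm p (fun z => f c (L (w, z)))) ^ (2 / p)) ^ (p / 2) := by
      unfold NN
      rw [Finset.sum_image inj]
      congr 1
      refine Finset.sum_congr rfl fun c hc => ?_
      congr 1
      unfold nrm
      refine lintegral_congr fun z => ?_
      rw [n1, hQ c hc]
    rwa [e1, e2] at this
  have fub : ∀ F : V × ℝ → ℂ, Measurable F → ∫⁻ w, nrm p (fun z => F (L (w, z))) = κ * nrm p F := by
    intro F hF
    unfold nrm
    rw [← hIntg _ (by fun_prop), lintegral_prod _ (by fun_prop)]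
  have big : κ * nrm p (fun z => ∑ c ∈ S, f c z) ≤ κ * (B * NN p S f) := by
    rw [← fub _ msum]
    calc _ ≤ ∫⁻ w, B * (∑ c ∈ S, (nrm p (fun z => f c (L (w, z)))) ^ (2 / p)) ^ (p / 2) := lintegral_mono key
      _ = B * ∫⁻ w, (∑ c ∈ S, (nrm p (fun z => f c (L (w, z)))) ^ (2 / p)) ^ (p / 2) := by
          have : ∀ c ∈ S, Measurable fun w => nrm p (fun z => f c (L (w, z))) := by
            intro c hc
            have := mf c hc
            unfold nrm
            exact Measurable.lintegral_prod_right' (f := fun q : ℝ × (V' × ℝ) => ‖f c (L q)‖ₑ ^ p) (by fun_prop)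
          rw [lintegral_const_mul]
          exact (Finset.measurable_sum _ fun c hc => (this c hc).pow_const _).pow_const _
      _ ≤ B * (∑ c ∈ S, (∫⁻ w, nrm p (fun z => f c (L (w, z)))) ^ (2 / p)) ^ (p / 2) := by
          refine mul_le_mul_right (mink_pow volume S _ (fun c hc => ?_) p hp) _
          have := mf c hc
          unfold nrm
          exact Measurable.lintegral_prod_right' (f := fun q : ℝ × (V' × ℝ) => ‖f c (L q)‖ₑ ^ p) (by fun_prop)
      _ = B * (κ * NN p S f) := by
          congr 1
          rw [Finset.sum_congr rfl fun c hc => by rw [fub _ (mf c hc), ENNReal.mul_rpow_of_nonneg _ _ (by positivity)],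
            ← Finset.mul_sum, ENNReal.mul_rpow_of_nonneg _ _ (by linarith), ← ENNReal.rpow_mul]
          have : 2 / p * (p / 2) = 1 := by field_simp
          rw [this, ENNReal.rpow_one]; rfl
      _ = _ := by ring
  exact (ENNReal.mul_le_mul_iff_right hκ0 hκ).1 big

theorem cyl {p A σ a : ℝ} {B : ℝ≥0∞} (hp : 2 ≤ p) (hA : 0 ≤ A) (hσ : 0 < σ)
    {ι : V' →ₗ[ℝ] V} {P : V →ₗ[ℝ] V'} {e : V} (h : Split ι P e)
    (hD : DecB V' p (4 * (A + (A + 2) ^ 2)) (σ / 2) B) (S : Finset V) (f : V → V × ℝ → ℂ) (hf : IsFam A σ S f)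
    (ha : ∀ c ∈ S, |inner ℝ e c - a| ≤ 2 * σ) :
    nrm p (fun z => ∑ c ∈ S, f c z) ≤ (11 : ℝ≥0∞) ^ (p / 2) * B * NN p S f := by
  classical
  let k : V → ℤ := fun c => ⌊(inner ℝ e c - a) * (2 / σ)⌋
  have hk : ∀ c ∈ S, k c ∈ Finset.Icc (-5 : ℤ) 5 := by
    intro c hc
    have := abs_le.1 (ha c hc)
    have h1 : (inner ℝ e c - a) * (2 / σ) ≤ 4 := by
      rw [mul_div_assoc', div_le_iff₀ hσ]; linarith [this.2]
    have h2 : -4 ≤ (inner ℝ e c - a) * (2 / σ) := by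
      rw [mul_div_assoc', le_div_iff₀ hσ]; linarith [this.1]
    rw [Finset.mem_Icc]
    constructor
    · rw [Int.le_floor]; push_cast; linarith
    · have : k c ≤ 4 := by
        have h3 := Int.floor_le ((inner ℝ e c - a) * (2 / σ))
        have : ((k c : ℤ) : ℝ) ≤ 4 := h3.trans h1
        exact_mod_cast this
      omega
  have e1 : ∀ z, ∑ c ∈ S, f c z = ∑ j ∈ Finset.Icc (-5 : ℤ) 5, ∑ c ∈ S with k c = j, f c z := by
    intro z; exact (Finset.sum_fiberwise_of_maps_to hk _).symm
  simp only [e1]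
  have mf : ∀ c ∈ S, Measurable (f c) := fun c hc => (hf.spec c hc).measurable
  refine (nrm_sum_card hp (Finset.Icc (-5 : ℤ) 5) (fun j z => ∑ c ∈ S with k c = j, f c z)
    fun j _ => Finset.measurable_sum _ fun c hc => mf c (Finset.mem_filter.1 hc).1).trans ?_
  have hcard : ((Finset.Icc (-5 : ℤ) 5).card : ℝ≥0∞) = 11 := by simp
  rw [hcard, mul_assoc]
  refine mul_le_mul_right ?_ _
  have h1 : ∀ j, nrm p (fun z => ∑ c ∈ S with k c = j, f c z) ^ (2 / p) ≤ B ^ (2 / p) * ∑ c ∈ S with k c = j, nrm p (f c) ^ (2 / p) := by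
    intro j
    have := cyl_class hp hA hσ h hD (S.filter fun c => k c = j) f (hf.sub (Finset.filter_subset _ _))
      (fun c hc => ha c (Finset.mem_filter.1 hc).1) (by
        intro c hc c' hc' hne
        obtain ⟨hc1, hc2⟩ := Finset.mem_filter.1 hc
        obtain ⟨hd1, hd2⟩ := Finset.mem_filter.1 hc'
        have h3 := hf.sep c hc1 c' hd1 hne
        have h4 := Int.abs_sub_lt_one_of_floor_eq_floor (hc2.trans hd2.symm)
        have h5 : |inner ℝ e (c - c')| ≤ σ / 2 := by
          have : (inner ℝ e c - a) * (2 / σ) - (inner ℝ e c' - a) * (2 / σ) = inner ℝ e (c - c') * (2 / σ) := by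
            rw [inner_sub_right]; ring
          rw [this, abs_mul, abs_of_pos (by positivity : 0 < 2 / σ), mul_div_assoc', div_lt_one hσ] at h4
          linarith
        rw [← map_sub]
        have h6 := h.norm_sq (c - c')
        have h7 : (inner ℝ e (c - c')) ^ 2 ≤ (σ / 2) ^ 2 := by rw [← sq_abs]; gcongr
        have h8 : σ ^ 2 ≤ ‖c - c'‖ ^ 2 := by gcongr
        refine abs_le_of_sq_le_sq' ?_ (norm_nonneg _) |>.2
        nlinarith)
    have h2 := ENNReal.rpow_le_rpow this (by positivity : 0 ≤ 2 / p)
    rw [ENNReal.mul_rpow_of_nonneg _ _ (by positivity)] at h2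
    refine h2.trans (le_of_eq ?_)
    unfold NN
    rw [← ENNReal.rpow_mul]
    have : p / 2 * (2 / p) = 1 := by field_simp
    rw [this, ENNReal.rpow_one]
  calc _ ≤ (∑ j ∈ Finset.Icc (-5 : ℤ) 5, B ^ (2 / p) * ∑ c ∈ S with k c = j, nrm p (f c) ^ (2 / p)) ^ (p / 2) :=
        ENNReal.rpow_le_rpow (Finset.sum_le_sum fun j _ => h1 j) (by linarith)
    _ = _ := by
        rw [← Finset.mul_sum, Finset.sum_fiberwise_of_maps_to hk,
          ENNReal.mul_rpow_of_nonneg _ _ (by linarith), ← ENNReal.rpow_mul]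
        have : 2 / p * (p / 2) = 1 := by field_simp
        rw [this, ENNReal.rpow_one]; rfl

/-- existence of splitting -/
theorem exists_split (d : ℕ) (hd : Module.finrank ℝ V = d + 1) (e : V) (he : ‖e‖ = 1) :
    ∃ (ι : EuclideanSpace ℝ (Fin d) →ₗ[ℝ] V) (P : V →ₗ[ℝ] EuclideanSpace ℝ (Fin d)), Split ι P e := by
  have e0 : e ≠ 0 := by rintro rfl; simp at he
  have e1 : inner ℝ e e = (1 : ℝ) := by rw [real_inner_self_eq_norm_sq, he]; norm_num
  have hfr : Module.finrank ℝ (ℝ ∙ e)ᗮ = d := by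
    have : Fact (Module.finrank ℝ V = d + 1) := ⟨hd⟩
    exact Submodule.finrank_orthogonal_span_singleton e0
  let b : OrthonormalBasis (Fin d) ℝ (ℝ ∙ e)ᗮ := (stdOrthonormalBasis ℝ (ℝ ∙ e)ᗮ).reindex (finCongr hfr)
  let W := (ℝ ∙ e)ᗮ
  let ι : EuclideanSpace ℝ (Fin d) →ₗ[ℝ] V := W.subtype ∘ₗ b.repr.symm.toLinearEquiv.toLinearMap
  have hι : ∀ x, ι x = ((b.repr.symm x : W) : V) := fun x => rfl
  have hiso : ∀ x y, inner ℝ (ι x) (ι y) = inner ℝ x y := by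
    intro x y
    rw [hι, hι, ← Submodule.coe_inner, b.repr.symm.inner_map_map]
  have adj : ∀ ξ x, inner ℝ ξ (ι x) = inner ℝ (LinearMap.adjoint ι ξ) x := fun ξ x => (LinearMap.adjoint_inner_left ι x ξ).symm
  have ort : ∀ x, inner ℝ e (ι x) = 0 := by
    intro x
    rw [hι]
    exact Submodule.mem_orthogonal_singleton_iff_inner_right.1 (b.repr.symm x).2
  have inv : ∀ x, LinearMap.adjoint ι (ι x) = x := by
    intro x
    refine ext_inner_right ℝ fun y => ?_
    rw [← adj, hiso]
  have ker : LinearMap.adjoint ι e = 0 := by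
    refine ext_inner_right ℝ fun y => ?_
    rw [← adj, ort, inner_zero_left]
  refine ⟨ι, LinearMap.adjoint ι, he, adj, ?_, ort, inv, ker⟩
  intro ξ
  have hr : ξ - (inner ℝ e ξ : ℝ) • e ∈ W := by
    refine Submodule.mem_orthogonal_singleton_iff_inner_right.2 ?_
    rw [inner_sub_right, inner_smul_right, e1]; ring
  have h2 : ι (b.repr ⟨_, hr⟩) = ξ - (inner ℝ e ξ : ℝ) • e := by
    rw [hι, b.repr.symm_apply_apply]
  have h3 : LinearMap.adjoint ι ξ = b.repr ⟨_, hr⟩ := by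
    rw [← inv (b.repr ⟨_, hr⟩), h2, map_sub, map_smul, ker, smul_zero, sub_zero]
  rw [h3, h2, sub_add_cancel]

end cyl
end Strz

open MeasureTheory Filter
open scoped ENNReal NNReal ComplexConjugate FourierTransform
set_option linter.unusedSectionVars false
set_option linter.unusedSimpArgs false
set_option linter.unusedVariables false
namespace Strz

section geom
variable {V : Type} [NormedAddCommGroup V] [InnerProductSpace ℝ V] [FiniteDimensional ℝ V]
  [MeasurableSpace V] [BorelSpace V]

/-- quantitative affine independence at index `j` -/
def DhAt {m : ℕ} (h : ℝ) (c : Fin (m + 1) → V) (j : Fin (m + 1)) : Prop :=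
  ∀ a : Fin (m + 1) → ℝ, ∑ i ∈ Finset.Iio j, a i = 1 → h ≤ ‖c j - ∑ i ∈ Finset.Iio j, a i • c i‖

theorem dichotomy (m : ℕ) (hm : 1 ≤ m) (hV : Module.finrank ℝ V = m) (h : ℝ) (S : Finset V) (hS : S.Nonempty) :
    (∃ c : Fin (m + 1) → V, (∀ j, c j ∈ S) ∧ ∀ j, DhAt h c j) ∨
      ∃ (e : V) (a : ℝ), ‖e‖ = 1 ∧ ∀ s ∈ S, |inner ℝ e s - a| ≤ h := by
  classical
  by_contra hcon
  rw [not_or] at hcon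
  obtain ⟨hc1, hc2⟩ := hcon
  apply hc1
  have key : ∀ k : ℕ, k ≤ m + 1 → ∃ c : Fin (m + 1) → V, ∀ j : Fin (m + 1), (j : ℕ) < k → c j ∈ S ∧ DhAt h c j := by
    intro k
    induction k with
    | zero => intro _; exact ⟨fun _ => 0, fun j hj => absurd hj (by omega)⟩
    | succ k ih =>
      intro hk
      obtain ⟨c, hc⟩ := ih (by omega)
      let k' : Fin (m + 1) := ⟨k, by omega⟩
      -- find s
      have : ∃ s ∈ S, ∀ a : Fin (m + 1) → ℝ, ∑ i ∈ Finset.Iio k', a i = 1 → h ≤ ‖s - ∑ i ∈ Finset.Iio k', a i • c i‖ := by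
        by_contra hno
        push Not at hno
        apply hc2
        let T : (V × ℝ) →ₗ[ℝ] (Fin m → ℝ) :=
          { toFun := fun z i => inner ℝ z.1 (c i.castSucc) - z.2
            map_add' := by intro x y; ext i; simp only [Prod.fst_add, Prod.snd_add, inner_add_left, Pi.add_apply]; ring
            map_smul' := by
              intro r x; ext i
              simp only [Prod.smul_fst, Prod.smul_snd, inner_smul_left, Pi.smul_apply, smul_eq_mul, RingHom.id_apply]
              simp; ring }
        have hker : LinearMap.ker T ≠ ⊥ := LinearMap.ker_ne_bot_of_finrank_lt (by
          rw [Module.finrank_prod, hV]; simp)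
        obtain ⟨z, hz, hz0⟩ := Submodule.exists_mem_ne_zero_of_ne_bot hker
        have hz' : ∀ i : Fin m, inner ℝ z.1 (c i.castSucc) = z.2 := by
          intro i
          have := congrFun (LinearMap.mem_ker.1 hz) i
          simp only [T, LinearMap.coe_mk, AddHom.coe_mk, Pi.zero_apply] at this
          linarith
        have hz1 : z.1 ≠ 0 := by
          intro h0
          apply hz0
          have := hz' ⟨0, by omega⟩
          rw [h0, inner_zero_left] at this
          exact Prod.ext h0 this.symm
        have hn : 0 < ‖z.1‖ := norm_pos_iff.2 hz1
        refine ⟨‖z.1‖⁻¹ • z.1, ‖z.1‖⁻¹ * z.2, ?_, ?_⟩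
        · rw [norm_smul, norm_inv, norm_norm, inv_mul_cancel₀ hn.ne']
        · intro s hs
          obtain ⟨a, ha1, ha2⟩ := hno s hs
          have e1 : inner ℝ z.1 (∑ i ∈ Finset.Iio k', a i • c i) = z.2 := by
            rw [inner_sum]
            calc _ = ∑ i ∈ Finset.Iio k', a i * z.2 := by
                  refine Finset.sum_congr rfl fun i hi => ?_
                  have hi' : (i : ℕ) < k := by simpa [k', Fin.lt_def] using hi
                  have := hz' ⟨i, by omega⟩
                  rw [inner_smul_right]
                  congr 1
              _ = _ := by rw [← Finset.sum_mul, ha1, one_mul]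
          rw [inner_smul_left]
          simp only [conj_trivial]
          rw [← mul_sub, ← e1, ← inner_sub_right, abs_mul, abs_of_pos (by positivity)]
          calc _ ≤ ‖z.1‖⁻¹ * (‖z.1‖ * ‖s - ∑ i ∈ Finset.Iio k', a i • c i‖) := by
                gcongr; exact abs_real_inner_le_norm _ _
            _ = ‖s - ∑ i ∈ Finset.Iio k', a i • c i‖ := by rw [← mul_assoc, inv_mul_cancel₀ hn.ne', one_mul]
            _ ≤ h := ha2.le
      obtain ⟨s, hs, hs2⟩ := this
      refine ⟨Function.update c k' s, fun j hj => ?_⟩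
      have hsum : ∀ a : Fin (m + 1) → ℝ, j ≤ k' → ∑ i ∈ Finset.Iio j, a i • Function.update c k' s i = ∑ i ∈ Finset.Iio j, a i • c i := by
        intro a hjk
        refine Finset.sum_congr rfl fun i hi => ?_
        have : i ≠ k' := ((Finset.mem_Iio.1 hi).trans_le hjk).ne
        rw [Function.update_of_ne this]
      rcases (Nat.lt_succ_iff_lt_or_eq.1 hj) with hj | hj
      · have hne : j ≠ k' := by intro h0; rw [h0] at hj; simp [k'] at hj
        have hle : j ≤ k' := by rw [Fin.le_def]; exact hj.le
        unfold DhAt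
        rw [Function.update_of_ne hne]
        refine ⟨(hc j hj).1, fun a ha => ?_⟩
        rw [hsum a hle]; exact (hc j hj).2 a ha
      · have hjk : j = k' := Fin.ext hj
        unfold DhAt
        subst hjk
        rw [Function.update_self]
        refine ⟨hs, fun a ha => ?_⟩
        rw [hsum a le_rfl]
        exact hs2 a ha
  obtain ⟨c, hc⟩ := key (m + 1) le_rfl
  exact ⟨c, fun j => (hc j j.2).1, fun j => (hc j j.2).2⟩

theorem Dh_indep {m : ℕ} {h : ℝ} (hh : 0 < h) {c : Fin (m + 1) → V} (hc : ∀ j, DhAt h c j) (y : Fin (m + 1) → ℝ) (hy : TT c y = 0) : y = 0 := by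
  classical
  by_contra hne
  have hex : (Finset.univ.filter fun i => y i ≠ 0).Nonempty := by
    obtain ⟨i, hi⟩ := Function.ne_iff.1 hne
    exact ⟨i, by simpa using hi⟩
  obtain ⟨j, hj, hmax⟩ := Finset.exists_max_image _ id hex
  have hj0 : y j ≠ 0 := (Finset.mem_filter.1 hj).2
  have hgt : ∀ i, j < i → y i = 0 := by
    intro i hi
    by_contra h0
    exact absurd (hmax i (by simp [h0])) (not_le.2 hi)
  have split : ∀ {W : Type} [AddCommGroup W] [Module ℝ W] (w : Fin (m + 1) → W), ∑ i, y i • w i = ∑ i ∈ Finset.Iio j, y i • w i + y j • w j := by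
    intro W _ _ w
    have : ∑ i ∈ Finset.Iic j, y i • w i = ∑ i, y i • w i := by
      refine Finset.sum_subset (Finset.subset_univ _) fun i _ hi => ?_
      rw [hgt i (by simpa using hi), zero_smul]
    rw [← this, ← Finset.Iio_insert, Finset.sum_insert (by simp), add_comm]
  have h1 := congrArg Prod.fst hy
  have h2 := congrArg Prod.snd hy
  simp only [TT, Prod.fst_sum, Prod.snd_sum, Prod.smul_fst, Prod.smul_snd, vv, Prod.fst_zero, Prod.snd_zero] at h1 h2
  rw [split (fun i => (2 : ℝ) • c i)] at h1
  rw [split (fun i => (1 : ℝ))] at h2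
  simp only [smul_eq_mul, mul_one] at h2
  have h3 := hc j (fun i => - y i / y j) (by
    rw [← Finset.sum_div, Finset.sum_neg_distrib, div_eq_one_iff_eq hj0]; linarith)
  have h4 : c j - ∑ i ∈ Finset.Iio j, (- y i / y j) • c i = 0 := by
    have e : ∑ i ∈ Finset.Iio j, (- y i / y j) • c i = - ((2 * y j)⁻¹ • ∑ i ∈ Finset.Iio j, y i • (2 : ℝ) • c i) := by
      rw [Finset.smul_sum, ← Finset.sum_neg_distrib]
      refine Finset.sum_congr rfl fun i _ => ?_
      rw [smul_smul, smul_smul, ← neg_smul]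
      congr 1; field_simp
    rw [e, eq_neg_of_add_eq_zero_left h1, smul_neg, neg_neg, smul_smul, smul_smul]
    have : (2 * y j)⁻¹ * y j * 2 = 1 := by field_simp
    rw [this, one_smul, sub_self]
  rw [h4, norm_zero] at h3
  linarith

variable (V) in
theorem exists_Lam (m : ℕ) (hV : Module.finrank ℝ V = m) (h : ℝ) (hh : 0 < h) : ∃ Λ : ℝ≥0∞, Λ ≠ ⊤ ∧
    ∀ c : Fin (m + 1) → V, (∀ i, ‖c i‖ ≤ 1) → (∀ j, DhAt h c j) → Measure.map (TT c) volume ≤ Λ • (volume : Measure (V × ℝ)) := by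
  have hfr : Module.finrank ℝ (Fin (m + 1) → ℝ) = Module.finrank ℝ (V × ℝ) := by
    rw [Module.finrank_prod, hV]; simp
  let Φ : (Fin (m + 1) → ℝ) ≃ₗ[ℝ] (V × ℝ) := LinearEquiv.ofFinrankEq _ _ hfr
  obtain ⟨κ, hκ0, hκ, hIntg⟩ := lint_lin (volume : Measure (Fin (m + 1) → ℝ)) (volume : Measure (V × ℝ)) Φ
  let Tl : (Fin (m + 1) → V) → ((Fin (m + 1) → ℝ) →ₗ[ℝ] (V × ℝ)) := fun c =>
    { toFun := TT c
      map_add' := by intro x y; simp only [TT, Pi.add_apply, add_smul, Finset.sum_add_distrib]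
      map_smul' := by intro r x; simp only [TT, Pi.smul_apply, smul_eq_mul, mul_smul, Finset.smul_sum, RingHom.id_apply] }
  have hTl : ∀ c y, Tl c y = TT c y := fun c y => rfl
  let D : (Fin (m + 1) → V) → ((Fin (m + 1) → ℝ) →ₗ[ℝ] (Fin (m + 1) → ℝ)) := fun c => Φ.symm.toLinearMap ∘ₗ Tl c
  let F : (Fin (m + 1) → V) → ℝ := fun c => |LinearMap.det (D c)|
  have hFc : Continuous F := by
    have e : F = fun c => |(Matrix.of fun i j => Φ.symm (vv (c j)) i).det| := by
      funext c
      simp only [F]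
      rw [← LinearMap.det_toMatrix', ]
      congr 2
      ext i j
      rw [LinearMap.toMatrix'_apply]
      simp only [D, LinearMap.comp_apply, hTl, LinearEquiv.coe_coe, Matrix.of_apply]
      congr 2
      simp [TT, Pi.single_apply]
    rw [e]
    have hΦ : Continuous Φ.symm := Φ.symm.toContinuousLinearEquiv.continuous
    refine Continuous.abs (Continuous.matrix_det ?_)
    refine continuous_matrix fun i j => ?_
    simp only [Matrix.of_apply]
    have : Continuous fun c : Fin (m + 1) → V => vv (c j) := by unfold vv; fun_prop
    exact (continuous_apply i).comp (hΦ.comp this)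
  let Kset : Set (Fin (m + 1) → V) := {c | (∀ i, ‖c i‖ ≤ 1) ∧ ∀ j, DhAt h c j}
  have hKc : IsCompact Kset := by
    have h1 : IsCompact (Set.univ.pi fun _ : Fin (m + 1) => Metric.closedBall (0 : V) 1) := isCompact_univ_pi fun _ => isCompact_closedBall _ _
    refine h1.of_isClosed_subset ?_ ?_
    · simp only [Kset, Set.setOf_and, Set.setOf_forall, DhAt]
      refine IsClosed.inter (isClosed_iInter fun i => isClosed_le (by fun_prop) continuous_const)
        (isClosed_iInter fun j => isClosed_iInter fun a => isClosed_iInter fun _ => isClosed_le continuous_const (by fun_prop))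
    · intro c hc i _
      simpa using hc.1 i
  have hFpos : ∀ c ∈ Kset, 0 < F c := by
    intro c hc
    refine abs_pos.2 ?_
    have : LinearMap.ker (D c) = ⊥ := by
      rw [LinearMap.ker_eq_bot']
      intro y hy
      refine Dh_indep hh hc.2 y ?_
      simpa [D, hTl] using hy
    intro h0
    exact absurd this (LinearMap.bot_lt_ker_of_det_eq_zero h0).ne'
  obtain ⟨δ0, hδ0, hδ⟩ : ∃ δ0 > 0, ∀ c ∈ Kset, δ0 ≤ F c := by
    rcases Kset.eq_empty_or_nonempty with he | hne
    · exact ⟨1, one_pos, fun c hc => by rw [he] at hc; exact hc.elim⟩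
    · obtain ⟨c0, hc0, hmin⟩ := hKc.exists_isMinOn hne hFc.continuousOn
      exact ⟨F c0, hFpos c0 hc0, fun c hc => hmin hc⟩
  refine ⟨ENNReal.ofReal δ0⁻¹ * κ, ENNReal.mul_ne_top (by simp) hκ, ?_⟩
  intro c hc1 hc2
  have hcK : c ∈ Kset := ⟨hc1, hc2⟩
  have hdet : LinearMap.det (D c) ≠ 0 := abs_pos.1 (hFpos c hcK)
  rw [Measure.le_iff]
  intro s hs
  have mΦ : Measurable Φ := Φ.toContinuousLinearEquiv.continuous.measurable
  rw [Measure.map_apply (TT_meas c) hs, Measure.smul_apply, smul_eq_mul]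
  have e1 : TT c ⁻¹' s = D c ⁻¹' (Φ ⁻¹' s) := by
    ext y
    simp [D, hTl]
  rw [e1, Measure.addHaar_preimage_linearMap _ hdet, mul_assoc]
  have e2 : (volume : Measure (Fin (m + 1) → ℝ)) (Φ ⁻¹' s) = κ * volume s := by
    have := hIntg (s.indicator 1) (measurable_one.indicator hs)
    rw [lintegral_indicator_one hs] at this
    rw [← this, ← lintegral_indicator_one (mΦ hs)]
    rfl
  rw [e2]
  refine mul_le_mul_left (ENNReal.ofReal_le_ofReal ?_) _
  rw [abs_inv]
  exact inv_anti₀ hδ0 (hδ c hcK)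

end geom
end Strz

open MeasureTheory Filter
open scoped ENNReal NNReal ComplexConjugate FourierTransform
set_option linter.unusedSectionVars false
set_option linter.unusedSimpArgs false
set_option linter.unusedVariables false
namespace Strz

section bn
variable {V : Type} [NormedAddCommGroup V] [InnerProductSpace ℝ V] [FiniteDimensional ℝ V]
  [MeasurableSpace V] [BorelSpace V]

theorem sum_small {ι : Type*} (T : Finset ι) (N : ℝ≥0∞) (hN : (T.card : ℝ≥0∞) ≤ N) (a : ι → ℂ) (Y : ℝ≥0∞)
    (h : ∀ γ ∈ T, N * N * ‖a γ‖ₑ ^ (2 : ℝ) ≤ Y) : ‖∑ γ ∈ T, a γ‖ₑ ^ (2 : ℝ) ≤ Y := by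
  rcases T.eq_empty_or_nonempty with rfl | hT
  · simp
  obtain ⟨γ, hγ, hmax⟩ := T.exists_max_image (fun γ => ‖a γ‖ₑ ^ (2 : ℝ)) hT
  refine (esq_sum_le T a).trans (le_trans ?_ (h γ hγ))
  have := Finset.sum_le_card_nsmul T (fun γ => ‖a γ‖ₑ ^ (2 : ℝ)) _ hmax
  rw [nsmul_eq_mul] at this
  calc _ ≤ (T.card : ℝ≥0∞) * (T.card * ‖a γ‖ₑ ^ (2 : ℝ)) := mul_le_mul_right this _
    _ ≤ N * (N * ‖a γ‖ₑ ^ (2 : ℝ)) := by gcongr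
    _ = _ := by ring

variable (V) in
/-- localisation window -/
theorem window (p : ℝ) (hp : 2 ≤ p) (D : ℕ) : ∃ w : V × ℝ → ℂ, Spec {ζ : V × ℝ | ‖ζ.1‖ ≤ 1 ∧ |ζ.2| ≤ 1} w ∧
    (∫⁻ y, ‖w y‖ₑ ^ p ≠ 0) ∧ ∫⁻ y, ENNReal.ofReal ((1 + ‖y‖) ^ D) * ‖w y‖ₑ ^ p ≠ ⊤ := by
  obtain ⟨χ, ψ, a1, a2, a3, a4, a5, a6, ⟨c, hc, a7⟩, _⟩ := sch_psi (E := V)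
  obtain ⟨χ', ψ', b1, b2, b3, b4, b5, b6, ⟨c', hc', b7⟩, _⟩ := sch_psi (E := ℝ)
  have hm : Measurable (fun y : V × ℝ => ψ y.1 * ψ' y.2) := by
    have := a4.measurable; have := b4.measurable; fun_prop
  refine ⟨fun y => ψ y.1 * ψ' y.2, ?_, ?_, ?_⟩
  · refine ⟨V × ℝ, inferInstance, volume, inferInstance, fun q => (q.1, - q.2), fun q => χ q.1 * χ' q.2,
      by fun_prop, by fun_prop, a2.mul_prod b2, ?_, ?_⟩
    · intro q hq
      exact ⟨a3 _ (left_ne_zero_of_mul hq), by simpa using b3 _ (right_ne_zero_of_mul hq)⟩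
    · intro z
      dsimp only
      rw [a5, b5]
      unfold ift
      rw [← integral_prod_mul]
      refine integral_congr_ae (Eventually.of_forall fun q => ?_)
      dsimp only
      unfold ec ph
      have : Complex.exp (Complex.I * ((inner ℝ q.1 z.1 - (-q.2) * z.2 : ℝ) : ℂ)) =
        Complex.exp (Complex.I * (inner ℝ q.1 z.1 : ℝ)) * Complex.exp (Complex.I * (inner ℝ q.2 z.2 : ℝ)) := by
        rw [← Complex.exp_add]
        congr 1
        simp only [RCLike.inner_apply, conj_trivial]
        push_cast
        ring
      simp only [this]
      ring
  · intro h0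
    rw [lintegral_eq_zero_iff (by fun_prop)] at h0
    have hcont : Continuous fun y : V × ℝ => ‖ψ y.1 * ψ' y.2‖ₑ ^ p := by
      have : Continuous fun y : V × ℝ => ψ y.1 * ψ' y.2 := by fun_prop
      exact (ENNReal.continuous_rpow_const).comp this.enorm
    have := (Continuous.ae_eq_iff_eq volume hcont continuous_const).1 h0
    have h1 : ‖ψ (0 : V × ℝ).1 * ψ' (0 : V × ℝ).2‖ₑ ^ p = 0 := congrFun this 0
    rw [ENNReal.rpow_eq_zero_iff_of_pos (by linarith), enorm_eq_zero] at h1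
    have h2 := a7 0 (by simp)
    have h3 := b7 0 (by simp)
    rcases mul_eq_zero.1 h1 with h | h
    · simp only [Prod.fst_zero] at h; rw [h] at h2; simp at h2; linarith
    · simp only [Prod.snd_zero] at h; rw [h] at h3; simp at h3; linarith
  · obtain ⟨C1, hC1, h1⟩ := a6 (D + dm (V × ℝ))
    obtain ⟨C2, hC2, h2⟩ := b6 (D + dm (V × ℝ))
    obtain ⟨C1', hC1', h1'⟩ := a6 0
    obtain ⟨C2', hC2', h2'⟩ := b6 0
    set B : ℝ := C1 * C2' + C1' * C2 with hB
    have hB0 : 0 ≤ B := by positivity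
    have hb : ∀ y : V × ℝ, ‖ψ y.1 * ψ' y.2‖ ≤ B * ((1 + ‖y‖) ^ (D + dm (V × ℝ)))⁻¹ := by
      intro y
      rw [norm_mul]
      have e1 := h1' y.1
      have e2 := h2' y.2
      simp only [pow_zero, inv_one, mul_one] at e1 e2
      rcases max_cases ‖y.1‖ ‖y.2‖ with ⟨h, _⟩ | ⟨h, _⟩
      · have : ‖y‖ = ‖y.1‖ := h
        rw [this]
        calc ‖ψ y.1‖ * ‖ψ' y.2‖ ≤ (C1 * ((1 + ‖y.1‖) ^ (D + dm (V × ℝ)))⁻¹) * C2' :=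
              mul_le_mul (h1 _) e2 (norm_nonneg _) (by positivity)
          _ = (C1 * C2') * ((1 + ‖y.1‖) ^ (D + dm (V × ℝ)))⁻¹ := by ring
          _ ≤ _ := by gcongr; rw [hB]; nlinarith [mul_nonneg hC1' hC2]
      · have : ‖y‖ = ‖y.2‖ := h
        rw [this]
        calc ‖ψ y.1‖ * ‖ψ' y.2‖ ≤ C1' * (C2 * ((1 + ‖y.2‖) ^ (D + dm (V × ℝ)))⁻¹) :=
              mul_le_mul e1 (h2 _) (norm_nonneg _) (by positivity)
          _ = (C1' * C2) * ((1 + ‖y.2‖) ^ (D + dm (V × ℝ)))⁻¹ := by ring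
          _ ≤ _ := by gcongr; rw [hB]; nlinarith [mul_nonneg hC1 hC2']
    have hfin : ∫⁻ y : V × ℝ, ENNReal.ofReal (B ^ p) * ENNReal.ofReal ((1 + ‖y‖) ^ (-(dm (V × ℝ) : ℝ))) ≠ ⊤ := by
      rw [lintegral_const_mul' _ _ (by simp)]
      exact ENNReal.mul_ne_top (by simp) (finite_integral_one_add_norm (by unfold dm; push_cast; linarith)).ne
    refine ne_top_of_le_ne_top hfin (lintegral_mono fun y => ?_)
    dsimp only
    rw [← ofReal_norm, ENNReal.ofReal_rpow_of_nonneg (norm_nonneg _) (by linarith), ← ENNReal.ofReal_mul (by positivity),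
      ← ENNReal.ofReal_mul (by positivity)]
    apply ENNReal.ofReal_le_ofReal
    have hy : 1 ≤ 1 + ‖y‖ := by linarith [norm_nonneg y]
    have e3 : ‖ψ y.1 * ψ' y.2‖ ^ p ≤ B ^ p * ((1 + ‖y‖) ^ (D + dm (V × ℝ)))⁻¹ := by
      calc _ ≤ (B * ((1 + ‖y‖) ^ (D + dm (V × ℝ)))⁻¹) ^ p := Real.rpow_le_rpow (norm_nonneg _) (hb y) (by linarith)
        _ = B ^ p * (((1 + ‖y‖) ^ (D + dm (V × ℝ)))⁻¹) ^ p := Real.mul_rpow hB0 (by positivity)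
        _ ≤ _ := by
          gcongr
          have : ((1 + ‖y‖) ^ (D + dm (V × ℝ)))⁻¹ ≤ 1 := inv_le_one_of_one_le₀ (one_le_pow₀ hy)
          calc _ ≤ (((1 + ‖y‖) ^ (D + dm (V × ℝ)))⁻¹) ^ (1 : ℝ) :=
                Real.rpow_le_rpow_of_exponent_ge (by positivity) this (by linarith)
            _ = _ := Real.rpow_one _
    calc _ ≤ (1 + ‖y‖) ^ D * (B ^ p * ((1 + ‖y‖) ^ (D + dm (V × ℝ)))⁻¹) := by gcongr
      _ = B ^ p * ((1 + ‖y‖) ^ (dm (V × ℝ)))⁻¹ := by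
        rw [pow_add]; field_simp
      _ = _ := by rw [Real.rpow_neg (by positivity), Real.rpow_natCast]

/-- scaling of windows -/
theorem window_scale {w : V × ℝ → ℂ} (hw : Spec {ζ : V × ℝ | ‖ζ.1‖ ≤ 1 ∧ |ζ.2| ≤ 1} w) {s : ℝ} (hs : 0 < s) :
    Spec {ζ : V × ℝ | ‖ζ.1‖ ≤ s ∧ |ζ.2| ≤ s} (fun y => w (s • y)) := by
  refine hw.comp (fun y => s • y) (fun ζ => s • ζ) (fun _ => 0) (by fun_prop) measurable_const ?_ ?_
  · intro ζ z
    unfold ph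
    simp only [Prod.smul_fst, Prod.smul_snd, inner_smul_left, inner_smul_right, smul_eq_mul, conj_trivial]
    ring
  · rintro ζ ⟨h1, h2⟩
    refine ⟨?_, ?_⟩
    · simp only [Prod.smul_fst, norm_smul, Real.norm_eq_abs, abs_of_pos hs]; nlinarith
    · simp only [Prod.smul_snd, smul_eq_mul, abs_mul, abs_of_pos hs]; nlinarith

/-- window multiplication preserves families -/
theorem IsFam.window {A σ : ℝ} (hA : 0 ≤ A) (hσ : 0 < σ) (hσ1 : σ ≤ 1) {S : Finset V} {f : V → V × ℝ → ℂ} (hf : IsFam A σ S f)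
    {W : V × ℝ → ℂ} (hW : Spec {ζ : V × ℝ | ‖ζ.1‖ ≤ σ ^ 2 ∧ |ζ.2| ≤ σ ^ 2} W) (z : V × ℝ) :
    IsFam (3 * A + 4) σ S (fun c y => f c (y + z) * W y) := by
  refine ⟨hf.ball, hf.sep, fun c hc => ?_⟩
  refine ((hf.spec c hc).translate z).mul hW ?_
  rintro ζ ⟨h1, h2⟩ ζ' ⟨h3, h4⟩
  have hs2 : σ ^ 2 ≤ σ := by nlinarith
  have hn : ‖ζ.1‖ ≤ 1 + A := by
    calc ‖ζ.1‖ = ‖(ζ.1 - c) + c‖ := by abel_nf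
      _ ≤ ‖ζ.1 - c‖ + ‖c‖ := norm_add_le _ _
      _ ≤ A * σ + 1 := add_le_add h1 (hf.ball c hc)
      _ ≤ _ := by nlinarith
  refine ⟨?_, ?_⟩
  · calc ‖(ζ + ζ').1 - c‖ = ‖(ζ.1 - c) + ζ'.1‖ := by simp only [Prod.fst_add]; abel_nf
      _ ≤ A * σ + σ ^ 2 := (norm_add_le _ _).trans (add_le_add h1 h3)
      _ ≤ _ := by nlinarith
  · have e : (ζ + ζ').2 - ‖(ζ + ζ').1‖ ^ 2 = (ζ.2 - ‖ζ.1‖ ^ 2) + ζ'.2 - 2 * inner ℝ ζ.1 ζ'.1 - ‖ζ'.1‖ ^ 2 := by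
      simp only [Prod.fst_add, Prod.snd_add, norm_add_sq_real]; ring
    have hi : |inner ℝ ζ.1 ζ'.1| ≤ (1 + A) * σ ^ 2 :=
      (abs_real_inner_le_norm _ _).trans (mul_le_mul hn h3 (norm_nonneg _) (by positivity))
    have hq : ‖ζ'.1‖ ^ 2 ≤ σ ^ 2 := by
      have := norm_nonneg ζ'.1
      nlinarith
    rw [e]
    rw [abs_le] at h2 h4 hi ⊢
    constructor <;> nlinarith [sq_nonneg ‖ζ'.1‖, sq_nonneg σ]

variable (V) in
/-- local constancy at scale `K`, with shifts -/
theorem loc_shift (A : ℝ) (hA : 0 < A) : ∃ C : ℝ≥0∞, C ≠ ⊤ ∧ ∀ (K : ℝ) (c : V) (g : V × ℝ → ℂ), 1 ≤ K → ‖c‖ ≤ 1 →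
    Spec (Box A (1 / K) c) g → ∀ z y, ‖g (z + y)‖ₑ ^ (2 : ℝ) ≤
      C * (ENNReal.ofReal ((1 + ‖y‖ / K) ^ dm (V × ℝ)) * av K (fun z => ‖g z‖ₑ ^ (2 : ℝ)) z) := by
  obtain ⟨C, hC, h⟩ := loc_iso (V := V) (A + A * (A + 2)) (by positivity) 2 (by norm_num)
  refine ⟨C, hC, fun K c g hK hc hg z y => ?_⟩
  have hK0 : 0 < K := by linarith
  have hg' : Spec {ζ : V × ℝ | ‖ζ.1 - c‖ ≤ (A + A * (A + 2)) * (1 / K) ∧ |ζ.2 - ‖c‖ ^ 2| ≤ (A + A * (A + 2)) * (1 / K)} g := by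
    refine hg.mono ?_
    rintro ζ ⟨h1, h2⟩
    have hi : 0 < 1 / K := by positivity
    have hi1 : 1 / K ≤ 1 := by rw [div_le_one hK0]; exact hK
    set i := 1 / K
    refine ⟨h1.trans ?_, ?_⟩
    · gcongr; nlinarith
    · have hn : ‖ζ.1‖ ≤ 1 + A := by
        calc ‖ζ.1‖ = ‖(ζ.1 - c) + c‖ := by abel_nf
          _ ≤ ‖ζ.1 - c‖ + ‖c‖ := norm_add_le _ _
          _ ≤ A * i + 1 := add_le_add h1 hc
          _ ≤ _ := by nlinarith
      have h3 : |‖ζ.1‖ - ‖c‖| ≤ A * i := (abs_norm_sub_norm_le _ _).trans h1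
      have h4 : |‖ζ.1‖ ^ 2 - ‖c‖ ^ 2| ≤ A * (A + 2) * i := by
        rw [sq_sub_sq, abs_mul, abs_of_nonneg (by positivity)]
        calc _ ≤ ((1 + A) + 1) * (A * i) := by gcongr
          _ = _ := by ring
      calc _ = |(ζ.2 - ‖ζ.1‖ ^ 2) + (‖ζ.1‖ ^ 2 - ‖c‖ ^ 2)| := by ring_nf
        _ ≤ A * i ^ 2 + A * (A + 2) * i := (abs_add_le _ _).trans (add_le_add h2 h4)
        _ ≤ _ := by nlinarith [mul_nonneg hA.le hi.le]
  have hm := hg.measurable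
  have h5 := h c (‖c‖ ^ 2) (1 / K) g (by positivity) hg' (z + y)
  rw [one_div_one_div] at h5
  refine h5.trans (mul_le_mul_right ?_ _)
  exact av_shift' hK0 (by fun_prop) z y

end bn
end Strz

open MeasureTheory Filter
open scoped ENNReal NNReal ComplexConjugate FourierTransform
set_option linter.unusedSectionVars false
set_option linter.unusedSimpArgs false
set_option linter.unusedVariables false
namespace Strz

section bn
variable {V : Type} [NormedAddCommGroup V] [InnerProductSpace ℝ V] [FiniteDimensional ℝ V]
  [MeasurableSpace V] [BorelSpace V]

theorem nrm_two {p : ℝ} (hp : 2 ≤ p) {f g : V × ℝ → ℂ} (hf : Measurable f) (hg : Measurable g) :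
    nrm p (fun z => f z + g z) ≤ 2 ^ p * nrm p f + 2 ^ p * nrm p g := by
  unfold nrm
  rw [← lintegral_const_mul _ (by fun_prop), ← lintegral_const_mul _ (by fun_prop), ← lintegral_add_left (by fun_prop)]
  refine lintegral_mono fun z => ?_
  dsimp only
  have h1 : ‖f z + g z‖ₑ ≤ 2 * max ‖f z‖ₑ ‖g z‖ₑ := by
    refine (enorm_add_le _ _).trans ?_
    rw [two_mul]
    exact add_le_add (le_max_left _ _) (le_max_right _ _)
  calc ‖f z + g z‖ₑ ^ p ≤ (2 * max ‖f z‖ₑ ‖g z‖ₑ) ^ p := ENNReal.rpow_le_rpow h1 (by linarith)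
    _ = 2 ^ p * (max ‖f z‖ₑ ‖g z‖ₑ) ^ p := ENNReal.mul_rpow_of_nonneg _ _ (by linarith)
    _ ≤ _ := by
      rcases max_cases ‖f z‖ₑ ‖g z‖ₑ with ⟨h, _⟩ | ⟨h, _⟩ <;> rw [h]
      · exact le_add_of_nonneg_right zero_le
      · exact le_add_of_nonneg_left zero_le

theorem bn_small {p : ℝ} (hp : 2 ≤ p) {F : V → V × ℝ → ℂ} {W : V × ℝ → ℂ} (hW : Measurable W) {wt : V × ℝ → ℝ≥0∞}
    (hwt : Measurable wt) {C Ω X N : ℝ≥0∞} {G : V → ℝ≥0∞} (z : V × ℝ) (T : Finset V) (hN : (T.card : ℝ≥0∞) ≤ N)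
    (hloc : ∀ γ ∈ T, ∀ y, ‖F γ (y + z)‖ₑ ^ (2 : ℝ) ≤ C * (wt y * G γ))
    (hΩ : ∫⁻ y, wt y ^ (p / 2) * ‖W y‖ₑ ^ p ≤ Ω) (hX : ∀ γ ∈ T, N * N * G γ ≤ X) :
    nrm p (fun y => (∑ γ ∈ T, F γ (y + z)) * W y) ≤ C ^ (p / 2) * Ω * X ^ (p / 2) := by
  have hp2 : 0 ≤ p / 2 := by linarith
  have h1 : ∀ y, ‖∑ γ ∈ T, F γ (y + z)‖ₑ ^ (2 : ℝ) ≤ C * (wt y * X) := by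
    intro y
    refine sum_small T N hN _ _ fun γ hγ => ?_
    calc _ ≤ N * N * (C * (wt y * G γ)) := mul_le_mul_right (hloc γ hγ y) _
      _ = C * (wt y * (N * N * G γ)) := by ring
      _ ≤ _ := by gcongr; exact hX γ hγ
  calc _ ≤ ∫⁻ y, (C ^ (p / 2) * X ^ (p / 2)) * (wt y ^ (p / 2) * ‖W y‖ₑ ^ p) := by
        unfold nrm
        refine lintegral_mono fun y => ?_
        dsimp only
        rw [enorm_mul, ENNReal.mul_rpow_of_nonneg _ _ (by linarith)]
        have e : ‖∑ γ ∈ T, F γ (y + z)‖ₑ ^ p = (‖∑ γ ∈ T, F γ (y + z)‖ₑ ^ (2 : ℝ)) ^ (p / 2) := by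
          rw [← ENNReal.rpow_mul]; congr 1; ring
        rw [e]
        calc _ ≤ (C * (wt y * X)) ^ (p / 2) * ‖W y‖ₑ ^ p := by
              gcongr; exact h1 y
          _ = _ := by
              rw [ENNReal.mul_rpow_of_nonneg _ _ hp2, ENNReal.mul_rpow_of_nonneg _ _ hp2]; ring
    _ = (C ^ (p / 2) * X ^ (p / 2)) * ∫⁻ y, (wt y ^ (p / 2) * ‖W y‖ₑ ^ p) := by
        rw [lintegral_const_mul _ (by fun_prop)]
    _ ≤ (C ^ (p / 2) * X ^ (p / 2)) * Ω := mul_le_mul_right hΩ _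
    _ = _ := by ring

open Classical in
theorem bn_point {k : ℕ} (hV : Module.finrank ℝ V = k + 1) {p A σ : ℝ} (hp : 2 ≤ p) (hA : 0 ≤ A) (hσ : 0 < σ) (hσ1 : σ ≤ 1)
    {Γ : Finset V} {F : V → V × ℝ → ℂ} (hF : ∀ γ ∈ Γ, Measurable (F γ)) {r : V → V} (hr : ∀ γ ∈ Γ, ‖γ - r γ‖ ≤ σ)
    (hB : IsFam A σ (Γ.image r) (crs Γ r F)) {W : V × ℝ → ℂ}
    (hW : Spec {ζ : V × ℝ | ‖ζ.1‖ ≤ σ ^ 2 ∧ |ζ.2| ≤ σ ^ 2} W) {wt : V × ℝ → ℝ≥0∞}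
    (hwt : Measurable wt) {C Ω N : ℝ≥0∞} {G : V → ℝ≥0∞} (z : V × ℝ) (hN1 : 1 ≤ N) (hN : (Γ.card : ℝ≥0∞) ≤ N)
    (hloc : ∀ γ ∈ Γ, ∀ y, ‖F γ (y + z)‖ₑ ^ (2 : ℝ) ≤ C * (wt y * G γ))
    (hΩ : ∫⁻ y, wt y ^ (p / 2) * ‖W y‖ₑ ^ p ≤ Ω) {B' : ℝ≥0∞}
    (hD : DecB (EuclideanSpace ℝ (Fin k)) p (4 * ((3 * A + 4) + ((3 * A + 4) + 2) ^ 2)) (σ / 2) B') :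
    nrm p (fun y => (∑ γ ∈ Γ, F γ (y + z)) * W y) ≤
      2 ^ p * ((11 : ℝ≥0∞) ^ (p / 2) * B') * NN p (Γ.image r) (fun β y => crs Γ r F β (y + z) * W y) +
      2 ^ p * (C ^ (p / 2) * Ω) * ∑ γ ∈ Γ, G γ ^ (p / 2) +
      (N * N * (N * N)) ^ (p / 2) * (C ^ (p / 2) * Ω) *
        ∑ c ∈ Fintype.piFinset (fun _ : Fin (k + 1 + 1) => Γ) with ∀ j, DhAt σ c j,
          ∏ j, G (c j) ^ (p / (2 * (((k + 1 : ℕ) : ℝ) + 1))) := by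
  have hp2 : 0 < p / 2 := by linarith
  have hWm := hW.measurable
  rcases Γ.eq_empty_or_nonempty with rfl | hne
  · simp [nrm, ENNReal.zero_rpow_of_pos (by linarith : 0 < p)]
  obtain ⟨γ0, hγ0, hmax⟩ := Γ.exists_max_image G hne
  set X := G γ0 with hX
  have hXs : X ^ (p / 2) ≤ ∑ γ ∈ Γ, G γ ^ (p / 2) :=
    Finset.single_le_sum (f := fun γ => G γ ^ (p / 2)) (fun _ _ => zero_le) hγ0
  let Z := Γ.filter fun γ => X ≤ N * N * G γ
  have hZ : Z ⊆ Γ := Finset.filter_subset _ _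
  have hZne : Z.Nonempty := ⟨γ0, Finset.mem_filter.2 ⟨hγ0, by
    calc X = 1 * 1 * X := by simp
      _ ≤ N * N * G γ0 := by gcongr⟩⟩
  rcases dichotomy (k + 1) (by omega) hV σ Z hZne with ⟨c, hc, hcD⟩ | ⟨e, a, he, hea⟩
  · refine le_trans ?_ (le_add_of_nonneg_left zero_le)
    have h1 := bn_small hp hWm hwt (X := N * N * X) z Γ hN hloc hΩ (fun γ hγ => by gcongr; exact hmax γ hγ)
    refine h1.trans ?_
    have h2 : X ^ (p / 2) ≤ (N * N) ^ (p / 2) * ∏ j, G (c j) ^ (p / (2 * (((k + 1 : ℕ) : ℝ) + 1))) := by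
      have e1 : ∀ x : ℝ≥0∞, ∏ j : Fin (k + 1 + 1), x ^ (p / (2 * (((k + 1 : ℕ) : ℝ) + 1))) = x ^ (p / 2) := by
        intro x
        rw [Finset.prod_const, Finset.card_univ, Fintype.card_fin, ← ENNReal.rpow_natCast, ← ENNReal.rpow_mul]
        congr 1
        push_cast
        field_simp
      rw [← e1 X, ← e1 (N * N), ← Finset.prod_mul_distrib]
      refine Finset.prod_le_prod' fun j _ => ?_
      rw [← ENNReal.mul_rpow_of_nonneg _ _ (by positivity)]
      exact ENNReal.rpow_le_rpow (Finset.mem_filter.1 (hc j)).2 (by positivity)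
    have h3 : ∏ j, G (c j) ^ (p / (2 * (((k + 1 : ℕ) : ℝ) + 1))) ≤
        ∑ c ∈ Fintype.piFinset (fun _ : Fin (k + 1 + 1) => Γ) with ∀ j, DhAt σ c j,
          ∏ j, G (c j) ^ (p / (2 * (((k + 1 : ℕ) : ℝ) + 1))) :=
      Finset.single_le_sum (f := fun c : Fin (k + 1 + 1) → V => ∏ j, G (c j) ^ (p / (2 * (((k + 1 : ℕ) : ℝ) + 1))))
        (fun _ _ => zero_le) (Finset.mem_filter.2 ⟨Fintype.mem_piFinset.2 fun j => hZ (hc j), hcD⟩)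
    rw [ENNReal.mul_rpow_of_nonneg (N * N) X hp2.le, ENNReal.mul_rpow_of_nonneg (N * N) (N * N) hp2.le]
    calc _ ≤ C ^ (p / 2) * Ω * ((N * N) ^ (p / 2) * ((N * N) ^ (p / 2) * ∏ j, G (c j) ^ (p / (2 * (((k + 1 : ℕ) : ℝ) + 1))))) := by
          gcongr
      _ = ((N * N) ^ (p / 2) * (N * N) ^ (p / 2)) * (C ^ (p / 2) * Ω) * ∏ j, G (c j) ^ (p / (2 * (((k + 1 : ℕ) : ℝ) + 1))) := by ring
      _ ≤ _ := mul_le_mul_right h3 _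
  · refine le_trans ?_ (le_add_of_nonneg_right zero_le)
    let I := Z.image r
    have hI : I ⊆ Γ.image r := Finset.image_subset_image hZ
    let T := Γ.filter fun γ => ¬ (r γ ∈ I)
    have hsplit : ∀ y, (∑ γ ∈ Γ, F γ (y + z)) * W y =
        (∑ β ∈ I, crs Γ r F β (y + z) * W y) + (∑ γ ∈ T, F γ (y + z)) * W y := by
      intro y
      rw [← Finset.sum_mul, ← add_mul]
      congr 1
      rw [← Finset.sum_filter_add_sum_filter_not Γ (fun γ => r γ ∈ I)]
      congr 1
      rw [← Finset.sum_fiberwise_of_maps_to (s := Γ.filter fun γ => r γ ∈ I) (t := I) (g := r)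
        (fun γ hγ => (Finset.mem_filter.1 hγ).2)]
      refine Finset.sum_congr rfl fun β hβ => ?_
      unfold crs
      refine Finset.sum_congr ?_ fun _ _ => rfl
      ext γ
      simp only [Finset.mem_filter]
      constructor
      · rintro ⟨⟨h1, _⟩, h2⟩; exact ⟨h1, h2⟩
      · rintro ⟨h1, h2⟩; exact ⟨⟨h1, h2 ▸ hβ⟩, h2⟩
    have hcm : ∀ β, Measurable (crs Γ r F β) := by
      intro β
      unfold crs
      exact Finset.measurable_sum _ fun γ hγ => hF γ (Finset.mem_filter.1 hγ).1
    have hm1 : Measurable (fun y => ∑ β ∈ I, crs Γ r F β (y + z) * W y) :=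
      Finset.measurable_sum _ fun β hβ => by have := hcm β; fun_prop
    have hm2 : Measurable (fun y => (∑ γ ∈ T, F γ (y + z)) * W y) := by
      refine Measurable.mul (Finset.measurable_sum _ fun γ hγ => ?_) hWm
      have := hF γ (Finset.mem_filter.1 hγ).1
      fun_prop
    have hn : nrm p (fun y => (∑ γ ∈ Γ, F γ (y + z)) * W y) =
      nrm p (fun y => (∑ β ∈ I, crs Γ r F β (y + z) * W y) + (∑ γ ∈ T, F γ (y + z)) * W y) := by
      congr 1; funext y; exact hsplit y
    rw [hn]
    refine (nrm_two hp hm1 hm2).trans (add_le_add ?_ ?_)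
    · rw [mul_assoc]
      refine mul_le_mul_right ?_ _
      have hfam := hB.window hA hσ hσ1 hW z
      obtain ⟨ι, P, hS⟩ := exists_split k hV e he
      have h1 := cyl hp (by linarith) hσ hS hD I _ (hfam.sub hI) (a := a) (by
        intro β hβ
        obtain ⟨γ, hγ, rfl⟩ := Finset.mem_image.1 hβ
        have h2 := hea γ hγ
        have h3 : |inner ℝ e (r γ - γ)| ≤ σ := by
          refine (abs_real_inner_le_norm _ _).trans ?_
          rw [he, one_mul, norm_sub_rev]
          exact hr γ (hZ hγ)
        rw [inner_sub_right] at h3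
        rw [abs_le] at h2 h3 ⊢
        constructor <;> linarith)
      exact h1.trans (mul_le_mul_right (NN_mono hp hI _) _)
    · rw [mul_assoc]
      refine mul_le_mul_right ?_ _
      have h1 := bn_small hp hWm hwt (X := X) z T (N := N) (G := G)
        (le_trans (by exact_mod_cast Finset.card_le_card (Finset.filter_subset _ _)) hN)
        (fun γ hγ => hloc γ (Finset.mem_filter.1 hγ).1) hΩ (by
          intro γ hγ
          obtain ⟨h1, h2⟩ := Finset.mem_filter.1 hγ
          by_contra h3
          exact h2 (Finset.mem_image_of_mem r (Finset.mem_filter.2 ⟨h1, (not_le.1 h3).le⟩)))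
      exact h1.trans (mul_le_mul_right hXs _)

end bn
end Strz

open MeasureTheory Filter
open scoped ENNReal NNReal ComplexConjugate FourierTransform
set_option linter.unusedSectionVars false
set_option linter.unusedSimpArgs false
set_option linter.unusedVariables false
namespace Strz

section bn
variable {V : Type} [NormedAddCommGroup V] [InnerProductSpace ℝ V] [FiniteDimensional ℝ V]
  [MeasurableSpace V] [BorelSpace V]

theorem win_meas {p : ℝ} {g W : V × ℝ → ℂ} (hg : Measurable g) (hW : Measurable W) :
    Measurable (fun z => nrm p (fun y => g (y + z) * W y)) := by
  unfold nrm
  have : Measurable (fun q : (V × ℝ) × (V × ℝ) => ‖g (q.2 + q.1) * W q.2‖ₑ ^ p) := by fun_prop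
  exact this.lintegral_prod_right'

theorem win_int {p : ℝ} (hp : 2 ≤ p) {g W : V × ℝ → ℂ} (hg : Measurable g) (hW : Measurable W) :
    ∫⁻ z, nrm p (fun y => g (y + z) * W y) = (∫⁻ y, ‖W y‖ₑ ^ p) * nrm p g := by
  unfold nrm
  rw [lintegral_lintegral_swap (by fun_prop)]
  have : ∀ y, ∫⁻ z, ‖g (y + z) * W y‖ₑ ^ p = ‖W y‖ₑ ^ p * ∫⁻ z, ‖g z‖ₑ ^ p := by
    intro y
    rw [← lintegral_add_left_eq_self (fun z => ‖g z‖ₑ ^ p) y, ← lintegral_const_mul _ (by fun_prop)]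
    refine lintegral_congr fun z => ?_
    rw [enorm_mul, ENNReal.mul_rpow_of_nonneg _ _ (by linarith), mul_comm]
  simp only [this]
  rw [lintegral_mul_const _ (by fun_prop)]

theorem sum_le_lp {ι : Type*} {p : ℝ} (hp : 2 ≤ p) (S : Finset ι) (a : ι → ℝ≥0∞) :
    ∑ c ∈ S, a c ≤ (∑ c ∈ S, a c ^ (2 / p)) ^ (p / 2) := by
  classical
  induction S using Finset.induction_on with
  | empty => simp
  | insert c S hc ih =>
    rw [Finset.sum_insert hc, Finset.sum_insert hc]
    refine le_trans ?_ (ENNReal.add_rpow_le_rpow_add _ _ (by linarith : 1 ≤ p / 2))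
    refine add_le_add ?_ ih
    rw [← ENNReal.rpow_mul]
    have : 2 / p * (p / 2) = 1 := by field_simp
    rw [this, ENNReal.rpow_one]

open Classical in
variable (V) in
theorem broad_narrow (k : ℕ) (hV : Module.finrank ℝ V = k + 1) (p : ℝ) (hp : 2 ≤ p) (A : ℝ) (hA : 2 ≤ A) :
    ∃ C1 : ℝ≥0∞, C1 ≠ ⊤ ∧ ∀ K0 K : ℝ, 2 ≤ K0 → K0 ^ 2 ≤ K → ∃ CK : ℝ≥0∞, CK ≠ ⊤ ∧ ∀ (δ : ℝ) (B' Bβ Bγ D : ℝ≥0∞),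
      0 < δ → 2 * δ ≤ 1 / K → B' ≠ ⊤ →
      DecB (EuclideanSpace ℝ (Fin k)) p (4 * ((3 * A + 4) + ((3 * A + 4) + 2) ^ 2)) (1 / K0 / 2) B' →
      DecB V p A (δ / (2 * (1 / K0))) Bβ → DecB V p A (δ / (2 * (1 / K))) Bγ →
      (∀ (c : Fin (k + 1 + 1) → V) (S : Fin (k + 1 + 1) → Finset V) (f : V → V × ℝ → ℂ), (∀ i, ‖c i‖ ≤ 1) →
        (∀ j, DhAt (1 / K0) c j) → (∀ i, ∀ τ ∈ S i, ‖τ - c i‖ * K ≤ 2) → (∀ j, IsFam A δ (S j) f) →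
        ∫⁻ z, ∏ j, (av K (fun z => ‖∑ c ∈ S j, f c z‖ₑ ^ (2 : ℝ)) z) ^ (p / (2 * (((k + 1 : ℕ) : ℝ) + 1))) ≤
          D * ∏ j, NN p (S j) f ^ (1 / (((k + 1 : ℕ) : ℝ) + 1))) →
      DecB V p A δ (C1 * B' * Bβ + C1 * Bγ + CK * D) := by
  have hp2 : 0 < p / 2 := by linarith
  obtain ⟨C, hC, hloc⟩ := loc_shift V A (by linarith)
  obtain ⟨Dn, hDn⟩ := exists_nat_ge ((dm (V × ℝ) : ℝ) * (p / 2))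
  obtain ⟨w, hw, hw0, hw1⟩ := window V p hp Dn
  have hwm := hw.measurable
  set w1 := ∫⁻ y, ‖w y‖ₑ ^ p with hw1d
  set w2 := ∫⁻ y, ENNReal.ofReal ((1 + ‖y‖) ^ Dn) * ‖w y‖ₑ ^ p with hw2d
  have hw12 : w1 ≤ w2 := by
    refine lintegral_mono fun y => ?_
    refine le_mul_of_one_le_left zero_le ?_
    rw [ENNReal.one_le_ofReal]
    exact one_le_pow₀ (by linarith [norm_nonneg y])
  have hw1t : w1 ≠ ⊤ := ne_top_of_le_ne_top hw1 hw12
  set C2 : ℝ≥0∞ := C ^ (p / 2) * (w1⁻¹ * w2) with hC2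
  have hC2t : C2 ≠ ⊤ := ENNReal.mul_ne_top (ENNReal.rpow_ne_top_of_nonneg hp2.le hC)
    (ENNReal.mul_ne_top (by simpa using hw0) hw1)
  set C1 : ℝ≥0∞ := 2 ^ p * (11 : ℝ≥0∞) ^ (p / 2) + 2 ^ p * C2 * mass (V × ℝ) ^ (p / 2) with hC1
  have h2p : (2 : ℝ≥0∞) ^ p ≠ ⊤ := ENNReal.rpow_ne_top_of_nonneg (by linarith) (by simp)
  have hmt : mass (V × ℝ) ^ (p / 2) ≠ ⊤ := ENNReal.rpow_ne_top_of_nonneg hp2.le mass_lt.ne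
  have hC1t : C1 ≠ ⊤ := ENNReal.add_ne_top.2 ⟨ENNReal.mul_ne_top h2p (ENNReal.rpow_ne_top_of_nonneg hp2.le (by simp)),
    ENNReal.mul_ne_top (ENNReal.mul_ne_top h2p hC2t) hmt⟩
  refine ⟨C1, hC1t, fun K0 K hK0 hK => ?_⟩
  have hK0p : 0 < K0 := by linarith
  have hK2 : 2 * K0 ≤ K := by nlinarith
  have hKp : 0 < K := by linarith
  have hK1 : 1 ≤ K := by linarith
  set N : ℝ≥0∞ := ENNReal.ofReal ((1 + 2 * 1 / (1 / K)) ^ Module.finrank ℝ V) with hNd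
  have hN1 : 1 ≤ N := by
    rw [hNd, ENNReal.one_le_ofReal]
    refine one_le_pow₀ ?_
    have : 0 < 2 * 1 / (1 / K) := by positivity
    linarith
  have hNt : N ≠ ⊤ := by simp [hNd]
  refine ⟨(N * N * (N * N)) ^ (p / 2) * C2 * N ^ (k + 1 + 1), ENNReal.mul_ne_top (ENNReal.mul_ne_top
    (ENNReal.rpow_ne_top_of_nonneg hp2.le (by finiteness)) hC2t) (by finiteness), ?_⟩
  intro δ B' Bβ Bγ D hδ hδK hB't hD' hβ hγ hmul S f hf
  set σ := 1 / K0 with hσd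
  have hσ : 0 < σ := by positivity
  have hσ1 : σ ≤ 1 := by rw [hσd, div_le_one hK0p]; linarith
  have hiK : 0 < 1 / K := by positivity
  obtain ⟨rγ, hr1, hr2⟩ := rounding S hiK
  set Γ := S.image rγ with hΓ
  set Fγ := crs S rγ f with hFγ
  have hfγ : IsFam A (1 / K) Γ Fγ := hf.coarse hA hδ hδK hr1 hr2
  have h2K : 2 * (1 / K) ≤ σ := by rw [hσd, mul_one_div, div_le_div_iff₀ hKp hK0p]; linarith
  obtain ⟨rβ, hs1, hs2⟩ := rounding Γ hσ
  have hfβ : IsFam A σ (Γ.image rβ) (crs Γ rβ Fγ) := hfγ.coarse hA hiK h2K hs1 hs2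
  have hcard : (Γ.card : ℝ≥0∞) ≤ N := by
    rw [hNd, ← ENNReal.ofReal_natCast]
    exact ENNReal.ofReal_le_ofReal (packing Γ 0 (1 / K) 1 hiK (by norm_num) (fun c hc => by simpa using hfγ.ball c hc) hfγ.sep)
  set W : V × ℝ → ℂ := fun y => w ((σ ^ 2) • y) with hWd
  have hW : Spec {ζ : V × ℝ | ‖ζ.1‖ ≤ σ ^ 2 ∧ |ζ.2| ≤ σ ^ 2} W := window_scale hw (by positivity)
  have hWm := hW.measurable
  set wt : V × ℝ → ℝ≥0∞ := fun y => ENNReal.ofReal ((1 + ‖y‖ / K) ^ dm (V × ℝ)) with hwtd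
  have hwt : Measurable wt := by fun_prop
  set κ : ℝ≥0∞ := ENNReal.ofReal (|((σ ^ 2) ^ Module.finrank ℝ (V × ℝ))⁻¹|) with hκ
  have hκ0 : κ ≠ 0 := by
    rw [hκ, Ne, ENNReal.ofReal_eq_zero, not_le]
    positivity
  have hκt : κ ≠ ⊤ := by simp [hκ]
  have hWp : ∫⁻ y, ‖W y‖ₑ ^ p = κ * w1 := lint_smul (fun y => ‖w y‖ₑ ^ p) (by positivity)
  have hΩ : ∫⁻ y, wt y ^ (p / 2) * ‖W y‖ₑ ^ p ≤ κ * w2 := by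
    rw [hw2d, hκ, ← lint_smul (fun y => ENNReal.ofReal ((1 + ‖y‖) ^ Dn) * ‖w y‖ₑ ^ p) (by positivity : σ ^ 2 ≠ 0)]
    refine lintegral_mono fun y => ?_
    refine mul_le_mul_left ?_ _
    dsimp only [wt]
    rw [ENNReal.ofReal_rpow_of_nonneg (by positivity) hp2.le]
    apply ENNReal.ofReal_le_ofReal
    have h1 : ‖y‖ / K ≤ ‖σ ^ 2 • y‖ := by
      rw [norm_smul, Real.norm_eq_abs, abs_of_pos (by positivity), hσd, div_pow, one_pow, div_eq_mul_one_div, mul_comm]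
      gcongr
    calc ((1 + ‖y‖ / K) ^ dm (V × ℝ)) ^ (p / 2) ≤ ((1 + ‖σ ^ 2 • y‖) ^ dm (V × ℝ)) ^ (p / 2) := by gcongr
      _ = (1 + ‖σ ^ 2 • y‖) ^ ((dm (V × ℝ) : ℝ) * (p / 2)) := by
        rw [← Real.rpow_natCast, ← Real.rpow_mul (by positivity)]
      _ ≤ (1 + ‖σ ^ 2 • y‖) ^ (Dn : ℝ) := Real.rpow_le_rpow_of_exponent_le (by linarith [norm_nonneg (σ ^ 2 • y)]) hDn
      _ = _ := Real.rpow_natCast _ _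
  set G : V → V × ℝ → ℝ≥0∞ := fun γ => av K (fun z => ‖Fγ γ z‖ₑ ^ (2 : ℝ)) with hG
  have hFm : ∀ γ ∈ Γ, Measurable (Fγ γ) := fun γ hγ => (hfγ.spec γ hγ).measurable
  have hGm : ∀ γ ∈ Γ, Measurable (G γ) := fun γ hγ => av_meas _ (by have := hFm γ hγ; fun_prop)
  have hsum : (fun z => ∑ c ∈ S, f c z) = fun z => ∑ γ ∈ Γ, Fγ γ z := by
    funext z; exact (crs_sum S rγ f z).symm
  have hpt := fun z => bn_point hV hp (by linarith) hσ hσ1 hFm (fun γ hγ => (hs1 γ hγ).2) hfβ hW hwt (G := fun γ => G γ z) z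
    hN1 hcard (fun γ hγ y => by
      have := hloc K γ (Fγ γ) hK1 (hfγ.ball γ hγ) (hfγ.spec γ hγ) z y
      rwa [add_comm z y] at this) hΩ hD'
  have hsm : Measurable (fun z => ∑ γ ∈ Γ, Fγ γ z) := Finset.measurable_sum _ fun γ hγ => hFm γ hγ
  have hI := win_int hp hsm hWm
  rw [hWp] at hI
  rw [hsum]
  -- integrate
  have hT1 : ∫⁻ z, NN p (Γ.image rβ) (fun β y => crs Γ rβ Fγ β (y + z) * W y) ≤ κ * w1 * (Bβ * NN p S f) := by
    have h1 := mink_pow (volume : Measure (V × ℝ)) (Γ.image rβ) (fun β z => nrm p (fun y => crs Γ rβ Fγ β (y + z) * W y))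
      (fun β hβ => win_meas (hfβ.spec β hβ).measurable hWm) p hp
    refine le_trans h1 ?_
    have h2 : ∀ β ∈ Γ.image rβ, (∫⁻ z, nrm p (fun y => crs Γ rβ Fγ β (y + z) * W y)) ^ (2 / p) =
        (κ * w1) ^ (2 / p) * nrm p (crs Γ rβ Fγ β) ^ (2 / p) := by
      intro β hβ
      rw [win_int hp (hfβ.spec β hβ).measurable hWm, hWp, ENNReal.mul_rpow_of_nonneg _ _ (by positivity)]
    rw [Finset.sum_congr rfl h2, ← Finset.mul_sum, ENNReal.mul_rpow_of_nonneg _ _ hp2.le, ← ENNReal.rpow_mul]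
    have : 2 / p * (p / 2) = 1 := by field_simp
    rw [this, ENNReal.rpow_one]
    refine mul_le_mul_right ?_ _
    have h3 := NN_coarse hp hσ hβ hf (π := rβ ∘ rγ) (by
      intro c hc
      calc ‖c - (rβ ∘ rγ) c‖ = ‖(c - rγ c) + (rγ c - rβ (rγ c))‖ := by simp
        _ ≤ 1 / K + σ := (norm_add_le _ _).trans (add_le_add (hr1 c hc).2 (hs1 _ (Finset.mem_image_of_mem _ hc)).2)
        _ ≤ _ := by linarith)
    rw [← crs_comp, ← Finset.image_image] at h3
    exact h3
  have hT2 : ∫⁻ z, ∑ γ ∈ Γ, G γ z ^ (p / 2) ≤ mass (V × ℝ) ^ (p / 2) * (Bγ * NN p S f) := by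
    rw [lintegral_finsetSum' _ fun γ hγ => ((hGm γ hγ).pow_const _).aemeasurable]
    have h1 : ∀ γ ∈ Γ, ∫⁻ z, G γ z ^ (p / 2) ≤ mass (V × ℝ) ^ (p / 2) * nrm p (Fγ γ) := by
      intro γ hγ
      have hm := hFm γ hγ
      have e : ∀ x : ℝ≥0∞, (x ^ (2 : ℝ)) ^ (p / 2) = x ^ p := by
        intro x; rw [← ENNReal.rpow_mul]; congr 1; ring
      calc _ ≤ ∫⁻ z, mass (V × ℝ) ^ (p / 2 - 1) * av K (fun z => ‖Fγ γ z‖ₑ ^ p) z := by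
            refine lintegral_mono fun z => ?_
            have := av_jensen hKp (F := fun z => ‖Fγ γ z‖ₑ ^ (2 : ℝ)) (by fun_prop) (p / 2) (by linarith) z
            simp only [e] at this
            exact this
        _ = mass (V × ℝ) ^ (p / 2 - 1) * (mass (V × ℝ) * nrm p (Fγ γ)) := by
            rw [lintegral_const_mul _ (av_meas _ (by fun_prop)), lint_av hKp (by fun_prop)]; rfl
        _ = _ := by
            rw [← mul_assoc]
            congr 1
            nth_rw 2 [← ENNReal.rpow_one (mass (V × ℝ))]
            rw [← ENNReal.rpow_add_of_nonneg _ _ (by linarith) (by norm_num)]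
            congr 1; ring
    calc _ ≤ ∑ γ ∈ Γ, mass (V × ℝ) ^ (p / 2) * nrm p (Fγ γ) := Finset.sum_le_sum h1
      _ = mass (V × ℝ) ^ (p / 2) * ∑ γ ∈ Γ, nrm p (Fγ γ) := by rw [Finset.mul_sum]
      _ ≤ mass (V × ℝ) ^ (p / 2) * NN p Γ Fγ := mul_le_mul_right (sum_le_lp hp Γ _) _
      _ ≤ _ := by
        refine mul_le_mul_right ?_ _
        refine NN_coarse hp hiK hγ hf (fun c hc => (hr1 c hc).2.trans ?_)
        linarith
  have hT3 : ∫⁻ z, ∑ c ∈ Fintype.piFinset (fun _ : Fin (k + 1 + 1) => Γ) with ∀ j, DhAt σ c j,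
      ∏ j, G (c j) z ^ (p / (2 * (((k + 1 : ℕ) : ℝ) + 1))) ≤ N ^ (k + 1 + 1) * (D * NN p S f) := by
    have hcm : ∀ c ∈ (Fintype.piFinset (fun _ : Fin (k + 1 + 1) => Γ)).filter (fun c => ∀ j, DhAt σ c j), ∀ j, c j ∈ Γ :=
      fun c hc => Fintype.mem_piFinset.1 (Finset.mem_filter.1 hc).1
    rw [lintegral_finsetSum' _ fun c hc =>
      (Finset.measurable_prod _ fun j _ => (hGm _ (hcm c hc j)).pow_const _).aemeasurable]
    have h1 : ∀ c ∈ (Fintype.piFinset (fun _ : Fin (k + 1 + 1) => Γ)).filter (fun c => ∀ j, DhAt σ c j),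
        ∫⁻ z, ∏ j, G (c j) z ^ (p / (2 * (((k + 1 : ℕ) : ℝ) + 1))) ≤ D * NN p S f := by
      intro c hc
      have h2 := hmul c (fun j => S.filter fun a => rγ a = c j) f (fun i => hfγ.ball _ (hcm c hc i)) (Finset.mem_filter.1 hc).2
        (by
          intro i τ hτ
          obtain ⟨h3, h4⟩ := Finset.mem_filter.1 hτ
          have := (hr1 τ h3).2
          rw [h4] at this
          calc _ ≤ 1 / K * K := by gcongr
            _ ≤ 2 := by rw [one_div, inv_mul_cancel₀ hKp.ne']; norm_num)
        (fun j => hf.sub (Finset.filter_subset _ _))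
      refine le_trans h2 (mul_le_mul_right ?_ _)
      calc _ ≤ ∏ j : Fin (k + 1 + 1), NN p S f ^ (1 / (((k + 1 : ℕ) : ℝ) + 1)) :=
            Finset.prod_le_prod' fun j _ => ENNReal.rpow_le_rpow (NN_mono hp (Finset.filter_subset _ _) _) (by positivity)
        _ = _ := by
            rw [Finset.prod_const, Finset.card_univ, Fintype.card_fin, ← ENNReal.rpow_natCast, ← ENNReal.rpow_mul]
            have : 1 / (((k + 1 : ℕ) : ℝ) + 1) * ((k + 1 + 1 : ℕ) : ℝ) = 1 := by push_cast; field_simp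
            rw [this, ENNReal.rpow_one]
    refine (Finset.sum_le_card_nsmul _ _ _ h1).trans ?_
    rw [nsmul_eq_mul]
    refine mul_le_mul_left ?_ _
    calc _ ≤ ((Fintype.piFinset (fun _ : Fin (k + 1 + 1) => Γ)).card : ℝ≥0∞) := by
          exact_mod_cast Finset.card_le_card (Finset.filter_subset _ _)
      _ = (Γ.card : ℝ≥0∞) ^ (k + 1 + 1) := by
          rw [Fintype.card_piFinset]; simp
      _ ≤ _ := pow_le_pow_left₀ zero_le hcard _
  have hm3 : Measurable (fun z => ∑ c ∈ Fintype.piFinset (fun _ : Fin (k + 1 + 1) => Γ) with ∀ j, DhAt σ c j,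
      ∏ j, G (c j) z ^ (p / (2 * (((k + 1 : ℕ) : ℝ) + 1)))) :=
    Finset.measurable_sum _ fun c hc => Finset.measurable_prod _ fun j _ =>
      (hGm _ (Fintype.mem_piFinset.1 (Finset.mem_filter.1 hc).1 j)).pow_const _
  have hm2 : Measurable (fun z => ∑ γ ∈ Γ, G γ z ^ (p / 2)) :=
    Finset.measurable_sum _ fun γ hγ => (hGm γ hγ).pow_const _
  have hall := lintegral_mono (μ := (volume : Measure (V × ℝ))) hpt
  rw [hI, lintegral_add_right _ (hm3.const_mul _), lintegral_add_right _ (hm2.const_mul _), lintegral_const_mul _ hm3,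
    lintegral_const_mul _ hm2, lintegral_const_mul' _ _ (ENNReal.mul_ne_top h2p (ENNReal.mul_ne_top
      (ENNReal.rpow_ne_top_of_nonneg hp2.le (by simp)) hB't))] at hall
  have hww : κ * w2 = κ * w1 * (w1⁻¹ * w2) := by
    rw [mul_assoc, ← mul_assoc w1, ENNReal.mul_inv_cancel hw0 hw1t, one_mul]
  have hfin : κ * w1 * nrm p (fun z => ∑ γ ∈ Γ, Fγ γ z) ≤ κ * w1 * ((C1 * B' * Bβ + C1 * Bγ +
      (N * N * (N * N)) ^ (p / 2) * C2 * N ^ (k + 1 + 1) * D) * NN p S f) := by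
    refine hall.trans ?_
    calc _ ≤ 2 ^ p * ((11 : ℝ≥0∞) ^ (p / 2) * B') * (κ * w1 * (Bβ * NN p S f)) +
          2 ^ p * (C ^ (p / 2) * (κ * w2)) * (mass (V × ℝ) ^ (p / 2) * (Bγ * NN p S f)) +
          (N * N * (N * N)) ^ (p / 2) * (C ^ (p / 2) * (κ * w2)) * (N ^ (k + 1 + 1) * (D * NN p S f)) :=
          add_le_add (add_le_add (mul_le_mul_right hT1 _) (mul_le_mul_right hT2 _)) (mul_le_mul_right hT3 _)
      _ = κ * w1 * (((2 ^ p * (11 : ℝ≥0∞) ^ (p / 2)) * B' * Bβ + (2 ^ p * C2 * mass (V × ℝ) ^ (p / 2)) * Bγ +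
          (N * N * (N * N)) ^ (p / 2) * C2 * N ^ (k + 1 + 1) * D) * NN p S f) := by
          rw [hww, hC2]; ring
      _ ≤ _ := by
          have a1 : 2 ^ p * (11 : ℝ≥0∞) ^ (p / 2) ≤ C1 := le_add_of_nonneg_right zero_le
          have a2 : 2 ^ p * C2 * mass (V × ℝ) ^ (p / 2) ≤ C1 := le_add_of_nonneg_left zero_le
          refine mul_le_mul_right (mul_le_mul_left ?_ _) _
          refine add_le_add (add_le_add ?_ ?_) le_rfl
          · exact mul_le_mul_left (mul_le_mul_left a1 _) _
          · exact mul_le_mul_left a2 _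
  exact (ENNReal.mul_le_mul_iff_right (mul_ne_zero hκ0 hw0) (ENNReal.mul_ne_top hκt hw1t)).1 hfin

end bn
end Strz

open MeasureTheory Filter
open scoped ENNReal NNReal ComplexConjugate FourierTransform
set_option linter.unusedSectionVars false
set_option linter.unusedSimpArgs false
set_option linter.unusedVariables false
namespace Strz

section boot
variable {V : Type} [NormedAddCommGroup V] [InnerProductSpace ℝ V] [FiniteDimensional ℝ V]
  [MeasurableSpace V] [BorelSpace V]

theorem small_pow (C : ℝ≥0∞) (hC : C ≠ ⊤) (a : ℝ) (ha : 0 < a) : ∃ X : ℝ, ∀ K, X ≤ K → C * ENNReal.ofReal (K ^ (-a)) ≤ 1 / 4 := by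
  have h1 : Tendsto (fun K : ℝ => C * ENNReal.ofReal (K ^ (-a))) atTop (nhds (C * ENNReal.ofReal 0)) :=
    ENNReal.Tendsto.const_mul (ENNReal.tendsto_ofReal (tendsto_rpow_neg_atTop ha)) (Or.inr hC)
  rw [ENNReal.ofReal_zero, mul_zero] at h1
  have h2 := h1.eventually_le_const (u := 1 / 4) (by simp)
  exact eventually_atTop.1 h2

theorem EE_mono {p A η η' : ℝ} (h : EE V p A η) (hη : η ≤ η') : EE V p A η' := by
  obtain ⟨C, hC, h⟩ := h
  refine ⟨C, hC, fun δ h0 h1 => (h δ h0 h1).mono ?_⟩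
  refine mul_le_mul_right (ENNReal.ofReal_le_ofReal ?_) _
  exact Real.rpow_le_rpow_of_exponent_ge h0 h1 (by linarith)

theorem quarter (x : ℝ≥0∞) : 1 / 4 * x + 1 / 4 * x + 1 / 2 * x = x := by
  have : (1 / 4 + 1 / 4 + 1 / 2 : ℝ≥0∞) = 1 := by
    have h : (1 / 4 : ℝ≥0∞) = ENNReal.ofReal (1 / 4) := by
      rw [ENNReal.ofReal_div_of_pos (by norm_num)]; simp
    have h' : (1 / 2 : ℝ≥0∞) = ENNReal.ofReal (1 / 2) := by
      rw [ENNReal.ofReal_div_of_pos (by norm_num)]; simp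
    rw [h, h', ← ENNReal.ofReal_add (by norm_num) (by norm_num), ← ENNReal.ofReal_add (by norm_num) (by norm_num)]
    norm_num
  rw [← add_mul, ← add_mul, this, one_mul]

variable (V) in
theorem improve (k : ℕ) (hV : Module.finrank ℝ V = k + 1) (p : ℝ) (hp : 2 ≤ p)
    (hmp : ((k + 1 : ℕ) : ℝ) * p ≤ 2 * (((k + 1 : ℕ) : ℝ) + 2)) (A : ℝ) (hA : 2 ≤ A)
    (hlow : ∀ ε : ℝ, 0 < ε → EE (EuclideanSpace ℝ (Fin k)) p (4 * ((3 * A + 4) + ((3 * A + 4) + 2) ^ 2)) ε)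
    (η : ℝ) (hη : 0 < η) (hE : EE V p A η) (M : ℕ) (hM1 : 1 ≤ M) (hM : dm (V × ℝ) * (p / 2) ≤ η * M / 4) :
    EE V p A (η * (1 - (1 / 2) ^ M)) := by
  set η' := η * (1 - (1 / 2) ^ M) with hη'
  have hη'0 : 0 < η' := by
    have : (1 / 2 : ℝ) ^ M < 1 := pow_lt_one₀ (by norm_num) (by norm_num) (by omega)
    exact mul_pos hη (by linarith)
  obtain ⟨C1, hC1, hbn⟩ := broad_narrow V k hV p hp A hA
  obtain ⟨C', hC', hlow⟩ := hlow (η' / 2) (by positivity)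
  -- choose K0
  obtain ⟨X0, hX0⟩ := small_pow (C1 * C' * ENNReal.ofReal (2 ^ (3 * (η' / 2)))) (by finiteness) (η' / 2) (by positivity)
  set K0 := max X0 4 with hK0d
  have hK04 : 4 ≤ K0 := le_max_right _ _
  have hK0p : 0 < K0 := by linarith
  have hK0 : C1 * (C' * ENNReal.ofReal ((1 / K0 / 2) ^ (-(η' / 2)))) * ENNReal.ofReal ((K0 / 2) ^ (-η')) ≤ 1 / 4 := by
    refine le_trans (le_of_eq ?_) (hX0 K0 (le_max_left _ _))
    have e : (1 / K0 / 2) ^ (-(η' / 2)) * (K0 / 2) ^ (-η') = 2 ^ (3 * (η' / 2)) * K0 ^ (-(η' / 2)) := by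
      rw [Real.rpow_def_of_pos (by positivity), Real.rpow_def_of_pos (by positivity), Real.rpow_def_of_pos (by positivity),
        Real.rpow_def_of_pos (by positivity), ← Real.exp_add, ← Real.exp_add, Real.log_div (by positivity) (by norm_num),
        Real.log_div (by norm_num) (by positivity), Real.log_div (by positivity) (by norm_num), Real.log_one]
      congr 1; ring
    calc _ = C1 * C' * (ENNReal.ofReal ((1 / K0 / 2) ^ (-(η' / 2))) * ENNReal.ofReal ((K0 / 2) ^ (-η'))) := by ring
      _ = C1 * C' * (ENNReal.ofReal (2 ^ (3 * (η' / 2))) * ENNReal.ofReal (K0 ^ (-(η' / 2)))) := by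
        rw [← ENNReal.ofReal_mul (by positivity), e, ENNReal.ofReal_mul (by positivity)]
      _ = _ := by ring
  obtain ⟨Λ, hΛ, hLam⟩ := exists_Lam V (k + 1) hV (1 / K0) (by positivity)
  obtain ⟨K1, hK1, hmd⟩ := muldec V (k + 1) p A hp hmp hA Λ hΛ η hη hE M hM
  obtain ⟨X1, hX1⟩ := small_pow (C1 * ENNReal.ofReal (2 ^ η')) (by finiteness) η' hη'0
  set K := max X1 (max K1 (K0 ^ 2)) with hKd
  have hKK0 : K0 ^ 2 ≤ K := (le_max_right _ _).trans (le_max_right _ _)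
  have hKK1 : K1 ≤ K := (le_max_left _ _).trans (le_max_right _ _)
  have hK16 : 16 ≤ K := by nlinarith
  have hKp : 0 < K := by linarith
  have hKs : C1 * ENNReal.ofReal ((K / 2) ^ (-η')) ≤ 1 / 4 := by
    refine le_trans (le_of_eq ?_) (hX1 K (le_max_left _ _))
    rw [mul_assoc, ← ENNReal.ofReal_mul (by positivity), Real.div_rpow (by positivity) (by norm_num), Real.rpow_neg (by norm_num : (0:ℝ) ≤ 2)]
    congr 2
    field_simp
  obtain ⟨CM, hCM, hmd⟩ := hmd K hKK1
  obtain ⟨CK, hCK, hbn⟩ := hbn K0 K (by linarith) hKK0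
  obtain ⟨CE, hCE, hEE⟩ := hE
  set Cf : ℝ≥0∞ := CE * ENNReal.ofReal ((1 / (2 * K)) ^ (-η)) + 2 * (CK * CM) with hCf
  have hCft : Cf ≠ ⊤ := by finiteness
  refine ⟨Cf, hCft, ?_⟩
  have base : ∀ δ : ℝ, 0 < δ → δ ≤ 1 → 1 / (2 * K) < δ → DecB V p A δ (Cf * ENNReal.ofReal (δ ^ (-η'))) := by
    intro δ h0 h1 h2
    refine (hEE δ h0 h1).mono ?_
    calc CE * ENNReal.ofReal (δ ^ (-η)) ≤ CE * ENNReal.ofReal ((1 / (2 * K)) ^ (-η)) := by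
          refine mul_le_mul_right (ENNReal.ofReal_le_ofReal ?_) _
          exact Real.rpow_le_rpow_of_nonpos (by positivity) h2.le (by linarith)
      _ ≤ Cf := le_add_of_nonneg_right zero_le
      _ = Cf * 1 := (mul_one _).symm
      _ ≤ _ := by
        refine mul_le_mul_right ?_ _
        rw [ENNReal.one_le_ofReal]
        exact Real.one_le_rpow_of_pos_of_le_one_of_nonpos h0 h1 (by linarith)
  have main : ∀ n : ℕ, ∀ δ : ℝ, 0 < δ → δ ≤ 1 → (1 / 2 : ℝ) ^ n ≤ δ → DecB V p A δ (Cf * ENNReal.ofReal (δ ^ (-η'))) := by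
    intro n
    induction n with
    | zero =>
      intro δ h0 h1 h2
      refine base δ h0 h1 (lt_of_lt_of_le ?_ h2)
      rw [pow_zero, div_lt_one (by positivity)]; linarith
    | succ n ih =>
      intro δ h0 h1 h2
      by_cases h3 : 1 / (2 * K) < δ
      · exact base δ h0 h1 h3
      rw [not_lt] at h3
      have h2K : 2 * δ ≤ 1 / K := by
        have : 1 / K = 2 * (1 / (2 * K)) := by field_simp
        rw [this]; linarith
      have hδK : δ * K ≤ 1 / 2 := by
        have := mul_le_mul_of_nonneg_right h3 hKp.le
        have e : 1 / (2 * K) * K = 1 / 2 := by field_simp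
        linarith
      have step : ∀ Q : ℝ, 4 ≤ Q → Q ≤ K → DecB V p A (δ / (2 * (1 / Q)))
          (ENNReal.ofReal ((Q / 2) ^ (-η')) * (Cf * ENNReal.ofReal (δ ^ (-η')))) := by
        intro Q hQ hQK
        have e : δ / (2 * (1 / Q)) = δ * (Q / 2) := by field_simp
        rw [e]
        refine (ih (δ * (Q / 2)) (by positivity) ?_ ?_).mono (le_of_eq ?_)
        · nlinarith
        · rw [pow_succ] at h2; nlinarith
        · rw [Real.mul_rpow h0.le (by positivity), ENNReal.ofReal_mul (by positivity)]; ring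
      have hB' := hlow (1 / K0 / 2) (by positivity) (by
        rw [div_div, div_le_one (by positivity)]; linarith)
      have hr := hbn δ _ _ _ (CM * ENNReal.ofReal (δ ^ (-η'))) h0 h2K (by finiteness) hB' (step K0 hK04 (by nlinarith)) (step K (by linarith) le_rfl)
        (by
          intro c S f hc hD hnear hfam
          exact hmd δ c S (fun _ => f) h0 h1 ⟨hc, hLam c hc hD, hnear⟩ hfam)
      refine hr.mono ?_
      set x := Cf * ENNReal.ofReal (δ ^ (-η')) with hx
      have hx2 : CK * (CM * ENNReal.ofReal (δ ^ (-η'))) ≤ 1 / 2 * x := by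
        rw [hx, ← mul_assoc, ← mul_assoc]
        refine mul_le_mul_left ?_ _
        calc CK * CM = 1 / 2 * (2 * (CK * CM)) := by
              rw [← mul_assoc, one_div, ENNReal.inv_mul_cancel (by norm_num) (by norm_num), one_mul]
          _ ≤ _ := mul_le_mul_right (le_add_of_nonneg_left zero_le) _
      calc _ ≤ 1 / 4 * x + 1 / 4 * x + 1 / 2 * x := by
            refine add_le_add (add_le_add ?_ ?_) hx2
            · rw [← mul_assoc]; exact mul_le_mul_left hK0 _
            · rw [← mul_assoc]; exact mul_le_mul_left hKs _
        _ = x := quarter x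
  intro δ h0 h1
  obtain ⟨n, hn⟩ := exists_pow_lt_of_lt_one h0 (by norm_num : (1 / 2 : ℝ) < 1)
  exact main n δ h0 h1 hn.le

variable (V) in
theorem iter (k : ℕ) (hV : Module.finrank ℝ V = k + 1) (p : ℝ) (hp : 2 ≤ p)
    (hmp : ((k + 1 : ℕ) : ℝ) * p ≤ 2 * (((k + 1 : ℕ) : ℝ) + 2)) (A : ℝ) (hA : 2 ≤ A)
    (hlow : ∀ ε : ℝ, 0 < ε → EE (EuclideanSpace ℝ (Fin k)) p (4 * ((3 * A + 4) + ((3 * A + 4) + 2) ^ 2)) ε)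
    (ε : ℝ) (hε : 0 < ε) : EE V p A ε := by
  obtain ⟨M, hM⟩ := exists_nat_ge (max 1 (dm (V × ℝ) * (p / 2) * 4 / ε))
  have hM1 : 1 ≤ M := by exact_mod_cast (le_max_left _ _).trans hM
  have hM2 : dm (V × ℝ) * (p / 2) * 4 ≤ M * ε := (div_le_iff₀ hε).1 ((le_max_right _ _).trans hM)
  set θ : ℝ := 1 - (1 / 2) ^ M with hθ
  have hθ0 : 0 ≤ θ := by
    have : (1 / 2 : ℝ) ^ M ≤ 1 := pow_le_one₀ (by norm_num) (by norm_num)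
    linarith
  have hθ1 : θ < 1 := by
    have : 0 < (1 / 2 : ℝ) ^ M := by positivity
    linarith
  set η0 : ℝ := Module.finrank ℝ V * (p / 2) with hη0
  have hη00 : 0 ≤ η0 := by positivity
  have main : ∀ j : ℕ, EE V p A (max ε (η0 * θ ^ j)) := by
    intro j
    induction j with
    | zero =>
      refine EE_mono (η := η0) ⟨_, ENNReal.ofReal_ne_top, fun δ h0 h1 => triv_dec hp h0 h1⟩ ?_
      simp
    | succ j ih =>
      have hb : ε ≤ max ε (η0 * θ ^ j) := le_max_left _ _
      refine EE_mono (improve V k hV p hp hmp A hA hlow _ (by linarith) ih M hM1 ?_) ?_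
      · have : (0 : ℝ) ≤ M := by positivity
        nlinarith
      · rw [← hθ, max_mul_of_nonneg _ _ hθ0]
        refine max_le_max ?_ ?_
        · nlinarith
        · rw [pow_succ, mul_assoc]
  have ht : Tendsto (fun j : ℕ => η0 * θ ^ j) atTop (nhds (η0 * 0)) :=
    (tendsto_pow_atTop_nhds_zero_of_lt_one hθ0 hθ1).const_mul _
  rw [mul_zero] at ht
  obtain ⟨j, hj⟩ := (ht.eventually_le_const hε).exists
  have := main j
  rwa [max_eq_left hj] at this

theorem decoupling (d : ℕ) : ∀ (V : Type) [NormedAddCommGroup V] [InnerProductSpace ℝ V] [FiniteDimensional ℝ V]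
    [MeasurableSpace V] [BorelSpace V], Module.finrank ℝ V = d → ∀ p : ℝ, 2 ≤ p → (d : ℝ) * p ≤ 2 * ((d : ℝ) + 2) →
    ∀ A : ℝ, 2 ≤ A → ∀ ε : ℝ, 0 < ε → EE V p A ε := by
  induction d with
  | zero =>
    intro V _ _ _ _ _ hV p hp _ A hA ε hε
    refine EE_mono (η := Module.finrank ℝ V * (p / 2)) ⟨_, ENNReal.ofReal_ne_top, fun δ h0 h1 => triv_dec hp h0 h1⟩ ?_
    rw [hV]; simp; exact hε.le
  | succ k ih =>
    intro V _ _ _ _ _ hV p hp hmp A hA ε hε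
    refine iter V k hV p hp hmp A hA (fun ε' hε' => ?_) ε hε
    refine ih (EuclideanSpace ℝ (Fin k)) (by simp) p hp ?_ _ (by nlinarith) ε' hε'
    push_cast at hmp
    nlinarith

end boot
end Strz

open MeasureTheory Filter
open scoped ENNReal NNReal ComplexConjugate FourierTransform
set_option linter.unusedSectionVars false
set_option linter.unusedSimpArgs false
set_option linter.unusedVariables false
namespace Strz

section fin1
variable {V : Type} [NormedAddCommGroup V] [InnerProductSpace ℝ V] [FiniteDimensional ℝ V]
  [MeasurableSpace V] [BorelSpace V]

theorem sq_int {E : Type} [NormedAddCommGroup E] [InnerProductSpace ℝ E] [FiniteDimensional ℝ E]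
    [MeasurableSpace E] [BorelSpace E] {ψ : E → ℂ} (h : Continuous ψ)
    (hd : ∀ k : ℕ, ∃ C : ℝ, 0 ≤ C ∧ ∀ x, ‖ψ x‖ ≤ C * ((1 + ‖x‖) ^ k)⁻¹) :
    Integrable (fun x => ψ x * conj (ψ x)) := by
  refine decay_integrable (by have := h.measurable; fun_prop) ?_
  intro k
  obtain ⟨C, hC, h1⟩ := hd k
  obtain ⟨C', hC', h2⟩ := hd 0
  refine ⟨C * C', by positivity, fun x => ?_⟩
  rw [norm_mul, RCLike.norm_conj]
  have e2 := h2 x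
  simp only [pow_zero, inv_one, mul_one] at e2
  calc ‖ψ x‖ * ‖ψ x‖ ≤ (C * ((1 + ‖x‖) ^ k)⁻¹) * C' := mul_le_mul (h1 x) e2 (norm_nonneg _) (by positivity)
    _ = _ := by ring

variable (V) in
theorem win2 : ∃ (ψ : V → ℂ) (ψ' : ℝ → ℂ) (c B : ℝ), 0 < c ∧ 0 ≤ B ∧ Continuous ψ ∧ Continuous ψ' ∧
    (∀ x, ‖x‖ ≤ 1 → c ≤ ‖ψ x‖) ∧ (∀ t, ‖t‖ ≤ 1 → c ≤ ‖ψ' t‖) ∧ (∀ x, ‖ψ x‖ ≤ B) ∧ (∀ t, ‖ψ' t‖ ≤ B) ∧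
    Integrable (fun x => ψ x * conj (ψ x)) ∧ Integrable (fun x => ψ' x * conj (ψ' x)) ∧
    (∀ ξ, 2 ≤ ‖ξ‖ → ∫ x, ψ x * conj (ψ x) * Complex.exp (-(Complex.I * (inner ℝ ξ x : ℝ))) = 0) ∧
    Spec {ζ : V × ℝ | ‖ζ.1‖ ≤ 1 ∧ |ζ.2| ≤ 1} (fun y => ψ y.1 * ψ' y.2) := by
  obtain ⟨χ, ψ, a1, a2, a3, a4, a5, a6, ⟨c, hc, a7⟩, a8⟩ := sch_psi (E := V)
  obtain ⟨χ', ψ', b1, b2, b3, b4, b5, b6, ⟨c', hc', b7⟩, _⟩ := sch_psi (E := ℝ)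
  obtain ⟨C1, hC1, h1⟩ := a6 0
  obtain ⟨C2, hC2, h2⟩ := b6 0
  simp only [pow_zero, inv_one, mul_one] at h1 h2
  refine ⟨ψ, ψ', min c c', max C1 C2, lt_min hc hc', hC1.trans (le_max_left _ _), a4, b4,
    fun x hx => (min_le_left _ _).trans (a7 x hx), fun x hx => (min_le_right _ _).trans (b7 x hx),
    fun x => (h1 x).trans (le_max_left _ _), fun x => (h2 x).trans (le_max_right _ _), sq_int a4 a6, sq_int b4 b6, a8, ?_⟩
  refine ⟨V × ℝ, inferInstance, volume, inferInstance, fun q => (q.1, - q.2), fun q => χ q.1 * χ' q.2,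
      by fun_prop, by fun_prop, a2.mul_prod b2, ?_, ?_⟩
  · intro q hq
    exact ⟨a3 _ (left_ne_zero_of_mul hq), by simpa using b3 _ (right_ne_zero_of_mul hq)⟩
  · intro z
    dsimp only
    rw [a5, b5]
    unfold ift
    rw [← integral_prod_mul]
    refine integral_congr_ae (Eventually.of_forall fun q => ?_)
    dsimp only
    unfold ec ph
    have : Complex.exp (Complex.I * ((inner ℝ q.1 z.1 - (-q.2) * z.2 : ℝ) : ℂ)) =
      Complex.exp (Complex.I * (inner ℝ q.1 z.1 : ℝ)) * Complex.exp (Complex.I * (inner ℝ q.2 z.2 : ℝ)) := by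
      rw [← Complex.exp_add]
      congr 1
      simp only [RCLike.inner_apply, conj_trivial]
      push_cast
      ring
    simp only [this]
    ring

theorem enorm_sq_lint {E : Type*} [MeasurableSpace E] {μ : Measure E} {g : E → ℂ}
    (hi : Integrable (fun x => g x * conj (g x)) μ) :
    ∫⁻ x, ‖g x‖ₑ ^ (2 : ℝ) ∂μ = ENNReal.ofReal (∫ x, g x * conj (g x) ∂μ).re := by
  have e : ∀ x, g x * conj (g x) = ((‖g x‖ ^ 2 : ℝ) : ℂ) := by
    intro x; rw [Complex.mul_conj, Complex.normSq_eq_norm_sq]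
  have h1 : ∫ x, g x * conj (g x) ∂μ = ((∫ x, ‖g x‖ ^ 2 ∂μ : ℝ) : ℂ) := by
    simp only [e]; exact integral_ofReal
  have h2 : Integrable (fun x => ‖g x‖ ^ 2) μ := by
    have := hi.re
    simp only [e] at this
    simpa [← Complex.ofReal_pow] using this
  rw [h1, Complex.ofReal_re, ofReal_integral_eq_lintegral_ofReal h2 (Eventually.of_forall fun x => by positivity)]
  refine lintegral_congr fun x => ?_
  rw [← ofReal_norm, ENNReal.ofReal_rpow_of_nonneg (norm_nonneg _) (by norm_num)]
  norm_num

/-- exact orthogonality -/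
theorem orth {ι : Type*} (S : Finset ι) (θ : ι → V) (b : ι → ℂ) (ψ : V → ℂ) (hψ : Continuous ψ)
    (hi : Integrable (fun x => ψ x * conj (ψ x)))
    (h0 : ∀ ξ, 2 ≤ ‖ξ‖ → ∫ x, ψ x * conj (ψ x) * Complex.exp (-(Complex.I * (inner ℝ ξ x : ℝ))) = 0)
    (hsep : ∀ n ∈ S, ∀ n' ∈ S, n ≠ n' → 2 ≤ ‖θ n - θ n'‖) :
    ∫⁻ x, ‖(∑ n ∈ S, b n * Complex.exp (Complex.I * (inner ℝ (θ n) x : ℝ))) * ψ x‖ₑ ^ (2 : ℝ) =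
      (∑ n ∈ S, ‖b n‖ₑ ^ (2 : ℝ)) * ∫⁻ x, ‖ψ x‖ₑ ^ (2 : ℝ) := by
  have hexp : ∀ x, ((∑ n ∈ S, b n * Complex.exp (Complex.I * (inner ℝ (θ n) x : ℝ))) * ψ x) *
      conj ((∑ n ∈ S, b n * Complex.exp (Complex.I * (inner ℝ (θ n) x : ℝ))) * ψ x) =
      ∑ n ∈ S, ∑ n' ∈ S, (b n * conj (b n')) * (ψ x * conj (ψ x) * Complex.exp (-(Complex.I * (inner ℝ (θ n' - θ n) x : ℝ)))) := by
    intro x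
    rw [map_mul, map_sum, mul_mul_mul_comm, Finset.sum_mul_sum, Finset.sum_mul]
    refine Finset.sum_congr rfl fun n _ => ?_
    rw [Finset.sum_mul]
    refine Finset.sum_congr rfl fun n' _ => ?_
    rw [map_mul, ← Complex.exp_conj, inner_sub_left]
    have : Complex.exp (-(Complex.I * ((inner ℝ (θ n') x - inner ℝ (θ n) x : ℝ) : ℂ))) =
      Complex.exp (Complex.I * (inner ℝ (θ n) x : ℝ)) * Complex.exp (conj (Complex.I * (inner ℝ (θ n') x : ℝ))) := by
      rw [← Complex.exp_add, map_mul, Complex.conj_I, Complex.conj_ofReal]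
      congr 1; push_cast; ring
    rw [this]; ring
  have hI : ∀ ξ : V, Integrable (fun x => ψ x * conj (ψ x) * Complex.exp (-(Complex.I * (inner ℝ ξ x : ℝ)))) := by
    intro ξ
    have hc : Continuous fun x : V => Complex.exp (-(Complex.I * (inner ℝ ξ x : ℝ))) := by fun_prop
    refine hi.mul_bdd (c := 1) hc.aestronglyMeasurable ?_
    refine Eventually.of_forall fun x => ?_
    rw [Complex.norm_exp]; simp
  have hI2 : Integrable (fun x => ((∑ n ∈ S, b n * Complex.exp (Complex.I * (inner ℝ (θ n) x : ℝ))) * ψ x) *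
      conj ((∑ n ∈ S, b n * Complex.exp (Complex.I * (inner ℝ (θ n) x : ℝ))) * ψ x)) := by
    simp only [hexp]
    exact integrable_finsetSum _ fun n _ => integrable_finsetSum _ fun n' _ => (hI _).const_mul _
  rw [enorm_sq_lint hI2, enorm_sq_lint hi]
  simp only [hexp]
  rw [integral_finsetSum _ fun n _ => integrable_finsetSum _ fun n' _ => (hI _).const_mul _]
  have e : ∀ n ∈ S, ∫ x, ∑ n' ∈ S, (b n * conj (b n')) * (ψ x * conj (ψ x) * Complex.exp (-(Complex.I * (inner ℝ (θ n' - θ n) x : ℝ)))) =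
      ((‖b n‖ ^ 2 : ℝ) : ℂ) * ∫ x, ψ x * conj (ψ x) := by
    intro n hn
    rw [integral_finsetSum _ fun n' _ => (hI _).const_mul _, Finset.sum_eq_single n]
    · rw [integral_const_mul, Complex.mul_conj, Complex.normSq_eq_norm_sq]
      simp
    · intro n' hn' hne
      rw [integral_const_mul, h0 _ (hsep n' hn' n hn hne), mul_zero]
    · intro h; exact absurd hn h
  rw [Finset.sum_congr rfl e, ← Finset.sum_mul, ← Complex.ofReal_sum, Complex.re_ofReal_mul,
    ENNReal.ofReal_mul (by positivity), ENNReal.ofReal_sum_of_nonneg (fun _ _ => by positivity)]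
  congr 1
  refine Finset.sum_congr rfl fun n _ => ?_
  rw [← ofReal_norm, ENNReal.ofReal_rpow_of_nonneg (norm_nonneg _) (by norm_num)]
  norm_num

end fin1
end Strz

open MeasureTheory Filter
open scoped ENNReal NNReal ComplexConjugate FourierTransform
set_option linter.unusedSectionVars false
set_option linter.unusedSimpArgs false
set_option linter.unusedVariables false
namespace Strz

section fin2
variable {V : Type} [NormedAddCommGroup V] [InnerProductSpace ℝ V] [FiniteDimensional ℝ V]
  [MeasurableSpace V] [BorelSpace V]

/-- exponential sum along the paraboloid -/
noncomputable def es (S : Finset V) (a : V → ℂ) (z : V × ℝ) : ℂ := ∑ ξ ∈ S, a ξ * ec (ξ, ‖ξ‖ ^ 2) z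

theorem meas_es (S : Finset V) (a : V → ℂ) : Measurable (es S a) := by
  unfold es
  exact Finset.measurable_sum _ fun ξ _ => (meas_ec measurable_const measurable_id).const_mul _

theorem enorm_ec (ζ z : V × ℝ) : ‖ec ζ z‖ₑ = 1 := by
  rw [← ofReal_norm, norm_ec]; simp

theorem es_sq (S : Finset V) (a : V → ℂ) (z : V × ℝ) :
    ‖es S a z‖ₑ ^ (2 : ℝ) ≤ S.card * ∑ ξ ∈ S, ‖a ξ‖ₑ ^ (2 : ℝ) := by
  refine (esq_sum_le S _).trans (le_of_eq ?_)
  simp only [enorm_mul, enorm_ec, mul_one]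

theorem cell_l2 (S : Finset V) (a : V → ℂ) (ψ : V → ℂ) (ψ' : ℝ → ℂ) (hψ : Continuous ψ) (hψ' : Continuous ψ')
    (hi : Integrable (fun x => ψ x * conj (ψ x)))
    (h0 : ∀ ξ, 2 ≤ ‖ξ‖ → ∫ x, ψ x * conj (ψ x) * Complex.exp (-(Complex.I * (inner ℝ ξ x : ℝ))) = 0)
    (R δ : ℝ) (hR : 0 < R) (hδ : 0 < δ) (hsep : ∀ ξ ∈ S, ∀ ξ' ∈ S, ξ ≠ ξ' → 2 ≤ R * ‖ξ - ξ'‖) :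
    ∫⁻ z : V × ℝ, ‖es S a z * (ψ ((1 / R) • z.1) * ψ' (δ ^ 2 * z.2))‖ₑ ^ (2 : ℝ) =
      ((∑ ξ ∈ S, ‖a ξ‖ₑ ^ (2 : ℝ)) * ∫⁻ x, ‖ψ x‖ₑ ^ (2 : ℝ)) * ENNReal.ofReal (R ^ Module.finrank ℝ V) *
        (ENNReal.ofReal (1 / δ ^ 2) * ∫⁻ x, ‖ψ' x‖ₑ ^ (2 : ℝ)) := by
  have hm : Measurable (fun z : V × ℝ => ‖es S a z * (ψ ((1 / R) • z.1) * ψ' (δ ^ 2 * z.2))‖ₑ ^ (2 : ℝ)) := by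
    have := hψ.measurable; have := hψ'.measurable; have := meas_es S a; fun_prop
  rw [Measure.volume_eq_prod, lintegral_prod_symm _ hm.aemeasurable]
  set G : ℝ → V → ℂ := fun s y => ∑ ξ ∈ S, (a ξ * Complex.exp (-(Complex.I * ((‖ξ‖ ^ 2 * s : ℝ) : ℂ)))) * Complex.exp (Complex.I * (inner ℝ (R • ξ) y : ℝ)) with hG
  have key : ∀ (s : ℝ) (x : V), es S a (x, s) = G s ((1 / R) • x) := by
    intro s x
    rw [hG]
    unfold es
    refine Finset.sum_congr rfl fun ξ _ => ?_
    unfold ec ph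
    rw [mul_assoc, ← Complex.exp_add, inner_smul_left, inner_smul_right]
    have : (conj R) * (1 / R * inner ℝ ξ x) = inner ℝ ξ x := by
      simp only [conj_trivial]; field_simp
    rw [this]
    congr 2
    push_cast; ring
  have inner_eq : ∀ s : ℝ, ∫⁻ x : V, ‖es S a (x, s) * (ψ ((1 / R) • x) * ψ' (δ ^ 2 * s))‖ₑ ^ (2 : ℝ) =
      ((∑ ξ ∈ S, ‖a ξ‖ₑ ^ (2 : ℝ)) * ∫⁻ x, ‖ψ x‖ₑ ^ (2 : ℝ)) * ENNReal.ofReal (R ^ Module.finrank ℝ V) * ‖ψ' (δ ^ 2 * s)‖ₑ ^ (2 : ℝ) := by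
    intro s
    have e : ∀ x : V, ‖es S a (x, s) * (ψ ((1 / R) • x) * ψ' (δ ^ 2 * s))‖ₑ ^ (2 : ℝ) =
        (fun y : V => ‖G s y * ψ y‖ₑ ^ (2 : ℝ)) ((1 / R) • x) * ‖ψ' (δ ^ 2 * s)‖ₑ ^ (2 : ℝ) := by
      intro x
      dsimp only
      rw [← mul_assoc, enorm_mul, ENNReal.mul_rpow_of_nonneg _ _ (by norm_num), key]
    have ho := orth S (fun ξ => R • ξ) (fun ξ => a ξ * Complex.exp (-(Complex.I * ((‖ξ‖ ^ 2 * s : ℝ) : ℂ)))) ψ hψ hi h0 (by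
      intro n hn n' hn' hne
      rw [← smul_sub, norm_smul, Real.norm_eq_abs, abs_of_pos hR]
      exact hsep n hn n' hn' hne)
    have e2 : ∀ ξ : V, ‖a ξ * Complex.exp (-(Complex.I * ((‖ξ‖ ^ 2 * s : ℝ) : ℂ)))‖ₑ = ‖a ξ‖ₑ := by
      intro ξ
      have : ‖Complex.exp (-(Complex.I * ((‖ξ‖ ^ 2 * s : ℝ) : ℂ)))‖ₑ = 1 := by
        rw [← ofReal_norm, Complex.norm_exp, ← mul_neg, ← Complex.ofReal_neg, Complex.I_mul_re, Complex.ofReal_im]; simp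
      rw [enorm_mul, this, mul_one]
    simp only [e2] at ho
    have e1 : |((1 / R) ^ Module.finrank ℝ V)⁻¹| = R ^ Module.finrank ℝ V := by
      rw [abs_of_pos (by positivity)]; simp
    rw [lintegral_congr e, lintegral_mul_const' _ _ (ENNReal.rpow_ne_top_of_nonneg (by norm_num) enorm_ne_top),
      lint_smul (fun y : V => ‖G s y * ψ y‖ₑ ^ (2 : ℝ)) (r := 1 / R) (by positivity), e1]
    have ho' : ∫⁻ x, ‖G s x * ψ x‖ₑ ^ (2 : ℝ) = (∑ ξ ∈ S, ‖a ξ‖ₑ ^ (2 : ℝ)) * ∫⁻ x, ‖ψ x‖ₑ ^ (2 : ℝ) := ho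
    rw [ho']
    ring
  rw [lintegral_congr inner_eq, lintegral_const_mul _ (by have := hψ'.measurable; fun_prop)]
  congr 1
  have := lint_smul (E := ℝ) (fun s => ‖ψ' s‖ₑ ^ (2 : ℝ)) (r := δ ^ 2) (by positivity)
  simp only [smul_eq_mul, Module.finrank_self, pow_one] at this
  rw [this, abs_of_pos (by positivity), one_div]

theorem cell_q (S : Finset V) (a : V → ℂ) (W : V × ℝ → ℂ) (B : ℝ) (hB : 0 ≤ B) (hW : ∀ z, ‖W z‖ ≤ B) {q : ℝ} (hq : 2 ≤ q)
    (m : ℝ≥0∞) (hmt : m ≠ ⊤) (hm : (S.card : ℝ≥0∞) ≤ m) :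
    nrm q (fun z => es S a z * W z) ≤ (m * (∑ ξ ∈ S, ‖a ξ‖ₑ ^ (2 : ℝ)) * ENNReal.ofReal (B ^ 2)) ^ ((q - 2) / 2) *
      ∫⁻ z, ‖es S a z * W z‖ₑ ^ (2 : ℝ) := by
  have hA : (m * (∑ ξ ∈ S, ‖a ξ‖ₑ ^ (2 : ℝ)) * ENNReal.ofReal (B ^ 2)) ^ ((q - 2) / 2) ≠ ⊤ := by
    refine ENNReal.rpow_ne_top_of_nonneg (by linarith) (ENNReal.mul_ne_top (ENNReal.mul_ne_top hmt ?_) ENNReal.ofReal_ne_top)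
    exact (ENNReal.sum_lt_top.2 fun ξ _ => (ENNReal.rpow_ne_top_of_nonneg (by norm_num) enorm_ne_top).lt_top).ne
  unfold nrm
  rw [← lintegral_const_mul' _ _ hA]
  refine lintegral_mono fun z => ?_
  have e : ‖es S a z * W z‖ₑ ^ q = (‖es S a z * W z‖ₑ ^ (2 : ℝ)) ^ ((q - 2) / 2) * ‖es S a z * W z‖ₑ ^ (2 : ℝ) := by
    rw [← ENNReal.rpow_mul, ← ENNReal.rpow_add_of_nonneg _ _ (by nlinarith) (by norm_num)]
    congr 1; ring
  dsimp only
  rw [e]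
  refine mul_le_mul_left (ENNReal.rpow_le_rpow ?_ (by linarith)) _
  rw [enorm_mul, ENNReal.mul_rpow_of_nonneg _ _ (by norm_num)]
  refine mul_le_mul' ((es_sq S a z).trans (mul_le_mul_left hm _)) ?_
  rw [← ofReal_norm, ENNReal.ofReal_rpow_of_nonneg (norm_nonneg _) (by norm_num)]
  refine ENNReal.ofReal_le_ofReal ?_
  have := hW z
  have := norm_nonneg (W z)
  norm_num
  gcongr

end fin2
end Strz

open MeasureTheory Filter
open scoped ENNReal NNReal ComplexConjugate FourierTransform
set_option linter.unusedSectionVars false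
set_option linter.unusedSimpArgs false
set_option linter.unusedVariables false
namespace Strz

section fin3
variable {V : Type} [NormedAddCommGroup V] [InnerProductSpace ℝ V] [FiniteDimensional ℝ V]
  [MeasurableSpace V] [BorelSpace V]

theorem exists_sep (S : Finset V) : ∃ R0 : ℝ, 0 ≤ R0 ∧ ∀ ξ ∈ S, ∀ ξ' ∈ S, ξ ≠ ξ' → 2 ≤ R0 * ‖ξ - ξ'‖ := by
  refine ⟨∑ ξ ∈ S, ∑ ξ' ∈ S, 2 / ‖ξ - ξ'‖, by positivity, fun ξ hξ ξ' hξ' hne => ?_⟩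
  have h0 : 0 < ‖ξ - ξ'‖ := norm_pos_iff.2 (sub_ne_zero.2 hne)
  rw [← div_le_iff₀ h0]
  have h1 : 2 / ‖ξ - ξ'‖ ≤ ∑ ξ' ∈ S, 2 / ‖ξ - ξ'‖ :=
    Finset.single_le_sum (f := fun ξ' => 2 / ‖ξ - ξ'‖) (fun i _ => by positivity) hξ'
  have h2 : ∑ ξ' ∈ S, 2 / ‖ξ - ξ'‖ ≤ ∑ ξ ∈ S, ∑ ξ' ∈ S, 2 / ‖ξ - ξ'‖ :=
    Finset.single_le_sum (f := fun ξ => ∑ ξ' ∈ S, 2 / ‖ξ - ξ'‖) (fun i _ => by positivity) hξ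
  exact h1.trans h2

theorem spec_win {w : V × ℝ → ℂ} (hw : Spec {ζ : V × ℝ | ‖ζ.1‖ ≤ 1 ∧ |ζ.2| ≤ 1} w) {r s : ℝ} (hr : 0 < r) (hs : 0 < s) :
    Spec {ζ : V × ℝ | ‖ζ.1‖ ≤ r ∧ |ζ.2| ≤ s} (fun y => w (r • y.1, s * y.2)) := by
  refine hw.comp (fun y => (r • y.1, s * y.2)) (fun ζ => (r • ζ.1, s * ζ.2)) (fun _ => 0) (by fun_prop) measurable_const ?_ ?_
  · intro ζ z
    unfold ph
    simp only [inner_smul_left, inner_smul_right, conj_trivial]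
    ring
  · rintro ζ ⟨h1, h2⟩
    refine ⟨?_, ?_⟩
    · simp only [norm_smul, Real.norm_eq_abs, abs_of_pos hr]; nlinarith
    · simp only [abs_mul, abs_of_pos hs]; nlinarith

theorem spec_piece {W : V × ℝ → ℂ} {δ : ℝ} (hδ : 0 < δ) (hδ1 : δ ≤ 1)
    (hW : Spec {ζ : V × ℝ | ‖ζ.1‖ ≤ δ ^ 2 ∧ |ζ.2| ≤ δ ^ 2} W) (S : Finset V) (a : V → ℂ) (c : V)
    (hS : ∀ ξ ∈ S, ‖ξ‖ ≤ 1 ∧ ‖ξ - c‖ ≤ δ) : Spec (Box 4 δ c) (fun z => es S a z * W z) := by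
  have e : (fun z => es S a z * W z) = fun z => ∑ ξ ∈ S, (a ξ * ec (ξ, ‖ξ‖ ^ 2) z) * W z := by
    ext z; unfold es; rw [Finset.sum_mul]
  rw [e]
  refine Spec.sum S fun ξ hξ => ?_
  refine (Spec.atom (Ω := {(ξ, ‖ξ‖ ^ 2)}) (ξ, ‖ξ‖ ^ 2) rfl (a ξ)).mul hW ?_
  rintro ζ rfl ζ' ⟨h3, h4⟩
  obtain ⟨h1, h2⟩ := hS ξ hξ
  have hs2 : δ ^ 2 ≤ δ := by nlinarith
  refine ⟨?_, ?_⟩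
  · calc ‖((ξ, ‖ξ‖ ^ 2) + ζ').1 - c‖ = ‖(ξ - c) + ζ'.1‖ := by simp only [Prod.fst_add]; abel_nf
      _ ≤ δ + δ ^ 2 := (norm_add_le _ _).trans (add_le_add h2 h3)
      _ ≤ _ := by nlinarith
  · have e : ((ξ, ‖ξ‖ ^ 2) + ζ').2 - ‖((ξ, ‖ξ‖ ^ 2) + ζ').1‖ ^ 2 = ζ'.2 - 2 * inner ℝ ξ ζ'.1 - ‖ζ'.1‖ ^ 2 := by
      simp only [Prod.fst_add, Prod.snd_add, norm_add_sq_real]; ring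
    have hi : |inner ℝ ξ ζ'.1| ≤ 1 * δ ^ 2 :=
      (abs_real_inner_le_norm _ _).trans (mul_le_mul h1 h3 (norm_nonneg _) (by positivity))
    have hq : ‖ζ'.1‖ ^ 2 ≤ δ ^ 2 := by
      have := norm_nonneg ζ'.1
      nlinarith
    rw [e]
    rw [abs_le] at h4 hi ⊢
    constructor <;> nlinarith [sq_nonneg ‖ζ'.1‖, sq_nonneg δ]

open Classical in
variable (V) in
theorem scaled (d : ℕ) (hV : Module.finrank ℝ V = d) (q : ℝ) (hq : 2 ≤ q) (hdq : (d : ℝ) * q ≤ 2 * ((d : ℝ) + 2))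
    (ε : ℝ) (hε : 0 < ε) : ∃ C : ℝ≥0∞, C ≠ ⊤ ∧ ∀ δ : ℝ, 0 < δ → δ ≤ 1 → ∀ S : Finset V, (∀ ξ ∈ S, ‖ξ‖ ≤ 1) →
      ∀ m : ℝ≥0∞, m ≠ ⊤ → (∀ c : V, ((S.filter fun ξ => ‖ξ - c‖ ≤ δ).card : ℝ≥0∞) ≤ m) → ∀ a : V → ℂ,
      ∃ R0 : ℝ, 0 < R0 ∧ ∀ R, R0 ≤ R →
        ∫⁻ z in Metric.closedBall (0 : V) R ×ˢ Set.Icc (0 : ℝ) (1 / δ ^ 2), ‖es S a z‖ₑ ^ q ≤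
          C * ENNReal.ofReal (δ ^ (-ε)) * (m ^ ((q - 2) / 2) * ENNReal.ofReal (R ^ d) * ENNReal.ofReal (1 / δ ^ 2) *
            (∑ ξ ∈ S, ‖a ξ‖ₑ ^ (2 : ℝ)) ^ (q / 2)) := by
  obtain ⟨ψ, ψ', c, B, hc, hB, w1, w2, w3, w4, w5, w6, w7, w8, w9, w10⟩ := win2 V
  obtain ⟨C, hC, hdec⟩ := decoupling d V hV q hq hdq 4 (by norm_num) ε hε
  have hI1 : ∫⁻ x, ‖ψ x‖ₑ ^ (2 : ℝ) ≠ ⊤ := by rw [enorm_sq_lint w7]; exact ENNReal.ofReal_ne_top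
  have hI2 : ∫⁻ x, ‖ψ' x‖ₑ ^ (2 : ℝ) ≠ ⊤ := by rw [enorm_sq_lint w8]; exact ENNReal.ofReal_ne_top
  set I1 := ∫⁻ x, ‖ψ x‖ₑ ^ (2 : ℝ) with hI1d
  set I2 := ∫⁻ x, ‖ψ' x‖ₑ ^ (2 : ℝ) with hI2d
  set D : ℝ≥0∞ := ENNReal.ofReal ((B * B) ^ 2) ^ ((q - 2) / 2) * I1 * I2 with hD
  have hDt : D ≠ ⊤ := ENNReal.mul_ne_top (ENNReal.mul_ne_top (ENNReal.rpow_ne_top_of_nonneg (by linarith) ENNReal.ofReal_ne_top) hI1) hI2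
  have hcc : ENNReal.ofReal (c * c) ^ q ≠ 0 := by
    rw [Ne, ENNReal.rpow_eq_zero_iff_of_pos (by linarith), ENNReal.ofReal_eq_zero]; nlinarith
  have hcc' : ENNReal.ofReal (c * c) ^ q ≠ ⊤ := ENNReal.rpow_ne_top_of_nonneg (by linarith) ENNReal.ofReal_ne_top
  refine ⟨(ENNReal.ofReal (c * c) ^ q)⁻¹ * (C * D), by finiteness, ?_⟩
  intro δ h0 h1 S hS m hmt hm a
  obtain ⟨R1, hR1, hsep⟩ := exists_sep S
  refine ⟨R1 + 1 / δ ^ 2, by positivity, fun R hR => ?_⟩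
  have hRδ : 1 / δ ^ 2 ≤ R := by linarith
  have hRp : 0 < R := lt_of_lt_of_le (by positivity) hRδ
  have hRR1 : R1 ≤ R := by have : 0 < 1 / δ ^ 2 := by positivity
                           linarith
  have hiR : 1 / R ≤ δ ^ 2 := by
    rw [div_le_iff₀ (by positivity)] at hRδ ⊢; linarith
  have hsepR : ∀ ξ ∈ S, ∀ ξ' ∈ S, ξ ≠ ξ' → 2 ≤ R * ‖ξ - ξ'‖ := fun ξ hξ ξ' hξ' hne =>
    (hsep ξ hξ ξ' hξ' hne).trans (mul_le_mul_of_nonneg_right hRR1 (norm_nonneg _))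
  set W : V × ℝ → ℂ := fun z => ψ ((1 / R) • z.1) * ψ' (δ ^ 2 * z.2) with hWd
  have hWs : Spec {ζ : V × ℝ | ‖ζ.1‖ ≤ δ ^ 2 ∧ |ζ.2| ≤ δ ^ 2} W := by
    refine (spec_win w10 (r := 1 / R) (s := δ ^ 2) (by positivity) (by positivity)).mono ?_
    rintro ζ ⟨h1, h2⟩
    exact ⟨h1.trans hiR, h2⟩
  have hWB : ∀ z, ‖W z‖ ≤ B * B := by
    intro z; rw [hWd]; dsimp only; rw [norm_mul]; exact mul_le_mul (w5 _) (w6 _) (norm_nonneg _) hB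
  obtain ⟨r, hr1, hr2⟩ := rounding S h0
  set f : V → V × ℝ → ℂ := fun τ z => es (S.filter fun ξ => r ξ = τ) a z * W z with hf
  have hfam : IsFam 4 δ (S.image r) f := by
    refine ⟨?_, ?_, ?_⟩
    · intro c hc
      obtain ⟨x, hx, rfl⟩ := Finset.mem_image.1 hc
      exact hS _ (hr1 x hx).1
    · intro c hc c' hc' hne
      obtain ⟨x, hx, rfl⟩ := Finset.mem_image.1 hc
      obtain ⟨x', hx', rfl⟩ := Finset.mem_image.1 hc'
      exact hr2 x hx x' hx' hne
    · intro c hc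
      refine spec_piece h0 h1 hWs _ a c ?_
      intro ξ hξ
      obtain ⟨hξS, rfl⟩ := Finset.mem_filter.1 hξ
      exact ⟨hS ξ hξS, (hr1 ξ hξS).2⟩
  have hd1 := hdec δ h0 h1 (S.image r) f hfam
  have hsum : ∀ z, ∑ τ ∈ S.image r, f τ z = es S a z * W z := by
    intro z
    rw [hf]
    dsimp only
    rw [← Finset.sum_mul]
    unfold es
    rw [Finset.sum_fiberwise_of_maps_to (fun c hc => Finset.mem_image_of_mem r hc)]
  simp only [hsum] at hd1
  -- lower bound
  have hlow : ENNReal.ofReal (c * c) ^ q * ∫⁻ z in Metric.closedBall (0 : V) R ×ˢ Set.Icc (0 : ℝ) (1 / δ ^ 2), ‖es S a z‖ₑ ^ q ≤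
      nrm q (fun z => es S a z * W z) := by
    rw [← lintegral_const_mul' _ _ hcc']
    unfold nrm
    refine le_trans ?_ (setLIntegral_le_lintegral (Metric.closedBall (0 : V) R ×ˢ Set.Icc (0 : ℝ) (1 / δ ^ 2)) _)
    refine setLIntegral_mono' (measurableSet_closedBall.prod measurableSet_Icc) ?_
    rintro z ⟨hz1, hz2⟩
    rw [enorm_mul, ENNReal.mul_rpow_of_nonneg _ _ (by linarith), mul_comm]
    refine mul_le_mul_right (ENNReal.rpow_le_rpow ?_ (by linarith)) _
    rw [← ofReal_norm]
    refine ENNReal.ofReal_le_ofReal ?_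
    rw [hWd]; dsimp only; rw [norm_mul]
    refine mul_le_mul (w3 _ ?_) (w4 _ ?_) hc.le (norm_nonneg _)
    · rw [norm_smul, Real.norm_eq_abs, abs_of_pos (by positivity)]
      have : ‖z.1‖ ≤ R := by simpa using hz1
      rw [one_div, inv_mul_le_iff₀ hRp]; linarith
    · have h3 := hz2.1
      have h4 := hz2.2
      rw [Real.norm_eq_abs, abs_of_nonneg (by positivity)]
      rw [le_div_iff₀ (by positivity)] at h4
      linarith
  -- pieces
  set X : ℝ≥0∞ := D * m ^ ((q - 2) / 2) * (ENNReal.ofReal (R ^ d) * ENNReal.ofReal (1 / δ ^ 2)) with hX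
  set Af : V → ℝ≥0∞ := fun τ => ∑ ξ ∈ S with r ξ = τ, ‖a ξ‖ₑ ^ (2 : ℝ) with hAf
  have hpiece : ∀ τ ∈ S.image r, nrm q (f τ) ≤ X * Af τ ^ (q / 2) := by
    intro τ hτ
    have hcard : (((S.filter fun ξ => r ξ = τ).card : ℕ) : ℝ≥0∞) ≤ m := by
      refine le_trans ?_ (hm τ)
      refine Nat.cast_le.2 (Finset.card_le_card ?_)
      intro ξ hξ
      obtain ⟨hξS, rfl⟩ := Finset.mem_filter.1 hξ
      exact Finset.mem_filter.2 ⟨hξS, (hr1 ξ hξS).2⟩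
    have k1 := cell_q (S.filter fun ξ => r ξ = τ) a W (B * B) (by positivity) hWB hq m hmt hcard
    rw [cell_l2 (S.filter fun ξ => r ξ = τ) a ψ ψ' w1 w2 w7 w9 R δ hRp h0
      (fun ξ hξ ξ' hξ' => hsepR ξ (Finset.mem_filter.1 hξ).1 ξ' (Finset.mem_filter.1 hξ').1), hV] at k1
    refine k1.trans (le_of_eq ?_)
    have e : Af τ ^ (q / 2) = Af τ ^ ((q - 2) / 2) * Af τ := by
      nth_rewrite 3 [← ENNReal.rpow_one (Af τ)]
      rw [← ENNReal.rpow_add_of_nonneg _ _ (by linarith) (by norm_num)]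
      congr 1; ring
    rw [e, ENNReal.mul_rpow_of_nonneg _ _ (by linarith), ENNReal.mul_rpow_of_nonneg _ _ (by linarith), hX, hD]
    ring
  have hNN : NN q (S.image r) f ≤ X * (∑ ξ ∈ S, ‖a ξ‖ₑ ^ (2 : ℝ)) ^ (q / 2) := by
    unfold NN
    have hq0 : 0 < q := by linarith
    calc _ ≤ (∑ τ ∈ S.image r, X ^ (2 / q) * Af τ) ^ (q / 2) := by
          refine ENNReal.rpow_le_rpow (Finset.sum_le_sum fun τ hτ => ?_) (by positivity)
          refine (ENNReal.rpow_le_rpow (hpiece τ hτ) (by positivity)).trans (le_of_eq ?_)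
          rw [ENNReal.mul_rpow_of_nonneg _ _ (by positivity), ← ENNReal.rpow_mul]
          have : q / 2 * (2 / q) = 1 := by field_simp
          rw [this, ENNReal.rpow_one]
      _ = _ := by
          rw [← Finset.mul_sum, ENNReal.mul_rpow_of_nonneg _ _ (by positivity), ← ENNReal.rpow_mul]
          have : 2 / q * (q / 2) = 1 := by field_simp
          rw [this, ENNReal.rpow_one, hAf]
          dsimp only
          rw [Finset.sum_fiberwise_of_maps_to (fun c hc => Finset.mem_image_of_mem r hc)]
  have hfin := hlow.trans (hd1.trans (mul_le_mul_right hNN _))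
  calc _ = (ENNReal.ofReal (c * c) ^ q)⁻¹ * (ENNReal.ofReal (c * c) ^ q * ∫⁻ z in Metric.closedBall (0 : V) R ×ˢ Set.Icc (0 : ℝ) (1 / δ ^ 2), ‖es S a z‖ₑ ^ q) := by
        rw [← mul_assoc, ENNReal.inv_mul_cancel hcc hcc', one_mul]
    _ ≤ _ := mul_le_mul_right hfin _
    _ = _ := by rw [hX]; ring

end fin3
end Strz

open MeasureTheory Filter
open scoped ENNReal NNReal ComplexConjugate FourierTransform
set_option linter.unusedSectionVars false
set_option linter.unusedSimpArgs false
set_option linter.unusedVariables false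
namespace Strz

section fin4
variable {V : Type} [NormedAddCommGroup V] [InnerProductSpace ℝ V] [FiniteDimensional ℝ V]
  [MeasurableSpace V] [BorelSpace V]

theorem lint_aniso (F : V × ℝ → ℝ≥0∞) (hF : Measurable F) {r s : ℝ} (hr : 0 < r) (hs : 0 < s) :
    ∫⁻ z : V × ℝ, F (r • z.1, s * z.2) = ENNReal.ofReal ((r ^ Module.finrank ℝ V)⁻¹) * ENNReal.ofReal s⁻¹ * ∫⁻ z, F z := by
  have h1 : Measurable fun z : V × ℝ => F (r • z.1, s * z.2) := by fun_prop
  rw [Measure.volume_eq_prod, lintegral_prod_symm _ h1.aemeasurable, lintegral_prod_symm _ hF.aemeasurable]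
  have e : ∀ t : ℝ, ∫⁻ x : V, F (r • x, s * t) = ENNReal.ofReal ((r ^ Module.finrank ℝ V)⁻¹) * ∫⁻ x : V, F (x, s * t) := by
    intro t
    rw [lint_smul (fun x : V => F (x, s * t)) hr.ne', abs_of_pos (by positivity)]
  dsimp only
  rw [lintegral_congr e, lintegral_const_mul' _ _ ENNReal.ofReal_ne_top]
  have := lint_smul (E := ℝ) (fun t => ∫⁻ x : V, F (x, t)) (r := s) hs.ne'
  simp only [smul_eq_mul, Module.finrank_self, pow_one] at this
  rw [this, abs_of_pos (by positivity), mul_assoc]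

theorem ec_scale (ξ : V) {N : ℝ} (hN : N ≠ 0) (z : V × ℝ) :
    ec ((1 / N) • ξ, ‖(1 / N) • ξ‖ ^ 2) (N • z.1, N ^ 2 * z.2) = ec (ξ, ‖ξ‖ ^ 2) z := by
  unfold ec ph
  congr 3
  dsimp only
  rw [inner_smul_left, inner_smul_right, norm_smul, Real.norm_eq_abs, mul_pow, sq_abs]
  simp only [conj_trivial]
  field_simp

open Classical in
variable (V) in
theorem unscaled (d : ℕ) (hV : Module.finrank ℝ V = d) (q : ℝ) (hq : 2 ≤ q) (hdq : (d : ℝ) * q ≤ 2 * ((d : ℝ) + 2))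
    (ε : ℝ) (hε : 0 < ε) (ι : Type) [Nonempty ι] : ∃ C : ℝ≥0∞, C ≠ ⊤ ∧ ∀ N ρ : ℝ, 1 ≤ N → 0 < ρ → ρ ≤ 1 →
      ∀ (T : Finset ι) (θ : ι → V), Set.InjOn θ T → (∀ n ∈ T, ‖θ n‖ ≤ N) →
      ∀ m : ℝ≥0∞, m ≠ ⊤ → (∀ c : V, ((T.filter fun n => ‖θ n - c‖ ≤ ρ).card : ℝ≥0∞) ≤ m) → ∀ a : ι → ℂ,
      ∃ L0 : ℝ, 0 < L0 ∧ ∀ L, L0 ≤ L →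
        ∫⁻ z in Metric.closedBall (0 : V) L ×ˢ Set.Icc (0 : ℝ) 1, ‖∑ n ∈ T, a n * ec (θ n, ‖θ n‖ ^ 2) z‖ₑ ^ q ≤
          C * ENNReal.ofReal ((N / ρ) ^ ε) * (m ^ ((q - 2) / 2) * ENNReal.ofReal (L ^ d) * ENNReal.ofReal (1 / ρ ^ 2) *
            (∑ n ∈ T, ‖a n‖ₑ ^ (2 : ℝ)) ^ (q / 2)) := by
  obtain ⟨C, hC, h⟩ := scaled V d hV q hq hdq ε hε
  refine ⟨C, hC, fun N ρ hN h0 h1 T θ hinj hθ m hmt hm a => ?_⟩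
  have hN0 : 0 < N := by linarith
  set g : ι → V := fun n => (1 / N) • θ n with hg
  have hginj : Set.InjOn g T := by
    intro x hx y hy hxy
    refine hinj hx hy ?_
    have := congrArg (fun v => N • v) hxy
    simpa [hg, smul_smul, hN0.ne'] using this
  set b : V → ℂ := fun ξ => a (Function.invFunOn g T ξ) with hb
  have hbg : ∀ n ∈ T, b (g n) = a n := by
    intro n hn
    rw [hb]; dsimp only
    rw [hginj.leftInvOn_invFunOn hn]
  have hsumg : ∀ {M : Type} [AddCommMonoid M] (f : V → M), ∑ ξ ∈ T.image g, f ξ = ∑ n ∈ T, f (g n) := by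
    intro M _ f
    exact Finset.sum_image hginj
  have hδ1 : ρ / N ≤ 1 := by rw [div_le_one hN0]; linarith
  obtain ⟨R0, hR0, hR⟩ := h (ρ / N) (by positivity) hδ1 (T.image g) (by
    intro ξ hξ
    obtain ⟨n, hn, rfl⟩ := Finset.mem_image.1 hξ
    rw [hg]; dsimp only
    rw [norm_smul, Real.norm_eq_abs, abs_of_pos (by positivity), one_div, inv_mul_le_iff₀ hN0, mul_one]
    exact hθ n hn) m hmt (by
    intro c
    refine le_trans ?_ (hm (N • c))
    refine Nat.cast_le.2 ?_
    refine (Finset.card_le_card (t := (T.filter fun n => ‖θ n - N • c‖ ≤ ρ).image g) ?_).trans Finset.card_image_le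
    intro ξ hξ
    obtain ⟨hξ1, hξ2⟩ := Finset.mem_filter.1 hξ
    obtain ⟨n, hn, rfl⟩ := Finset.mem_image.1 hξ1
    refine Finset.mem_image.2 ⟨n, Finset.mem_filter.2 ⟨hn, ?_⟩, rfl⟩
    have e : θ n - N • c = N • (g n - c) := by
      rw [hg]; dsimp only; rw [smul_sub, smul_smul, mul_one_div_cancel hN0.ne', one_smul]
    rw [e, norm_smul, Real.norm_eq_abs, abs_of_pos hN0]
    rw [le_div_iff₀ hN0] at hξ2
    linarith) b
  refine ⟨R0 / N, by positivity, fun L hL => ?_⟩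
  have hRL := hR (N * L) (by rw [div_le_iff₀ hN0] at hL; linarith)
  have hL0 : 0 < L := lt_of_lt_of_le (by positivity) hL
  set Q : Set (V × ℝ) := Metric.closedBall (0 : V) (N * L) ×ˢ Set.Icc (0 : ℝ) (1 / (ρ / N) ^ 2) with hQ
  have hQm : MeasurableSet Q := measurableSet_closedBall.prod measurableSet_Icc
  rw [← lintegral_indicator hQm] at hRL
  set H : V × ℝ → ℝ≥0∞ := Q.indicator fun z => ‖es (T.image g) b z‖ₑ ^ q with hH
  have hHm : Measurable H := by
    have := meas_es (T.image g) b
    exact Measurable.indicator (by fun_prop) hQm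
  have hle : ∫⁻ z in Metric.closedBall (0 : V) L ×ˢ Set.Icc (0 : ℝ) 1, ‖∑ n ∈ T, a n * ec (θ n, ‖θ n‖ ^ 2) z‖ₑ ^ q ≤
      ∫⁻ z : V × ℝ, H (N • z.1, N ^ 2 * z.2) := by
    rw [← lintegral_indicator (measurableSet_closedBall.prod measurableSet_Icc)]
    refine lintegral_mono fun z => ?_
    by_cases hz : z ∈ Metric.closedBall (0 : V) L ×ˢ Set.Icc (0 : ℝ) 1
    · rw [Set.indicator_of_mem hz, hH, Set.indicator_of_mem]
      · refine le_of_eq ?_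
        congr 2
        unfold es
        rw [hsumg]
        refine Finset.sum_congr rfl fun n hn => ?_
        rw [hbg n hn, hg]
        dsimp only
        rw [ec_scale _ hN0.ne']
      · obtain ⟨hz1, hz2⟩ := hz
        have hz1' : ‖z.1‖ ≤ L := by simpa using hz1
        refine ⟨?_, ?_, ?_⟩
        · simp only [mem_closedBall_zero_iff, norm_smul, Real.norm_eq_abs, abs_of_pos hN0]
          exact mul_le_mul_of_nonneg_left hz1' hN0.le
        · have := hz2.1; positivity
        · have e : 1 / (ρ / N) ^ 2 = N ^ 2 * (1 / ρ ^ 2) := by field_simp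
          have : 1 ≤ 1 / ρ ^ 2 := by rw [le_div_iff₀ (by positivity)]; nlinarith
          dsimp only
          rw [e]
          exact mul_le_mul_of_nonneg_left (hz2.2.trans this) (by positivity)
    · rw [Set.indicator_of_notMem hz]; exact zero_le
  refine hle.trans ?_
  rw [lint_aniso H hHm hN0 (by positivity), hV]
  refine (mul_le_mul_right hRL _).trans (le_of_eq ?_)
  rw [hsumg]
  rw [Finset.sum_congr rfl fun n hn => by rw [hbg n hn]]
  have e1 : (ρ / N) ^ (-ε) = (N / ρ) ^ ε := by
    rw [Real.rpow_neg (by positivity), ← Real.inv_rpow (by positivity), inv_div]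
  rw [e1]
  have e2 : ENNReal.ofReal (N ^ d)⁻¹ * ENNReal.ofReal (N ^ 2)⁻¹ * (ENNReal.ofReal ((N * L) ^ d) * ENNReal.ofReal (1 / (ρ / N) ^ 2)) =
      ENNReal.ofReal (L ^ d) * ENNReal.ofReal (1 / ρ ^ 2) := by
    rw [← ENNReal.ofReal_mul (by positivity), ← ENNReal.ofReal_mul (by positivity), ← ENNReal.ofReal_mul (by positivity), ← ENNReal.ofReal_mul (by positivity)]
    congr 1
    rw [mul_pow]
    field_simp
  calc _ = C * ENNReal.ofReal ((N / ρ) ^ ε) * (m ^ ((q - 2) / 2) * (ENNReal.ofReal (N ^ d)⁻¹ * ENNReal.ofReal (N ^ 2)⁻¹ * (ENNReal.ofReal ((N * L) ^ d) * ENNReal.ofReal (1 / (ρ / N) ^ 2))) *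
            (∑ n ∈ T, ‖a n‖ₑ ^ (2 : ℝ)) ^ (q / 2)) := by ring
    _ = _ := by rw [e2]; ring

end fin4
end Strz

open MeasureTheory Filter
open scoped ENNReal NNReal ComplexConjugate FourierTransform
set_option linter.unusedSectionVars false
set_option linter.unusedSimpArgs false
set_option linter.unusedVariables false
namespace Strz

section fin5
variable {V : Type} [NormedAddCommGroup V] [InnerProductSpace ℝ V] [FiniteDimensional ℝ V]
  [MeasurableSpace V] [BorelSpace V]

open Classical in
variable (V) in
theorem piece_p (d : ℕ) (hV : Module.finrank ℝ V = d) (p q : ℝ) (hq : 2 ≤ q) (hqp : q ≤ p) (hdq : (d : ℝ) * q ≤ 2 * ((d : ℝ) + 2))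
    (ε : ℝ) (hε : 0 < ε) (ι : Type) [Nonempty ι] : ∃ C : ℝ≥0∞, C ≠ ⊤ ∧ ∀ N ρ : ℝ, 1 ≤ N → 0 < ρ → ρ ≤ 1 →
      ∀ (T : Finset ι) (θ : ι → V), Set.InjOn θ T → (∀ n ∈ T, ‖θ n‖ ≤ N) →
      ∀ m M : ℝ≥0∞, m ≠ ⊤ → M ≠ ⊤ → (T.card : ℝ≥0∞) ≤ M → (∀ c : V, ((T.filter fun n => ‖θ n - c‖ ≤ ρ).card : ℝ≥0∞) ≤ m) → ∀ a : ι → ℂ,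
      ∃ L0 : ℝ, 0 < L0 ∧ ∀ L, L0 ≤ L →
        ∫⁻ z in Metric.closedBall (0 : V) L ×ˢ Set.Icc (0 : ℝ) 1, ‖∑ n ∈ T, a n * ec (θ n, ‖θ n‖ ^ 2) z‖ₑ ^ p ≤
          C * ENNReal.ofReal ((N / ρ) ^ ε) * (M ^ ((p - q) / 2) * m ^ ((q - 2) / 2) * ENNReal.ofReal (L ^ d) * ENNReal.ofReal (1 / ρ ^ 2) *
            (∑ n ∈ T, ‖a n‖ₑ ^ (2 : ℝ)) ^ (p / 2)) := by
  obtain ⟨C, hC, h⟩ := unscaled V d hV q hq hdq ε hε ι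
  refine ⟨C, hC, fun N ρ hN h0 h1 T θ hinj hθ m M hmt hMt hM hm a => ?_⟩
  obtain ⟨L0, hL0, hL⟩ := h N ρ hN h0 h1 T θ hinj hθ m hmt hm a
  refine ⟨L0, hL0, fun L hLL => ?_⟩
  set A := ∑ n ∈ T, ‖a n‖ₑ ^ (2 : ℝ) with hA
  have hAt : A ≠ ⊤ := (ENNReal.sum_lt_top.2 fun ξ _ => (ENNReal.rpow_ne_top_of_nonneg (by norm_num) enorm_ne_top).lt_top).ne
  have hXt : (M * A) ^ ((p - q) / 2) ≠ ⊤ := ENNReal.rpow_ne_top_of_nonneg (by linarith) (ENNReal.mul_ne_top hMt hAt)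
  have hpt : ∫⁻ z in Metric.closedBall (0 : V) L ×ˢ Set.Icc (0 : ℝ) 1, ‖∑ n ∈ T, a n * ec (θ n, ‖θ n‖ ^ 2) z‖ₑ ^ p ≤
      (M * A) ^ ((p - q) / 2) * ∫⁻ z in Metric.closedBall (0 : V) L ×ˢ Set.Icc (0 : ℝ) 1, ‖∑ n ∈ T, a n * ec (θ n, ‖θ n‖ ^ 2) z‖ₑ ^ q := by
    rw [← lintegral_const_mul' _ _ hXt]
    refine lintegral_mono fun z => ?_
    dsimp only
    set x := ‖∑ n ∈ T, a n * ec (θ n, ‖θ n‖ ^ 2) z‖ₑ with hx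
    have e : x ^ p = (x ^ (2 : ℝ)) ^ ((p - q) / 2) * x ^ q := by
      rw [← ENNReal.rpow_mul, ← ENNReal.rpow_add_of_nonneg _ _ (by nlinarith) (by linarith)]
      congr 1; ring
    rw [e]
    refine mul_le_mul_left (ENNReal.rpow_le_rpow ?_ (by linarith)) _
    refine (esq_sum_le T _).trans ?_
    simp only [enorm_mul, enorm_ec, mul_one]
    exact mul_le_mul_left hM _
  refine hpt.trans ((mul_le_mul_right (hL L hLL) _).trans (le_of_eq ?_))
  have e : A ^ (p / 2) = A ^ ((p - q) / 2) * A ^ (q / 2) := by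
    rw [← ENNReal.rpow_add_of_nonneg _ _ (by linarith) (by linarith)]
    congr 1; ring
  rw [e, ENNReal.mul_rpow_of_nonneg _ _ (by linarith)]
  ring

theorem prod_count (x n : ℕ) (hn : 1 ≤ n) : ∏ j : Fin n, (if j.val = 0 then 1 else x) = x ^ (n - 1) := by
  obtain ⟨k, rfl⟩ : ∃ k, n = k + 1 := ⟨n - 1, by omega⟩
  rw [Fin.prod_univ_succ]
  simp

theorem count_all {d : ℕ} {ν : Fin d → ℕ} (M : ℕ) (T : Finset (∀ i, Fin (ν i) → ℤ)) (hT : ∀ n ∈ T, ∀ i j, |n i j| ≤ M) :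
    T.card ≤ (2 * M + 1) ^ (∑ i, ν i) := by
  classical
  have hsub : T ⊆ Fintype.piFinset fun i => Fintype.piFinset fun j : Fin (ν i) => Finset.Icc (-(M : ℤ)) M := by
    intro n hn
    simp only [Fintype.mem_piFinset, Finset.mem_Icc]
    intro i j
    exact abs_le.1 (hT n hn i j)
  refine (Finset.card_le_card hsub).trans (le_of_eq ?_)
  simp only [Fintype.card_piFinset, Int.card_Icc, Finset.prod_const, Finset.card_univ, Fintype.card_fin]
  rw [Finset.prod_pow_eq_pow_sum]
  congr 1
  omega

theorem count_cell {d : ℕ} {ν : Fin d → ℕ} (hν : ∀ i, 1 ≤ ν i) (ω : ∀ i, Fin (ν i) → ℝ) (ρ : ℝ)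
    (hρ : ∀ i j, 2 * ρ < ω i j) (M : ℕ) (T : Finset (∀ i, Fin (ν i) → ℤ)) (hT : ∀ n ∈ T, ∀ i j, |n i j| ≤ M)
    (c : Fin d → ℝ) (hc : ∀ n ∈ T, ∀ i, |freqVec ω n i - c i| ≤ ρ) :
    T.card ≤ (2 * M + 1) ^ (∑ i, (ν i - 1)) := by
  classical
  set Φ : (∀ i, Fin (ν i) → ℤ) → (∀ i, Fin (ν i) → ℤ) := fun n i j => if j.val = 0 then 0 else n i j with hΦ
  have hinj : Set.InjOn Φ T := by
    intro n hn n' hn' he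
    funext i
    have hj : ∀ j : Fin (ν i), j.val ≠ 0 → n i j = n' i j := by
      intro j hj
      have := congrFun (congrFun he i) j
      simpa [hΦ, hj] using this
    set j0 : Fin (ν i) := ⟨0, hν i⟩ with hj0
    have hsum : freqVec ω n i - freqVec ω n' i = ((n i j0 : ℝ) - n' i j0) * ω i j0 := by
      unfold freqVec
      rw [← Finset.sum_sub_distrib, Finset.sum_eq_single j0]
      · ring
      · intro j _ hne
        rw [hj j (fun h => hne (Fin.ext h))]; ring
      · simp
    have h1 : |freqVec ω n i - freqVec ω n' i| ≤ 2 * ρ := by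
      have a1 := hc n hn i
      have a2 := hc n' hn' i
      rw [abs_le] at *
      constructor <;> linarith
    have hρ0 : 0 ≤ ρ := (abs_nonneg _).trans (hc n hn i)
    have hω : 0 < ω i j0 := by have := hρ i j0; linarith
    rw [hsum, abs_mul, abs_of_pos hω] at h1
    have h2 : |((n i j0 : ℝ) - n' i j0)| < 1 := by
      by_contra hcon
      rw [not_lt] at hcon
      have := hρ i j0
      nlinarith
    have h3 : n i j0 = n' i j0 := by
      have : |n i j0 - n' i j0| < 1 := by exact_mod_cast h2
      rw [Int.abs_lt_one_iff] at this
      omega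
    funext j
    by_cases hjj : j.val = 0
    · have : j = j0 := Fin.ext hjj
      rw [this]; exact h3
    · exact hj j hjj
  rw [← Finset.card_image_of_injOn hinj]
  have hsub : T.image Φ ⊆ Fintype.piFinset fun i => Fintype.piFinset fun j : Fin (ν i) =>
      if j.val = 0 then ({0} : Finset ℤ) else Finset.Icc (-(M : ℤ)) M := by
    intro n' hn'
    obtain ⟨n, hn, rfl⟩ := Finset.mem_image.1 hn'
    simp only [Fintype.mem_piFinset]
    intro i j
    by_cases hjj : j.val = 0
    · simp [hΦ, hjj]
    · simp only [hΦ, hjj, if_false, Finset.mem_Icc]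
      exact abs_le.1 (hT n hn i j)
  refine (Finset.card_le_card hsub).trans (le_of_eq ?_)
  simp only [Fintype.card_piFinset]
  rw [← Finset.prod_pow_eq_pow_sum]
  refine Finset.prod_congr rfl fun i _ => ?_
  rw [← prod_count (2 * M + 1) (ν i) (hν i)]
  refine Finset.prod_congr rfl fun j _ => ?_
  split_ifs
  · simp
  · rw [Int.card_Icc]; omega

theorem mink_sum {α ι : Type*} [MeasurableSpace α] (μ : Measure α) (S : Finset ι) (f : ι → α → ℂ) (hf : ∀ k ∈ S, Measurable (f k))
    (p : ℝ) (hp : 1 ≤ p) (X : ι → ℝ≥0∞) (hX : ∀ k ∈ S, ∫⁻ x, ‖f k x‖ₑ ^ p ∂μ ≤ X k ^ p) :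
    ∫⁻ x, ‖∑ k ∈ S, f k x‖ₑ ^ p ∂μ ≤ (∑ k ∈ S, X k) ^ p := by
  have hp0 : 0 < p := by linarith
  have h := eLpNorm'_sum_le (μ := μ) (s := S) (f := f) (q := p) (fun i hi => (hf i hi).aestronglyMeasurable) hp
  unfold eLpNorm' at h
  have h2 : (∫⁻ x, ‖∑ k ∈ S, f k x‖ₑ ^ p ∂μ) ^ (1 / p) ≤ ∑ k ∈ S, X k := by
    have e : ∀ x, (∑ k ∈ S, f k) x = ∑ k ∈ S, f k x := fun x => Finset.sum_apply x S f
    simp only [e] at h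
    refine h.trans (Finset.sum_le_sum fun k hk => ?_)
    rw [one_div, ENNReal.rpow_inv_le_iff hp0]
    exact hX k hk
  rwa [one_div, ENNReal.rpow_inv_le_iff hp0] at h2

end fin5
end Strz

open MeasureTheory Filter
open scoped ENNReal NNReal ComplexConjugate FourierTransform
set_option linter.unusedSectionVars false
set_option linter.unusedSimpArgs false
set_option linter.unusedVariables false
namespace Strz

section fin6

/-- frequency vector in Euclidean space -/
noncomputable def thv {d : ℕ} {ν : Fin d → ℕ} (ω : ∀ i, Fin (ν i) → ℝ) (n : ∀ i, Fin (ν i) → ℤ) : EuclideanSpace ℝ (Fin d) :=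
  WithLp.toLp 2 (freqVec ω n)

theorem thv_apply {d : ℕ} {ν : Fin d → ℕ} (ω : ∀ i, Fin (ν i) → ℝ) (n : ∀ i, Fin (ν i) → ℤ) (i : Fin d) :
    thv ω n i = freqVec ω n i := rfl

theorem thv_inj {d : ℕ} {ν : Fin d → ℕ} (ω : ∀ i, Fin (ν i) → ℝ)
    (hnr : ∀ i, ∀ m : Fin (ν i) → ℤ, (∑ j, (m j : ℝ) * ω i j) = 0 → m = 0) : Function.Injective (thv ω) := by
  intro n n' h
  funext i
  have h1 : freqVec ω n i = freqVec ω n' i := by rw [← thv_apply, ← thv_apply, h]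
  have h2 := hnr i (fun j => n i j - n' i j) (by
    unfold freqVec at h1
    push_cast
    simp only [sub_mul, Finset.sum_sub_distrib]
    linarith)
  funext j
  have := congrFun h2 j
  simp only [Pi.zero_apply] at this
  omega

theorem height_nonneg {d : ℕ} {ν : Fin d → ℕ} (n : ∀ i, Fin (ν i) → ℤ) : 0 ≤ heightVec n := Real.sqrt_nonneg _

theorem abs_le_height {d : ℕ} {ν : Fin d → ℕ} (n : ∀ i, Fin (ν i) → ℤ) (i : Fin d) (j : Fin (ν i)) :
    |(n i j : ℝ)| ≤ heightVec n := by
  unfold heightVec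
  rw [← Real.sqrt_sq_eq_abs]
  refine Real.sqrt_le_sqrt ?_
  refine (Finset.single_le_sum (f := fun j => ((n i j : ℝ)) ^ 2) (fun j _ => sq_nonneg _) (Finset.mem_univ j)).trans ?_
  exact Finset.single_le_sum (f := fun i => ∑ j, ((n i j : ℝ)) ^ 2) (fun i _ => Finset.sum_nonneg fun j _ => sq_nonneg _) (Finset.mem_univ i)

theorem thv_norm {d : ℕ} {ν : Fin d → ℕ} (ω : ∀ i, Fin (ν i) → ℝ) (hpos : ∀ i j, 0 < ω i j) (n : ∀ i, Fin (ν i) → ℤ) :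
    ‖thv ω n‖ ≤ (∑ i, ∑ j, ω i j) * heightVec n := by
  have h0 := height_nonneg n
  have h1 : ∀ i, |freqVec ω n i| ≤ (∑ j, ω i j) * heightVec n := by
    intro i
    unfold freqVec
    refine (Finset.abs_sum_le_sum_abs _ _).trans ?_
    rw [Finset.sum_mul]
    refine Finset.sum_le_sum fun j _ => ?_
    rw [abs_mul, abs_of_pos (hpos i j), mul_comm]
    exact mul_le_mul_of_nonneg_left (abs_le_height n i j) (hpos i j).le
  rw [EuclideanSpace.norm_eq]
  refine Real.sqrt_le_iff.2 ⟨mul_nonneg (Finset.sum_nonneg fun i _ => Finset.sum_nonneg fun j _ => (hpos i j).le) h0, ?_⟩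
  have h2 : ∑ i, ‖thv ω n i‖ ^ 2 ≤ (∑ i, ‖thv ω n i‖) ^ 2 :=
    Finset.sum_sq_le_sq_sum_of_nonneg fun i _ => norm_nonneg _
  refine h2.trans (pow_le_pow_left₀ (Finset.sum_nonneg fun i _ => norm_nonneg _) ?_ 2)
  rw [Finset.sum_mul]
  exact Finset.sum_le_sum fun i _ => h1 i

theorem ex_rho {d : ℕ} {ν : Fin d → ℕ} (ω : ∀ i, Fin (ν i) → ℝ) (hpos : ∀ i j, 0 < ω i j) :
    ∃ ρ : ℝ, 0 < ρ ∧ ρ ≤ 1 ∧ ∀ i j, 2 * ρ < ω i j := by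
  have h : ∀ᶠ ρ : ℝ in nhdsWithin 0 (Set.Ioi 0), ∀ i j, 2 * ρ < ω i j := by
    refine eventually_all.2 fun i => eventually_all.2 fun j => ?_
    have : Set.Ioo (0:ℝ) (ω i j / 2) ∈ nhdsWithin (0:ℝ) (Set.Ioi 0) := Ioo_mem_nhdsGT (by have := hpos i j; linarith)
    filter_upwards [this] with ρ hρ
    have := hρ.2
    linarith
  have h1 : Set.Ioo (0:ℝ) 1 ∈ nhdsWithin (0:ℝ) (Set.Ioi 0) := Ioo_mem_nhdsGT one_pos
  obtain ⟨ρ, a, b⟩ := (h.and h1).exists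
  exact ⟨ρ, b.1, b.2.le, a⟩

theorem expo (y : ℝ≥0∞) (h0 : y ≠ 0) (ht : y ≠ ⊤) (p q γ s b d : ℝ) (hp : 2 < p) (hq : 2 ≤ q) (hqp : q ≤ p) (hb : 0 ≤ b) (hd : 0 ≤ d)
    (hs : s * p = b * (p - 2) / 2 + d * (p - q) / 2 + 2 * p * γ) (C D E H L : ℝ≥0∞) :
    C * (D * y ^ (p * γ)) * (((5 * y) ^ (b + d)) ^ ((p - q) / 2) * ((5 * y) ^ b) ^ ((q - 2) / 2) * L * E * (y ^ (-(2 * s)) * H) ^ (p / 2)) =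
      (C * D * E * 5 ^ ((b + d) * ((p - q) / 2)) * 5 ^ (b * ((q - 2) / 2))) * L * y ^ (-(p * γ)) * H ^ (p / 2) := by
  rw [← ENNReal.rpow_mul, ← ENNReal.rpow_mul, ENNReal.mul_rpow_of_nonneg _ _ (mul_nonneg (by linarith) (by linarith)),
    ENNReal.mul_rpow_of_nonneg _ _ (mul_nonneg (by linarith) (by linarith)), ENNReal.mul_rpow_of_nonneg _ _ (show 0 ≤ p / 2 by linarith), ← ENNReal.rpow_mul y]
  have e : y ^ (-(p * γ)) = y ^ (p * γ) * y ^ ((b + d) * ((p - q) / 2)) * y ^ (b * ((q - 2) / 2)) * y ^ (-(2 * s) * (p / 2)) := by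
    rw [← ENNReal.rpow_add _ _ h0 ht, ← ENNReal.rpow_add _ _ h0 ht, ← ENNReal.rpow_add _ _ h0 ht]
    congr 1
    linarith
  rw [e]
  ring

open Classical in
theorem dyadic_piece {d : ℕ} {ν : Fin d → ℕ} (hν : ∀ i, 1 ≤ ν i) (ω : ∀ i, Fin (ν i) → ℝ) (hpos : ∀ i j, 0 < ω i j)
    (hnr : ∀ i, ∀ m : Fin (ν i) → ℤ, (∑ j, (m j : ℝ) * ω i j) = 0 → m = 0) (p q : ℝ) (hp : 2 < p) (hq : 2 ≤ q) (hqp : q ≤ p)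
    (hdq : (d : ℝ) * q ≤ 2 * ((d : ℝ) + 2)) (γ s : ℝ) (hγ : 0 < γ)
    (hs : s * p = ((∑ i, (ν i - 1) : ℕ) : ℝ) * (p - 2) / 2 + d * (p - q) / 2 + 2 * p * γ) :
    ∃ C : ℝ≥0∞, C ≠ ⊤ ∧ ∀ (k : ℕ) (T : Finset (∀ i, Fin (ν i) → ℤ)),
      (∀ n ∈ T, (2:ℝ) ^ k ≤ 1 + heightVec n ∧ 1 + heightVec n ≤ 2 ^ (k + 1)) → ∀ a : (∀ i, Fin (ν i) → ℤ) → ℂ,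
      ∃ L0 : ℝ, 0 < L0 ∧ ∀ L, L0 ≤ L →
        ∫⁻ z in Metric.closedBall (0 : EuclideanSpace ℝ (Fin d)) L ×ˢ Set.Icc (0 : ℝ) 1,
          ‖∑ n ∈ T, a n * ec (thv ω n, ‖thv ω n‖ ^ 2) z‖ₑ ^ p ≤
        C * ENNReal.ofReal (L ^ d) * ((2:ℝ≥0∞) ^ k) ^ (-(p * γ)) * (∑ n ∈ T, ENNReal.ofReal ((1 + heightVec n) ^ (2 * s)) * ‖a n‖ₑ ^ (2:ℝ)) ^ (p / 2) := by
  obtain ⟨ρ, hρ0, hρ1, hρ⟩ := ex_rho ω hpos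
  set W : ℝ := 1 + ∑ i, ∑ j, ω i j with hW
  have hW0 : 0 ≤ ∑ i, ∑ j, ω i j := Finset.sum_nonneg fun i _ => Finset.sum_nonneg fun j _ => (hpos i j).le
  set b : ℕ := ∑ i, (ν i - 1) with hb
  have hbd : ∑ i, ν i = b + d := by
    have : ∑ i, ν i = ∑ i, ((ν i - 1) + 1) := Finset.sum_congr rfl fun i _ => by have := hν i; omega
    rw [this, Finset.sum_add_distrib]; simp [hb]
  have hpγ : 0 < p * γ := by nlinarith
  have hs0 : 0 < s := by
    have : 0 < s * p := by
      rw [hs]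
      have h1 : 0 ≤ (b:ℝ) * (p - 2) / 2 := by have : 0 ≤ (b:ℝ) := by positivity
                                              have : 0 ≤ p - 2 := by linarith
                                              positivity
      have h2 : 0 ≤ (d:ℝ) * (p - q) / 2 := by have : 0 ≤ p - q := by linarith
                                              positivity
      nlinarith
    by_contra h
    rw [not_lt] at h
    nlinarith
  obtain ⟨C, hC, h⟩ := piece_p (EuclideanSpace ℝ (Fin d)) d (by simp) p q hq hqp hdq (p * γ) hpγ (∀ i, Fin (ν i) → ℤ)
  refine ⟨C * ENNReal.ofReal ((2 * W / ρ) ^ (p * γ)) * ENNReal.ofReal (1 / ρ ^ 2) * 5 ^ (((b:ℝ) + d) * ((p - q) / 2)) * 5 ^ ((b:ℝ) * ((q - 2) / 2)),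
    ?_, fun k T hT a => ?_⟩
  · refine ENNReal.mul_ne_top (ENNReal.mul_ne_top (ENNReal.mul_ne_top (ENNReal.mul_ne_top hC ENNReal.ofReal_ne_top) ENNReal.ofReal_ne_top) ?_) ?_
    · exact ENNReal.rpow_ne_top_of_nonneg (mul_nonneg (by positivity) (by linarith)) (by norm_num)
    · exact ENNReal.rpow_ne_top_of_nonneg (mul_nonneg (by positivity) (by linarith)) (by norm_num)
  have h2k : (1:ℝ) ≤ 2 ^ k := one_le_pow₀ (by norm_num)
  have hTM : ∀ n ∈ T, ∀ i j, |n i j| ≤ ((2 ^ (k + 1) : ℕ) : ℤ) := by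
    intro n hn i j
    have h1 := abs_le_height n i j
    have h2 := (hT n hn).2
    have h3 : |(n i j : ℝ)| ≤ 2 ^ (k + 1) := by linarith
    exact_mod_cast h3
  have h5 : 2 * 2 ^ (k + 1) + 1 ≤ 5 * 2 ^ k := by
    have : 1 ≤ 2 ^ k := Nat.one_le_two_pow
    rw [pow_succ]; omega
  set y : ℝ≥0∞ := (2:ℝ≥0∞) ^ k with hy
  have hy0 : y ≠ 0 := by positivity
  have hyt : y ≠ ⊤ := ENNReal.pow_ne_top (by norm_num)
  have hyr : ENNReal.ofReal ((2:ℝ) ^ k) = y := by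
    rw [ENNReal.ofReal_pow (by norm_num)]; simp [hy]
  have hcast : ∀ c e : ℕ, c ≤ (2 * 2 ^ (k + 1) + 1) ^ e → (c : ℝ≥0∞) ≤ (5 * y) ^ (e : ℝ) := by
    intro c e hce
    have h1 : c ≤ (5 * 2 ^ k) ^ e := hce.trans (Nat.pow_le_pow_left h5 e)
    have h2 : (c : ℝ≥0∞) ≤ (((5 * 2 ^ k) ^ e : ℕ) : ℝ≥0∞) := by exact_mod_cast h1
    rw [ENNReal.rpow_natCast]
    refine h2.trans (le_of_eq ?_)
    push_cast
    rfl
  have h5t : ∀ e : ℝ, 0 ≤ e → (5 * y) ^ e ≠ ⊤ := fun e he =>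
    ENNReal.rpow_ne_top_of_nonneg he (ENNReal.mul_ne_top (by norm_num) hyt)
  obtain ⟨L0, hL0, hL⟩ := h (W * 2 ^ (k + 1)) ρ (by rw [pow_succ]; nlinarith) hρ0 hρ1 T (thv ω) (thv_inj ω hnr).injOn
    (fun n hn => by
      refine (thv_norm ω hpos n).trans ?_
      have h2 := (hT n hn).2
      have h3 := height_nonneg n
      nlinarith) ((5 * y) ^ (b:ℝ)) ((5 * y) ^ ((b:ℝ) + d)) (h5t _ (by positivity)) (h5t _ (by positivity))
    (by
      have := hcast T.card (b + d) (by rw [← hbd]; exact count_all _ T hTM)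
      push_cast at this
      exact this)
    (fun c => by
      refine hcast _ b ?_
      refine count_cell hν ω ρ hρ _ _ (fun n hn => hTM n (Finset.mem_filter.1 hn).1) (fun i => c i) ?_
      intro n hn i
      have h1 := (Finset.mem_filter.1 hn).2
      have h2 := PiLp.norm_apply_le (thv ω n - c) i
      exact h2.trans h1) a
  refine ⟨L0, hL0, fun L hLL => (hL L hLL).trans ?_⟩
  have hA : ∑ n ∈ T, ‖a n‖ₑ ^ (2:ℝ) ≤ y ^ (-(2 * s)) * ∑ n ∈ T, ENNReal.ofReal ((1 + heightVec n) ^ (2 * s)) * ‖a n‖ₑ ^ (2:ℝ) := by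
    rw [Finset.mul_sum]
    refine Finset.sum_le_sum fun n hn => ?_
    rw [← mul_assoc]
    have h1 : (1:ℝ≥0∞) ≤ y ^ (-(2 * s)) * ENNReal.ofReal ((1 + heightVec n) ^ (2 * s)) := by
      have e : y ^ (-(2 * s)) * y ^ (2 * s) = 1 := by
        rw [← ENNReal.rpow_add _ _ hy0 hyt]; simp
      rw [← e]
      refine mul_le_mul_right ?_ _
      rw [← ENNReal.ofReal_rpow_of_nonneg (by have := height_nonneg n; linarith) (by linarith), ← hyr]
      exact ENNReal.rpow_le_rpow (ENNReal.ofReal_le_ofReal (hT n hn).1) (by linarith)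
    calc _ = 1 * ‖a n‖ₑ ^ (2:ℝ) := (one_mul _).symm
      _ ≤ _ := mul_le_mul_left h1 _
  have hN : ENNReal.ofReal ((W * 2 ^ (k + 1) / ρ) ^ (p * γ)) = ENNReal.ofReal ((2 * W / ρ) ^ (p * γ)) * y ^ (p * γ) := by
    rw [← hyr, ENNReal.ofReal_rpow_of_nonneg (by positivity) hpγ.le, ← ENNReal.ofReal_mul (by positivity), ← Real.mul_rpow (by positivity) (by positivity)]
    congr 2
    rw [pow_succ]; ring
  rw [hN, ← expo y hy0 hyt p q γ s b d hp hq hqp (by positivity) (by positivity) hs]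
  gcongr

end fin6
end Strz

open MeasureTheory Filter
open scoped ENNReal NNReal ComplexConjugate FourierTransform
set_option linter.unusedSectionVars false
set_option linter.unusedSimpArgs false
set_option linter.unusedVariables false
namespace Strz

section fin7

theorem geo_bound (γ : ℝ) (hγ : 0 < γ) : ∃ Z : ℝ≥0∞, Z ≠ ⊤ ∧ ∀ S : Finset ℕ, ∑ k ∈ S, ((2:ℝ≥0∞) ^ k) ^ (-γ) ≤ Z := by
  refine ⟨(1 - (2:ℝ≥0∞) ^ (-γ))⁻¹, ?_, fun S => ?_⟩
  · rw [ENNReal.inv_ne_top]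
    have : (2:ℝ≥0∞) ^ (-γ) < 1 := ENNReal.rpow_lt_one_of_one_lt_of_neg (by norm_num) (by linarith)
    exact (tsub_pos_of_lt this).ne'
  · rw [← ENNReal.tsum_geometric]
    refine le_trans (le_of_eq ?_) (ENNReal.sum_le_tsum S)
    refine Finset.sum_congr rfl fun k _ => ?_
    rw [← ENNReal.rpow_natCast, ← ENNReal.rpow_mul, ← ENNReal.rpow_natCast, ← ENNReal.rpow_mul, mul_comm]

theorem full_est {d : ℕ} {ν : Fin d → ℕ} (hν : ∀ i, 1 ≤ ν i) (ω : ∀ i, Fin (ν i) → ℝ) (hpos : ∀ i j, 0 < ω i j)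
    (hnr : ∀ i, ∀ m : Fin (ν i) → ℤ, (∑ j, (m j : ℝ) * ω i j) = 0 → m = 0) (p q : ℝ) (hp : 2 < p) (hq : 2 ≤ q) (hqp : q ≤ p)
    (hdq : (d : ℝ) * q ≤ 2 * ((d : ℝ) + 2)) (γ s : ℝ) (hγ : 0 < γ)
    (hs : s * p = ((∑ i, (ν i - 1) : ℕ) : ℝ) * (p - 2) / 2 + d * (p - q) / 2 + 2 * p * γ) :
    ∃ C : ℝ≥0∞, C ≠ ⊤ ∧ ∀ (S : Finset (∀ i, Fin (ν i) → ℤ)), ∀ a : (∀ i, Fin (ν i) → ℤ) → ℂ,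
      ∀ᶠ L : ℝ in atTop,
        ∫⁻ z in Metric.closedBall (0 : EuclideanSpace ℝ (Fin d)) L ×ˢ Set.Icc (0 : ℝ) 1,
          ‖∑ n ∈ S, a n * ec (thv ω n, ‖thv ω n‖ ^ 2) z‖ₑ ^ p ≤
        C * ENNReal.ofReal (L ^ d) * (∑ n ∈ S, ENNReal.ofReal ((1 + heightVec n) ^ (2 * s)) * ‖a n‖ₑ ^ (2:ℝ)) ^ (p / 2) := by
  classical
  obtain ⟨C, hC, h⟩ := dyadic_piece hν ω hpos hnr p q hp hq hqp hdq γ s hγ hs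
  obtain ⟨Z, hZ, hZb⟩ := geo_bound γ hγ
  have hp0 : 0 < p := by linarith
  refine ⟨C * Z ^ p, ENNReal.mul_ne_top hC (ENNReal.rpow_ne_top_of_nonneg hp0.le hZ), fun S a => ?_⟩
  set κ : (∀ i, Fin (ν i) → ℤ) → ℕ := fun n => Nat.log 2 ⌊1 + heightVec n⌋₊ with hκ
  set R : Finset ℕ := S.image κ with hR
  have hT : ∀ k, ∀ n ∈ S.filter (fun n => κ n = k), (2:ℝ) ^ k ≤ 1 + heightVec n ∧ 1 + heightVec n ≤ 2 ^ (k + 1) := by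
    intro k n hn
    have hk : κ n = k := (Finset.mem_filter.1 hn).2
    have h0 := height_nonneg n
    have h1 : 1 ≤ ⌊1 + heightVec n⌋₊ := Nat.le_floor (by push_cast; linarith)
    have h2 : 2 ^ k ≤ ⌊1 + heightVec n⌋₊ := by rw [← hk]; exact Nat.pow_log_le_self 2 (by omega)
    have h3 : ⌊1 + heightVec n⌋₊ < 2 ^ (k + 1) := by rw [← hk]; exact Nat.lt_pow_succ_log_self (by norm_num) _
    constructor
    · have := (Nat.le_floor_iff (by linarith)).1 h2
      push_cast at this; exact this
    · have := (Nat.floor_lt (by linarith)).1 h3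
      push_cast at this; exact this.le
  have hev : ∀ᶠ L : ℝ in atTop, ∀ k ∈ R, ∫⁻ z in Metric.closedBall (0 : EuclideanSpace ℝ (Fin d)) L ×ˢ Set.Icc (0 : ℝ) 1,
          ‖∑ n ∈ S.filter (fun n => κ n = k), a n * ec (thv ω n, ‖thv ω n‖ ^ 2) z‖ₑ ^ p ≤
        C * ENNReal.ofReal (L ^ d) * ((2:ℝ≥0∞) ^ k) ^ (-(p * γ)) * (∑ n ∈ S.filter (fun n => κ n = k), ENNReal.ofReal ((1 + heightVec n) ^ (2 * s)) * ‖a n‖ₑ ^ (2:ℝ)) ^ (p / 2) := by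
    refine (eventually_all_finset R).2 fun k _ => ?_
    obtain ⟨L0, _, hL⟩ := h k _ (hT k) a
    exact eventually_atTop.2 ⟨L0, hL⟩
  filter_upwards [hev] with L hL
  set H := ∑ n ∈ S, ENNReal.ofReal ((1 + heightVec n) ^ (2 * s)) * ‖a n‖ₑ ^ (2:ℝ) with hH
  set B := C * ENNReal.ofReal (L ^ d) * H ^ (p / 2) with hB
  have hm := mink_sum (volume.restrict (Metric.closedBall (0 : EuclideanSpace ℝ (Fin d)) L ×ˢ Set.Icc (0 : ℝ) 1)) R
    (fun k z => ∑ n ∈ S.filter (fun n => κ n = k), a n * ec (thv ω n, ‖thv ω n‖ ^ 2) z)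
    (fun k _ => Finset.measurable_sum _ fun n _ => (meas_ec measurable_const measurable_id).const_mul _) p (by linarith)
    (fun k => B ^ (1 / p) * ((2:ℝ≥0∞) ^ k) ^ (-γ)) (fun k hk => by
      refine (hL k hk).trans ?_
      rw [ENNReal.mul_rpow_of_nonneg _ _ hp0.le, ← ENNReal.rpow_mul, ← ENNReal.rpow_mul, one_div, inv_mul_cancel₀ hp0.ne', ENNReal.rpow_one,
        show -γ * p = -(p * γ) by ring, hB]
      have : (∑ n ∈ S.filter (fun n => κ n = k), ENNReal.ofReal ((1 + heightVec n) ^ (2 * s)) * ‖a n‖ₑ ^ (2:ℝ)) ^ (p / 2) ≤ H ^ (p / 2) :=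
        ENNReal.rpow_le_rpow (Finset.sum_le_sum_of_subset (Finset.filter_subset _ _)) (by linarith)
      refine (mul_le_mul_right this _).trans (le_of_eq ?_)
      ring)
  have e : ∀ z : EuclideanSpace ℝ (Fin d) × ℝ, ∑ k ∈ R, ∑ n ∈ S.filter (fun n => κ n = k), a n * ec (thv ω n, ‖thv ω n‖ ^ 2) z =
      ∑ n ∈ S, a n * ec (thv ω n, ‖thv ω n‖ ^ 2) z := fun z =>
    Finset.sum_fiberwise_of_maps_to (fun n hn => Finset.mem_image_of_mem κ hn) _
  simp only [e] at hm
  refine hm.trans ?_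
  rw [← Finset.mul_sum]
  refine (ENNReal.rpow_le_rpow (mul_le_mul_right (hZb R) _) hp0.le).trans (le_of_eq ?_)
  rw [ENNReal.mul_rpow_of_nonneg _ _ hp0.le, ← ENNReal.rpow_mul, one_div, inv_mul_cancel₀ hp0.ne', ENNReal.rpow_one, hB]
  ring

end fin7
end Strz

open MeasureTheory Filter
open scoped ENNReal NNReal ComplexConjugate FourierTransform
set_option linter.unusedSectionVars false
set_option linter.unusedSimpArgs false
set_option linter.unusedVariables false
namespace Strz

section fin8

theorem cube_le {d : ℕ} (L R : ℝ) (hL : 0 ≤ L) (hR : (d:ℝ) * L ≤ R) (G : EuclideanSpace ℝ (Fin d) × ℝ → ℝ≥0∞) (hG : Measurable G) :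
    ∫⁻ t in Set.Icc (0 : ℝ) 1, ∫⁻ x in (Set.univ.pi fun _ : Fin d => Set.Icc (-L) L), G (WithLp.toLp 2 x, t) ≤
      ∫⁻ z in Metric.closedBall (0 : EuclideanSpace ℝ (Fin d)) R ×ˢ Set.Icc (0 : ℝ) 1, G z := by
  rw [Measure.volume_eq_prod, ← Measure.prod_restrict, lintegral_prod_symm _ hG.aemeasurable]
  refine lintegral_mono fun t => ?_
  dsimp only
  have hmp := EuclideanSpace.volume_preserving_symm_measurableEquiv_toLp (Fin d)
  have hg : Measurable fun y : EuclideanSpace ℝ (Fin d) => G (y, t) := by fun_prop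
  have hm2 : MeasurePreserving (MeasurableEquiv.toLp 2 (Fin d → ℝ)) volume volume := hmp.symm
  have hms : MeasurableSet (Metric.closedBall (0 : EuclideanSpace ℝ (Fin d)) R) := Metric.isClosed_closedBall.measurableSet
  rw [← hm2.setLIntegral_comp_preimage hms hg]
  refine lintegral_mono_set ?_
  intro x hx
  simp only [Set.mem_preimage, Metric.mem_closedBall, dist_zero_right]
  refine le_trans ?_ hR
  rw [EuclideanSpace.norm_eq]
  refine Real.sqrt_le_iff.2 ⟨by positivity, ?_⟩
  refine (Finset.sum_sq_le_sq_sum_of_nonneg fun i _ => norm_nonneg _).trans (pow_le_pow_left₀ (Finset.sum_nonneg fun i _ => norm_nonneg _) ?_ 2)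
  refine (Finset.sum_le_sum (g := fun _ => L) fun i _ => ?_).trans (le_of_eq (by simp))
  have := hx i (Set.mem_univ i)
  rw [Real.norm_eq_abs, abs_le]
  exact this

theorem bochner_le {d : ℕ} (L : ℝ) (p : ℝ) (hp : 0 < p) (F : (Fin d → ℝ) → ℝ → ℂ) :
    ‖∫ t in Set.Icc (0 : ℝ) 1, ∫ x in (Set.univ.pi fun _ : Fin d => Set.Icc (-L) L), ‖F x t‖ ^ p‖ₑ ≤
      ∫⁻ t in Set.Icc (0 : ℝ) 1, ∫⁻ x in (Set.univ.pi fun _ : Fin d => Set.Icc (-L) L), ‖F x t‖ₑ ^ p := by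
  refine (enorm_integral_le_lintegral_enorm _).trans (lintegral_mono fun t => ?_)
  refine (enorm_integral_le_lintegral_enorm _).trans (lintegral_mono fun x => le_of_eq ?_)
  rw [Real.enorm_rpow_of_nonneg (norm_nonneg _) hp.le, enorm_norm]

theorem ec_eq {d : ℕ} {ν : Fin d → ℕ} (ω : ∀ i, Fin (ν i) → ℝ) (n : ∀ i, Fin (ν i) → ℤ) (x : Fin d → ℝ) (t : ℝ) :
    Complex.exp (Complex.I * ((∑ i, freqVec ω n i * x i - t * ∑ i, freqVec ω n i ^ 2 : ℝ) : ℂ)) =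
      ec (thv ω n, ‖thv ω n‖ ^ 2) (WithLp.toLp 2 x, t) := by
  unfold ec ph
  congr 3
  dsimp only
  rw [EuclideanSpace.norm_sq_eq, PiLp.inner_apply]
  simp only [thv_apply, Real.norm_eq_abs, sq_abs, RCLike.inner_apply, conj_trivial]
  rw [mul_comm t]
  congr 1
  exact Finset.sum_congr rfl fun i _ => mul_comm _ _

end fin8
end Strz

/-- Fixed-time `L^p` Strichartz estimates in higher dimensions from `ℓ²`-decoupling
(Theorem 3.3). -/
theorem fixed_time_Lp_strichartz_higher_dim
    (d : ℕ) (hd : 1 ≤ d) (ν : Fin d → ℕ) (hν : ∀ i, 1 ≤ ν i)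
    (ω : ∀ i, Fin (ν i) → ℝ)
    (hpos : ∀ i j, 0 < ω i j)
    (hnr : ∀ i, ∀ m : Fin (ν i) → ℤ, (∑ j, (m j : ℝ) * ω i j) = 0 → m = 0)
    (p : ℝ) (hp : 2 < p)
    (s : ℝ)
    (hs : (∑ i, ((ν i : ℝ) - 1)) * (1 / 2 - 1 / p)
            + max ((d : ℝ) / 2 - ((d : ℝ) + 2) / p) 0 < s) :
    ∃ K : ℝ, 0 < K ∧
      ∀ a : (∀ i, Fin (ν i) → ℤ) → ℂ, (Function.support a).Finite →
      limsup (fun L : ℝ =>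
          (1 / (2 * L) ^ d) * ∫ t in Set.Icc (0 : ℝ) 1,
            ∫ x in (Set.univ.pi fun _ : Fin d => Set.Icc (-L) L),
              ‖∑' n : ∀ i, Fin (ν i) → ℤ, a n *
                Complex.exp (Complex.I *
                  ((∑ i, freqVec ω n i * x i
                      - t * ∑ i, freqVec ω n i ^ 2 : ℝ) : ℂ))‖ ^ p) atTop
        ≤ K ^ p *
            (∑' n : ∀ i, Fin (ν i) → ℤ,
              (1 + heightVec n) ^ (2 * s) * ‖a n‖ ^ 2) ^ (p / 2) := by
  have hp0 : 0 < p := by linarith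
  have hd0 : (0:ℝ) < d := by exact_mod_cast hd
  set b : ℕ := ∑ i, (ν i - 1) with hb
  have hbc : ∑ i, ((ν i : ℝ) - 1) = b := by
    rw [hb]; push_cast
    exact Finset.sum_congr rfl fun i _ => by rw [Nat.cast_sub (hν i)]; simp
  rw [hbc] at hs
  set q : ℝ := min p (2 * ((d:ℝ) + 2) / d) with hqdef
  have hq2 : 2 ≤ q := by
    refine le_min hp.le ?_
    rw [le_div_iff₀ hd0]; linarith
  have hqp : q ≤ p := min_le_left _ _
  have hdq : (d:ℝ) * q ≤ 2 * ((d:ℝ) + 2) := by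
    have : q ≤ 2 * ((d:ℝ) + 2) / d := min_le_right _ _
    rw [le_div_iff₀ hd0] at this; linarith
  have hmax : (d:ℝ) * (p - q) / 2 ≤ p * max ((d : ℝ) / 2 - ((d : ℝ) + 2) / p) 0 := by
    rcases min_choice p (2 * ((d:ℝ) + 2) / d) with h | h
    · rw [hqdef, h]
      have : 0 ≤ p * max ((d : ℝ) / 2 - ((d : ℝ) + 2) / p) 0 := mul_nonneg hp0.le (le_max_right _ _)
      linarith
    · rw [hqdef, h]
      refine le_trans (le_of_eq ?_) (mul_le_mul_of_nonneg_left (le_max_left _ _) hp0.le)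
      field_simp
  have hsp : (b:ℝ) * (p - 2) / 2 + d * (p - q) / 2 < s * p := by
    have h1 := mul_lt_mul_of_pos_right hs hp0
    have h2 : (b:ℝ) * (1 / 2 - 1 / p) * p = b * (p - 2) / 2 := by field_simp
    rw [add_mul, h2] at h1
    linarith
  obtain ⟨C, hC, hmain⟩ := Strz.full_est hν ω hpos hnr p q hp hq2 hqp hdq
    ((s * p - (b:ℝ) * (p - 2) / 2 - d * (p - q) / 2) / (2 * p)) s (div_pos (by linarith) (by linarith)) (by field_simp; ring)
  set D : ℝ := C.toReal * ((d:ℝ) / 2) ^ d with hD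
  have hD0 : 0 ≤ D := by positivity
  refine ⟨(D + 1) ^ (1 / p), by positivity, fun a ha => ?_⟩
  have hKp : ((D + 1) ^ (1 / p)) ^ p = D + 1 := by
    rw [← Real.rpow_mul (by positivity), one_div, inv_mul_cancel₀ hp0.ne', Real.rpow_one]
  rw [hKp]
  set S : Finset (∀ i, Fin (ν i) → ℤ) := ha.toFinset with hS
  have hSn : ∀ n, n ∉ S → a n = 0 := by
    intro n hn
    by_contra h
    exact hn (by rw [hS, Set.Finite.mem_toFinset]; exact h)
  have hH : ∑' n : ∀ i, Fin (ν i) → ℤ, (1 + heightVec n) ^ (2 * s) * ‖a n‖ ^ 2 = ∑ n ∈ S, (1 + heightVec n) ^ (2 * s) * ‖a n‖ ^ 2 :=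
    tsum_eq_sum fun n hn => by rw [hSn n hn]; simp
  rw [hH]
  set H : ℝ := ∑ n ∈ S, (1 + heightVec n) ^ (2 * s) * ‖a n‖ ^ 2 with hHdef
  have hterm : ∀ n : ∀ i, Fin (ν i) → ℤ, 0 ≤ (1 + heightVec n) ^ (2 * s) := fun n =>
    Real.rpow_nonneg (by have := Strz.height_nonneg n; linarith) _
  have hH0 : 0 ≤ H := Finset.sum_nonneg fun n _ => mul_nonneg (hterm n) (sq_nonneg _)
  have hHe : ∑ n ∈ S, ENNReal.ofReal ((1 + heightVec n) ^ (2 * s)) * ‖a n‖ₑ ^ (2:ℝ) = ENNReal.ofReal H := by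
    rw [hHdef, ENNReal.ofReal_sum_of_nonneg fun n _ => mul_nonneg (hterm n) (sq_nonneg _)]
    refine Finset.sum_congr rfl fun n _ => ?_
    rw [ENNReal.ofReal_mul (hterm n), ENNReal.ofReal_pow (norm_nonneg _), ofReal_norm]
    norm_num
  have hF : ∀ (x : Fin d → ℝ) (t : ℝ), (∑' n : ∀ i, Fin (ν i) → ℤ, a n *
                Complex.exp (Complex.I * ((∑ i, freqVec ω n i * x i - t * ∑ i, freqVec ω n i ^ 2 : ℝ) : ℂ))) =
      ∑ n ∈ S, a n * Strz.ec (Strz.thv ω n, ‖Strz.thv ω n‖ ^ 2) (WithLp.toLp 2 x, t) := by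
    intro x t
    rw [tsum_eq_sum (s := S) fun n hn => by rw [hSn n hn]; simp]
    exact Finset.sum_congr rfl fun n _ => by rw [Strz.ec_eq]
  have htend : Tendsto (fun L : ℝ => (d:ℝ) * L) atTop atTop := tendsto_id.const_mul_atTop hd0
  have hev : ∀ᶠ L : ℝ in atTop, (1 / (2 * L) ^ d) * ∫ t in Set.Icc (0 : ℝ) 1,
            ∫ x in (Set.univ.pi fun _ : Fin d => Set.Icc (-L) L),
              ‖∑' n : ∀ i, Fin (ν i) → ℤ, a n *
                Complex.exp (Complex.I *
                  ((∑ i, freqVec ω n i * x i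
                      - t * ∑ i, freqVec ω n i ^ 2 : ℝ) : ℂ))‖ ^ p ≤ (D + 1) * H ^ (p / 2) := by
    filter_upwards [htend.eventually (hmain S a), eventually_gt_atTop 0] with L hL hL0
    have h1 := Strz.bochner_le (d := d) L p hp0 (fun x t => ∑' n : ∀ i, Fin (ν i) → ℤ, a n *
                Complex.exp (Complex.I * ((∑ i, freqVec ω n i * x i - t * ∑ i, freqVec ω n i ^ 2 : ℝ) : ℂ)))
    set I := ∫ t in Set.Icc (0 : ℝ) 1,
            ∫ x in (Set.univ.pi fun _ : Fin d => Set.Icc (-L) L),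
              ‖∑' n : ∀ i, Fin (ν i) → ℤ, a n *
                Complex.exp (Complex.I *
                  ((∑ i, freqVec ω n i * x i
                      - t * ∑ i, freqVec ω n i ^ 2 : ℝ) : ℂ))‖ ^ p with hI
    simp only [hF] at h1
    have h2 := Strz.cube_le (d := d) L (d * L) hL0.le le_rfl (fun z => ‖∑ n ∈ S, a n * Strz.ec (Strz.thv ω n, ‖Strz.thv ω n‖ ^ 2) z‖ₑ ^ p)
      ((Finset.measurable_sum _ fun n _ => (Strz.meas_ec measurable_const measurable_id).const_mul _).enorm.pow_const p)
    have h3 : ‖I‖ₑ ≤ C * ENNReal.ofReal (((d:ℝ) * L) ^ d) * (ENNReal.ofReal H) ^ (p / 2) := by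
      rw [← hHe]
      refine le_trans ?_ ((h1.trans h2).trans hL)
      rw [hI]
    have h4 : I ≤ C.toReal * ((d:ℝ) * L) ^ d * H ^ (p / 2) := by
      have e : C * ENNReal.ofReal (((d:ℝ) * L) ^ d) * (ENNReal.ofReal H) ^ (p / 2) =
          ENNReal.ofReal (C.toReal * ((d:ℝ) * L) ^ d * H ^ (p / 2)) := by
        rw [ENNReal.ofReal_mul (by positivity), ENNReal.ofReal_mul (by positivity), ENNReal.ofReal_toReal hC,
          ENNReal.ofReal_rpow_of_nonneg hH0 (by linarith)]
      rw [e, ← ofReal_norm, ENNReal.ofReal_le_ofReal_iff (by positivity)] at h3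
      exact (Real.le_norm_self I).trans h3
    calc (1 / (2 * L) ^ d) * I ≤ (1 / (2 * L) ^ d) * (C.toReal * ((d:ℝ) * L) ^ d * H ^ (p / 2)) :=
          mul_le_mul_of_nonneg_left h4 (by positivity)
      _ = D * H ^ (p / 2) := by
          rw [hD, mul_pow, mul_pow, div_pow]; field_simp
      _ ≤ (D + 1) * H ^ (p / 2) := mul_le_mul_of_nonneg_right (by linarith) (by positivity)
  refine limsup_le_of_le ?_ hev
  refine IsCoboundedUnder.of_frequently_ge (a := 0) (Eventually.frequently ?_)
  filter_upwards [eventually_gt_atTop 0] with L hL0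
  refine mul_nonneg (by positivity) (integral_nonneg fun t => integral_nonneg fun x => by positivity)
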